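/- Let c be a real number with 1 < c < 609/293 and c ∉ ℕ (in particular c ≠ 2). Then there exist constants c₀ > 0 and r₀ > 0 such that for every integer r ≥ r₀, the number ℬ₅(r) of ordered quintuples (p₁, …, p₅) of primes with X/8 < pⱼ ≤ X (j = 1,…,5), where X = r^{1/c}, satisfying ⌊p₁^c⌋ + ⋯ + ⌊p₅^c⌋ = r, is at least c₀ · r^{5/c − 1}/(log r)⁵. -/

import Mathlib

open Real MeasureTheory

/-- `countSolFloor c r s` is the number of ordered `s`-tuples of primes `p₁, …, pₛ` with
`X/8 < pⱼ ≤ X` (where `X = r^{1/c}`) and `⌊p₁^c⌋ + ⋯ + ⌊pₛ^c⌋ = r`. -/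
noncomputable def countSolFloor (c : ℝ) (r : ℕ) (s : ℕ) : ℕ :=
  Nat.card {p : Fin s → ℕ //
    (∀ j, (p j).Prime ∧ (r : ℝ) ^ (1/c) / 8 < (p j : ℝ) ∧ (p j : ℝ) ≤ (r : ℝ) ^ (1/c)) ∧
    (∑ j, ⌊(p j : ℝ) ^ c⌋) = (r : ℤ)}

open Finset (range Ioc sum_congr sum_le_sum mem_filter mem_Ioc mul_sum)

/-! ## Part A: exponential sums -/

/-- `ee x = e^{2πix}`. -/
noncomputable def ee (x : ℝ) : ℂ := Complex.exp (((2 * π * x : ℝ) : ℂ) * Complex.I)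

lemma ee_add (x y : ℝ) : ee (x + y) = ee x * ee y := by
  unfold ee
  rw [← Complex.exp_add]
  congr 1
  push_cast
  ring

lemma norm_ee (x : ℝ) : ‖ee x‖ = 1 := Complex.norm_exp_ofReal_mul_I _

lemma ee_zero : ee 0 = 1 := by simp [ee]

lemma ee_ne_zero (x : ℝ) : ee x ≠ 0 := Complex.exp_ne_zero _

lemma ee_int (k : ℤ) : ee k = 1 := by
  unfold ee
  rw [Complex.exp_eq_one_iff]
  exact ⟨k, by push_cast; ring⟩

lemma ee_nat (k : ℕ) : ee k = 1 := by simpa using ee_int k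

lemma ee_add_int (x : ℝ) (k : ℤ) : ee (x + k) = ee x := by rw [ee_add, ee_int, mul_one]

lemma ee_neg (x : ℝ) : ee (-x) = (starRingEnd ℂ) (ee x) := by
  unfold ee
  rw [← Complex.exp_conj]
  congr 1
  rw [map_mul, Complex.conj_ofReal, Complex.conj_I]
  push_cast
  ring

lemma ee_sub (x y : ℝ) : ee (x - y) = ee x * (starRingEnd ℂ) (ee y) := by
  rw [sub_eq_add_neg, ee_add, ee_neg]

lemma ee_mul_conj (x : ℝ) : ee x * (starRingEnd ℂ) (ee x) = 1 := by
  rw [← ee_sub, sub_self, ee_zero]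

lemma continuous_ee : Continuous ee := by unfold ee; fun_prop

lemma norm_ee_sub_one_le (x : ℝ) : ‖ee x - 1‖ ≤ 2 * π * |x| := by
  unfold ee
  have h := Real.norm_exp_I_mul_ofReal_sub_one_le (x := 2 * π * x)
  rw [mul_comm Complex.I] at h
  refine h.trans (le_of_eq ?_)
  rw [Real.norm_eq_abs, abs_mul, abs_of_pos (by positivity : (0:ℝ) < 2 * π)]

lemma norm_ee_sub_le (x y : ℝ) : ‖ee x - ee y‖ ≤ 2 * π * |x - y| := by
  have : ee x - ee y = ee y * (ee (x - y) - 1) := by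
    rw [mul_sub, ← ee_add, mul_one]; congr 2; ring
  rw [this, norm_mul, norm_ee, one_mul]
  exact norm_ee_sub_one_le _

lemma ee_natmul (x : ℝ) (n : ℕ) : ee (n * x) = ee x ^ n := by
  induction n with
  | zero => simp [ee_zero]
  | succ n ih => rw [pow_succ, ← ih, ← ee_add]; congr 1; push_cast; ring

/-- `1 - e(x) = -2 i sin(πx) e(x/2)`. -/
lemma one_sub_ee (x : ℝ) : 1 - ee x = -2 * Complex.I * (Real.sin (π * x) : ℂ) * ee (x / 2) := by
  have h1 : ee x = ee (x/2) * ee (x/2) := by rw [← ee_add]; congr 1; ring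
  have h2 : ee (x/2) = (Real.cos (π * x) : ℂ) + (Real.sin (π * x) : ℂ) * Complex.I := by
    unfold ee
    rw [Complex.exp_mul_I, ← Complex.ofReal_cos, ← Complex.ofReal_sin]
    congr 3 <;> ring_nf
  have h3 : ((Real.cos (π * x) : ℂ))^2 + ((Real.sin (π * x) : ℂ))^2 = 1 := by
    norm_cast; exact Real.cos_sq_add_sin_sq _
  rw [h1, h2]
  have hI := Complex.I_sq
  linear_combination (-1 : ℂ) * h3 + (-(Real.sin (π * x) : ℂ)^2 + 2 * (Real.sin (π * x) : ℂ)^2) * hI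

lemma norm_one_sub_ee (x : ℝ) : ‖1 - ee x‖ = 2 * |Real.sin (π * x)| := by
  rw [one_sub_ee, norm_mul, norm_ee, norm_mul, Complex.norm_real]
  simp

lemma two_mul_le_sin {x : ℝ} (h0 : 0 ≤ x) (h1 : x ≤ 1/2) : 2 * x ≤ Real.sin (π * x) := by
  have h := Real.mul_le_sin (x := π * x) (by positivity) (by nlinarith [Real.pi_pos])
  calc 2 * x = 2 / π * (π * x) := by field_simp
    _ ≤ _ := h

lemma two_mul_le_sin' {x θ : ℝ} (hθ : 0 < θ) (h0 : θ ≤ x) (h1 : x ≤ 1 - θ) :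
    2 * θ ≤ Real.sin (π * x) := by
  rcases le_total x (1/2) with h | h
  · linarith [two_mul_le_sin (by linarith) h]
  · have := two_mul_le_sin (x := 1 - x) (by linarith) (by linarith)
    have h2 : Real.sin (π * (1 - x)) = Real.sin (π * x) := by
      rw [mul_sub, mul_one, Real.sin_pi_sub]
    linarith

/-- the weight in Kusmin-Landau. -/
lemma inv_one_sub_ee {x : ℝ} (hs : Real.sin (π * x) ≠ 0) :
    (1 - ee x)⁻¹ = 1/2 + (Real.cos (π * x) / Real.sin (π * x) / 2 : ℝ) * Complex.I := by
  rw [one_sub_ee]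
  have h2 : ee (x/2) = (Real.cos (π * x) : ℂ) + (Real.sin (π * x) : ℂ) * Complex.I := by
    unfold ee
    rw [Complex.exp_mul_I, ← Complex.ofReal_cos, ← Complex.ofReal_sin]
    congr 3 <;> ring_nf
  have hs' : (Real.sin (π * x) : ℂ) ≠ 0 := by exact_mod_cast hs
  have h3 : ((Real.cos (π * x) : ℂ))^2 + ((Real.sin (π * x) : ℂ))^2 = 1 := by
    norm_cast; exact Real.cos_sq_add_sin_sq _
  have hI := Complex.I_sq
  rw [inv_eq_iff_eq_inv, eq_comm]
  refine inv_eq_of_mul_eq_one_left ?_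
  rw [h2]
  push_cast
  set s := Complex.sin (π * x) with hs1
  set cc := Complex.cos (π * x) with hc1
  have hs'' : s ≠ 0 := by rw [hs1]; exact_mod_cast hs'
  have h3' : cc^2 + s^2 = 1 := by rw [hs1, hc1]; exact_mod_cast h3
  field_simp
  linear_combination h3' + (-(cc^2 + s^2) - Complex.I * cc * s) * hI


/-- Kusmin–Landau, normalized. -/
lemma kusmin_landau_aux (f : ℕ → ℝ) (N : ℕ) (θ : ℝ) (hθ : 0 < θ)
    (h0 : ∀ n < N, θ ≤ f (n+1) - f n) (h1 : ∀ n < N, f (n+1) - f n ≤ 1 - θ)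
    (hm : ∀ n, n + 1 < N → f (n+1) - f n ≤ f (n+2) - f (n+1)) :
    ‖∑ n ∈ range N, ee (f n)‖ ≤ 2 / θ := by
  rcases Nat.eq_zero_or_pos N with rfl | hN
  · simp; positivity
  set u : ℕ → ℝ := fun n => Real.cos (π * (f (n+1) - f n)) / Real.sin (π * (f (n+1) - f n)) / 2
    with hu
  have hsin : ∀ n < N, 2 * θ ≤ Real.sin (π * (f (n+1) - f n)) := fun n hn =>
    two_mul_le_sin' hθ (h0 n hn) (h1 n hn)
  have hsin0 : ∀ n < N, Real.sin (π * (f (n+1) - f n)) ≠ 0 := fun n hn => by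
    have := hsin n hn
    exact ne_of_gt (by linarith)
  have hterm : ∀ n < N, ee (f n) = (1/2 + (u n : ℂ) * Complex.I) * (ee (f n) - ee (f (n+1))) := by
    intro n hn
    have e1 : ee (f n) - ee (f (n+1)) = (1 - ee (f (n+1) - f n)) * ee (f n) := by
      rw [sub_mul, ← ee_add]; simp
    rw [e1, ← mul_assoc, ← inv_one_sub_ee (hsin0 n hn), inv_mul_cancel₀, one_mul]
    intro h
    have := norm_one_sub_ee (f (n+1) - f n)
    rw [h, norm_zero] at this
    have h3 := abs_pos.mpr (hsin0 n hn)
    linarith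
  have hubd : ∀ n < N, |u n| ≤ 1 / (4 * θ) := by
    intro n hn
    have h2 := hsin n hn
    rw [hu]
    simp only
    rw [abs_div, abs_div, abs_of_pos (by linarith : 0 < Real.sin (π * (f (n+1) - f n))), abs_two,
      div_div, div_le_div_iff₀ (by linarith) (by positivity)]
    have := Real.abs_cos_le_one (π * (f (n+1) - f n))
    nlinarith
  have hmono : ∀ n, n + 1 < N → u (n+1) ≤ u n := by
    intro n hn
    have a1 := hsin n (by omega)
    have a2 := hsin (n+1) hn
    have b := hm n hn
    rw [hu]
    simp only
    have key : 0 ≤ Real.sin (π * (f (n+1+1) - f (n+1)) - π * (f (n+1) - f n)) := by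
      apply Real.sin_nonneg_of_nonneg_of_le_pi
      · have : f (n+1) - f n ≤ f (n+1+1) - f (n+1) := b
        nlinarith [Real.pi_pos]
      · have c1 := h1 (n+1) hn
        have c2 := h0 n (by omega)
        nlinarith [Real.pi_pos]
    rw [Real.sin_sub] at key
    gcongr ?_ / 2
    rw [div_le_div_iff₀ (by linarith) (by linarith)]
    linarith
  -- induction on the partial sums
  have main : ∀ n, n < N → ‖∑ m ∈ range (n+1), ee (f m)
      + (1/2 + (u n : ℂ) * Complex.I) * ee (f (n+1))‖ ≤ 1/2 + |u 0| + (u 0 - u n) := by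
    intro n
    induction n with
    | zero =>
      intro hn
      simp only [zero_add, Finset.range_one, Finset.sum_singleton, sub_self, add_zero]
      have : ee (f 0) + (1/2 + (u 0 : ℂ) * Complex.I) * ee (f 1)
          = (1/2 + (u 0 : ℂ) * Complex.I) * ee (f 0) := by
        linear_combination hterm 0 hn
      rw [this, norm_mul, norm_ee, mul_one]
      refine (norm_add_le _ _).trans ?_
      simp
    | succ n ih =>
      intro hn
      have ih' := ih (by omega)
      have : ∑ m ∈ range (n+1+1), ee (f m) + (1/2 + (u (n+1) : ℂ) * Complex.I) * ee (f (n+1+1))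
        = (∑ m ∈ range (n+1), ee (f m) + (1/2 + (u n : ℂ) * Complex.I) * ee (f (n+1)))
          + ((u (n+1) - u n : ℝ) : ℂ) * Complex.I * ee (f (n+1)) := by
        rw [Finset.sum_range_succ _ (n+1)]
        push_cast
        linear_combination hterm (n+1) hn
      rw [this]
      refine (norm_add_le _ _).trans ?_
      rw [norm_mul, norm_mul, norm_ee, Complex.norm_real, Complex.norm_I, Real.norm_eq_abs,
        abs_of_nonpos (by linarith [hmono n hn])]
      linarith
  obtain ⟨n, rfl⟩ : ∃ n, N = n + 1 := ⟨N - 1, by omega⟩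
  have h := main n (by omega)
  have hb0 := hubd 0 (by omega)
  have hbn := hubd n (by omega)
  have hc : ‖(1/2 + (u n : ℂ) * Complex.I) * ee (f (n+1))‖ ≤ 1/2 + |u n| := by
    rw [norm_mul, norm_ee, mul_one]
    refine (norm_add_le _ _).trans ?_
    simp
  have hfin : ‖∑ m ∈ range (n+1), ee (f m)‖ ≤ 1/2 + |u 0| + (u 0 - u n) + (1/2 + |u n|) := by
    have := norm_sub_le (∑ m ∈ range (n+1), ee (f m)
      + (1/2 + (u n : ℂ) * Complex.I) * ee (f (n+1))) ((1/2 + (u n : ℂ) * Complex.I) * ee (f (n+1)))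
    rw [add_sub_cancel_right] at this
    linarith
  have hθ2 : θ ≤ 1/2 := by linarith [h0 0 (by omega), h1 0 (by omega)]
  have e1 : 1 / (4 * θ) = (1/4) * (1/θ) := by field_simp
  have e2 : 2 ≤ 1/θ := by rw [le_div_iff₀ hθ]; linarith
  have e3 : 2 / θ = 2 * (1/θ) := by field_simp
  linarith [le_abs_self (u 0), neg_abs_le (u n)]

/-- Kusmin–Landau over an interval of integers. -/
lemma kusmin_landau (f : ℕ → ℝ) (a b : ℕ) (θ : ℝ) (k : ℤ) (hθ : 0 < θ)
    (h0 : ∀ n, a ≤ n → n < b → k + θ ≤ f (n+1) - f n)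
    (h1 : ∀ n, a ≤ n → n < b → f (n+1) - f n ≤ k + 1 - θ)
    (hm : ∀ n, a ≤ n → n + 1 < b → f (n+1) - f n ≤ f (n+2) - f (n+1)) :
    ‖∑ n ∈ Finset.Ico a b, ee (f n)‖ ≤ 2 / θ := by
  have h := kusmin_landau_aux (fun n => f (a + n) - k * n) (b - a) θ hθ
    (fun n hn => by
      have := h0 (a+n) (by omega) (by omega)
      push_cast; rw [← add_assoc]; linarith)
    (fun n hn => by
      have := h1 (a+n) (by omega) (by omega)
      push_cast; rw [← add_assoc]; linarith)
    (fun n hn => by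
      have := hm (a+n) (by omega) (by omega)
      push_cast; rw [← add_assoc, ← add_assoc]; linarith)
  rw [Finset.sum_Ico_eq_sum_range]
  refine le_trans (le_of_eq ?_) h
  congr 1
  refine sum_congr rfl fun n _ => ?_
  rw [show f (a+n) - k * n = f (a+n) + ((-k * n : ℤ) : ℝ) by push_cast; ring, ee_add_int]

/-- An order-convex finite set of naturals is an interval. -/
lemma exists_Ico_of_convex (s : Finset ℕ)
    (h : ∀ x ∈ s, ∀ y ∈ s, ∀ z, x ≤ z → z ≤ y → z ∈ s) : ∃ a b, s = Finset.Ico a b := by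
  rcases s.eq_empty_or_nonempty with rfl | hs
  · exact ⟨0, 0, by simp⟩
  · refine ⟨s.min' hs, s.max' hs + 1, ?_⟩
    ext z
    rw [Finset.mem_Ico]
    constructor
    · intro hz
      exact ⟨s.min'_le z hz, Nat.lt_succ_of_le (s.le_max' z hz)⟩
    · rintro ⟨h1, h2⟩
      exact h _ (s.min'_mem hs) _ (s.max'_mem hs) z h1 (by omega)

/-- a set of naturals on which a `λ`-growing sequence stays in an interval of length `ℓ`. -/
lemma card_le_of_growth (s : Finset ℕ) (g : ℕ → ℝ) (l ℓ x : ℝ) (hl : 0 < l) (hℓ : 0 ≤ ℓ)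
    (hg : ∀ m ∈ s, ∀ n ∈ s, m ≤ n → l * ((n:ℝ) - m) ≤ g n - g m)
    (hs : ∀ n ∈ s, x ≤ g n ∧ g n ≤ x + ℓ) : (s.card : ℝ) ≤ ℓ / l + 1 := by
  rcases s.eq_empty_or_nonempty with rfl | hne
  · simp; positivity
  have h1 : s ⊆ Finset.Icc (s.min' hne) (s.max' hne) := fun z hz =>
    Finset.mem_Icc.mpr ⟨s.min'_le z hz, s.le_max' z hz⟩
  have h2 := Finset.card_le_card h1
  rw [Nat.card_Icc] at h2
  have h3 := hg _ (s.min'_mem hne) _ (s.max'_mem hne) (s.min'_le _ (s.max'_mem hne))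
  have h4 := hs _ (s.min'_mem hne)
  have h5 := hs _ (s.max'_mem hne)
  have h6 := s.min'_le _ (s.max'_mem hne)
  have h7 : (s.card : ℝ) ≤ (s.max' hne : ℝ) - s.min' hne + 1 := by
    have : s.card + s.min' hne ≤ s.max' hne + 1 := by omega
    have : (s.card : ℝ) + s.min' hne ≤ s.max' hne + 1 := by exact_mod_cast this
    linarith
  have h8 : (s.max' hne : ℝ) - s.min' hne ≤ ℓ / l := by
    rw [le_div_iff₀ hl]; nlinarith
  linarith

/-- forward difference -/
def dff (f : ℕ → ℝ) : ℕ → ℝ := fun n => f (n+1) - f n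

/-- van der Corput's second derivative test (discrete form). -/
lemma second_test (f : ℕ → ℝ) (N : ℕ) (l A : ℝ) (hl : 0 < l) (hA : 1 ≤ A)
    (h : ∀ n < N, l ≤ dff (dff f) n ∧ dff (dff f) n ≤ A * l) :
    ‖∑ n ∈ range N, ee (f n)‖ ≤ 16 * A * (N * l ^ (1/2:ℝ) + l ^ (-(1/2):ℝ)) := by
  have hsq : l ^ (1/2:ℝ) = √l := (Real.sqrt_eq_rpow l).symm
  have hsq' : l ^ (-(1/2):ℝ) = 1 / √l := by rw [Real.rpow_neg hl.le, hsq, one_div]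
  rw [hsq, hsq']
  have hs0 : 0 < √l := Real.sqrt_pos.mpr hl
  have hss : √l * √l = l := Real.mul_self_sqrt hl.le
  have htriv : ‖∑ n ∈ range N, ee (f n)‖ ≤ N := by
    refine (norm_sum_le _ _).trans ?_
    simp [norm_ee]
  by_cases hbig : 1/2 < √l
  · refine htriv.trans ?_
    have : 0 < 1 / √l := by positivity
    have hN : (0:ℝ) ≤ N := Nat.cast_nonneg N
    have : (N:ℝ) ≤ 16 * (N * √l) := by nlinarith
    have : 16 * (N * √l + 1/√l) ≤ 16 * A * (N * √l + 1/√l) := by gcongr; linarith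
    linarith
  push Not at hbig
  set g := dff f with hg
  have hgrow : ∀ m n, m ≤ n → n ≤ N → l * ((n:ℝ) - m) ≤ g n - g m ∧ g n - g m ≤ A * l * ((n:ℝ) - m) := by
    intro m n hmn
    induction n, hmn using Nat.le_induction with
    | base => intro _; simp
    | succ n hmn ih =>
      intro hN
      have i1 := ih (by omega)
      have i2 := h n (by omega)
      have e : dff g n = g (n+1) - g n := rfl
      rw [e] at i2
      push_cast
      constructor <;> nlinarith
  have hmono : ∀ m n, m ≤ n → n ≤ N → g m ≤ g n := fun m n h1 h2 => by
    have := (hgrow m n h1 h2).1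
    have : (m:ℝ) ≤ n := by exact_mod_cast h1
    nlinarith
  rcases Nat.eq_zero_or_pos N with rfl | hNpos
  · simp; positivity
  set θ := √l with hθ
  -- for each integer part
  have hk : ∀ k : ℤ, ‖∑ n ∈ (range N).filter (fun n => ⌊g n⌋ = k), ee (f n)‖ ≤ 6 / θ := by
    intro k
    set s := (range N).filter (fun n => ⌊g n⌋ = k) with hs
    have hsk : ∀ n ∈ s, n < N ∧ (k:ℝ) ≤ g n ∧ g n < k + 1 := by
      intro n hn
      rw [hs, mem_filter, Finset.mem_range, Int.floor_eq_iff] at hn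
      exact hn
    set mid := s.filter (fun n => k + θ ≤ g n ∧ g n ≤ k + 1 - θ) with hmid
    set lo := s.filter (fun n => g n < k + θ)
    set hi := s.filter (fun n => k + 1 - θ < g n)
    have hlo : (lo.card : ℝ) ≤ θ / l + 1 := by
      refine card_le_of_growth lo g l θ k hl hs0.le (fun m hm n hn hmn => ?_) (fun n hn => ?_)
      · exact (hgrow m n hmn (hsk n (mem_filter.mp hn).1).1.le).1
      · have := hsk n (mem_filter.mp hn).1
        exact ⟨this.2.1, (mem_filter.mp hn).2.le⟩
    have hhi : (hi.card : ℝ) ≤ θ / l + 1 := by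
      refine card_le_of_growth hi g l θ (k+1-θ) hl hs0.le (fun m hm n hn hmn => ?_) (fun n hn => ?_)
      · exact (hgrow m n hmn (hsk n (mem_filter.mp hn).1).1.le).1
      · have := hsk n (mem_filter.mp hn).1
        exact ⟨(mem_filter.mp hn).2.le, by linarith⟩
    have hmidb : ‖∑ n ∈ mid, ee (f n)‖ ≤ 2 / θ := by
      have hmm : ∀ n ∈ mid, n < N ∧ k + θ ≤ g n ∧ g n ≤ k + 1 - θ := fun n hn =>
        ⟨(hsk n (mem_filter.mp hn).1).1, (mem_filter.mp hn).2⟩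
      have hmm' : ∀ n, n < N → k + θ ≤ g n → g n ≤ k + 1 - θ → n ∈ mid := by
        intro n h1 h2 h3
        rw [hmid, hs, mem_filter, mem_filter, Finset.mem_range, Int.floor_eq_iff]
        exact ⟨⟨h1, by linarith, by linarith⟩, h2, h3⟩
      obtain ⟨a, b, hab⟩ := exists_Ico_of_convex mid (fun x hx y hy z hxz hzy => by
        have h1 := hmm x hx
        have h2 := hmm y hy
        exact hmm' z (by omega) (h1.2.1.trans (hmono x z hxz (by omega)))
          ((hmono z y hzy (by omega)).trans h2.2.2))
      rw [hab]
      have hmem : ∀ n, a ≤ n → n < b → n < N ∧ k + θ ≤ g n ∧ g n ≤ k + 1 - θ := fun n h1 h2 =>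
        hmm n (by rw [hab]; exact Finset.mem_Ico.mpr ⟨h1, h2⟩)
      exact kusmin_landau f a b θ k hs0 (fun n h1 h2 => (hmem n h1 h2).2.1)
        (fun n h1 h2 => (hmem n h1 h2).2.2)
        (fun n h1 h2 => hmono n (n+1) (by omega) (hmem (n+1) (by omega) h2).1.le)
    have hsplit : s = mid ∪ (lo ∪ hi) := by
      ext n
      simp only [mid, lo, hi, Finset.mem_union, mem_filter]
      constructor
      · intro hn
        by_cases c1 : g n < k + θ
        · exact Or.inr (Or.inl ⟨hn, c1⟩)
        by_cases c2 : k + 1 - θ < g n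
        · exact Or.inr (Or.inr ⟨hn, c2⟩)
        · exact Or.inl ⟨hn, by linarith, by linarith⟩
      · rintro (h | h | h) <;> exact h.1
    have hdis : Disjoint mid (lo ∪ hi) := by
      rw [Finset.disjoint_left]
      intro n hn hn2
      have h1 := (mem_filter.mp hn).2
      rcases Finset.mem_union.mp hn2 with h2 | h2
      · have := (mem_filter.mp h2).2; linarith
      · have := (mem_filter.mp h2).2; linarith
    rw [hsplit, Finset.sum_union hdis]
    refine (norm_add_le _ _).trans ?_
    have h3 : ‖∑ n ∈ lo ∪ hi, ee (f n)‖ ≤ (lo.card : ℝ) + hi.card := by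
      refine (norm_sum_le _ _).trans ?_
      simp only [norm_ee, Finset.sum_const, nsmul_eq_mul, mul_one]
      exact_mod_cast Finset.card_union_le _ _
    have e1 : θ / l = 1 / θ := by rw [← hss]; field_simp
    have e2 : (1:ℝ) ≤ 1 / θ := by rw [le_div_iff₀ hs0]; linarith
    rw [e1] at hlo hhi
    have e3 : 2 / θ = 2 * (1/θ) := by ring
    have e4 : 6 / θ = 6 * (1/θ) := by ring
    linarith
  have hdecomp : ∑ n ∈ range N, ee (f n)
      = ∑ k ∈ Finset.Icc ⌊g 0⌋ ⌊g N⌋, ∑ n ∈ (range N).filter (fun n => ⌊g n⌋ = k), ee (f n) := by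
    rw [Finset.sum_fiberwise_of_maps_to]
    intro n hn
    rw [Finset.mem_range] at hn
    exact Finset.mem_Icc.mpr ⟨Int.floor_mono (hmono 0 n (by omega) hn.le),
      Int.floor_mono (hmono n N hn.le le_rfl)⟩
  rw [hdecomp]
  refine (norm_sum_le _ _).trans ?_
  refine (sum_le_sum fun k _ => hk k).trans ?_
  rw [Finset.sum_const, nsmul_eq_mul, Int.card_Icc]
  have hcard : (((⌊g N⌋ + 1 - ⌊g 0⌋).toNat : ℕ) : ℝ) ≤ A * l * N + 2 := by
    have h1 := hmono 0 N (by omega) le_rfl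
    have h2 : ⌊g 0⌋ ≤ ⌊g N⌋ := Int.floor_mono h1
    have h3 : (((⌊g N⌋ + 1 - ⌊g 0⌋).toNat : ℕ) : ℝ) = ((⌊g N⌋ + 1 - ⌊g 0⌋ : ℤ) : ℝ) := by
      have := Int.toNat_of_nonneg (a := ⌊g N⌋ + 1 - ⌊g 0⌋) (by omega)
      exact_mod_cast congrArg (fun z : ℤ => (z : ℝ)) this
    rw [h3]
    push_cast
    have := (hgrow 0 N (by omega) le_rfl).2
    have h4 := Int.floor_le (g N)
    have h5 := Int.lt_floor_add_one (g 0)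
    simp only [Nat.cast_zero, sub_zero] at this
    linarith
  calc _ ≤ (A * l * N + 2) * (6 / θ) := by gcongr
    _ = 6 * A * (N * θ) + 12 * (1 / θ) := by rw [← hss]; field_simp; ring
    _ ≤ _ := by
      have : 0 < 1/θ := by positivity
      have : 0 ≤ N * θ := by positivity
      nlinarith [mul_nonneg (by linarith : 0 ≤ A - 1) (by positivity : 0 ≤ 1/θ),
        mul_nonneg (by linarith : (0:ℝ) ≤ A) this]

lemma weyl_ineq (z : ℕ → ℂ) (N H : ℕ) :
    (H:ℝ)^2 * ‖∑ n ∈ range N, z n‖^2 ≤ (N + H) * (2 * H * ∑ q ∈ range H,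
      ‖∑ n ∈ range (N - q), z (n+q) * (starRingEnd ℂ) (z n)‖) := by
  set C : ℕ → ℝ := fun q => ‖∑ n ∈ range (N - q), z (n+q) * (starRingEnd ℂ) (z n)‖ with hC
  have hC0 : ∀ q, 0 ≤ C q := fun q => norm_nonneg _
  set y : ℕ → ℕ → ℂ := fun h m => if h ≤ m ∧ m < h + N then z (m - h) else 0 with hy
  have hsum : ∀ h ∈ range H, ∑ m ∈ range (N + H), y h m = ∑ n ∈ range N, z n := by
    intro h hh
    rw [Finset.mem_range] at hh
    simp only [hy]
    rw [← Finset.sum_filter]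
    have : (range (N+H)).filter (fun m => h ≤ m ∧ m < h + N) = Finset.Ico h (h+N) := by
      ext m; simp; omega
    rw [this, Finset.sum_Ico_eq_sum_range]
    simp
  -- correlation for `h' = h + q`
  have hcorr : ∀ h q, h + q < H → ‖∑ m ∈ range (N+H), y h m * (starRingEnd ℂ) (y (h+q) m)‖ = C q := by
    intro h q hq
    simp only [hC]
    congr 1
    have e1 : ∀ m, y h m * (starRingEnd ℂ) (y (h+q) m) =
        if h + q ≤ m ∧ m < h + N then z (m - h) * (starRingEnd ℂ) (z (m - (h+q))) else 0 := by
      intro m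
      simp only [hy]
      by_cases c1 : h ≤ m ∧ m < h + N <;> by_cases c2 : h + q ≤ m ∧ m < h + q + N
      · rw [if_pos c1, if_pos c2, if_pos ⟨c2.1, c1.2⟩]
      · rw [if_pos c1, if_neg c2, if_neg (by omega)]; simp
      · rw [if_neg c1, if_pos c2, if_neg (by omega)]; simp
      · rw [if_neg c1, if_neg c2, if_neg (by omega)]; simp
    simp only [e1]
    rw [← Finset.sum_filter]
    have : (range (N+H)).filter (fun m => h + q ≤ m ∧ m < h + N)
        = Finset.Ico (h+q) (h+N) := by
      ext m; simp; omega
    rw [this, Finset.sum_Ico_eq_sum_range]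
    rw [show h + N - (h + q) = N - q by omega]
    refine sum_congr rfl fun n _ => ?_
    congr 2
    · omega
    · congr 1; omega
  have hcorr2 : ∀ h ∈ range H, ∀ h' ∈ range H,
      ‖∑ m ∈ range (N+H), y h m * (starRingEnd ℂ) (y h' m)‖ ≤ C ((h - h') + (h' - h)) := by
    intro h hh h' hh'
    rw [Finset.mem_range] at hh hh'
    rcases le_total h h' with c | c
    · have := hcorr h (h' - h) (by omega)
      rw [show h + (h' - h) = h' by omega] at this
      rw [this, show h - h' = 0 by omega, zero_add]
    · have := hcorr h' (h - h') (by omega)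
      rw [show h' + (h - h') = h by omega] at this
      rw [show h' - h = 0 by omega, add_zero, ← this, ← Complex.norm_conj, map_sum]
      refine le_of_eq ?_
      congr 1
      refine sum_congr rfl fun m _ => ?_
      rw [map_mul, Complex.conj_conj, mul_comm]
  have hrow : ∀ h ∈ range H, ∑ h' ∈ range H, C ((h - h') + (h' - h))
      ≤ 2 * ∑ q ∈ range H, C q := by
    intro h hh
    rw [Finset.mem_range] at hh
    rw [← Finset.sum_filter_add_sum_filter_not (range H) (fun h' => h' ≤ h), two_mul]
    refine add_le_add ?_ ?_
    · have : ∀ x ∈ (range H).filter (fun h' => h' ≤ h), C ((h - x) + (x - h)) = C (h - x) := by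
        intro x hx
        rw [mem_filter] at hx
        congr 1; omega
      rw [sum_congr rfl this]
      rw [← Finset.sum_image (s := (range H).filter (fun h' => h' ≤ h)) (g := fun x => h - x)
        (f := C) (by
          intro x hx x' hx'
          simp at hx hx' ⊢
          omega)]
      refine Finset.sum_le_sum_of_subset_of_nonneg ?_ (fun _ _ _ => hC0 _)
      intro q hq
      simp at hq ⊢
      omega
    · have : ∀ x ∈ (range H).filter (fun h' => ¬ h' ≤ h), C ((h - x) + (x - h)) = C (x - h) := by
        intro x hx
        rw [mem_filter] at hx
        congr 1; omega
      rw [sum_congr rfl this]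
      rw [← Finset.sum_image (s := (range H).filter (fun h' => ¬ h' ≤ h)) (g := fun x => x - h)
        (f := C) (by
          intro x hx x' hx'
          simp at hx hx' ⊢
          omega)]
      refine Finset.sum_le_sum_of_subset_of_nonneg ?_ (fun _ _ _ => hC0 _)
      intro q hq
      simp at hq ⊢
      omega
  have hHS : (H : ℂ) * ∑ n ∈ range N, z n
      = ∑ m ∈ range (N+H), ∑ h ∈ range H, y h m := by
    rw [Finset.sum_comm, sum_congr rfl hsum]
    simp
  have hnorm : (H:ℝ)^2 * ‖∑ n ∈ range N, z n‖^2
      = ‖∑ m ∈ range (N+H), ∑ h ∈ range H, y h m‖^2 := by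
    rw [← hHS, norm_mul, mul_pow]; simp
  rw [hnorm]
  have hCS : ‖∑ m ∈ range (N+H), ∑ h ∈ range H, y h m‖^2
      ≤ (N + H) * ∑ m ∈ range (N+H), ‖∑ h ∈ range H, y h m‖^2 := by
    have h1 := norm_sum_le (range (N+H)) (fun m => ∑ h ∈ range H, y h m)
    have h2 := sq_sum_le_card_mul_sum_sq (s := range (N+H))
      (f := fun m => ‖∑ h ∈ range H, y h m‖)
    rw [Finset.card_range] at h2
    push_cast at h2
    exact (pow_le_pow_left₀ (norm_nonneg _) h1 2).trans h2
  refine hCS.trans ?_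
  gcongr
  have hexp : ((∑ m ∈ range (N+H), ‖∑ h ∈ range H, y h m‖^2 : ℝ) : ℂ)
      = ∑ h ∈ range H, ∑ h' ∈ range H,
        ∑ m ∈ range (N+H), y h m * (starRingEnd ℂ) (y h' m) := by
    push_cast
    have : ∀ m, ((‖∑ h ∈ range H, y h m‖:ℂ))^2
        = ∑ h ∈ range H, ∑ h' ∈ range H, y h m * (starRingEnd ℂ) (y h' m) := by
      intro m
      rw [← Complex.mul_conj', map_sum, Finset.sum_mul_sum]
    simp only [this]
    rw [Finset.sum_comm]
    refine sum_congr rfl fun h _ => ?_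
    rw [Finset.sum_comm]
  have h0 : 0 ≤ ∑ m ∈ range (N+H), ‖∑ h ∈ range H, y h m‖^2 :=
    Finset.sum_nonneg fun _ _ => by positivity
  calc ∑ m ∈ range (N+H), ‖∑ h ∈ range H, y h m‖^2
      = ‖((∑ m ∈ range (N+H), ‖∑ h ∈ range H, y h m‖^2 : ℝ) : ℂ)‖ := by
        rw [Complex.norm_real, Real.norm_of_nonneg h0]
    _ ≤ ∑ h ∈ range H, ∑ h' ∈ range H, C ((h - h') + (h' - h)) := by
        rw [hexp]
        refine (norm_sum_le _ _).trans (sum_le_sum fun h hh => ?_)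
        exact (norm_sum_le _ _).trans (sum_le_sum fun h' hh' => hcorr2 h hh h' hh')
    _ ≤ ∑ h ∈ range H, 2 * ∑ q ∈ range H, C q := sum_le_sum hrow
    _ = 2 * H * ∑ q ∈ range H, C q := by
        rw [Finset.sum_const, Finset.card_range, nsmul_eq_mul]; ring

/-- The statement of the `k`-th derivative test with exponents `s`, `t`. -/
def VDC (k : ℕ) (s t : ℝ) : Prop :=
  ∀ A : ℝ, 1 ≤ A → ∃ C : ℝ, 0 < C ∧ ∀ (N : ℕ) (f : ℕ → ℝ) (l : ℝ), 0 < l →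
    (∀ n < N, l ≤ dff^[k] f n ∧ dff^[k] f n ≤ A * l) →
    ‖∑ n ∈ range N, ee (f n)‖ ≤ C * (N * l ^ s + (N:ℝ) ^ t * l ^ (-s))

lemma VDC_two : VDC 2 (1/2) 0 := by
  intro A hA
  refine ⟨16 * A, by positivity, fun N f l hl h => ?_⟩
  rw [Real.rpow_zero, one_mul]
  exact second_test f N l A hl hA h

lemma dff_shift_sub (f : ℕ → ℝ) (q k n : ℕ) :
    dff^[k] (fun n => f (n+q) - f n) n = dff^[k] f (n+q) - dff^[k] f n := by
  induction k generalizing n with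
  | zero => rfl
  | succ k ih =>
    rw [Function.iterate_succ_apply', Function.iterate_succ_apply']
    simp only [dff, ih]
    rw [show n + 1 + q = n + q + 1 by ring]
    ring

lemma dff_sub_eq_sum (g : ℕ → ℝ) (q n : ℕ) : g (n+q) - g n = ∑ j ∈ range q, dff g (n+j) := by
  induction q with
  | zero => simp
  | succ q ih => rw [Finset.sum_range_succ, ← ih]; simp only [dff]; rw [← add_assoc]; ring

lemma sum_inv_sqrt (H : ℕ) : ∑ q ∈ range (H+1), (1:ℝ) / √q ≤ 2 * √H := by
  induction H with
  | zero => simp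
  | succ n ih =>
    rw [Finset.sum_range_succ]
    have h1 : 0 < √((n+1:ℕ):ℝ) := Real.sqrt_pos.mpr (by positivity)
    have h0 : 0 ≤ √(n:ℝ) := Real.sqrt_nonneg _
    have e1 := Real.mul_self_sqrt (show (0:ℝ) ≤ ((n+1:ℕ):ℝ) by positivity)
    have e0 := Real.mul_self_sqrt (show (0:ℝ) ≤ (n:ℝ) by positivity)
    have : 1 / √((n+1:ℕ):ℝ) ≤ 2 * √((n+1:ℕ):ℝ) - 2 * √(n:ℝ) := by
      rw [div_le_iff₀ h1]
      push_cast at *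
      nlinarith [sq_nonneg (√((n:ℝ)+1) - √(n:ℝ))]
    linarith

lemma sum_rpow_neg (H : ℕ) (s : ℝ) (hs : s ≤ 1/2) :
    ∑ q ∈ range H, (if q = 0 then 0 else (q:ℝ) ^ (-s)) ≤ 2 * (H:ℝ) ^ (1 - s) := by
  rcases Nat.eq_zero_or_pos H with rfl | hH
  · simp; positivity
  have hH' : (0:ℝ) < H := by exact_mod_cast hH
  calc ∑ q ∈ range H, (if q = 0 then 0 else (q:ℝ) ^ (-s))
      ≤ ∑ q ∈ range H, (H:ℝ)^(1/2 - s) * (1 / √q) := by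
        refine sum_le_sum fun q hq => ?_
        split_ifs with h0
        · positivity
        · have hq' : (0:ℝ) < q := by exact_mod_cast Nat.pos_of_ne_zero h0
          rw [Real.sqrt_eq_rpow, one_div (_ ^ _), ← Real.rpow_neg hq'.le,
            show -s = (1/2 - s) + -(1/2) by ring, Real.rpow_add hq']
          have : (q:ℝ) ≤ H := by exact_mod_cast (Finset.mem_range.mp hq).le
          gcongr
    _ ≤ (H:ℝ)^(1/2 - s) * (2 * √H) := by
        rw [← mul_sum]
        gcongr
        refine le_trans ?_ (sum_inv_sqrt H)
        exact Finset.sum_le_sum_of_subset_of_nonneg (Finset.range_mono (by omega))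
          (fun _ _ _ => by positivity)
    _ = 2 * (H:ℝ) ^ (1 - s) := by
        rw [Real.sqrt_eq_rpow, show 1 - s = (1/2 - s) + 1/2 by ring, Real.rpow_add hH']; ring

set_option maxHeartbeats 1000000 in
lemma VDC_step (k : ℕ) (s t : ℝ) (hs : 0 < s) (hs2 : s ≤ 1/2) (ht : 0 ≤ t) (h : VDC k s t) :
    VDC (k+1) (s/(2+2*s)) ((1+t)/2) := by
  intro A hA
  obtain ⟨C, hC, hV⟩ := h A hA
  refine ⟨4 + 8 * C, by positivity, fun N f l hl hf => ?_⟩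
  set s' := s/(2+2*s) with hs'
  have hs'0 : 0 < s' := by positivity
  have hid : (1 - 2*s') * s = 2 * s' := by rw [hs']; field_simp; ring
  have h1s : 0 < 1 - 2*s' := by
    have : (1 - 2*s') * s > 0 := by rw [hid]; positivity
    exact (pos_iff_pos_of_mul_pos this).mpr hs
  set a := (N:ℝ) * l ^ s' with ha
  set b := (N:ℝ) ^ ((1+t)/2) * l ^ (-s') with hb
  have ha0 : 0 ≤ a := by positivity
  have hb0 : 0 ≤ b := by positivity
  have htriv : ‖∑ n ∈ range N, ee (f n)‖ ≤ N := by
    refine (norm_sum_le _ _).trans ?_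
    simp [norm_ee]
  rcases Nat.eq_zero_or_pos N with hN0 | hN0
  · rw [hN0]; simp only [Finset.range_zero, Finset.sum_empty, norm_zero]; positivity
  have hN : (1:ℝ) ≤ N := by exact_mod_cast hN0
  rcases le_or_gt 1 l with hl1 | hl1
  · refine htriv.trans ?_
    have : 1 ≤ l ^ s' := Real.one_le_rpow hl1 hs'0.le
    have : (N:ℝ) ≤ a := by rw [ha]; nlinarith
    nlinarith
  set H0 := l ^ (-(2*s')) with hH0
  have hH01 : 1 ≤ H0 := Real.one_le_rpow_of_pos_of_le_one_of_nonpos hl hl1.le (by linarith)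
  have hH0pos : 0 < H0 := by linarith
  rcases le_or_gt (N:ℝ) (2 * H0) with hNH | hNH
  · -- trivial
    refine htriv.trans ?_
    have e1 : H0 = (l ^ (-s'))^2 := by
      rw [← Real.rpow_natCast, ← Real.rpow_mul hl.le, hH0]; congr 1; push_cast; ring
    have e2 : ((N:ℝ) ^ ((1+t)/2))^2 ≥ N := by
      rw [← Real.rpow_natCast, ← Real.rpow_mul (by positivity)]
      calc (N:ℝ) = (N:ℝ)^(1:ℝ) := (Real.rpow_one _).symm
        _ ≤ _ := Real.rpow_le_rpow_of_exponent_le hN (by push_cast; linarith)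
    have e3 : (N:ℝ)^2 ≤ (2 * b)^2 := by
      have : (2*b)^2 = 4 * ((N:ℝ) ^ ((1+t)/2))^2 * H0 := by rw [e1, hb]; ring
      rw [this]
      nlinarith
    have : (N:ℝ) ≤ 2 * b := by
      exact le_of_sq_le_sq e3 (by positivity)
    nlinarith
  set H := ⌈H0⌉₊ with hH
  have hHle : H0 ≤ H := Nat.le_ceil _
  have hHle2 : (H:ℝ) ≤ 2 * H0 := by
    have := Nat.ceil_lt_add_one hH0pos.le
    linarith
  have hHpos : (0:ℝ) < H := by linarith
  have hHN : (H:ℝ) ≤ N := by linarith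
  have hHN' : H ≤ N := by exact_mod_cast hHN
  -- correlations
  have hcor : ∀ q ∈ range H,
      ‖∑ n ∈ range (N - q), ee (f (n+q)) * (starRingEnd ℂ) (ee (f n))‖
      ≤ (if q = 0 then (N:ℝ) else 0) + C * ((N:ℝ) * (H * l)^s)
        + C * (N:ℝ)^t * l^(-s) * (if q = 0 then 0 else (q:ℝ) ^ (-s)) := by
    intro q hq
    rw [Finset.mem_range] at hq
    split_ifs with hq0
    · subst hq0
      have : ‖∑ n ∈ range (N - 0), ee (f (n+0)) * (starRingEnd ℂ) (ee (f n))‖ ≤ N := by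
        refine (norm_sum_le _ _).trans ?_
        simp [norm_ee]
      have : 0 ≤ C * ((N:ℝ) * (H * l)^s) := by positivity
      linarith
    · have hqpos : (0:ℝ) < q := by exact_mod_cast Nat.pos_of_ne_zero hq0
      have h1 := hV (N - q) (fun n => f (n+q) - f n) (q * l) (by positivity) (by
        intro n hn
        rw [dff_shift_sub, dff_sub_eq_sum]
        have hj : ∀ j ∈ range q, l ≤ dff (dff^[k] f) (n+j) ∧ dff (dff^[k] f) (n+j) ≤ A * l := by
          intro j hj
          rw [Finset.mem_range] at hj
          have := hf (n+j) (by omega)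
          rwa [Function.iterate_succ_apply'] at this
        constructor
        · have := Finset.card_nsmul_le_sum (range q) (fun j => dff (dff^[k] f) (n+j)) l
            (fun j hj' => (hj j hj').1)
          simpa using this
        · have := Finset.sum_le_card_nsmul (range q) (fun j => dff (dff^[k] f) (n+j)) (A*l)
            (fun j hj' => (hj j hj').2)
          rw [Finset.card_range, nsmul_eq_mul] at this
          linarith)
      simp only [ee_sub] at h1
      refine h1.trans ?_
      have hNq : ((N - q : ℕ) : ℝ) ≤ N := by exact_mod_cast Nat.sub_le N q
      have hqH : (q:ℝ) ≤ H := by exact_mod_cast hq.le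
      have e1 : ((N - q : ℕ) : ℝ) * (q * l)^s ≤ N * (H * l)^s := by gcongr
      have e2 : ((N - q : ℕ) : ℝ)^t * (q * l)^(-s) ≤ (N:ℝ)^t * l^(-s) * (q:ℝ)^(-s) := by
        rw [Real.mul_rpow hqpos.le hl.le]
        have : ((N - q : ℕ) : ℝ)^t ≤ (N:ℝ)^t := by gcongr
        calc _ ≤ (N:ℝ)^t * ((q:ℝ)^(-s) * l^(-s)) := by gcongr
          _ = _ := by ring
      calc C * (((N - q : ℕ) : ℝ) * (q * l)^s + ((N - q : ℕ) : ℝ)^t * (q * l)^(-s))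
          ≤ C * (N * (H * l)^s + (N:ℝ)^t * l^(-s) * (q:ℝ)^(-s)) := by gcongr
        _ = _ := by ring
  have hsumcor := sum_le_sum hcor
  rw [Finset.sum_add_distrib, Finset.sum_add_distrib, ← mul_sum (a := C * (N:ℝ)^t * l^(-s)),
    Finset.sum_const, Finset.card_range, nsmul_eq_mul] at hsumcor
  have hfirst : ∑ q ∈ range H, (if q = 0 then (N:ℝ) else 0) ≤ N := by
    rw [Finset.sum_ite_eq']
    split_ifs <;> linarith
  have hthird := sum_rpow_neg H s hs2
  have hw := weyl_ineq (fun n => ee (f n)) N H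
  set S := ‖∑ n ∈ range N, ee (f n)‖ with hS
  set Sc := ∑ q ∈ range H, ‖∑ n ∈ range (N - q), ee (f (n+q)) * (starRingEnd ℂ) (ee (f n))‖
    with hSg
  have hSgb : Sc ≤ N + H * (C * ((N:ℝ) * (H * l)^s)) + C * (N:ℝ)^t * l^(-s) * (2 * (H:ℝ) ^ (1 - s)) := by
    refine hsumcor.trans ?_
    gcongr
  have hHl1 : ((H:ℝ) * l)^s ≤ 2 * l^(2*s') := by
    calc ((H:ℝ) * l)^s ≤ (2 * (l ^ (1 - 2*s')))^s := by
          refine Real.rpow_le_rpow (by positivity) ?_ hs.le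
          rw [show 1 - 2*s' = -(2*s') + 1 by ring, Real.rpow_add hl, Real.rpow_one, ← mul_assoc]
          gcongr
      _ = 2^s * l^(2*s') := by
          rw [Real.mul_rpow (by norm_num) (by positivity), ← Real.rpow_mul hl.le, hid]
      _ ≤ 2^(1:ℝ) * l^(2*s') := by gcongr <;> linarith
      _ = _ := by rw [Real.rpow_one]
  have hHl2 : l^(-s) * (H:ℝ)^(-s) ≤ l^(-(2*s')) := by
    rw [← Real.mul_rpow hl.le hHpos.le]
    calc (l * H)^(-s) ≤ (l ^ (1 - 2*s'))^(-s) := by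
          apply Real.rpow_le_rpow_of_nonpos (by positivity) _ (by linarith)
          rw [show 1 - 2*s' = 1 + -(2*s') by ring, Real.rpow_add hl, Real.rpow_one]
          gcongr
      _ = _ := by rw [← Real.rpow_mul hl.le]; congr 1; linarith
  have hHl3 : (1:ℝ) ≤ H * l^(2*s') := by
    calc (1:ℝ) = H0 * l^(2*s') := by rw [hH0, ← Real.rpow_add hl]; simp
      _ ≤ _ := by gcongr
  have hH1s : (H:ℝ)^(1-s) = H * (H:ℝ)^(-s) := by
    rw [sub_eq_add_neg, Real.rpow_add hHpos, Real.rpow_one]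
  have hSgb2 : Sc ≤ H * (N * l^(2*s') + 2 * C * (N * l^(2*s')) + 2 * C * (N:ℝ)^t * l^(-(2*s'))) := by
    refine hSgb.trans ?_
    rw [hH1s]
    have t1 : (N:ℝ) ≤ H * (N * l^(2*s')) := by nlinarith
    have t2 : H * (C * ((N:ℝ) * (H * l)^s)) ≤ H * (C * ((N:ℝ) * (2 * l^(2*s')))) := by gcongr
    have t3 : C * (N:ℝ)^t * l^(-s) * (2 * (H * (H:ℝ)^(-s))) ≤ H * (2 * C * (N:ℝ)^t * l^(-(2*s'))) := by
      calc C * (N:ℝ)^t * l^(-s) * (2 * (H * (H:ℝ)^(-s)))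
          = H * (2 * C * (N:ℝ)^t * (l^(-s) * (H:ℝ)^(-s))) := by ring
        _ ≤ _ := by gcongr
    linarith
  have hasq : a^2 = N * (N * l^(2*s')) := by
    rw [ha, mul_pow, ← Real.rpow_natCast (l^s'), ← Real.rpow_mul hl.le]; push_cast; ring_nf
  have hbsq : b^2 = N * ((N:ℝ)^t * l^(-(2*s'))) := by
    rw [hb, mul_pow, ← Real.rpow_natCast (l^(-s')), ← Real.rpow_mul hl.le,
      ← Real.rpow_natCast ((N:ℝ)^((1+t)/2)), ← Real.rpow_mul (by positivity),
      show ((1+t)/2) * ((2:ℕ):ℝ) = 1 + t by push_cast; ring, Real.rpow_add (by linarith), Real.rpow_one]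
    push_cast; ring_nf
  have hfin : S^2 ≤ ((4 + 8*C) * (a + b))^2 := by
    have h1 : (H:ℝ)^2 * S^2 ≤ (2 * N) * (2 * H * (H * (N * l^(2*s') + 2 * C * (N * l^(2*s'))
        + 2 * C * (N:ℝ)^t * l^(-(2*s'))))) := by
      refine hw.trans ?_
      have hSg0 : 0 ≤ Sc := Finset.sum_nonneg fun _ _ => norm_nonneg _
      gcongr
      linarith
    have h2 : (H:ℝ)^2 * S^2 ≤ (H:ℝ)^2 * ((4 + 8*C) * a^2 + 8 * C * b^2) := by
      refine h1.trans (le_of_eq ?_)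
      rw [hasq, hbsq]; ring
    have h3 := le_of_mul_le_mul_left h2 (by positivity)
    have hab := mul_nonneg ha0 hb0
    have h4 : S^2 ≤ (4 + 8*C) * (a+b)^2 := by
      refine h3.trans ?_
      have : 0 ≤ (4 + 8*C) * (2 * (a*b)) + 4 * b^2 := by positivity
      linarith
    have h5 : (4 + 8*C) * (a+b)^2 ≤ (4 + 8*C) * ((4 + 8*C) * (a+b)^2) := by
      have : 0 ≤ (4 + 8*C) * (a+b)^2 := by positivity
      nlinarith
    linarith
  exact le_of_sq_le_sq hfin (by positivity)

lemma VDC_three : VDC 3 (1/6) (1/2) := by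
  have := VDC_step 2 (1/2) 0 (by norm_num) le_rfl le_rfl VDC_two
  norm_num at this
  exact this

lemma VDC_exists (k : ℕ) : ∃ s t : ℝ, 0 < s ∧ s ≤ 1/2 ∧ 0 ≤ t ∧ t + 3/2 * s < 1 ∧ VDC (k+2) s t := by
  induction k with
  | zero => exact ⟨1/2, 0, by norm_num, le_rfl, le_rfl, by norm_num, VDC_two⟩
  | succ k ih =>
    obtain ⟨s, t, h1, h2, h3, h4, h5⟩ := ih
    have h6 : s/(2+2*s) ≤ s / 2 := by gcongr; linarith
    refine ⟨s/(2+2*s), (1+t)/2, by positivity, by linarith, by positivity, by linarith, ?_⟩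
    exact VDC_step (k+2) s t h1 h2 h3 h5

lemma dff_chain (k : ℕ) (x0 : ℝ) (hx0 : 0 < x0) : ∀ (G : ℕ → ℝ → ℝ),
    (∀ j x, 0 < x → HasDerivAt (G j) (G (j+1) x) x) → ∀ n : ℕ,
    ∃ ξ, x0 + n ≤ ξ ∧ ξ ≤ x0 + n + k ∧ dff^[k] (fun n : ℕ => G 0 (x0 + n)) n = G k ξ := by
  induction k with
  | zero => intro G _ n; exact ⟨x0 + n, le_rfl, by simp, rfl⟩
  | succ k ih =>
    intro G hG n
    obtain ⟨ξ, h1, h2, h3⟩ := ih (fun j x => G j (x+1) - G j x) (fun j x hx => by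
      have a1 := hG j x hx
      have a2 := hG j (x+1) (by linarith)
      exact (a2.comp_add_const x 1).sub a1) n
    have hξ : 0 < ξ := by
      have : (0:ℝ) ≤ n := Nat.cast_nonneg n
      linarith
    obtain ⟨η, hη, he⟩ := exists_hasDerivAt_eq_slope (G k) (G (k+1)) (show ξ < ξ + 1 by linarith)
      (fun x hx => (hG k x (by linarith [hx.1])).continuousAt.continuousWithinAt)
      (fun x hx => hG k x (by linarith [hx.1]))
    refine ⟨η, by linarith [hη.1], by push_cast; linarith [hη.2], ?_⟩
    rw [he, show ξ + 1 - ξ = 1 by ring, div_one, ← h3, Function.iterate_succ_apply]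
    have : dff (fun n : ℕ => G 0 (x0 + n)) = fun n : ℕ => G 0 (x0 + n + 1) - G 0 (x0 + n) := by
      funext m
      simp only [dff]
      push_cast
      rw [add_assoc]
    rw [this]

/-- falling product `c(c-1)⋯(c-k+1)` -/
noncomputable def fall (c : ℝ) (k : ℕ) : ℝ := ∏ i ∈ range k, (c - i)

lemma pow_chain (c y : ℝ) (j : ℕ) (x : ℝ) (hx : 0 < x) :
    HasDerivAt (fun x : ℝ => y * (fall c j * x ^ (c - j)))
      (y * (fall c (j+1) * x ^ (c - (j+1:ℕ)))) x := by
  have h := ((Real.hasDerivAt_rpow_const (x := x) (p := c - j) (Or.inl hx.ne')).const_mul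
    (fall c j)).const_mul y
  refine h.congr_deriv ?_
  rw [show fall c (j+1) = fall c j * (c - j) from Finset.prod_range_succ _ _]
  push_cast
  rw [show c - (j:ℝ) - 1 = c - (j+1) by ring]
  ring

lemma dff_pow (c y x0 : ℝ) (hx0 : 0 < x0) (k n : ℕ) :
    ∃ ξ, x0 + n ≤ ξ ∧ ξ ≤ x0 + n + k ∧
      dff^[k] (fun n : ℕ => y * (x0 + n)^c) n = y * (fall c k * ξ ^ (c - k)) := by
  obtain ⟨ξ, h1, h2, h3⟩ := dff_chain k x0 hx0 (fun j x => y * (fall c j * x ^ (c - j)))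
    (fun j x hx => pow_chain c y j x hx) n
  refine ⟨ξ, h1, h2, ?_⟩
  rw [← h3]
  simp [fall]

lemma fall_ne_zero (c : ℝ) (hc : ∀ n : ℕ, c ≠ n) (k : ℕ) : fall c k ≠ 0 :=
  Finset.prod_ne_zero_iff.mpr fun i _ => sub_ne_zero.mpr (hc i)

lemma norm_sum_ee_neg {ι : Type*} (s : Finset ι) (f : ι → ℝ) :
    ‖∑ n ∈ s, ee (-f n)‖ = ‖∑ n ∈ s, ee (f n)‖ := by
  simp only [ee_neg]
  rw [← map_sum, Complex.norm_conj]

lemma sum_Ioc_shift (g : ℝ → ℂ) (a b : ℕ) :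
    ∑ m ∈ Ioc a b, g m = ∑ n ∈ range (b - a), g ((a:ℝ) + 1 + n) := by
  have : Ioc a b = Finset.Ico (a+1) (b+1) := by ext; simp [Nat.succ_le_iff]
  rw [this, Finset.sum_Ico_eq_sum_range]
  rw [show b + 1 - (a+1) = b - a by omega]
  refine sum_congr rfl fun n _ => ?_
  push_cast; rfl

/-- two-sided bounds for powers -/
lemma rpow_two_sided (β B : ℝ) (hB : 1 ≤ B) : ∃ κ1 κ2 : ℝ, 0 < κ1 ∧ 0 < κ2 ∧ ∀ M x : ℝ, 0 < M →
    M ≤ x → x ≤ B * M → κ1 * M ^ β ≤ x ^ β ∧ x ^ β ≤ κ2 * M ^ β := by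
  have hB0 : 0 < B := by linarith
  rcases le_total 0 β with h | h
  · refine ⟨1, B ^ β, one_pos, by positivity, fun M x hM h1 h2 => ⟨?_, ?_⟩⟩
    · rw [one_mul]; gcongr
    · rw [← Real.mul_rpow hB0.le hM.le]; gcongr
      linarith
  · refine ⟨B ^ β, 1, by positivity, one_pos, fun M x hM h1 h2 => ⟨?_, ?_⟩⟩
    · rw [← Real.mul_rpow hB0.le hM.le]
      exact Real.rpow_le_rpow_of_nonpos (by linarith) h2 h
    · rw [one_mul]; exact Real.rpow_le_rpow_of_nonpos hM h1 h

lemma pow_test_aux (k : ℕ) (s t : ℝ) (hs : 0 ≤ s) (ht : 0 ≤ t) (hV : VDC k s t) (c B : ℝ)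
    (hc : fall c k ≠ 0) (hB : 1 ≤ B) :
    ∃ C : ℝ, 0 < C ∧ ∀ (M : ℝ) (a b : ℕ) (y : ℝ), 1 ≤ M → M ≤ a → (b:ℝ) ≤ B * M →
      0 < y * fall c k →
      ‖∑ m ∈ Ioc a b, ee (y * (m:ℝ)^c)‖ ≤
        C * (M * (|y| * M^(c-k))^s + M^t * (|y| * M^(c-k))^(-s)) := by
  obtain ⟨κ1, κ2, hκ1, hκ2, hκ⟩ := rpow_two_sided (c - k) (B + 1 + k) (by
    have : (0:ℝ) ≤ k := Nat.cast_nonneg k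
    linarith)
  have hF : 0 < |fall c k| := abs_pos.mpr hc
  have hκ12 : κ1 ≤ κ2 := by
    have := hκ 1 1 one_pos le_rfl (by linarith [(Nat.cast_nonneg k : (0:ℝ) ≤ k)])
    simp at this; linarith
  obtain ⟨C, hC, hb⟩ := hV (κ2/κ1) (by rw [le_div_iff₀ hκ1]; linarith)
  set F := |fall c k| * κ1 with hFdef
  have hF0 : 0 < F := by positivity
  refine ⟨C * (B * F^s + B^t * F^(-s)), by positivity, fun M a b y hM ha hbM hy => ?_⟩
  have hy0 : 0 < |y| := abs_pos.mpr (by rintro rfl; simp at hy)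
  have hyF : y * fall c k = |y| * |fall c k| := by rw [← abs_mul, abs_of_pos hy]
  have hM0 : 0 < M := by linarith
  set L := |y| * M^(c-k) with hL
  have hL0 : 0 < L := by positivity
  rw [sum_Ioc_shift (fun x => ee (y * x^c))]
  have h1 := hb (b - a) (fun n : ℕ => y * ((a:ℝ) + 1 + n)^c) (F * L) (by positivity) (by
    intro n hn
    obtain ⟨ξ, h1, h2, h3⟩ := dff_pow c y ((a:ℝ)+1) (by positivity) k n
    rw [h3, ← mul_assoc y, hyF]
    have hn' : (n:ℝ) + a + 1 ≤ b := by exact_mod_cast (by omega : n + a + 1 ≤ b)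
    have hk0 : (0:ℝ) ≤ k := Nat.cast_nonneg k
    have hn0 : (0:ℝ) ≤ n := Nat.cast_nonneg n
    have := hκ M ξ hM0 (by linarith) (by nlinarith)
    rw [hL, hFdef]
    constructor
    · calc |fall c k| * κ1 * (|y| * M^(c-k)) = |y| * |fall c k| * (κ1 * M^(c-k)) := by ring
        _ ≤ _ := by gcongr; exact this.1
    · calc |y| * |fall c k| * ξ^(c-k) ≤ |y| * |fall c k| * (κ2 * M^(c-k)) := by gcongr; exact this.2
        _ = _ := by field_simp)
  refine h1.trans ?_
  have hN : ((b - a : ℕ) : ℝ) ≤ B * M := by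
    refine le_trans ?_ hbM
    exact_mod_cast Nat.sub_le b a
  rw [Real.mul_rpow hF0.le hL0.le, Real.mul_rpow hF0.le hL0.le]
  have e1 : ((b - a : ℕ) : ℝ)^t ≤ B^t * M^t := by
    rw [← Real.mul_rpow (by linarith) hM0.le]; gcongr
  calc C * (((b - a : ℕ) : ℝ) * (F^s * L^s) + ((b - a : ℕ) : ℝ)^t * (F^(-s) * L^(-s)))
      ≤ C * ((B * M) * (F^s * L^s) + (B^t * M^t) * (F^(-s) * L^(-s))) := by gcongr
    _ = C * ((B * F^s) * (M * L^s) + (B^t * F^(-s)) * (M^t * L^(-s))) := by ring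
    _ ≤ C * ((B * F^s + B^t * F^(-s)) * (M * L^s) + (B * F^s + B^t * F^(-s)) * (M^t * L^(-s))) := by
        have : 0 ≤ B^t * F^(-s) := by positivity
        have : 0 ≤ B * F^s := by positivity
        gcongr <;> linarith
    _ = _ := by ring

lemma pow_test (k : ℕ) (s t : ℝ) (hs : 0 ≤ s) (ht : 0 ≤ t) (hV : VDC k s t) (c B : ℝ)
    (hc : fall c k ≠ 0) (hB : 1 ≤ B) :
    ∃ C : ℝ, 0 < C ∧ ∀ (M : ℝ) (a b : ℕ) (y : ℝ), 1 ≤ M → M ≤ a → (b:ℝ) ≤ B * M → y ≠ 0 →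
      ‖∑ m ∈ Ioc a b, ee (y * (m:ℝ)^c)‖ ≤
        C * (M * (|y| * M^(c-k))^s + M^t * (|y| * M^(c-k))^(-s)) := by
  obtain ⟨C, hC, h⟩ := pow_test_aux k s t hs ht hV c B hc hB
  refine ⟨C, hC, fun M a b y hM ha hb hy => ?_⟩
  rcases lt_or_gt_of_ne (mul_ne_zero hy hc) with h1 | h1
  · have := h M a b (-y) hM ha hb (by linarith)
    rw [abs_neg] at this
    rw [← norm_sum_ee_neg]
    simpa only [neg_mul] using this
  · exact h M a b y hM ha hb h1

lemma pow_KL (c B : ℝ) (hc : 1 < c) (hB : 1 ≤ B) :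
    ∃ c1 C : ℝ, 0 < c1 ∧ 0 < C ∧ ∀ (M : ℝ) (a b : ℕ) (y : ℝ), 1 ≤ M → M ≤ a → (b:ℝ) ≤ B * M →
      y ≠ 0 → |y| * M^(c-1) ≤ c1 →
      ‖∑ m ∈ Ioc a b, ee (y * (m:ℝ)^c)‖ ≤ C / (|y| * M^(c-1)) := by
  set c1 := 1 / (2 * c * (B+1)^(c-1)) with hc1
  have hB1 : 1 ≤ (B+1)^(c-1) := Real.one_le_rpow (by linarith) (by linarith)
  refine ⟨c1, 2/c, by positivity, by positivity, fun M a b y hM ha hb hy hyM => ?_⟩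
  have hM0 : 0 < M := by linarith
  have main : ∀ y : ℝ, 0 < y → y * M^(c-1) ≤ c1 →
      ‖∑ m ∈ Ioc a b, ee (y * (m:ℝ)^c)‖ ≤ 2/c / (y * M^(c-1)) := by
    intro y hy hyM
    rw [sum_Ioc_shift (fun x => ee (y * x^c)), ← Nat.Ico_zero_eq_range]
    have key : ∀ n : ℕ, n < b - a → c * (y * M^(c-1)) ≤ dff (fun n : ℕ => y * ((a:ℝ) + 1 + n)^c) n ∧
        dff (fun n : ℕ => y * ((a:ℝ) + 1 + n)^c) n ≤ 1/2 := by
      intro n hn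
      obtain ⟨ξ, h1, h2, h3⟩ := dff_pow c y ((a:ℝ)+1) (by positivity) 1 n
      simp only [Function.iterate_one, fall, Finset.range_one, Finset.prod_singleton,
        Nat.cast_zero, sub_zero, Nat.cast_one] at h3 h2
      rw [h3]
      have hn' : (n:ℝ) + a + 1 ≤ b := by exact_mod_cast (by omega : n + a + 1 ≤ b)
      have hn0 : (0:ℝ) ≤ n := Nat.cast_nonneg n
      have hξ1 : M ≤ ξ := by linarith
      have hξ2 : ξ ≤ (B+1) * M := by nlinarith
      constructor
      · calc c * (y * M^(c-1)) = y * (c * M^(c-1)) := by ring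
          _ ≤ _ := by gcongr
      · calc y * (c * ξ^(c-1)) ≤ y * (c * ((B+1)*M)^(c-1)) := by gcongr; linarith
          _ = (y * M^(c-1)) * (c * (B+1)^(c-1)) := by
              rw [Real.mul_rpow (by linarith) hM0.le]; ring
          _ ≤ c1 * (c * (B+1)^(c-1)) := by gcongr
          _ = 1/2 := by rw [hc1]; field_simp
    have hpos : 0 < c * (y * M^(c-1)) := by positivity
    refine (kusmin_landau (fun n : ℕ => y * ((a:ℝ) + 1 + n)^c) 0 (b-a) (c * (y * M^(c-1))) 0 hpos
      (fun n _ hn => ?_) (fun n _ hn => ?_) (fun n _ hn => ?_)).trans (le_of_eq ?_)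
    · have := (key n hn).1
      simpa [dff] using this
    · have h1 := (key n hn)
      have : dff (fun n : ℕ => y * ((a:ℝ) + 1 + n)^c) n ≤ 1 - c * (y * M^(c-1)) := by linarith
      simpa [dff] using this
    · obtain ⟨ξ, h1, h2, h3⟩ := dff_pow c y ((a:ℝ)+1) (by positivity) 2 n
      have hn0 : (0:ℝ) ≤ n := Nat.cast_nonneg n
      have hξ : 0 < ξ := by linarith
      have : 0 ≤ dff^[2] (fun n : ℕ => y * ((a:ℝ) + 1 + n)^c) n := by
        rw [h3]
        have : 0 ≤ fall c 2 := by
          simp [fall, Finset.prod_range_succ]; nlinarith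
        positivity
      have e : dff^[2] (fun n : ℕ => y * ((a:ℝ) + 1 + n)^c) n
          = (y * ((a:ℝ) + 1 + (n+2:ℕ))^c - y * ((a:ℝ) + 1 + (n+1:ℕ))^c)
            - (y * ((a:ℝ) + 1 + (n+1:ℕ))^c - y * ((a:ℝ) + 1 + n)^c) := rfl
      rw [e] at this
      linarith
    · field_simp
  rcases lt_or_gt_of_ne hy with h | h
  · rw [abs_of_neg h] at hyM ⊢
    have := main (-y) (by linarith) hyM
    rw [← norm_sum_ee_neg]
    simpa only [neg_mul] using this
  · rw [abs_of_pos h] at hyM ⊢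
    exact main y h hyM

lemma norm_sum_ee_le {ι : Type*} (s : Finset ι) (f : ι → ℝ) : ‖∑ n ∈ s, ee (f n)‖ ≤ s.card := by
  refine (norm_sum_le _ _).trans ?_
  simp [norm_ee]

/-- Combined exponential sum estimate. -/
lemma exp_sum_E (c B : ℝ) (hc : 1 < c) (hcn : ∀ n : ℕ, c ≠ n) (hB : 1 ≤ B) (K : ℕ) :
    ∃ δ C : ℝ, 0 < δ ∧ δ ≤ 1/4 ∧ 0 < C ∧ ∀ (M : ℝ) (a b : ℕ) (y : ℝ), 1 ≤ M → M ≤ a →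
      (b:ℝ) ≤ B * M → y ≠ 0 → |y| * M^c ≤ M^((K:ℝ) + 1/2) →
      ‖∑ m ∈ Ioc a b, ee (y * (m:ℝ)^c)‖ ≤ C * (M / (|y| * M^c) + M^(1-δ)) := by
  induction K with
  | zero =>
    obtain ⟨c1, C, hc1, hC, h⟩ := pow_KL c B hc hB
    refine ⟨1/4, C + B * c1^(-2:ℝ), by norm_num, le_rfl, by positivity, fun M a b y hM ha hb hy hT => ?_⟩
    have hM0 : 0 < M := by linarith
    have hy0 : 0 < |y| := abs_pos.mpr hy
    have e : |y| * M^c = (|y| * M^(c-1)) * M := by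
      rw [mul_assoc, ← Real.rpow_add_one hM0.ne']; congr 2; ring
    have e2 : M / (|y| * M^c) = 1 / (|y| * M^(c-1)) := by rw [e]; field_simp
    have hp : 0 < M / (|y| * M^c) := by positivity
    have hp2 : 1 ≤ M^(1-1/4:ℝ) := Real.one_le_rpow hM (by norm_num)
    have hp3 : 0 ≤ B * c1^(-2:ℝ) := by positivity
    rcases le_or_gt (|y| * M^(c-1)) c1 with h1 | h1
    · refine (h M a b y hM ha hb hy h1).trans ?_
      rw [div_eq_mul_one_div, ← e2]
      nlinarith
    · have h2 : c1 * M < M^(1/2:ℝ) := by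
        rw [e] at hT
        have : M^(((0:ℕ):ℝ) + 1/2) = M^(1/2:ℝ) := by norm_num
        rw [this] at hT
        nlinarith
      have h3 : c1 * M^(1/2:ℝ) < 1 := by
        have : M = M^(1/2:ℝ) * M^(1/2:ℝ) := by rw [← Real.rpow_add hM0]; norm_num
        have hp : 0 < M^(1/2:ℝ) := by positivity
        by_contra hcon
        push Not at hcon
        nlinarith
      have h4 : M ≤ c1^(-2:ℝ) := by
        have h5 : M^(1/2:ℝ) ≤ c1⁻¹ := by
          rw [le_inv_comm₀ (by positivity) hc1, ← one_div, le_div_iff₀ (by positivity)]; exact h3.le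
        have h6 : (M^(1/2:ℝ))^(2:ℝ) ≤ (c1⁻¹)^(2:ℝ) := by gcongr
        rw [← Real.rpow_mul hM0.le, Real.inv_rpow hc1.le, ← Real.rpow_neg hc1.le] at h6
        norm_num at h6 ⊢
        exact h6
      have h5 := norm_sum_ee_le (Ioc a b) (fun m => y * (m:ℝ)^c)
      rw [Nat.card_Ioc] at h5
      have h6 : ((b - a : ℕ) : ℝ) ≤ B * M := by
        refine le_trans ?_ hb
        exact_mod_cast Nat.sub_le b a
      have h7 : B * M ≤ B * c1^(-2:ℝ) := by gcongr
      nlinarith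
  | succ K ih =>
    obtain ⟨δ, C, hδ, hδ2, hC, h⟩ := ih
    obtain ⟨s, t, hs, hs2, ht, hts, hV⟩ := VDC_exists K
    obtain ⟨C', hC', h'⟩ := pow_test (K+2) s t hs.le ht hV c B (fall_ne_zero c hcn _) hB
    have hδ' : 0 < min δ (min (s/2) (1 - (t + 3/2*s))) := by
      refine lt_min hδ (lt_min (by linarith) (by linarith))
    refine ⟨min δ (min (s/2) (1 - (t + 3/2*s))), C + 2*C', hδ', (min_le_left _ _).trans hδ2,
      by positivity, fun M a b y hM ha hb hy hT => ?_⟩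
    set δ' := min δ (min (s/2) (1 - (t + 3/2*s))) with hδdef
    have d1 : δ' ≤ δ := min_le_left _ _
    have d2 : δ' ≤ s/2 := (min_le_right _ _).trans (min_le_left _ _)
    have d3 : δ' ≤ 1 - (t+3/2*s) := (min_le_right _ _).trans (min_le_right _ _)
    have hM0 : 0 < M := by linarith
    have hy0 : 0 < |y| := abs_pos.mpr hy
    have hp : 0 < M / (|y| * M^c) := by positivity
    have hp2 : 0 < M^(1-δ') := by positivity
    rcases le_or_gt (|y| * M^c) (M^((K:ℝ) + 1/2)) with h1 | h1
    · refine (h M a b y hM ha hb hy h1).trans ?_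
      have : M^(1-δ) ≤ M^(1-δ') := Real.rpow_le_rpow_of_exponent_le hM (by linarith)
      gcongr
      linarith
    · refine (h' M a b y hM ha hb hy).trans ?_
      have e : |y| * M^(c - ((K+2:ℕ):ℝ)) = (|y| * M^c) * M^(-((K:ℝ)+2)) := by
        rw [mul_assoc, ← Real.rpow_add hM0]; push_cast; congr 2
      have u1 : |y| * M^(c - ((K+2:ℕ):ℝ)) ≤ M^(-(1/2):ℝ) := by
        rw [e]
        calc _ ≤ M^(((K+1:ℕ):ℝ) + 1/2) * M^(-((K:ℝ)+2)) := by gcongr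
          _ = _ := by rw [← Real.rpow_add hM0]; push_cast; congr 1; ring
      have u2 : M^(-(3/2):ℝ) ≤ |y| * M^(c - ((K+2:ℕ):ℝ)) := by
        rw [e]
        calc _ = M^((K:ℝ) + 1/2) * M^(-((K:ℝ)+2)) := by rw [← Real.rpow_add hM0]; congr 1; ring
          _ ≤ _ := by gcongr
      have v1 : M * (|y| * M^(c - ((K+2:ℕ):ℝ)))^s ≤ M^(1-δ') := by
        calc _ ≤ M * (M^(-(1/2):ℝ))^s := by gcongr
          _ = M^(1 + -(1/2)*s) := by
              rw [← Real.rpow_mul hM0.le, Real.rpow_add hM0, Real.rpow_one]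
          _ ≤ _ := Real.rpow_le_rpow_of_exponent_le hM (by linarith)
      have v2 : M^t * (|y| * M^(c - ((K+2:ℕ):ℝ)))^(-s) ≤ M^(1-δ') := by
        calc _ ≤ M^t * (M^(-(3/2):ℝ))^(-s) := by
              gcongr ?_ * ?_
              exact Real.rpow_le_rpow_of_nonpos (by positivity) u2 (by linarith)
          _ = M^(t + -(3/2)*(-s)) := by rw [← Real.rpow_mul hM0.le, Real.rpow_add hM0]
          _ ≤ _ := Real.rpow_le_rpow_of_exponent_le hM (by linarith)
      calc _ ≤ C' * (M^(1-δ') + M^(1-δ')) := by gcongr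
        _ ≤ _ := by nlinarith [mul_pos hC hp, mul_pos hC hp2, mul_pos hC' hp]

/-! ## Part B: the fourth moment -/

lemma taylor_pow (β B : ℝ) (hB : 1 ≤ B) : ∃ C : ℝ, 1 ≤ C ∧ ∀ x ρ : ℝ, 1/B ≤ x → x ≤ B →
    1/B ≤ ρ → ρ ≤ B → |x^β - ρ^β| ≤ C * |x - ρ| ∧
      |x^β - ρ^β - β * ρ^(β-1) * (x - ρ)| ≤ C * (x - ρ)^2 := by
  have hB0 : 0 < B := by linarith
  have hB1 : 0 < 1/B := by positivity
  have hbd : ∀ γ : ℝ, ∃ C : ℝ, 0 < C ∧ ∀ x : ℝ, 1/B ≤ x → x ≤ B → |x^γ| ≤ C := by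
    intro γ
    obtain ⟨κ1, κ2, h1, h2, h⟩ := rpow_two_sided γ (B*B) (by nlinarith)
    refine ⟨κ2 * (1/B)^γ, by positivity, fun x hx1 hx2 => ?_⟩
    have := (h (1/B) x hB1 hx1 (by field_simp; linarith)).2
    rwa [abs_of_nonneg (Real.rpow_nonneg (by linarith) _)]
  obtain ⟨C1, hC1, hb1⟩ := hbd (β-1)
  obtain ⟨C2, hC2, hb2⟩ := hbd (β-1-1)
  set S := Set.Icc (1/B) B with hS
  have hconv : Convex ℝ S := convex_Icc _ _
  have lip : ∀ γ Cg : ℝ, (∀ x : ℝ, 1/B ≤ x → x ≤ B → |x^(γ-1)| ≤ Cg) → ∀ x ∈ S, ∀ y ∈ S,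
      |x^γ - y^γ| ≤ |γ| * Cg * |x - y| := by
    intro γ Cg hCg x hx y hy
    have := hconv.norm_image_sub_le_of_norm_hasDerivWithin_le (f := fun x : ℝ => x^γ)
      (f' := fun x => γ * x^(γ-1)) (C := |γ| * Cg) (fun z hz =>
        (Real.hasDerivAt_rpow_const (Or.inl (by linarith [hz.1]))).hasDerivWithinAt)
      (fun z hz => by
        rw [norm_mul, Real.norm_eq_abs, Real.norm_eq_abs]
        exact mul_le_mul_of_nonneg_left (hCg z hz.1 hz.2) (abs_nonneg _)) hy hx
    simpa [Real.norm_eq_abs] using this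
  refine ⟨1 + |β| * C1 + |β| * (|β-1| * C2), by
    have : 0 ≤ |β| * C1 := by positivity
    have : 0 ≤ |β| * (|β-1| * C2) := by positivity
    linarith, fun x ρ hx1 hx2 hr1 hr2 => ⟨?_, ?_⟩⟩
  · refine (lip β C1 hb1 x ⟨hx1, hx2⟩ ρ ⟨hr1, hr2⟩).trans ?_
    gcongr
    have : 0 ≤ |β| * (|β-1| * C2) := by positivity
    linarith
  · -- mean value on the segment
    have hsub : Set.uIcc ρ x ⊆ S := Set.uIcc_subset_Icc ⟨hr1, hr2⟩ ⟨hx1, hx2⟩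
    have hcv : Convex ℝ (Set.uIcc ρ x) := convex_uIcc _ _
    have := hcv.norm_image_sub_le_of_norm_hasDerivWithin_le
      (f := fun z : ℝ => z^β - β * ρ^(β-1) * z)
      (f' := fun z => β * z^(β-1) - β * ρ^(β-1)) (C := |β| * (|β-1| * C2 * |x - ρ|)) (fun z hz => by
        have h0 : z ≠ 0 := by have := (hsub hz).1; linarith
        have h1 := (Real.hasDerivAt_rpow_const (x := z) (p := β) (Or.inl h0))
        have h2 := (hasDerivAt_id z).const_mul (β * ρ^(β-1))
        simp only [id, mul_one] at h2
        exact (h1.sub h2).hasDerivWithinAt)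
      (fun z hz => by
        rw [← mul_sub, norm_mul, Real.norm_eq_abs, Real.norm_eq_abs]
        refine mul_le_mul_of_nonneg_left ?_ (abs_nonneg _)
        refine (lip (β-1) C2 hb2 z (hsub hz) ρ ⟨hr1, hr2⟩).trans ?_
        gcongr ?_ * ?_
        exact Set.abs_sub_left_of_mem_uIcc hz) Set.left_mem_uIcc Set.right_mem_uIcc
    rw [Real.norm_eq_abs, Real.norm_eq_abs] at this
    have e : x^β - β * ρ^(β-1) * x - (ρ^β - β * ρ^(β-1) * ρ) = x^β - ρ^β - β * ρ^(β-1) * (x - ρ) := by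
      ring
    rw [e] at this
    refine this.trans ?_
    rw [← sq_abs (x - ρ)]
    have h1 : 0 ≤ |β| * C1 * |x - ρ|^2 := by positivity
    nlinarith [sq_nonneg |x - ρ|]

set_option maxHeartbeats 1000000 in
/-- geometry inside a cell -/
lemma cell_geom (c B C : ℝ) (hc : 1 < c) (hB : 1 ≤ B) (hC : 0 < C) : ∃ C1 : ℝ, 1 ≤ C1 ∧
    ∀ s x1 x2 x3 r1 r2 r3 : ℝ, 0 < s → s ≤ 1 →
    (1/B ≤ x1 ∧ x1 ≤ B) → (1/B ≤ x2 ∧ x2 ≤ B) → (1/B ≤ x3 ∧ x3 ≤ B) →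
    (1/B ≤ r1 ∧ r1 ≤ B) → (1/B ≤ r2 ∧ r2 ≤ B) → (1/B ≤ r3 ∧ r3 ≤ B) →
    |x1^c + x2^c - x3^c - 1| ≤ C * s^2 → |r1^c + r2^c - r3^c - 1| ≤ C * s^2 →
    |x1 - r1| ≤ s → |x2 - r2| ≤ s →
    |x3 - r3 - (r1/r3)^(c-1) * (x1 - r1) - (r2/r3)^(c-1) * (x2 - r2)| ≤ C1 * s^2 := by
  have hB0 : 0 < B := by linarith
  obtain ⟨T, hT1, hT⟩ := taylor_pow c B hB
  have hBc : 1/B ≤ B^c ∧ True := ⟨by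
    have : 1 ≤ B^c := Real.one_le_rpow hB (by linarith)
    have : 1/B ≤ 1 := by rw [div_le_one hB0]; exact hB
    linarith, trivial⟩
  have hBcB : B ≤ B^c := by
    calc B = B^(1:ℝ) := (Real.rpow_one B).symm
      _ ≤ B^c := Real.rpow_le_rpow_of_exponent_le hB hc.le
  obtain ⟨T', hT1', hT'⟩ := taylor_pow (1/c) (B^c) (hB.trans hBcB)
  set E := T' * (2*T + 2*C) with hE
  have hE0 : 0 < E := by positivity
  set Q := B^(c-1) / c with hQ
  have hQ0 : 0 < Q := by positivity
  refine ⟨1 + Q * (2*C + 2*T + T * E^2), by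
    have : 0 ≤ Q * (2*C + 2*T + T * E^2) := by positivity
    linarith, ?_⟩
  intro s x1 x2 x3 r1 r2 r3 hs hs1 hx1 hx2 hx3 hr1 hr2 hr3 hx hr h1 h2
  have hiB : 0 < 1/B := by positivity
  have p1 : 0 < r1 := by linarith
  have p2 : 0 < r2 := by linarith
  have p3 : 0 < r3 := by linarith
  have q3 : 0 < x3 := by linarith
  have ss : s^2 ≤ s := by nlinarith
  have t1 := hT x1 r1 hx1.1 hx1.2 hr1.1 hr1.2
  have t2 := hT x2 r2 hx2.1 hx2.2 hr2.1 hr2.2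
  have t3 := hT x3 r3 hx3.1 hx3.2 hr3.1 hr3.2
  -- |x3 - r3| ≤ E s
  have hpow : |x3^c - r3^c| ≤ (2*T + 2*C) * s := by
    have a1 := abs_le.mp t1.1
    have a2 := abs_le.mp t2.1
    have b1 : T * |x1 - r1| ≤ T * s := by gcongr
    have b2 : T * |x2 - r2| ≤ T * s := by gcongr
    have a3 := abs_le.mp hx
    have a4 := abs_le.mp hr
    have : C * s^2 ≤ C * s := by gcongr
    rw [abs_le]; constructor <;> linarith
  have hx3r3 : |x3 - r3| ≤ E * s := by
    have inB : ∀ z : ℝ, 1/B ≤ z → z ≤ B → 1/B^c ≤ z^c ∧ z^c ≤ B^c := by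
      intro z hz1 hz2
      constructor
      · rw [one_div, ← Real.inv_rpow hB0.le, ← one_div]; gcongr
      · have : 0 < z := by linarith
        gcongr
    have a1 := inB x3 hx3.1 hx3.2
    have a2 := inB r3 hr3.1 hr3.2
    have := (hT' (x3^c) (r3^c) a1.1 a1.2 a2.1 a2.2).1
    rw [← Real.rpow_mul q3.le, ← Real.rpow_mul p3.le, mul_one_div_cancel (by linarith), Real.rpow_one,
      Real.rpow_one] at this
    refine this.trans ?_
    calc T' * |x3^c - r3^c| ≤ T' * ((2*T + 2*C) * s) := by gcongr
      _ = E * s := by rw [hE]; ring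
  have sq1 : (x1 - r1)^2 ≤ s^2 := by rw [← sq_abs]; gcongr
  have sq2 : (x2 - r2)^2 ≤ s^2 := by rw [← sq_abs]; gcongr
  have sq3 : (x3 - r3)^2 ≤ E^2 * s^2 := by rw [← sq_abs, ← mul_pow]; gcongr
  have key : |c * r3^(c-1) * (x3 - r3) - c * r1^(c-1) * (x1 - r1) - c * r2^(c-1) * (x2 - r2)|
      ≤ (2*C + 2*T + T * E^2) * s^2 := by
    have a1 := abs_le.mp t1.2
    have a2 := abs_le.mp t2.2
    have a3 := abs_le.mp t3.2
    have b1 : T * (x1 - r1)^2 ≤ T * s^2 := by gcongr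
    have b2 : T * (x2 - r2)^2 ≤ T * s^2 := by gcongr
    have b3 : T * (x3 - r3)^2 ≤ T * (E^2 * s^2) := by gcongr
    have a4 := abs_le.mp hx
    have a5 := abs_le.mp hr
    rw [abs_le]; constructor <;> linarith
  have hr3pos : 0 < r3^(c-1) := by positivity
  have e : x3 - r3 - (r1/r3)^(c-1) * (x1 - r1) - (r2/r3)^(c-1) * (x2 - r2)
      = (1/(c * r3^(c-1))) * (c * r3^(c-1) * (x3 - r3) - c * r1^(c-1) * (x1 - r1)
        - c * r2^(c-1) * (x2 - r2)) := by
    rw [Real.div_rpow p1.le p3.le, Real.div_rpow p2.le p3.le]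
    field_simp
  rw [e, abs_mul]
  have f : |1/(c * r3^(c-1))| ≤ Q := by
    rw [abs_of_pos (by positivity), hQ, div_le_div_iff₀ (by positivity) (by linarith)]
    have : 1 ≤ B^(c-1) * r3^(c-1) := by
      rw [← Real.mul_rpow hB0.le p3.le]
      refine Real.one_le_rpow ?_ (by linarith)
      have := hr3.1
      rw [div_le_iff₀ hB0] at this
      linarith
    calc 1 * c ≤ (B^(c-1) * r3^(c-1)) * c := by gcongr
      _ = _ := by ring
  calc |1/(c * r3^(c-1))| * _ ≤ Q * ((2*C + 2*T + T * E^2) * s^2) := by gcongr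
    _ ≤ _ := by linarith [sq_nonneg s]

lemma rpow_mem_box (B γ : ℝ) (hB : 1 ≤ B) : ∃ B' : ℝ, 1 ≤ B' ∧ ∀ x : ℝ, 1/B ≤ x → x ≤ B →
    1/B' ≤ x^γ ∧ x^γ ≤ B' := by
  have hB0 : 0 < B := by linarith
  refine ⟨B^|γ|, Real.one_le_rpow hB (abs_nonneg _), fun x h1 h2 => ?_⟩
  have hx : 0 < x := lt_of_lt_of_le (by positivity) h1
  have h3 : x⁻¹ ≤ B := by
    rw [inv_le_comm₀ hx hB0, ← one_div]; exact h1
  have key : ∀ z : ℝ, 0 < z → z ≤ B → z⁻¹ ≤ B → ∀ g : ℝ, z^g ≤ B^|g| := by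
    intro z hz hzB hzi g
    rcases le_total 0 g with h | h
    · rw [abs_of_nonneg h]; gcongr
    · rw [abs_of_nonpos h, ← neg_neg g, Real.rpow_neg hz.le, ← Real.inv_rpow hz.le, neg_neg]
      gcongr
      linarith
  refine ⟨?_, key x hx h2 h3 γ⟩
  rw [one_div, inv_le_comm₀ (by positivity) (by positivity), ← Real.rpow_neg hx.le]
  have := key x hx h2 h3 (-γ)
  rwa [abs_neg] at this

set_option maxHeartbeats 2000000 in
/-- geometry on the dual side -/
lemma dual_geom (c B C : ℝ) (hc : 1 < c) (hB : 1 ≤ B) (hC : 0 < C) :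
    ∃ K0 B' C' C'' : ℝ, 1 ≤ K0 ∧ 1 ≤ B' ∧ 0 < C' ∧ 0 < C'' ∧
    ∀ M K r1 r2 r3 m1 m2 L m4 : ℝ, K0 ≤ K → K ≤ M → 1 ≤ L → L * K ≤ M →
    (1/B ≤ r1 ∧ r1 ≤ B) → (1/B ≤ r2 ∧ r2 ≤ B) → (1/B ≤ r3 ∧ r3 ≤ B) →
    |r1^c + r2^c - r3^c - 1| ≤ C / M^2 →
    |m1 - (r1/r3)^(c-1) * L| ≤ 1/√K → |m2 - (r2/r3)^(c-1) * L| ≤ 1/√K →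
    |m4 - r1 * m1 - r2 * m2 + r3 * L| ≤ 1/M →
    (L/B' ≤ m1 ∧ m1 ≤ B' * L) ∧ (L/B' ≤ m2 ∧ m2 ≤ B' * L) ∧ (L/B' ≤ m4 ∧ m4 ≤ B' * L) ∧
    |m1^(c/(c-1)) + m2^(c/(c-1)) - L^(c/(c-1)) - m4^(c/(c-1))| ≤ C' * L^(c/(c-1) - 2) ∧
    |r1 - (m1/m4)^(1/(c-1))| ≤ C'' / (L * √K) ∧ |r2 - (m2/m4)^(1/(c-1))| ≤ C'' / (L * √K) := by
  have hB0 : 0 < B := by linarith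
  have hc1 : 0 < c - 1 := by linarith
  set e := c/(c-1) with he
  have he1 : e - 1 = 1/(c-1) := by rw [he]; field_simp; ring
  obtain ⟨A, hA1, hA⟩ := rpow_mem_box (B*B) (c-1) (by nlinarith)
  obtain ⟨A2, hA21, hA2⟩ := rpow_mem_box B (1-c) hB
  -- a box containing everything
  set D := 2 * (A + A2) with hD
  have hD1 : 1 ≤ D := by linarith
  have hD0 : 0 < D := by linarith
  obtain ⟨T, hT1, hT⟩ := taylor_pow e D hD1
  obtain ⟨T2, hT21, hT2⟩ := taylor_pow (1/(c-1)) (D*D) (by nlinarith)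
  set W := 2*B + 1 + C * A2 with hW
  have hW0 : 1 ≤ W := by
    have : 0 < C * A2 := by positivity
    linarith
  obtain ⟨A3, hA31, hA3⟩ := rpow_mem_box B (-c) hB
  have he0 : 0 < e := by positivity
  refine ⟨(W*D)^2, D, A3 * C + e * B * (A2 * C + 1) + T * (2 + W^2),
    T2 * (D * A2 * (A2 + A * W)), ?_, hD1, by positivity, by positivity, ?_⟩
  · have : 1 ≤ W * D := by nlinarith
    nlinarith
  intro M K r1 r2 r3 m1 m2 L m4 hK0 hKM hL hLK hr1 hr2 hr3 hr h1 h2 h4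
  have hiB : 0 < 1/B := by positivity
  have p1 : 0 < r1 := by linarith
  have p2 : 0 < r2 := by linarith
  have p3 : 0 < r3 := by linarith
  have hL0 : 0 < L := by linarith
  have hWD1 : 1 ≤ W * D := one_le_mul_of_one_le_of_one_le hW0 hD1
  have hsK : W * D ≤ √K := Real.le_sqrt_of_sq_le hK0
  have hsK1 : 1 ≤ √K := hWD1.trans hsK
  have hK1 : 1 ≤ K := (one_le_pow₀ hWD1).trans hK0
  have hsKK : √K ≤ K := by
    have := Real.mul_self_sqrt (show 0 ≤ K by linarith)
    calc √K = √K * 1 := by ring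
      _ ≤ √K * √K := by gcongr
      _ = K := this
  have hML : L ≤ M := (le_mul_of_one_le_right hL0.le hK1).trans hLK
  have hM0 : 0 < M := by linarith
  have hMLs : L * √K ≤ M := (mul_le_mul_of_nonneg_left hsKK hL0.le).trans hLK
  set a := (r1/r3)^(c-1) with ha
  set b := (r2/r3)^(c-1) with hb
  set d := r3^(1-c) with hd
  have hrat : ∀ x y : ℝ, (1/B ≤ x ∧ x ≤ B) → (1/B ≤ y ∧ y ≤ B) → 1/(B*B) ≤ x/y ∧ x/y ≤ B*B := by
    intro x y hx hy
    have hy0 : 0 < y := by linarith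
    have i1 := hx.1
    have i2 := hy.1
    rw [div_le_iff₀ hB0] at i1 i2
    constructor
    · rw [div_le_div_iff₀ (by positivity) hy0]
      calc 1 * y ≤ 1 * B := by linarith
        _ ≤ x * B * B := by gcongr
        _ = _ := by ring
    · rw [div_le_iff₀ hy0]
      calc x ≤ B * 1 := by linarith
        _ ≤ B * (y * B) := by gcongr
        _ = _ := by ring
  have ha' := hA (r1/r3) (hrat r1 r3 hr1 hr3).1 (hrat r1 r3 hr1 hr3).2
  have hb' := hA (r2/r3) (hrat r2 r3 hr2 hr3).1 (hrat r2 r3 hr2 hr3).2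
  have hd' := hA2 r3 hr3.1 hr3.2
  have hd3' := hA3 r3 hr3.1 hr3.2
  rw [← ha] at ha'
  rw [← hb] at hb'
  rw [← hd] at hd'
  have hA0 : 0 < A := by linarith
  have hA20 : 0 < A2 := by linarith
  have a0 : 0 < a := lt_of_lt_of_le (by positivity) ha'.1
  have b0 : 0 < b := lt_of_lt_of_le (by positivity) hb'.1
  have d0 : 0 < d := lt_of_lt_of_le (by positivity) hd'.1
  set η := r1^c + r2^c - r3^c - 1 with hη
  have id1 : ∀ r : ℝ, 0 < r → r * (r/r3)^(c-1) = d * r^c := by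
    intro r hr
    rw [Real.div_rpow hr.le p3.le, hd, show (1:ℝ)-c = -(c-1) by ring, Real.rpow_neg p3.le,
      Real.rpow_sub_one hr.ne']
    field_simp
  have id3 : r3 = d * r3^c := by
    rw [hd, ← Real.rpow_add p3]; simp
  have rel : a * r1 + b * r2 - r3 - d = d * η := by
    have i1 := id1 r1 p1
    have i2 := id1 r2 p2
    rw [hη, ha, hb]
    linear_combination i1 + i2 - id3
  set u := m1/L - a with hu
  set v := m2/L - b with hv
  set w := m4/L - d with hw
  have hm1 : m1 = L * (a + u) := by rw [hu]; field_simp; ring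
  have hm2 : m2 = L * (b + v) := by rw [hv]; field_simp; ring
  have hm4 : m4 = L * (d + w) := by rw [hw]; field_simp; ring
  set δ := 1/(L*√K) with hδ
  have hδ0 : 0 < δ := by positivity
  have hub : |u| ≤ δ := by
    rw [hm1, show L * (a+u) - a*L = L * u by ring, abs_mul, abs_of_pos hL0] at h1
    rw [hδ, show 1/(L*√K) = (1/√K)/L by field_simp, le_div_iff₀ hL0]; linarith
  have hvb : |v| ≤ δ := by
    rw [hm2, show L * (b+v) - b*L = L * v by ring, abs_mul, abs_of_pos hL0] at h2
    rw [hδ, show 1/(L*√K) = (1/√K)/L by field_simp, le_div_iff₀ hL0]; linarith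
  have hwb : |w - r1 * u - r2 * v| ≤ A2 * (C / M^2) + 1/(M*L) := by
    have e1 : m4 - r1*m1 - r2*m2 + r3*L = L * (w - r1*u - r2*v - d*η) := by
      rw [hm1, hm2, hm4]; linear_combination (-L) * rel
    rw [e1, abs_mul, abs_of_pos hL0] at h4
    have e2 : |w - r1*u - r2*v - d*η| ≤ 1/(M*L) := by
      rw [show 1/(M*L) = (1/M)/L by field_simp, le_div_iff₀ hL0]; linarith
    have e3 : |d * η| ≤ A2 * (C/M^2) := by
      rw [abs_mul, abs_of_pos d0]
      exact mul_le_mul hd'.2 hr (abs_nonneg _) hA20.le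
    have := abs_add_le (w - r1*u - r2*v - d*η) (d*η)
    rw [sub_add_cancel] at this
    linarith
  have hM1 : 1 ≤ M := hL.trans hML
  have iM : 1/(M*L) ≤ δ := by
    rw [hδ]; apply one_div_le_one_div_of_le (by positivity)
    exact hMLs.trans (le_mul_of_one_le_right hM0.le hL)
  have iM2 : 1/M^2 ≤ δ := by
    rw [hδ]; apply one_div_le_one_div_of_le (by positivity)
    exact hMLs.trans (le_self_pow₀ hM1 two_ne_zero)
  have hwW : |w| ≤ W * δ := by
    have i1 : |r1 * u| ≤ B * δ := by
      rw [abs_mul, abs_of_pos p1]; exact mul_le_mul hr1.2 hub (abs_nonneg _) hB0.le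
    have i2 : |r2 * v| ≤ B * δ := by
      rw [abs_mul, abs_of_pos p2]; exact mul_le_mul hr2.2 hvb (abs_nonneg _) hB0.le
    have i3 : A2 * (C/M^2) ≤ A2 * C * δ := by
      rw [show A2 * (C/M^2) = A2 * C * (1/M^2) by ring]; gcongr
    have j1 := abs_le.mp i1
    have j2 := abs_le.mp i2
    have j3 := abs_le.mp hwb
    rw [hW, abs_le]; constructor <;> linarith
  have hδD : W * δ ≤ 1/D := by
    rw [hδ, show W * (1/(L*√K)) = W/(L*√K) by ring, div_le_div_iff₀ (by positivity) hD0]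
    calc W * D ≤ √K := hsK
      _ ≤ L * √K := le_mul_of_one_le_left (by positivity) hL
      _ = 1 * (L * √K) := by ring
  have hδD1 : δ ≤ 1/D := le_trans (le_mul_of_one_le_left hδ0.le hW0) hδD
  have hDi : 1/D ≤ 1 := by rw [div_le_one hD0]; exact hD1
  have hD2A : 2/D ≤ 1/A := by rw [div_le_div_iff₀ hD0 hA0]; linarith
  have hD2A2 : 2/D ≤ 1/A2 := by rw [div_le_div_iff₀ hD0 hA20]; linarith
  have hD2 : 2/D = 1/D + 1/D := by ring
  have ub := abs_le.mp hub
  have vb := abs_le.mp hvb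
  have wb := abs_le.mp hwW
  have bx1 : 1/D ≤ a+u ∧ a+u ≤ D := ⟨by linarith [ha'.1], by linarith [ha'.2]⟩
  have bx2 : 1/D ≤ b+v ∧ b+v ≤ D := ⟨by linarith [hb'.1], by linarith [hb'.2]⟩
  have bx4 : 1/D ≤ d+w ∧ d+w ≤ D := ⟨by linarith [hd'.1], by linarith [hd'.2]⟩
  have ba : 1/D ≤ a ∧ a ≤ D := ⟨by linarith [ha'.1, show 0 < 1/D by positivity], by linarith [ha'.2]⟩
  have bb : 1/D ≤ b ∧ b ≤ D := ⟨by linarith [hb'.1, show 0 < 1/D by positivity], by linarith [hb'.2]⟩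
  have bd : 1/D ≤ d ∧ d ≤ D := ⟨by linarith [hd'.1, show 0 < 1/D by positivity], by linarith [hd'.2]⟩
  have iD0 : 0 < 1/D := by positivity
  have x1p : 0 < a + u := by linarith
  have x2p : 0 < b + v := by linarith
  have x4p : 0 < d + w := by linarith
  have scal : ∀ x : ℝ, 1/D ≤ x ∧ x ≤ D → L/D ≤ L * x ∧ L * x ≤ D * L := by
    intro x hx
    constructor
    · rw [div_eq_mul_one_div]; gcongr; exact hx.1
    · rw [mul_comm D]; gcongr; exact hx.2
  refine ⟨?_, ?_, ?_, ?_, ?_, ?_⟩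
  · rw [hm1]; exact scal _ bx1
  · rw [hm2]; exact scal _ bx2
  · rw [hm4]; exact scal _ bx4
  · have t1 := (hT (a+u) a bx1.1 bx1.2 ba.1 ba.2).2
    have t2 := (hT (b+v) b bx2.1 bx2.2 bb.1 bb.2).2
    have t4 := (hT (d+w) d bx4.1 bx4.2 bd.1 bd.2).2
    rw [add_sub_cancel_left] at t1 t2 t4
    have cne : c - 1 ≠ 0 := hc1.ne'
    have pe : (c-1)*e = c := by rw [he]; field_simp
    have pe1 : (c-1)*(e-1) = 1 := by rw [he1]; field_simp
    have ae : a^e = r3^(-c) * r1^c := by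
      rw [ha, ← Real.rpow_mul (by positivity), pe, Real.div_rpow p1.le p3.le, Real.rpow_neg p3.le]
      field_simp
    have be : b^e = r3^(-c) * r2^c := by
      rw [hb, ← Real.rpow_mul (by positivity), pe, Real.div_rpow p2.le p3.le, Real.rpow_neg p3.le]
      field_simp
    have de : d^e = r3^(-c) := by
      rw [hd, ← Real.rpow_mul p3.le]; congr 1; linarith
    have ae1 : a^(e-1) = r1/r3 := by
      rw [ha, ← Real.rpow_mul (by positivity), pe1, Real.rpow_one]
    have be1 : b^(e-1) = r2/r3 := by
      rw [hb, ← Real.rpow_mul (by positivity), pe1, Real.rpow_one]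
    have de1 : d^(e-1) = 1/r3 := by
      rw [hd, ← Real.rpow_mul p3.le, show (1-c)*(e-1) = -1 by linarith, Real.rpow_neg_one, one_div]
    have r3c : r3^(-c) * r3^c = 1 := by rw [← Real.rpow_add p3]; simp
    rw [ae1] at t1
    rw [be1] at t2
    rw [de1] at t4
    have main : |(a+u)^e + (b+v)^e - 1 - (d+w)^e| ≤
        A3 * (C/M^2) + e * B * (A2 * (C/M^2) + 1/(M*L)) + T * (u^2 + v^2 + w^2) := by
      have z1 : |a^e + b^e - 1 - d^e| ≤ A3 * (C/M^2) := by
        have : a^e + b^e - 1 - d^e = r3^(-c) * η := by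
          rw [ae, be, de, hη]; linear_combination r3c
        rw [this, abs_mul, abs_of_pos (by positivity)]
        exact mul_le_mul hd3'.2 hr (abs_nonneg _) (by linarith)
      have z2 : |e * (1/r3) * (w - r1*u - r2*v)| ≤ e * B * (A2 * (C/M^2) + 1/(M*L)) := by
        rw [abs_mul, abs_of_pos (by positivity)]
        have : 1/r3 ≤ B := by
          rw [div_le_iff₀ p3]; have := hr3.1; rw [div_le_iff₀ hB0] at this; linarith
        gcongr
      have z2' : e * (1/r3) * (w - r1*u - r2*v) = e*(1/r3)*w - e*(r1/r3)*u - e*(r2/r3)*v := by ring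
      rw [z2'] at z2
      have y1 := abs_le.mp z1
      have y2 := abs_le.mp z2
      have y3 := abs_le.mp t1
      have y4 := abs_le.mp t2
      have y5 := abs_le.mp t4
      rw [abs_le]; constructor <;> linarith
    have hfac : m1^e + m2^e - L^e - m4^e = L^e * ((a+u)^e + (b+v)^e - 1 - (d+w)^e) := by
      rw [hm1, hm2, hm4, Real.mul_rpow hL0.le x1p.le, Real.mul_rpow hL0.le x2p.le,
        Real.mul_rpow hL0.le x4p.le]; ring
    have hLe : L^(e-2) = L^e * (1/L^2) := by
      rw [Real.rpow_sub hL0, Real.rpow_two]; ring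
    rw [hfac, abs_mul, abs_of_pos (by positivity), hLe,
      show ∀ z : ℝ, z * (L^e * (1/L^2)) = L^e * (z * (1/L^2)) by intro z; ring]
    gcongr
    refine main.trans ?_
    have l1 : 1/M^2 ≤ 1/L^2 := by gcongr
    have l2 : 1/(M*L) ≤ 1/L^2 := by rw [pow_two]; gcongr
    have l3 : δ^2 ≤ 1/L^2 := by
      rw [hδ, div_pow, one_pow]; apply one_div_le_one_div_of_le (by positivity)
      rw [mul_pow, Real.sq_sqrt (by linarith)]; exact le_mul_of_one_le_right (sq_nonneg L) hK1
    have s1 : u^2 ≤ δ^2 := by rw [← sq_abs u]; gcongr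
    have s2 : v^2 ≤ δ^2 := by rw [← sq_abs v]; gcongr
    have s3 : w^2 ≤ W^2*δ^2 := by rw [← sq_abs w, ← mul_pow]; gcongr
    have l4 : u^2 + v^2 + w^2 ≤ (2 + W^2) * (1/L^2) := by
      have := mul_le_mul_of_nonneg_left l3 (sq_nonneg W)
      linarith
    calc A3 * (C/M^2) + e * B * (A2 * (C/M^2) + 1/(M*L)) + T * (u^2 + v^2 + w^2)
        = A3 * C * (1/M^2) + e * B * (A2 * C * (1/M^2) + 1/(M*L)) + T * (u^2 + v^2 + w^2) := by ring
      _ ≤ A3 * C * (1/L^2) + e * B * (A2 * C * (1/L^2) + 1/L^2) + T * ((2+W^2) * (1/L^2)) := by gcongr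
      _ = _ := by ring
  all_goals
    have gen : ∀ r x y : ℝ, 0 < r → x = (r/r3)^(c-1) → (1/A ≤ x ∧ x ≤ A) → (1/D ≤ x ∧ x ≤ D) →
        (1/D ≤ x + y ∧ x + y ≤ D) → |y| ≤ δ →
        |r - ((L * (x+y))/(L*(d+w)))^(1/(c-1))| ≤ T2 * (D * A2 * (A2 + A * W)) / (L * √K) := by
      intro r x y hr hx hxA hxD hxyD hy
      have e1 : r = (x/d)^(1/(c-1)) := by
        have : x / d = r^(c-1) := by
          rw [hx, hd, Real.div_rpow hr.le p3.le, show (1:ℝ)-c = -(c-1) by ring, Real.rpow_neg p3.le]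
          field_simp
        rw [this, ← Real.rpow_mul hr.le, mul_one_div_cancel hc1.ne', Real.rpow_one]
      have rr : ∀ x y : ℝ, (1/D ≤ x ∧ x ≤ D) → (1/D ≤ y ∧ y ≤ D) → 1/(D*D) ≤ x/y ∧ x/y ≤ D*D := by
        intro x y hx hy
        have hy0 : 0 < y := by linarith
        have i1 := hx.1
        have i2 := hy.1
        rw [div_le_iff₀ hD0] at i1 i2
        constructor
        · rw [div_le_div_iff₀ (by positivity) hy0]
          calc 1 * y ≤ 1 * D := by linarith
            _ ≤ x * D * D := by gcongr
            _ = _ := by ring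
        · rw [div_le_iff₀ hy0]
          calc x ≤ D * 1 := by linarith
            _ ≤ D * (y * D) := by gcongr
            _ = _ := by ring
      rw [mul_div_mul_left _ _ hL0.ne']
      have q1 := rr x d hxD bd
      have q2 := rr (x+y) (d+w) hxyD bx4
      have q := (hT2 (x/d) ((x+y)/(d+w)) q1.1 q1.2 q2.1 q2.2).1
      rw [← e1] at q
      refine q.trans ?_
      rw [mul_div_assoc]
      gcongr
      have e2 : x/d - (x+y)/(d+w) = (1/(d+w)) * (1/d) * (x*w - d*y) := by
        field_simp; ring
      have xp : 0 < x := lt_of_lt_of_le (by positivity) hxA.1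
      rw [e2, abs_mul, abs_of_pos (by positivity)]
      have g1 : 1/(d+w) ≤ D := by
        rw [div_le_iff₀ x4p]; have := bx4.1; rw [div_le_iff₀ hD0] at this; linarith
      have g2 : 1/d ≤ A2 := by
        rw [div_le_iff₀ d0]; have := hd'.1; rw [div_le_iff₀ hA20] at this; linarith
      have g3 : |x*w - d*y| ≤ (A2 + A*W) * δ := by
        have k1 : |x*w| ≤ A * (W*δ) := by
          rw [abs_mul, abs_of_pos xp]; exact mul_le_mul hxA.2 hwW (abs_nonneg _) hA0.le
        have k2 : |d*y| ≤ A2 * δ := by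
          rw [abs_mul, abs_of_pos d0]; exact mul_le_mul hd'.2 hy (abs_nonneg _) hA20.le
        have := abs_sub (x*w) (d*y)
        linarith
      calc 1/(d+w) * (1/d) * |x*w - d*y| ≤ D * A2 * ((A2 + A*W) * δ) := by gcongr
        _ = _ := by rw [hδ]; ring
  · rw [hm1, hm4]; exact gen r1 a u p1 ha ha' ba bx1 hub
  · rw [hm2, hm4]; exact gen r2 b v p2 hb hb' bb bx2 hvb

/-! ### transference -/

lemma sum_ee_range (q : ℕ) (hq : 0 < q) (k : ℤ) :
    ∑ w ∈ range q, ee ((k:ℝ) * w / q) = if (q:ℤ) ∣ k then (q:ℂ) else 0 := by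
  have hq0 : (q:ℝ) ≠ 0 := by positivity
  have hpow : ∀ w : ℕ, ee ((k:ℝ) * w / q) = ee ((k:ℝ)/q) ^ w := by
    intro w
    rw [← ee_natmul]; congr 1; ring
  simp only [hpow]
  split_ifs with h
  · obtain ⟨m, rfl⟩ := h
    have : ee ((((q:ℤ) * m : ℤ) : ℝ)/q) = 1 := by
      rw [← ee_int m]; congr 1; push_cast; field_simp
    rw [this]; simp
  · have hne : ee ((k:ℝ)/q) ≠ 1 := by
      intro h1
      apply h
      rw [ee, Complex.exp_eq_one_iff] at h1
      obtain ⟨n, hn⟩ := h1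
      have h2 : (((k:ℝ)/q : ℝ) : ℂ) = n := by
        have : (2 * π * Complex.I : ℂ) ≠ 0 := Complex.two_pi_I_ne_zero
        apply mul_left_cancel₀ this
        rw [mul_comm _ (n:ℂ), ← hn]; push_cast; ring
      have h3 : (k:ℝ)/q = n := by exact_mod_cast h2
      rw [div_eq_iff hq0] at h3
      exact ⟨n, by have : k = n * (q:ℤ) := by exact_mod_cast h3
                   rw [this]; ring⟩
    have := mul_neg_geom_sum (ee ((k:ℝ)/q)) q
    have h1 : ee ((k:ℝ)/q) ^ q = 1 := by
      rw [← ee_natmul, ← ee_int k]; congr 1; field_simp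
    rw [h1, sub_self] at this
    exact (mul_eq_zero.mp this).resolve_left (sub_ne_zero.mpr (Ne.symm hne))

/-- the phase -/
def dot4 (n u : ℤ × ℤ × ℤ × ℤ) : ℤ :=
  n.1 * u.1 + n.2.1 * u.2.1 + n.2.2.1 * u.2.2.1 + n.2.2.2 * u.2.2.2

noncomputable def box4 (q : ℕ) : Finset (ℤ × ℤ × ℤ × ℤ) :=
  ((range q) ×ˢ (range q) ×ˢ (range q) ×ˢ (range q)).map
    ⟨fun w => ((w.1:ℤ), (w.2.1:ℤ), (w.2.2.1:ℤ), (w.2.2.2:ℤ)), by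
      rintro ⟨a, b, c, d⟩ ⟨a', b', c', d'⟩ h
      simpa using h⟩

lemma orth4 (q : ℕ) (hq : 0 < q) (k : ℤ × ℤ × ℤ × ℤ) :
    ∑ w ∈ box4 q, ee ((dot4 k w : ℝ) / q) =
      if ((q:ℤ) ∣ k.1 ∧ (q:ℤ) ∣ k.2.1 ∧ (q:ℤ) ∣ k.2.2.1 ∧ (q:ℤ) ∣ k.2.2.2) then (q:ℂ)^4 else 0 := by
  have e : ∀ w1 w2 w3 w4 : ℕ, ee ((dot4 k ((w1:ℤ), (w2:ℤ), (w3:ℤ), (w4:ℤ)) : ℝ) / q) =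
      ee ((k.1:ℝ) * w1 / q) * (ee ((k.2.1:ℝ) * w2 / q) * (ee ((k.2.2.1:ℝ) * w3 / q) *
        ee ((k.2.2.2:ℝ) * w4 / q))) := by
    intro w1 w2 w3 w4
    rw [← ee_add, ← ee_add, ← ee_add]; congr 1; simp only [dot4]; push_cast; ring
  rw [box4, Finset.sum_map]
  change ∑ w ∈ (range q) ×ˢ (range q) ×ˢ (range q) ×ˢ (range q), ee ((dot4 k ((w.1:ℤ), (w.2.1:ℤ), (w.2.2.1:ℤ), (w.2.2.2:ℤ)) : ℝ) / q) = _
  simp only [Finset.sum_product, e, ← mul_sum, ← Finset.sum_mul,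
    sum_ee_range q hq]
  by_cases h1 : (q:ℤ) ∣ k.1 <;> by_cases h2 : (q:ℤ) ∣ k.2.1 <;> by_cases h3 : (q:ℤ) ∣ k.2.2.1 <;>
    by_cases h4 : (q:ℤ) ∣ k.2.2.2 <;> simp [h1, h2, h3, h4]
  ring

lemma parseval4 (q : ℕ) (hq : 0 < q) (S : Finset (ℤ × ℤ × ℤ × ℤ))
    (hS : ∀ n ∈ S, ∀ n' ∈ S, ((q:ℤ) ∣ (n - n').1 ∧ (q:ℤ) ∣ (n - n').2.1 ∧ (q:ℤ) ∣ (n - n').2.2.1 ∧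
      (q:ℤ) ∣ (n - n').2.2.2) → n = n') :
    ∑ w ∈ box4 q, ‖∑ n ∈ S, ee ((dot4 n w : ℝ) / q)‖^2 = (q:ℝ)^4 * S.card := by
  have h1 : ∀ w, ((‖∑ n ∈ S, ee ((dot4 n w : ℝ) / q)‖^2 : ℝ) : ℂ) =
      ∑ n ∈ S, ∑ n' ∈ S, ee ((dot4 (n - n') w : ℝ) / q) := by
    intro w
    rw [← Complex.normSq_eq_norm_sq, ← Complex.mul_conj, map_sum, Finset.sum_mul_sum]
    refine sum_congr rfl fun n _ => sum_congr rfl fun n' _ => ?_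
    rw [← ee_sub]; congr 1; simp only [dot4, Prod.fst_sub, Prod.snd_sub]; push_cast; ring
  have : ((∑ w ∈ box4 q, ‖∑ n ∈ S, ee ((dot4 n w : ℝ) / q)‖^2 : ℝ) : ℂ) =
      (((q:ℝ)^4 * S.card : ℝ) : ℂ) := by
    rw [Complex.ofReal_sum]
    simp only [h1]
    rw [Finset.sum_comm]
    have : ∀ n ∈ S, ∑ w ∈ box4 q, ∑ n' ∈ S, ee ((dot4 (n - n') w : ℝ) / q) = (q:ℂ)^4 := by
      intro n hn
      rw [Finset.sum_comm]
      simp only [orth4 q hq]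
      rw [Finset.sum_eq_single_of_mem n hn]
      · simp
      · intro n' hn' hne
        rw [if_neg]
        intro h
        exact hne (hS n hn n' hn' h).symm
    rw [sum_congr rfl this]
    simp [mul_comm]
  exact_mod_cast this

set_option maxHeartbeats 1000000 in
lemma transfer (a b ρ1 ρ2 ρ3 e1 e2 e3 e4 : ℝ) (he1 : 0 < e1) (he2 : 0 < e2) (he3 : 0 < e3)
    (he4 : 0 < e4) (S H : Finset (ℤ × ℤ × ℤ × ℤ))
    (hS : ∀ n1 n2 n3 n4 : ℤ, (n1, n2, n3, n4) ∈ S → |(n4:ℝ)| * e4 + |n1 - ρ1 * n4| * e1 +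
      |n2 - ρ2 * n4| * e2 + |n3 - ρ3 * n4 - a * (n1 - ρ1 * n4) - b * (n2 - ρ2 * n4)| * e3 ≤ 1/16)
    (hH : ∀ x1 x2 x3 x4 : ℤ, |(x3:ℝ)| ≤ e3 → |x1 + a * x3| ≤ e1 → |x2 + b * x3| ≤ e2 →
      |x4 + ρ1 * x1 + ρ2 * x2 + ρ3 * x3| ≤ e4 → (x1, x2, x3, x4) ∈ H) :
    (S.card : ℝ) * (e1 * e2 * e3 * e4) ≤ 64 * H.card := by
  -- choose q
  obtain ⟨q, hq0, hqe, hqS⟩ : ∃ q : ℕ, 0 < q ∧ (∀ e ∈ ({e1, e2, e3, e4} : Finset ℝ), 2 ≤ q * e) ∧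
      ∀ n ∈ S, ∀ n' ∈ S, ((q:ℤ) ∣ (n - n').1 ∧ (q:ℤ) ∣ (n - n').2.1 ∧ (q:ℤ) ∣ (n - n').2.2.1 ∧
      (q:ℤ) ∣ (n - n').2.2.2) → n = n' := by
    have ev1 : ∀ e : ℝ, 0 < e → ∀ᶠ q : ℕ in Filter.atTop, 2 ≤ (q:ℝ) * e := by
      intro e he
      have := (tendsto_natCast_atTop_atTop (R := ℝ)).atTop_mul_const he
      exact this.eventually_ge_atTop 2
    have ev2 : ∀ k : ℤ, ∀ᶠ q : ℕ in Filter.atTop, (q:ℤ) ∣ k → k = 0 := by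
      intro k
      filter_upwards [Filter.eventually_gt_atTop k.natAbs] with q hq hd
      exact Int.eq_zero_of_abs_lt_dvd hd (by rw [Int.abs_eq_natAbs]; exact_mod_cast hq)
    have ev3 : ∀ᶠ q : ℕ in Filter.atTop, ∀ n ∈ S, ∀ n' ∈ S, ((q:ℤ) ∣ (n - n').1 ∧ (q:ℤ) ∣ (n - n').2.1 ∧
        (q:ℤ) ∣ (n - n').2.2.1 ∧ (q:ℤ) ∣ (n - n').2.2.2) → n = n' := by
      rw [Filter.eventually_all_finset]; intro n hn
      rw [Filter.eventually_all_finset]; intro n' hn'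
      filter_upwards [ev2 (n-n').1, ev2 (n-n').2.1, ev2 (n-n').2.2.1, ev2 (n-n').2.2.2]
        with q h1 h2 h3 h4 h
      rw [← sub_eq_zero]
      exact Prod.ext (h1 h.1) (Prod.ext (h2 h.2.1) (Prod.ext (h3 h.2.2.1) (h4 h.2.2.2)))
    have ev4 : ∀ᶠ q : ℕ in Filter.atTop, ∀ e ∈ ({e1, e2, e3, e4} : Finset ℝ), 2 ≤ (q:ℝ) * e := by
      rw [Filter.eventually_all_finset]; intro e he
      apply ev1
      simp only [Finset.mem_insert, Finset.mem_singleton] at he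
      rcases he with rfl | rfl | rfl | rfl <;> assumption
    obtain ⟨q, h⟩ := ((Filter.eventually_gt_atTop 0).and (ev4.and ev3)).exists
    exact ⟨q, h.1, h.2.1, h.2.2⟩
  have hqR : (0:ℝ) < q := by exact_mod_cast hq0
  have hqe1 : 2 ≤ q * e1 := hqe _ (by simp)
  have hqe2 : 2 ≤ q * e2 := hqe _ (by simp)
  have hqe3 : 2 ≤ q * e3 := hqe _ (by simp)
  have hqe4 : 2 ≤ q * e4 := hqe _ (by simp)
  -- index box
  set N : ℝ → ℕ := fun e => ⌊q * e⌋₊ with hN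
  have hNle : ∀ e : ℝ, 0 < e → (N e : ℝ) ≤ q * e := fun e he => Nat.floor_le (by positivity)
  have hNge : ∀ e : ℝ, 2 ≤ q * e → q * e / 2 ≤ (N e : ℝ) := fun e he => by
    have := (Nat.lt_floor_add_one ((q:ℝ) * e)).le
    simp only [hN]; linarith
  set I := (range (N e1)) ×ˢ (range (N e2)) ×ˢ (range (N e3)) ×ˢ
    (range (N e4)) with hI
  set U : ℕ × ℕ × ℕ × ℕ → ℤ × ℤ × ℤ × ℤ := fun i =>
    ((i.1:ℤ) - ⌊a * i.2.2.1⌋, (i.2.1:ℤ) - ⌊b * i.2.2.1⌋, (i.2.2.1 : ℤ),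
      (i.2.2.2:ℤ) - ⌊ρ1 * ((i.1:ℤ) - ⌊a * i.2.2.1⌋ : ℤ) + ρ2 * ((i.2.1:ℤ) - ⌊b * i.2.2.1⌋ : ℤ)
        + ρ3 * i.2.2.1⌋) with hU
  have hUinj : Function.Injective U := by
    rintro ⟨i1, i2, i3, i4⟩ ⟨j1, j2, j3, j4⟩ h
    simp only [hU, Prod.mk.injEq] at h
    obtain ⟨h1, h2, h3, h4⟩ := h
    have h3' : i3 = j3 := by exact_mod_cast h3
    subst h3'
    have h1' : i1 = j1 := by
      have := sub_left_inj.mp h1; exact_mod_cast this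
    have h2' : i2 = j2 := by
      have := sub_left_inj.mp h2; exact_mod_cast this
    subst h1'; subst h2'
    have h4' : i4 = j4 := by
      have := sub_left_inj.mp h4; exact_mod_cast this
    rw [h4']
  have hUb : ∀ i ∈ I, (0 ≤ ((U i).2.2.1 : ℝ) ∧ ((U i).2.2.1 : ℝ) ≤ q * e3) ∧
      (0 ≤ (U i).1 + a * (U i).2.2.1 ∧ (U i).1 + a * (U i).2.2.1 ≤ q * e1) ∧
      (0 ≤ (U i).2.1 + b * (U i).2.2.1 ∧ (U i).2.1 + b * (U i).2.2.1 ≤ q * e2) ∧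
      (0 ≤ (U i).2.2.2 + ρ1 * (U i).1 + ρ2 * (U i).2.1 + ρ3 * (U i).2.2.1 ∧
       (U i).2.2.2 + ρ1 * (U i).1 + ρ2 * (U i).2.1 + ρ3 * (U i).2.2.1 ≤ q * e4) := by
    rintro ⟨i1, i2, i3, i4⟩ hi
    simp only [hI, Finset.mem_product, Finset.mem_range] at hi
    obtain ⟨h1, h2, h3, h4⟩ := hi
    have key : ∀ (i : ℕ) (e x : ℝ), 0 < e → i < N e → 0 ≤ ((i:ℤ) - ⌊x⌋ : ℤ) + x ∧
        ((i:ℤ) - ⌊x⌋ : ℤ) + x ≤ q * e := by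
      intro i e x he hi
      have a1 := Int.floor_le x
      have a2 := Int.lt_floor_add_one x
      have a3 : (i:ℝ) + 1 ≤ N e := by exact_mod_cast hi
      have a4 := hNle e he
      have a5 : (0:ℝ) ≤ i := by positivity
      push_cast
      constructor <;> linarith
    refine ⟨?_, ?_, ?_, ?_⟩
    · have a3 : (i3:ℝ) ≤ N e3 := by exact_mod_cast h3.le
      simp only [hU, Int.cast_natCast]
      exact ⟨by positivity, a3.trans (hNle e3 he3)⟩
    · simpa only [hU, Int.cast_natCast] using key i1 e1 (a * i3) he1 h1
    · simpa only [hU, Int.cast_natCast] using key i2 e2 (b * i3) he2 h2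
    · have := key i4 e4 (ρ1 * ((i1:ℤ) - ⌊a * i3⌋ : ℤ) + ρ2 * ((i2:ℤ) - ⌊b * i3⌋ : ℤ)
        + ρ3 * i3) he4 h4
      simp only [hU, Int.cast_natCast] at this ⊢
      rwa [add_assoc, add_assoc, ← add_assoc (ρ1 * _)]
  -- lower bound of the sums
  have hlow : ∀ i ∈ I, (S.card : ℝ)/2 ≤ ‖∑ n ∈ S, ee ((dot4 n (U i) : ℝ) / q)‖ := by
    intro i hi
    obtain ⟨b3, b1, b2, b4⟩ := hUb i hi
    have h1 : ∀ n ∈ S, ‖ee ((dot4 n (U i) : ℝ) / q) - 1‖ ≤ 1/2 := by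
      rintro ⟨n1, n2, n3, n4⟩ hn
      refine (norm_ee_sub_one_le _).trans ?_
      have hs := hS n1 n2 n3 n4 hn
      have hph : |(dot4 (n1, n2, n3, n4) (U i) : ℝ) / q| ≤ 1/16 := by
        rw [abs_div, abs_of_pos hqR, div_le_iff₀ hqR]
        set u1 := (U i).1
        set u2 := (U i).2.1
        set u3 := (U i).2.2.1
        set u4 := (U i).2.2.2
        have e : (dot4 (n1, n2, n3, n4) (U i) : ℝ) = n4 * (u4 + ρ1 * u1 + ρ2 * u2 + ρ3 * u3) +
            (n1 - ρ1 * n4) * (u1 + a * u3) + (n2 - ρ2 * n4) * (u2 + b * u3) +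
            (n3 - ρ3 * n4 - a * (n1 - ρ1 * n4) - b * (n2 - ρ2 * n4)) * u3 := by
          simp only [dot4]; push_cast; ring
        have m : ∀ x y z : ℝ, 0 ≤ y → y ≤ z → |x * y| ≤ |x| * z := by
          intro x y z h0 h1
          rw [abs_mul, abs_of_nonneg h0]; gcongr
        rw [e]
        refine (abs_add_le _ _).trans ?_
        have t1 := m n4 _ _ b4.1 b4.2
        have t2 := m (n1 - ρ1 * n4) _ _ b1.1 b1.2
        have t3 := m (n2 - ρ2 * n4) _ _ b2.1 b2.2
        have t4 := m (n3 - ρ3 * n4 - a * (n1 - ρ1 * n4) - b * (n2 - ρ2 * n4)) _ _ b3.1 b3.2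
        have s1 := abs_add_le (n4 * (u4 + ρ1 * u1 + ρ2 * u2 + ρ3 * u3) +
            (n1 - ρ1 * n4) * (u1 + a * u3)) ((n2 - ρ2 * n4) * (u2 + b * u3))
        have s2 := abs_add_le (n4 * (u4 + ρ1 * u1 + ρ2 * u2 + ρ3 * u3))
            ((n1 - ρ1 * n4) * (u1 + a * u3))
        have hs' := mul_le_mul_of_nonneg_right hs hqR.le
        linarith
      have := Real.pi_lt_d2
      have := Real.pi_pos
      calc 2 * π * |(dot4 (n1, n2, n3, n4) (U i) : ℝ) / q| ≤ 2 * π * (1/16) := by gcongr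
        _ ≤ 1/2 := by linarith
    have h2 : ‖∑ n ∈ S, ee ((dot4 n (U i) : ℝ) / q) - (S.card : ℂ)‖ ≤ S.card * (1/2) := by
      have : (S.card : ℂ) = ∑ n ∈ S, (1:ℂ) := by simp
      rw [this, ← Finset.sum_sub_distrib]
      refine (norm_sum_le _ _).trans ?_
      calc _ ≤ ∑ n ∈ S, (1/2 : ℝ) := sum_le_sum h1
        _ = _ := by simp
    have h3 := norm_sub_norm_le (S.card : ℂ) (∑ n ∈ S, ee ((dot4 n (U i) : ℝ) / q))
    rw [norm_sub_rev] at h3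
    have h4 : ‖(S.card : ℂ)‖ = S.card := by simp
    rw [h4] at h3
    linarith
  -- the reduction
  set R : ℤ × ℤ × ℤ × ℤ → ℤ × ℤ × ℤ × ℤ := fun u => (u.1 % q, u.2.1 % q, u.2.2.1 % q, u.2.2.2 % q)
    with hR
  have hRmem : ∀ u, R u ∈ box4 q := by
    intro u
    have hz : (q:ℤ) ≠ 0 := by exact_mod_cast hq0.ne'
    have key : ∀ x : ℤ, ∃ k < q, (k:ℤ) = x % q := by
      intro x
      refine ⟨(x % q).toNat, ?_, Int.toNat_of_nonneg (Int.emod_nonneg _ hz)⟩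
      have := Int.emod_lt_of_pos x (show (0:ℤ) < q by exact_mod_cast hq0)
      have := Int.emod_nonneg x hz
      omega
    obtain ⟨k1, l1, m1⟩ := key u.1
    obtain ⟨k2, l2, m2⟩ := key u.2.1
    obtain ⟨k3, l3, m3⟩ := key u.2.2.1
    obtain ⟨k4, l4, m4⟩ := key u.2.2.2
    rw [box4, Finset.mem_map]
    exact ⟨(k1, k2, k3, k4), by simp [l1, l2, l3, l4], by
      change ((k1:ℤ), (k2:ℤ), (k3:ℤ), (k4:ℤ)) = R u
      rw [m1, m2, m3, m4]⟩
  have hRf : ∀ n u, ee ((dot4 n (R u) : ℝ) / q) = ee ((dot4 n u : ℝ) / q) := by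
    intro n u
    have : dot4 n u = dot4 n (R u) + q * (dot4 n (u.1 / q, u.2.1 / q, u.2.2.1 / q, u.2.2.2 / q)) := by
      simp only [dot4, hR]
      have a1 := Int.emod_add_mul_ediv u.1 q
      have a2 := Int.emod_add_mul_ediv u.2.1 q
      have a3 := Int.emod_add_mul_ediv u.2.2.1 q
      have a4 := Int.emod_add_mul_ediv u.2.2.2 q
      linear_combination (-n.1) * a1 - n.2.1 * a2 - n.2.2.1 * a3 - n.2.2.2 * a4
    rw [this]
    push_cast
    rw [add_div, mul_div_cancel_left₀ _ hqR.ne', ee_add_int]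
  have hfib : ∀ w ∈ box4 q, ((I.filter (fun i => R (U i) = w)).card : ℝ) ≤ H.card := by
    intro w _
    rcases (I.filter (fun i => R (U i) = w)).eq_empty_or_nonempty with h0 | ⟨i0, hi0⟩
    · rw [h0]; simp
    · have hi0' := mem_filter.mp hi0
      norm_cast
      have hdiv : ∀ i, R (U i) = w → ((q:ℤ) ∣ (U i).1 - (U i0).1 ∧ (q:ℤ) ∣ (U i).2.1 - (U i0).2.1 ∧
          (q:ℤ) ∣ (U i).2.2.1 - (U i0).2.2.1 ∧ (q:ℤ) ∣ (U i).2.2.2 - (U i0).2.2.2) := by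
        intro i hi
        have h := hi.trans hi0'.2.symm
        simp only [hR, Prod.mk.injEq] at h
        exact ⟨Int.ModEq.dvd h.1.symm, Int.ModEq.dvd h.2.1.symm,
          Int.ModEq.dvd h.2.2.1.symm, Int.ModEq.dvd h.2.2.2.symm⟩
      refine Finset.card_le_card_of_injOn (fun i => (((U i).1 - (U i0).1)/q, ((U i).2.1 - (U i0).2.1)/q,
        ((U i).2.2.1 - (U i0).2.2.1)/q, ((U i).2.2.2 - (U i0).2.2.2)/q)) ?_ ?_
      · intro i hi
        have hi' := mem_filter.mp (Finset.mem_coe.mp hi)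
        obtain ⟨⟨k1, d1⟩, ⟨k2, d2⟩, ⟨k3, d3⟩, ⟨k4, d4⟩⟩ := hdiv i hi'.2
        have hz : (q:ℤ) ≠ 0 := by exact_mod_cast hq0.ne'
        obtain ⟨b3, b1, b2, b4⟩ := hUb i hi'.1
        obtain ⟨c3, c1, c2, c4⟩ := hUb i0 hi0'.1
        simp only [d1, d2, d3, d4, Int.mul_ediv_cancel_left _ hz]
        have f1 : ((U i).1 : ℝ) = (U i0).1 + q * k1 := by
          have : (U i).1 = (U i0).1 + q * k1 := by linarith
          exact_mod_cast this
        have f2 : ((U i).2.1 : ℝ) = (U i0).2.1 + q * k2 := by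
          have : (U i).2.1 = (U i0).2.1 + q * k2 := by linarith
          exact_mod_cast this
        have f3 : ((U i).2.2.1 : ℝ) = (U i0).2.2.1 + q * k3 := by
          have : (U i).2.2.1 = (U i0).2.2.1 + q * k3 := by linarith
          exact_mod_cast this
        have f4 : ((U i).2.2.2 : ℝ) = (U i0).2.2.2 + q * k4 := by
          have : (U i).2.2.2 = (U i0).2.2.2 + q * k4 := by linarith
          exact_mod_cast this
        rw [f1, f3] at b1
        rw [f2, f3] at b2
        rw [f1, f2, f3, f4] at b4
        rw [f3] at b3
        have ab : ∀ x e : ℝ, -(q * e) ≤ q * x → q * x ≤ q * e → |x| ≤ e := by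
          intro x e h1 h2
          rw [← mul_neg] at h1
          exact abs_le.mpr ⟨le_of_mul_le_mul_left h1 hqR, le_of_mul_le_mul_left h2 hqR⟩
        apply hH
        · apply ab <;> linarith
        · apply ab <;> linarith
        · apply ab <;> linarith
        · apply ab <;> linarith
      · intro i hi j hj hij
        have hi' := mem_filter.mp (Finset.mem_coe.mp hi)
        have hj' := mem_filter.mp (Finset.mem_coe.mp hj)
        obtain ⟨d1, d2, d3, d4⟩ := hdiv i hi'.2
        obtain ⟨d1', d2', d3', d4'⟩ := hdiv j hj'.2
        simp only [Prod.mk.injEq] at hij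
        obtain ⟨g1, g2, g3, g4⟩ := hij
        apply hUinj
        have key : ∀ x y z : ℤ, (q:ℤ) ∣ x - z → (q:ℤ) ∣ y - z → (x-z)/q = (y-z)/q → x = y := by
          intro x y z h1 h2 h3
          have := Int.ediv_left_inj h1 h2 |>.mp h3
          linarith
        exact Prod.ext (key _ _ _ d1 d1' g1) (Prod.ext (key _ _ _ d2 d2' g2)
          (Prod.ext (key _ _ _ d3 d3' g3) (key _ _ _ d4 d4' g4)))
  have hup : ∑ i ∈ I, ‖∑ n ∈ S, ee ((dot4 n (U i) : ℝ) / q)‖^2 ≤ H.card * ((q:ℝ)^4 * S.card) := by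
    rw [← parseval4 q hq0 S hqS, mul_sum,
      ← Finset.sum_fiberwise_of_maps_to (t := box4 q) (g := fun i => R (U i)) (fun i _ => hRmem _)]
    refine sum_le_sum fun w hw => ?_
    have : ∀ i ∈ I.filter (fun i => R (U i) = w), ‖∑ n ∈ S, ee ((dot4 n (U i) : ℝ) / q)‖^2 =
        ‖∑ n ∈ S, ee ((dot4 n w : ℝ) / q)‖^2 := by
      intro i hi
      rw [← (mem_filter.mp hi).2]
      simp only [hRf]
    rw [sum_congr rfl this, Finset.sum_const, nsmul_eq_mul]
    exact mul_le_mul_of_nonneg_right (hfib w hw) (by positivity)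
  have hlo : (I.card : ℝ) * ((S.card:ℝ)/2)^2 ≤ ∑ i ∈ I, ‖∑ n ∈ S, ee ((dot4 n (U i) : ℝ) / q)‖^2 := by
    rw [← nsmul_eq_mul, ← Finset.sum_const]
    refine sum_le_sum fun i hi => ?_
    have := hlow i hi
    gcongr
  have hIc : (q:ℝ)^4 * (e1 * e2 * e3 * e4) / 16 ≤ I.card := by
    rw [hI]
    simp only [Finset.card_product, Finset.card_range]
    push_cast
    calc (q:ℝ)^4 * (e1 * e2 * e3 * e4) / 16 = (q*e1/2) * ((q*e2/2) * ((q*e3/2) * (q*e4/2))) := by ring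
      _ ≤ _ := by
        gcongr
        · exact hNge e1 hqe1
        · exact hNge e2 hqe2
        · exact hNge e3 hqe3
        · exact hNge e4 hqe4
  rcases Nat.eq_zero_or_pos S.card with h0 | h0
  · rw [h0]; simp
  · have hs0 : (0:ℝ) < S.card := by exact_mod_cast h0
    have h1 : (q:ℝ)^4 * (e1 * e2 * e3 * e4) / 16 * ((S.card:ℝ)/2)^2 ≤ H.card * ((q:ℝ)^4 * S.card) :=
      le_trans (mul_le_mul_of_nonneg_right hIc (by positivity)) (hlo.trans hup)
    have h2 : ((S.card : ℝ) * (e1 * e2 * e3 * e4)) * ((q:ℝ)^4 * S.card) ≤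
        (64 * H.card) * ((q:ℝ)^4 * S.card) := by
      calc _ = 64 * ((q:ℝ)^4 * (e1 * e2 * e3 * e4) / 16 * ((S.card:ℝ)/2)^2) := by ring
        _ ≤ 64 * (H.card * ((q:ℝ)^4 * S.card)) := by gcongr
        _ = _ := by ring
    exact le_of_mul_le_mul_right h2 (by positivity)

lemma transfer' (a b ρ1 ρ2 ρ3 e1 e2 e3 e4 : ℝ) (he1 : 0 < e1) (he2 : 0 < e2) (he3 : 0 < e3)
    (he4 : 0 < e4) (S : Finset (ℤ × ℤ × ℤ × ℤ))
    (hS : ∀ n1 n2 n3 n4 : ℤ, (n1, n2, n3, n4) ∈ S → |(n4:ℝ)| * e4 + |n1 - ρ1 * n4| * e1 +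
      |n2 - ρ2 * n4| * e2 + |n3 - ρ3 * n4 - a * (n1 - ρ1 * n4) - b * (n2 - ρ2 * n4)| * e3 ≤ 1/16) :
    ∃ H : Finset (ℤ × ℤ × ℤ × ℤ), (∀ x1 x2 x3 x4 : ℤ, (x1, x2, x3, x4) ∈ H ↔
      (|(x3:ℝ)| ≤ e3 ∧ |x1 + a * x3| ≤ e1 ∧ |x2 + b * x3| ≤ e2 ∧
      |x4 + ρ1 * x1 + ρ2 * x2 + ρ3 * x3| ≤ e4)) ∧
    (S.card : ℝ) * (e1 * e2 * e3 * e4) ≤ 64 * H.card := by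
  have hfin : {x : ℤ × ℤ × ℤ × ℤ | |(x.2.2.1:ℝ)| ≤ e3 ∧ |x.1 + a * x.2.2.1| ≤ e1 ∧
      |x.2.1 + b * x.2.2.1| ≤ e2 ∧ |x.2.2.2 + ρ1 * x.1 + ρ2 * x.2.1 + ρ3 * x.2.2.1| ≤ e4}.Finite := by
    set Y1 := e1 + |a| * e3 with hY1
    set Y2 := e2 + |b| * e3 with hY2
    set Y4 := e4 + |ρ1| * Y1 + |ρ2| * Y2 + |ρ3| * e3 with hY4
    have hI : ∀ Y : ℝ, {k : ℤ | |(k:ℝ)| ≤ Y}.Finite := by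
      intro Y
      refine (Set.finite_Icc (⌈-Y⌉) ⌊Y⌋).subset ?_
      intro k hk
      have hk' : |(k:ℝ)| ≤ Y := hk
      have := abs_le.mp hk'
      exact ⟨Int.ceil_le.mpr this.1, Int.le_floor.mpr this.2⟩
    refine ((hI Y1).prod ((hI Y2).prod ((hI e3).prod (hI Y4)))).subset ?_
    rintro ⟨x1, x2, x3, x4⟩ ⟨h3, h1, h2, h4⟩
    simp only at h1 h2 h3 h4
    have m3 : ∀ t : ℝ, |t * x3| ≤ |t| * e3 := fun t => by rw [abs_mul]; gcongr
    have q1 : |(x1:ℝ)| ≤ Y1 := by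
      have := abs_sub (x1 + a * x3) (a * x3)
      rw [add_sub_cancel_right] at this
      linarith [m3 a]
    have q2 : |(x2:ℝ)| ≤ Y2 := by
      have := abs_sub (x2 + b * x3) (b * x3)
      rw [add_sub_cancel_right] at this
      linarith [m3 b]
    have q4 : |(x4:ℝ)| ≤ Y4 := by
      have k1 : |ρ1 * x1| ≤ |ρ1| * Y1 := by rw [abs_mul]; gcongr
      have k2 : |ρ2 * x2| ≤ |ρ2| * Y2 := by rw [abs_mul]; gcongr
      have k3 := m3 ρ3
      have l1 := abs_le.mp k1
      have l2 := abs_le.mp k2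
      have l3 := abs_le.mp k3
      have l4 := abs_le.mp h4
      rw [abs_le]; constructor <;> linarith
    exact ⟨q1, q2, h3, q4⟩
  refine ⟨hfin.toFinset, fun x1 x2 x3 x4 => by simp, ?_⟩
  refine transfer a b ρ1 ρ2 ρ3 e1 e2 e3 e4 he1 he2 he3 he4 S _ hS ?_
  intro x1 x2 x3 x4 h3 h1 h2 h4
  simp [h1, h2, h3, h4]

set_option maxHeartbeats 400000 in
lemma cell_bound (c B C : ℝ) (hc : 1 < c) (hB : 1 ≤ B) (hC : 0 < C) : ∃ ε : ℝ, 0 < ε ∧ ε ≤ 1/2 ∧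
    ∀ M K r1 r2 r3 : ℝ, 1 ≤ K → K ≤ M →
    (1/B ≤ r1 ∧ r1 ≤ B) → (1/B ≤ r2 ∧ r2 ≤ B) → (1/B ≤ r3 ∧ r3 ≤ B) →
    |r1^c + r2^c - r3^c - 1| ≤ C / M^2 → ∀ S : Finset (ℤ × ℤ × ℤ × ℤ),
    (∀ n1 n2 n3 n4 : ℤ, (n1, n2, n3, n4) ∈ S → 0 < (n4:ℝ) ∧ (n4:ℝ) ≤ M ∧
      (1/B ≤ (n1:ℝ)/n4 ∧ (n1:ℝ)/n4 ≤ B) ∧ (1/B ≤ (n2:ℝ)/n4 ∧ (n2:ℝ)/n4 ≤ B) ∧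
      (1/B ≤ (n3:ℝ)/n4 ∧ (n3:ℝ)/n4 ≤ B) ∧
      |((n1:ℝ)/n4)^c + ((n2:ℝ)/n4)^c - ((n3:ℝ)/n4)^c - 1| ≤ C / M^2 ∧
      |(n1:ℝ)/n4 - r1| ≤ √K/M ∧ |(n2:ℝ)/n4 - r2| ≤ √K/M) →
    ∃ H : Finset (ℤ × ℤ × ℤ × ℤ), (∀ x1 x2 x3 x4 : ℤ, (x1, x2, x3, x4) ∈ H ↔
      (|(x3:ℝ)| ≤ ε * M / K ∧ |x1 + (r1/r3)^(c-1) * x3| ≤ ε / √K ∧ |x2 + (r2/r3)^(c-1) * x3| ≤ ε/√K ∧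
      |x4 + r1 * x1 + r2 * x2 + r3 * x3| ≤ ε / M)) ∧
    (S.card : ℝ) ≤ 64 / ε^4 * K^2 * H.card := by
  obtain ⟨C1, hC1, hgeom⟩ := cell_geom c B C hc hB hC
  refine ⟨1/(64*C1), by positivity, ?_, ?_⟩
  · rw [div_le_div_iff₀ (by positivity) (by norm_num)]; linarith
  set ε := 1/(64*C1) with hε
  have hε0 : 0 < ε := by positivity
  have hεC : C1 * ε = 1/64 := by rw [hε]; field_simp
  have hεle : ε ≤ 1/64 := by rw [← hεC]; exact le_mul_of_one_le_left hε0.le hC1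
  intro M K r1 r2 r3 hK hKM hr1 hr2 hr3 hr S hS
  have hM : 1 ≤ M := hK.trans hKM
  have hK0 : 0 < K := by linarith
  have hM0 : 0 < M := by linarith
  have hsq : √K * √K = K := Real.mul_self_sqrt hK0.le
  have hsq0 : 0 < √K := Real.sqrt_pos.mpr hK0
  have hs1 : √K / M ≤ 1 := by
    rw [div_le_one hM0]
    refine le_trans ?_ hKM
    have : 1 ≤ √K := Real.one_le_sqrt.mpr hK
    nlinarith
  have hs2 : (√K/M)^2 = K/M^2 := by rw [div_pow, Real.sq_sqrt hK0.le]
  have hCs : C / M^2 ≤ C * (√K/M)^2 := by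
    rw [hs2, ← mul_div_assoc]; gcongr; exact le_mul_of_one_le_right hC.le hK
  obtain ⟨H, hH, hcard⟩ := transfer' ((r1/r3)^(c-1)) ((r2/r3)^(c-1)) r1 r2 r3 (ε/√K) (ε/√K) (ε*M/K) (ε/M)
    (by positivity) (by positivity) (by positivity) (by positivity) S (by
      intro n1 n2 n3 n4 hn
      obtain ⟨h0, hle, b1, b2, b3, hx, d1, d2⟩ := hS n1 n2 n3 n4 hn
      have g := hgeom (√K/M) _ _ _ r1 r2 r3 (by positivity) hs1 b1 b2 b3 hr1 hr2 hr3
        (hx.trans hCs) (hr.trans hCs) d1 d2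
      have f1 : |(n1:ℝ) - r1 * n4| ≤ √K := by
        have : (n1:ℝ) - r1 * n4 = n4 * ((n1:ℝ)/n4 - r1) := by field_simp
        rw [this, abs_mul, abs_of_pos h0]
        calc (n4:ℝ) * |(n1:ℝ)/n4 - r1| ≤ M * (√K/M) := by gcongr
          _ = √K := by field_simp
      have f2 : |(n2:ℝ) - r2 * n4| ≤ √K := by
        have : (n2:ℝ) - r2 * n4 = n4 * ((n2:ℝ)/n4 - r2) := by field_simp
        rw [this, abs_mul, abs_of_pos h0]
        calc (n4:ℝ) * |(n2:ℝ)/n4 - r2| ≤ M * (√K/M) := by gcongr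
          _ = √K := by field_simp
      have f3 : |n3 - r3 * n4 - (r1/r3)^(c-1) * (n1 - r1 * n4) - (r2/r3)^(c-1) * (n2 - r2 * n4)|
          ≤ C1 * K / M := by
        have : n3 - r3 * n4 - (r1/r3)^(c-1) * (n1 - r1 * n4) - (r2/r3)^(c-1) * (n2 - r2 * n4) =
          n4 * ((n3:ℝ)/n4 - r3 - (r1/r3)^(c-1) * ((n1:ℝ)/n4 - r1) - (r2/r3)^(c-1) * ((n2:ℝ)/n4 - r2)) := by
          field_simp
        rw [this, abs_mul, abs_of_pos h0]
        calc (n4:ℝ) * _ ≤ M * (C1 * (√K/M)^2) := by gcongr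
          _ = C1 * K / M := by rw [hs2]; field_simp
      calc _ ≤ M * (ε/M) + √K * (ε/√K) + √K * (ε/√K) + (C1 * K / M) * (ε*M/K) := by
            rw [abs_of_pos h0]; gcongr
        _ = 3 * ε + C1 * ε := by field_simp; ring
        _ ≤ 1/16 := by linarith)
  refine ⟨H, hH, ?_⟩
  have : ε/√K * (ε/√K) * (ε*M/K) * (ε/M) = ε^4/K^2 := by
    rw [div_mul_div_comm, hsq]; field_simp
  rw [this] at hcard
  calc (S.card : ℝ) = (S.card * (ε^4/K^2)) * (K^2/ε^4) := by field_simp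
    _ ≤ (64 * H.card) * (K^2/ε^4) := by gcongr
    _ = _ := by ring

lemma box_count (Z : Finset (ℤ × ℤ)) (x y R : ℝ) (hR : 1 ≤ R)
    (h : ∀ z ∈ Z, |(z.1:ℝ) - x| ≤ R ∧ |(z.2:ℝ) - y| ≤ R) : (Z.card : ℝ) ≤ 9 * R^2 := by
  have hsub : Z ⊆ (Finset.Icc ⌈x - R⌉ ⌊x + R⌋) ×ˢ (Finset.Icc ⌈y - R⌉ ⌊y + R⌋) := by
    intro z hz
    obtain ⟨h1, h2⟩ := h z hz
    have a1 := abs_le.mp h1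
    have a2 := abs_le.mp h2
    simp only [Finset.mem_product, Finset.mem_Icc, Int.ceil_le, Int.le_floor]
    refine ⟨⟨?_, ?_⟩, ?_, ?_⟩ <;> linarith
  have hI : ∀ x : ℝ, ((Finset.Icc ⌈x - R⌉ ⌊x + R⌋).card : ℝ) ≤ 3 * R := by
    intro x
    rw [Int.card_Icc]
    have h1 := Int.le_ceil (x - R)
    have h2 := Int.floor_le (x + R)
    have h3 : ((⌊x+R⌋ + 1 - ⌈x-R⌉ : ℤ) : ℝ) ≤ 3 * R := by push_cast; linarith
    have h4 : (((⌊x+R⌋ + 1 - ⌈x-R⌉).toNat : ℤ) : ℝ) ≤ 3 * R := by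
      rw [Int.ofNat_toNat]; push_cast
      apply max_le
      · push_cast at h3; exact h3
      · linarith
    exact_mod_cast h4
  have := Finset.card_le_card hsub
  rw [Finset.card_product] at this
  calc (Z.card : ℝ) ≤ ((Finset.Icc ⌈x - R⌉ ⌊x + R⌋).card : ℝ) * ((Finset.Icc ⌈y - R⌉ ⌊y + R⌋).card) := by
        exact_mod_cast this
    _ ≤ (3*R) * (3*R) := by gcongr <;> apply hI
    _ = _ := by ring

lemma dyadic_sum (θ : ℝ) (hθ : 0 < θ) : ∃ C > 0, ∀ (ι : Type) (𝓜 : Finset ι) (l : ι → ℕ) (D Y : ℝ),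
    0 ≤ D → 1 ≤ Y → (∀ m ∈ 𝓜, 1 ≤ l m ∧ (l m : ℝ) ≤ Y) →
    (∀ j : ℕ, ((𝓜.filter (fun m => 2^j ≤ l m ∧ l m < 2^(j+1))).card : ℝ) ≤ D * ((2:ℝ)^j)^(2+θ)) →
    ∑ m ∈ 𝓜, 1/(l m : ℝ)^2 ≤ C * D * Y^θ := by
  have h2 : (1:ℝ) < 2^θ := Real.one_lt_rpow (by norm_num) hθ
  refine ⟨2^θ/(2^θ-1), div_pos (by linarith) (by linarith), ?_⟩
  intro ι 𝓜 l D Y hD hY hl hcount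
  set J := Nat.log 2 ⌊Y⌋₊ with hJ
  have hmaps : ∀ m ∈ 𝓜, Nat.log 2 (l m) ∈ range (J+1) := by
    intro m hm
    rw [Finset.mem_range, Nat.lt_succ_iff]
    exact Nat.log_mono_right (Nat.le_floor (hl m hm).2)
  rw [← Finset.sum_fiberwise_of_maps_to hmaps]
  have hJY : ((2:ℝ)^J)^θ ≤ Y^θ := by
    have : 2^J ≤ ⌊Y⌋₊ := Nat.pow_log_le_self 2 (Nat.floor_pos.mpr hY).ne'
    have h3 : ((2^J : ℕ) : ℝ) ≤ Y := le_trans (by exact_mod_cast this) (Nat.floor_le (by linarith))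
    push_cast at h3
    gcongr
  calc _ ≤ ∑ j ∈ range (J+1), D * ((2:ℝ)^θ)^j := by
        refine sum_le_sum fun j _ => ?_
        have hle : ∀ m ∈ 𝓜.filter (fun m => Nat.log 2 (l m) = j), 1/(l m : ℝ)^2 ≤ 1/((2:ℝ)^j)^2 := by
          intro m hm
          obtain ⟨hm1, hm2⟩ := mem_filter.mp hm
          have : 2^j ≤ l m := by
            rw [← hm2]; exact Nat.pow_log_le_self 2 (by have := (hl m hm1).1; omega)
          have h3 : (2:ℝ)^j ≤ l m := by exact_mod_cast this
          gcongr
        refine (sum_le_sum hle).trans ?_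
        rw [Finset.sum_const, nsmul_eq_mul]
        have hc : ((𝓜.filter (fun m => Nat.log 2 (l m) = j)).card : ℝ) ≤ D * ((2:ℝ)^j)^(2+θ) := by
          refine le_trans ?_ (hcount j)
          norm_cast
          apply Finset.card_le_card
          intro m hm
          obtain ⟨hm1, hm2⟩ := mem_filter.mp hm
          refine mem_filter.mpr ⟨hm1, ?_, ?_⟩
          · rw [← hm2]; exact Nat.pow_log_le_self 2 (by have := (hl m hm1).1; omega)
          · rw [← hm2]; exact Nat.lt_pow_succ_log_self (by norm_num) _
        calc _ ≤ (D * ((2:ℝ)^j)^(2+θ)) * (1/((2:ℝ)^j)^2) := by gcongr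
          _ = D * ((2:ℝ)^θ)^j := by
            have h5 : ((2:ℝ)^j)^θ = ((2:ℝ)^θ)^j := by
              rw [← Real.rpow_natCast, ← Real.rpow_mul (by norm_num), mul_comm (j:ℝ) θ,
                Real.rpow_mul (by norm_num), Real.rpow_natCast]
            rw [Real.rpow_add (by positivity), Real.rpow_two, h5]
            field_simp
    _ = D * (((2:ℝ)^θ)^(J+1) - 1) / (2^θ - 1) := by
        rw [← mul_sum, geom_sum_eq h2.ne', mul_div_assoc]
    _ ≤ D * (((2:ℝ)^θ) * Y^θ) / (2^θ - 1) := by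
        have : ((2:ℝ)^θ)^(J+1) ≤ (2:ℝ)^θ * Y^θ := by
          rw [pow_succ, mul_comm]
          gcongr
          rw [← Real.rpow_natCast, ← Real.rpow_mul (by norm_num), mul_comm θ, Real.rpow_mul (by norm_num),
            Real.rpow_natCast]
          exact hJY
        have h4 : (0:ℝ) ≤ 2^θ - 1 := by linarith
        gcongr
        linarith
    _ = _ := by ring

/-- the counting statement -/
def PP (c θ : ℝ) : Prop := ∀ B C : ℝ, 1 ≤ B → 0 < C → ∃ D > 0, ∀ M : ℝ, 1 ≤ M →
  ∀ S : Finset (ℤ × ℤ × ℤ × ℤ), (∀ n1 n2 n3 n4 : ℤ, (n1, n2, n3, n4) ∈ S →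
    (M/B ≤ n1 ∧ (n1:ℝ) ≤ M) ∧ (M/B ≤ n2 ∧ (n2:ℝ) ≤ M) ∧ (M/B ≤ n3 ∧ (n3:ℝ) ≤ M) ∧
    (M/B ≤ n4 ∧ (n4:ℝ) ≤ M) ∧ |(n1:ℝ)^c + (n2:ℝ)^c - (n3:ℝ)^c - (n4:ℝ)^c| ≤ C * M^(c-2)) →
    (S.card : ℝ) ≤ D * M^(2+θ)

lemma card4 (M B : ℝ) (hM : 1 ≤ M) (hB : 1 ≤ B) (S : Finset (ℤ × ℤ × ℤ × ℤ))
    (h : ∀ n1 n2 n3 n4 : ℤ, (n1, n2, n3, n4) ∈ S →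
    (M/B ≤ n1 ∧ (n1:ℝ) ≤ M) ∧ (M/B ≤ n2 ∧ (n2:ℝ) ≤ M) ∧ (M/B ≤ n3 ∧ (n3:ℝ) ≤ M) ∧
    (M/B ≤ n4 ∧ (n4:ℝ) ≤ M)) : (S.card : ℝ) ≤ M^4 := by
  set I := Finset.Icc (1:ℤ) ⌊M⌋ with hI
  have hp : 0 < M/B := by positivity
  have key : ∀ k : ℤ, (M/B ≤ k ∧ (k:ℝ) ≤ M) → k ∈ I := by
    intro k hk
    rw [hI, Finset.mem_Icc]
    refine ⟨?_, Int.le_floor.mpr hk.2⟩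
    have : (0:ℝ) < k := by linarith [hk.1]
    have : 0 < k := by exact_mod_cast this
    omega
  have hsub : S ⊆ I ×ˢ I ×ˢ I ×ˢ I := by
    rintro ⟨n1, n2, n3, n4⟩ hn
    obtain ⟨h1, h2, h3, h4⟩ := h n1 n2 n3 n4 hn
    simp only [Finset.mem_product]
    exact ⟨key _ h1, key _ h2, key _ h3, key _ h4⟩
  have hIc : (I.card : ℝ) ≤ M := by
    rw [hI, Int.card_Icc, add_sub_cancel_right]
    have h0 : (0:ℤ) ≤ ⌊M⌋ := Int.floor_nonneg.mpr (by linarith)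
    have : ((⌊M⌋.toNat : ℤ) : ℝ) ≤ M := by
      rw [Int.toNat_of_nonneg h0]; exact Int.floor_le M
    exact_mod_cast this
  have := Finset.card_le_card hsub
  simp only [Finset.card_product] at this
  calc (S.card : ℝ) ≤ I.card * (I.card * (I.card * I.card)) := by exact_mod_cast this
    _ ≤ M * (M * (M * M)) := by gcongr
    _ = M^4 := by ring

lemma PP_two (c : ℝ) : PP c 2 := by
  intro B C hB hC
  refine ⟨1, one_pos, fun M hM S hS => ?_⟩
  have := card4 M B hM hB S (fun n1 n2 n3 n4 hn => by
    obtain ⟨a, b, c, d, _⟩ := hS n1 n2 n3 n4 hn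
    exact ⟨a, b, c, d⟩)
  rw [one_mul, show (2:ℝ)+2 = (4:ℕ) by norm_num, Real.rpow_natCast]
  exact this

lemma norm_sol (c B C M n1 n2 n3 n4 : ℝ) (hc : 1 < c) (hB : 1 ≤ B) (hM : 1 ≤ M)
    (h1 : M/B ≤ n1 ∧ n1 ≤ M) (h2 : M/B ≤ n2 ∧ n2 ≤ M) (h3 : M/B ≤ n3 ∧ n3 ≤ M)
    (h4 : M/B ≤ n4 ∧ n4 ≤ M) (h : |n1^c + n2^c - n3^c - n4^c| ≤ C * M^(c-2)) :
    0 < n4 ∧ n4 ≤ M ∧ (1/B ≤ n1/n4 ∧ n1/n4 ≤ B) ∧ (1/B ≤ n2/n4 ∧ n2/n4 ≤ B) ∧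
    (1/B ≤ n3/n4 ∧ n3/n4 ≤ B) ∧ |(n1/n4)^c + (n2/n4)^c - (n3/n4)^c - 1| ≤ C * B^c / M^2 := by
  have hB0 : 0 < B := by linarith
  have hM0 : 0 < M := by linarith
  have hMB : 0 < M/B := by positivity
  have p4 : 0 < n4 := by linarith
  have rat : ∀ x : ℝ, M/B ≤ x ∧ x ≤ M → 1/B ≤ x/n4 ∧ x/n4 ≤ B := by
    intro x hx
    constructor
    · rw [le_div_iff₀ p4]
      calc 1/B * n4 ≤ 1/B * M := by gcongr; exact h4.2
        _ = M/B := by ring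
        _ ≤ x := hx.1
    · rw [div_le_iff₀ p4]
      calc x ≤ M := hx.2
        _ = B * (M/B) := by field_simp
        _ ≤ B * n4 := by gcongr; exact h4.1
  refine ⟨p4, h4.2, rat _ h1, rat _ h2, rat _ h3, ?_⟩
  have q1 : 0 ≤ n1 := by linarith
  have q2 : 0 ≤ n2 := by linarith
  have q3 : 0 ≤ n3 := by linarith
  have hn4 : 0 < n4^c := by positivity
  have e : (n1/n4)^c + (n2/n4)^c - (n3/n4)^c - 1 = (n1^c + n2^c - n3^c - n4^c)/n4^c := by
    rw [Real.div_rpow q1 p4.le, Real.div_rpow q2 p4.le, Real.div_rpow q3 p4.le]; field_simp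
  rw [e, abs_div, abs_of_pos hn4]
  have hlow : (M/B)^c ≤ n4^c := Real.rpow_le_rpow hMB.le h4.1 (by linarith)
  have hC0 : 0 ≤ C * M^(c-2) := (abs_nonneg _).trans h
  calc _ ≤ C * M^(c-2) / (M/B)^c := by gcongr
    _ = C * B^c / M^2 := by
      rw [Real.rpow_sub hM0, Real.rpow_two, Real.div_rpow hM0.le hB0.le]; field_simp

set_option maxHeartbeats 1600000 in
lemma PP_main (θ : ℝ) (hθ : 0 < θ) (c : ℝ) (hc : 1 < c) (hPP : PP (c/(c-1)) θ) (B C : ℝ)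
    (hB : 1 ≤ B) (hC : 0 < C) : ∃ K0 D : ℝ, 1 ≤ K0 ∧ 0 < D ∧ ∀ M K : ℝ, K0 ≤ K → K ≤ M →
    ∀ S : Finset (ℤ × ℤ × ℤ × ℤ), (∀ n1 n2 n3 n4 : ℤ, (n1, n2, n3, n4) ∈ S →
    (M/B ≤ n1 ∧ (n1:ℝ) ≤ M) ∧ (M/B ≤ n2 ∧ (n2:ℝ) ≤ M) ∧ (M/B ≤ n3 ∧ (n3:ℝ) ≤ M) ∧
    (M/B ≤ n4 ∧ (n4:ℝ) ≤ M) ∧ |(n1:ℝ)^c + (n2:ℝ)^c - (n3:ℝ)^c - (n4:ℝ)^c| ≤ C * M^(c-2)) →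
    (S.card : ℝ) ≤ D * (M^2 * K + M^2 * (M/K)^θ) := by
  classical
  have hB0 : 0 < B := by linarith
  set Ca := C * B^c with hCa
  have hCa0 : 0 < Ca := by positivity
  obtain ⟨ε, hε0, hε1, hcell⟩ := cell_bound c B Ca hc hB hCa0
  obtain ⟨K0, B', C', C'', hK0, hB', hC', hC'', hdual⟩ := dual_geom c B Ca hc hB hCa0
  obtain ⟨κ1, κ2, hκ1, hκ2, hκ⟩ := rpow_two_sided (c/(c-1) - 2) (2*B') (by linarith)
  obtain ⟨D', hD'0, hD'⟩ := hPP (2*B'^2) (C'/κ1) (by nlinarith) (by positivity)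
  obtain ⟨Cθ, hCθ, hdy⟩ := dyadic_sum θ hθ
  set D2 := D' * (2*B')^(2+θ) with hD2
  have hD20 : 0 < D2 := by positivity
  set Q := 64/ε^4 with hQ
  have hQ0 : 0 < Q := by positivity
  refine ⟨K0, Q * (9 * B^2) + Q * (2 * (9 * (C''+1)^2 * (Cθ * D2))), hK0, by positivity, ?_⟩
  intro M K hKK hKM S hS
  have hK1 : 1 ≤ K := hK0.trans hKK
  have hM1 : 1 ≤ M := hK1.trans hKM
  have hKp : 0 < K := by linarith
  have hMp : 0 < M := by linarith
  have hsq0 : 0 < √K := Real.sqrt_pos.mpr hKp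
  have hsqK : √K * √K = K := Real.mul_self_sqrt hKp.le
  have hsq1 : 1 ≤ √K := Real.one_le_sqrt.mpr hK1
  set s := √K / M with hs
  have hs0 : 0 < s := by positivity
  have hs1 : s ≤ 1 := by
    rw [hs, div_le_one hMp]
    refine le_trans ?_ hKM
    calc √K = √K * 1 := by ring
      _ ≤ √K * √K := by gcongr
      _ = K := hsqK
  have hnorm : ∀ n1 n2 n3 n4 : ℤ, (n1, n2, n3, n4) ∈ S → _ := fun n1 n2 n3 n4 hn =>
    norm_sol c B C M n1 n2 n3 n4 hc hB hM1 (hS n1 n2 n3 n4 hn).1 (hS n1 n2 n3 n4 hn).2.1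
      (hS n1 n2 n3 n4 hn).2.2.1 (hS n1 n2 n3 n4 hn).2.2.2.1 (hS n1 n2 n3 n4 hn).2.2.2.2
  set κ : ℤ × ℤ × ℤ × ℤ → ℤ × ℤ := fun n => (⌊(n.1:ℝ)/n.2.2.2/s⌋, ⌊(n.2.1:ℝ)/n.2.2.2/s⌋) with hκd
  set Z := S.image κ with hZ
  have hbase : ∀ z ∈ Z, ∃ n ∈ S, κ n = z := fun z hz => Finset.mem_image.mp hz
  choose! b hbS hbκ using hbase
  set r1 : ℤ × ℤ → ℝ := fun z => ((b z).1:ℝ)/(b z).2.2.2 with hr1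
  set r2 : ℤ × ℤ → ℝ := fun z => ((b z).2.1:ℝ)/(b z).2.2.2 with hr2
  set r3 : ℤ × ℤ → ℝ := fun z => ((b z).2.2.1:ℝ)/(b z).2.2.2 with hr3
  have hbn : ∀ z ∈ Z, (1/B ≤ r1 z ∧ r1 z ≤ B) ∧ (1/B ≤ r2 z ∧ r2 z ≤ B) ∧ (1/B ≤ r3 z ∧ r3 z ≤ B) ∧
      |(r1 z)^c + (r2 z)^c - (r3 z)^c - 1| ≤ Ca/M^2 := by
    intro z hz
    exact (hnorm (b z).1 (b z).2.1 (b z).2.2.1 (b z).2.2.2 (hbS z hz)).2.2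
  have hbz : ∀ z ∈ Z, (⌊r1 z / s⌋ = z.1 ∧ ⌊r2 z / s⌋ = z.2) := by
    intro z hz
    have := hbκ z hz
    exact ⟨congrArg Prod.fst this, congrArg Prod.snd this⟩
  have hH : ∀ z ∈ Z, ∃ H : Finset (ℤ × ℤ × ℤ × ℤ), (∀ x1 x2 x3 x4 : ℤ, (x1, x2, x3, x4) ∈ H ↔
      (|(x3:ℝ)| ≤ ε * M / K ∧ |x1 + (r1 z/r3 z)^(c-1) * x3| ≤ ε / √K ∧
        |x2 + (r2 z/r3 z)^(c-1) * x3| ≤ ε/√K ∧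
      |x4 + r1 z * x1 + r2 z * x2 + r3 z * x3| ≤ ε / M)) ∧
      ((S.filter (fun n => κ n = z)).card : ℝ) ≤ Q * K^2 * H.card := by
    intro z hz
    obtain ⟨g1, g2, g3, g4⟩ := hbn z hz
    refine hcell M K (r1 z) (r2 z) (r3 z) hK1 hKM g1 g2 g3 g4 _ ?_
    intro n1 n2 n3 n4 hn
    obtain ⟨hn1, hn2⟩ := mem_filter.mp hn
    obtain ⟨i1, i2, i3, i4, i5, i6⟩ := hnorm n1 n2 n3 n4 hn1
    have hz' := hbz z hz
    have close : ∀ x y : ℝ, ⌊x/s⌋ = ⌊y/s⌋ → |x - y| ≤ s := by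
      intro x y h
      have := (Int.abs_sub_lt_one_of_floor_eq_floor h).le
      rw [← sub_div, abs_div, abs_of_pos hs0, div_le_one hs0] at this
      exact this
    refine ⟨i1, i2, i3, i4, i5, i6, close _ _ ?_, close _ _ ?_⟩
    · rw [hz'.1]; exact congrArg Prod.fst hn2
    · rw [hz'.2]; exact congrArg Prod.snd hn2
  choose! H hHm hHc using hH
  set Hp : ℤ × ℤ → Finset (ℤ × ℤ × ℤ × ℤ) := fun z => (H z).filter (fun x => 0 < x.2.2.1) with hHp
  -- H in terms of Hp
  have hHcard : ∀ z ∈ Z, ((H z).card : ℝ) ≤ 1 + 2 * (Hp z).card := by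
    intro z hz
    set Hm := (H z).filter (fun x => x.2.2.1 < 0) with hHmd
    have hsub : H z ⊆ {(0,0,0,0)} ∪ (Hp z ∪ Hm) := by
      rintro ⟨x1, x2, x3, x4⟩ hx
      rcases lt_trichotomy x3 0 with h | h | h
      · simp only [Finset.mem_union]; right; right
        exact mem_filter.mpr ⟨hx, h⟩
      · simp only [Finset.mem_union]; left
        obtain ⟨a3, a1, a2, a4⟩ := (hHm z hz x1 x2 x3 x4).mp hx
        subst h
        simp only [Int.cast_zero, mul_zero, add_zero] at a1 a2 a4
        have small : ∀ (k : ℤ) (t : ℝ), 1 ≤ t → |(k:ℝ)| ≤ ε/t → k = 0 := by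
          intro k t ht hk
          have : ε/t ≤ 1/2 := by
            rw [div_le_iff₀ (by linarith)]; linarith
          have h1 : |(k:ℝ)| < 1 := by linarith
          rw [← Int.cast_abs] at h1
          have h2 : |k| < 1 := by exact_mod_cast h1
          exact Int.abs_lt_one_iff.mp h2
        have e1 := small x1 _ hsq1 a1
        have e2 := small x2 _ hsq1 a2
        subst e1; subst e2
        simp only [Int.cast_zero, mul_zero, add_zero] at a4
        have e4 := small x4 _ hM1 a4
        subst e4
        simp
      · simp only [Finset.mem_union]; right; left
        exact mem_filter.mpr ⟨hx, h⟩
    have hneg : Hm.card ≤ (Hp z).card := by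
      refine Finset.card_le_card_of_injOn (fun x => -x) ?_ (fun x _ y _ h => neg_injective h)
      rintro ⟨x1, x2, x3, x4⟩ hx
      obtain ⟨h1, h2⟩ := mem_filter.mp (Finset.mem_coe.mp hx)
      obtain ⟨a3, a1, a2, a4⟩ := (hHm z hz x1 x2 x3 x4).mp h1
      refine Finset.mem_coe.mpr (mem_filter.mpr ⟨?_, by simpa using h2⟩)
      refine (hHm z hz (-x1) (-x2) (-x3) (-x4)).mpr ⟨?_, ?_, ?_, ?_⟩
      · push_cast; rwa [abs_neg]
      · rw [← abs_neg] at a1; convert a1 using 2; push_cast; ring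
      · rw [← abs_neg] at a2; convert a2 using 2; push_cast; ring
      · rw [← abs_neg] at a4; convert a4 using 2; push_cast; ring
    have h1 := Finset.card_le_card hsub
    have h2 := Finset.card_union_le {((0:ℤ),(0:ℤ),(0:ℤ),(0:ℤ))} (Hp z ∪ Hm)
    have h3 := Finset.card_union_le (Hp z) Hm
    rw [Finset.card_singleton] at h2
    have : (H z).card ≤ 1 + 2 * (Hp z).card := by omega
    exact_mod_cast this
  -- the number of cells
  have hZcard : (Z.card : ℝ) ≤ 9 * B^2 * (M^2/K) := by
    have hBs : 1 ≤ B/s := by rw [le_div_iff₀ hs0]; linarith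
    have := box_count Z 0 0 (B/s) hBs (by
      intro z hz
      obtain ⟨g1, g2, g3, g4⟩ := hbn z hz
      obtain ⟨f1, f2⟩ := hbz z hz
      have key : ∀ x : ℝ, (1/B ≤ x ∧ x ≤ B) → |((⌊x/s⌋ : ℤ) : ℝ)| ≤ B/s := by
        intro x hx
        have x0 : 0 ≤ x := le_trans (by positivity) hx.1
        rw [abs_of_nonneg (by exact_mod_cast Int.floor_nonneg.mpr (by positivity))]
        refine (Int.floor_le _).trans ?_
        gcongr; exact hx.2
      rw [sub_zero, sub_zero, ← f1, ← f2]
      exact ⟨key _ g1, key _ g2⟩)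
    calc (Z.card : ℝ) ≤ 9 * (B/s)^2 := this
      _ = 9 * B^2 * (M^2/K) := by rw [hs, div_div_eq_mul_div, div_pow, mul_pow, Real.sq_sqrt hKp.le]; ring
  -- consequences of the dual geometry
  have hdg : ∀ z ∈ Z, ∀ x1 x2 x3 x4 : ℤ, (x1, x2, x3, x4) ∈ Hp z → 1 ≤ (x3:ℝ) ∧ (x3:ℝ) * K ≤ M ∧ _ :=
    fun z hz x1 x2 x3 x4 hx => by
    obtain ⟨hx1, hx3⟩ := mem_filter.mp hx
    simp only at hx3
    obtain ⟨a3, a1, a2, a4⟩ := (hHm z hz x1 x2 x3 x4).mp hx1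
    obtain ⟨g1, g2, g3, g4⟩ := hbn z hz
    have L1 : 1 ≤ (x3:ℝ) := by exact_mod_cast hx3
    have LK : (x3:ℝ) * K ≤ M := by
      rw [abs_of_pos (by linarith), le_div_iff₀ hKp] at a3
      have : ε * M ≤ 1 * M := by gcongr; linarith
      linarith
    refine ⟨L1, LK, hdual M K (r1 z) (r2 z) (r3 z) (-(x1:ℝ)) (-(x2:ℝ)) x3 x4 hKK hKM L1 LK g1 g2 g3 g4 ?_ ?_ ?_⟩
    · rw [← abs_neg, show -(-(x1:ℝ) - (r1 z/r3 z)^(c-1) * x3) = x1 + (r1 z/r3 z)^(c-1) * x3 by ring]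
      refine a1.trans ?_
      gcongr; linarith
    · rw [← abs_neg, show -(-(x2:ℝ) - (r2 z/r3 z)^(c-1) * x3) = x2 + (r2 z/r3 z)^(c-1) * x3 by ring]
      refine a2.trans ?_
      gcongr; linarith
    · rw [show (x4:ℝ) - r1 z * -(x1:ℝ) - r2 z * -(x2:ℝ) + r3 z * x3 =
        x4 + r1 z * x1 + r2 z * x2 + r3 z * x3 by ring]
      refine a4.trans ?_
      gcongr; linarith
  -- double counting
  set 𝓜 := Z.biUnion Hp with h𝓜
  have hex : ∀ x1 x2 x3 x4 : ℤ, (x1, x2, x3, x4) ∈ 𝓜 → ∃ z ∈ Z, (x1, x2, x3, x4) ∈ Hp z := by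
    intro x1 x2 x3 x4 hx; exact Finset.mem_biUnion.mp hx
  have hdc : ∑ z ∈ Z, ((Hp z).card : ℝ) = ∑ x ∈ 𝓜, ((Z.filter (fun z => x ∈ Hp z)).card : ℝ) := by
    have := Finset.sum_card_bipartiteAbove_eq_sum_card_bipartiteBelow (s := Z) (t := 𝓜)
      (fun z x => x ∈ Hp z)
    simp only [Finset.bipartiteAbove, Finset.bipartiteBelow] at this
    have e : ∀ z ∈ Z, 𝓜.filter (fun x => x ∈ Hp z) = Hp z := by
      intro z hz
      ext x
      simp only [mem_filter, h𝓜, Finset.mem_biUnion]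
      exact ⟨fun h => h.2, fun h => ⟨⟨z, hz, h⟩, h⟩⟩
    rw [sum_congr rfl (fun z hz => by rw [e z hz])] at this
    exact_mod_cast this
  set R0 := (C''+1) * (M/K) with hR0
  have hzc : ∀ x ∈ 𝓜, ((Z.filter (fun z => x ∈ Hp z)).card : ℝ) ≤ 9 * R0^2 * (1/(x.2.2.1.toNat : ℝ)^2) := by
    rintro ⟨x1, x2, x3, x4⟩ hx
    obtain ⟨z0, hz0, hxz0⟩ := hex x1 x2 x3 x4 hx
    obtain ⟨L1, LK, -⟩ := hdg z0 hz0 x1 x2 x3 x4 hxz0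
    have hL : ((x3.toNat : ℕ) : ℝ) = x3 := by
      have : (0:ℤ) ≤ x3 := by have : (0:ℝ) ≤ x3 := by linarith
                              exact_mod_cast this
      have := Int.toNat_of_nonneg this
      exact_mod_cast congrArg (fun k : ℤ => (k:ℝ)) this
    simp only [hL]
    have Lp : (0:ℝ) < x3 := by linarith
    have hT : 1 ≤ M/K/x3 := by
      rw [le_div_iff₀ Lp, le_div_iff₀ hKp]; linarith
    have := box_count (Z.filter (fun z => (x1, x2, x3, x4) ∈ Hp z))
      ((-(x1:ℝ)/x4)^(1/(c-1))/s) ((-(x2:ℝ)/x4)^(1/(c-1))/s) (R0/x3) (by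
        rw [hR0, mul_div_assoc]
        nlinarith) (by
        intro z hz
        obtain ⟨hz1, hz2⟩ := mem_filter.mp hz
        obtain ⟨-, -, -, -, -, -, q1, q2⟩ := hdg z hz1 x1 x2 x3 x4 hz2
        obtain ⟨f1, f2⟩ := hbz z hz1
        have key : ∀ r y : ℝ, |r - y| ≤ C''/(x3 * √K) → |((⌊r/s⌋:ℤ):ℝ) - y/s| ≤ R0/x3 := by
          intro r y h
          have h1 := Int.floor_le (r/s)
          have h2 := Int.lt_floor_add_one (r/s)
          have h3 : |r/s - y/s| ≤ C'' * (M/K/x3) := by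
            rw [← sub_div, abs_div, abs_of_pos hs0, div_le_iff₀ hs0]
            refine h.trans (le_of_eq ?_)
            rw [hs]
            field_simp
            rw [pow_two, hsqK]
          have h4 := abs_le.mp h3
          have h5 : R0/x3 = C'' * (M/K/x3) + M/K/x3 := by rw [hR0]; ring
          rw [h5, abs_le]; constructor <;> linarith
        rw [← f1, ← f2]
        exact ⟨key _ _ q1, key _ _ q2⟩)
    refine this.trans (le_of_eq ?_)
    rw [div_pow]; ring
  -- sum over dyadic ranges
  have hMK : 1 ≤ M/K := by rw [le_div_iff₀ hKp]; linarith
  have hsum : ∑ x ∈ 𝓜, 1/(x.2.2.1.toNat : ℝ)^2 ≤ Cθ * D2 * (M/K)^θ := by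
    refine hdy _ 𝓜 (fun x => x.2.2.1.toNat) D2 (M/K) hD20.le hMK ?_ ?_
    · rintro ⟨x1, x2, x3, x4⟩ hx
      obtain ⟨z0, hz0, hxz0⟩ := hex x1 x2 x3 x4 hx
      obtain ⟨L1, LK, -⟩ := hdg z0 hz0 x1 x2 x3 x4 hxz0
      have h1 : 1 ≤ x3 := by exact_mod_cast L1
      have h0 : (0:ℤ) ≤ x3 := by omega
      have hL : ((x3.toNat : ℕ) : ℝ) = x3 := by
        exact_mod_cast congrArg (fun k : ℤ => (k:ℝ)) (Int.toNat_of_nonneg h0)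
      refine ⟨by simp only; omega, ?_⟩
      simp only [hL]
      rw [le_div_iff₀ hKp]; exact LK
    · intro j
      set F := 𝓜.filter (fun m => 2^j ≤ m.2.2.1.toNat ∧ m.2.2.1.toNat < 2^(j+1)) with hF
      set M' : ℝ := B' * 2^(j+1) with hM'
      have h2j : (1:ℝ) ≤ 2^j := one_le_pow₀ (by norm_num)
      have h2j1 : (2:ℝ)^(j+1) = 2 * 2^j := by rw [pow_succ]; ring
      have hM'1 : 1 ≤ M' := by rw [hM', h2j1]; nlinarith
      set g : ℤ × ℤ × ℤ × ℤ → ℤ × ℤ × ℤ × ℤ := fun x => (-x.1, -x.2.1, x.2.2.1, x.2.2.2) with hg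
      have hginj : Function.Injective g := by
        rintro ⟨x1, x2, x3, x4⟩ ⟨y1, y2, y3, y4⟩ h
        simpa [hg] using h
      have hp := hD' M' hM'1 (F.image g) (by
        intro m1 m2 m3 m4 hm
        obtain ⟨⟨x1, x2, x3, x4⟩, hx, hxe⟩ := Finset.mem_image.mp hm
        simp only [hg, Prod.mk.injEq] at hxe
        obtain ⟨rfl, rfl, rfl, rfl⟩ := hxe
        obtain ⟨hx1, hx2, hx3⟩ := mem_filter.mp hx
        obtain ⟨z0, hz0, hxz0⟩ := hex x1 x2 x3 x4 hx1
        obtain ⟨L1, LK, b1, b2, b4, q, -, -⟩ := hdg z0 hz0 x1 x2 x3 x4 hxz0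
        simp only at hx2 hx3
        have h0 : (0:ℤ) ≤ x3 := by
          have : (0:ℝ) ≤ x3 := by linarith
          exact_mod_cast this
        have hL : ((x3.toNat : ℕ) : ℝ) = x3 := by
          exact_mod_cast congrArg (fun k : ℤ => (k:ℝ)) (Int.toNat_of_nonneg h0)
        have hl1 : (2:ℝ)^j ≤ x3 := by rw [← hL]; exact_mod_cast hx2
        have hl2 : (x3:ℝ) ≤ 2^(j+1) := by rw [← hL]; exact_mod_cast hx3.le
        have hB'0 : 0 < B' := by linarith
        have k1 : M'/(2*B'^2) ≤ x3/B' := by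
          have : M'/(2*B'^2) = 2^j/B' := by rw [hM', h2j1]; field_simp
          rw [this]; gcongr
        have k2 : B' * x3 ≤ M' := by rw [hM']; gcongr
        have k3 : (x3:ℝ)/B' ≤ x3 := div_le_self (by linarith) hB'
        have k4 : (x3:ℝ) ≤ B' * x3 := le_mul_of_one_le_left (by linarith) hB'
        push_cast
        refine ⟨⟨k1.trans b1.1, b1.2.trans k2⟩, ⟨k1.trans b2.1, b2.2.trans k2⟩, ⟨k1.trans k3, k4.trans k2⟩,
          ⟨k1.trans b4.1, b4.2.trans k2⟩, q.trans ?_⟩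
        have hk := (hκ x3 M' (by linarith) (k4.trans k2) (by
          rw [hM', h2j1]
          calc B' * (2 * 2^j) = 2 * B' * 2^j := by ring
            _ ≤ 2 * B' * x3 := by gcongr)).1
        rw [div_mul_eq_mul_div, le_div_iff₀ hκ1]
        calc C' * (x3:ℝ)^(c/(c-1)-2) * κ1 = C' * (κ1 * (x3:ℝ)^(c/(c-1)-2)) := by ring
          _ ≤ C' * M'^(c/(c-1)-2) := by gcongr)
      rw [Finset.card_image_of_injective _ hginj] at hp
      refine hp.trans (le_of_eq ?_)
      rw [hD2, hM', h2j1, show B' * (2 * 2^j) = (2*B') * 2^j by ring,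
        Real.mul_rpow (by positivity) (by positivity)]
      ring
  have hsumHp : ∑ z ∈ Z, ((Hp z).card : ℝ) ≤ 9 * R0^2 * (Cθ * D2 * (M/K)^θ) := by
    rw [hdc]
    refine (sum_le_sum hzc).trans ?_
    rw [← mul_sum]
    gcongr
  have hScard : (S.card : ℝ) = ∑ z ∈ Z, ((S.filter (fun n => κ n = z)).card : ℝ) := by
    have := Finset.card_eq_sum_card_image κ S
    rw [this]; push_cast; rfl
  rw [hScard]
  calc ∑ z ∈ Z, ((S.filter (fun n => κ n = z)).card : ℝ)
      ≤ ∑ z ∈ Z, Q * K^2 * (1 + 2 * (Hp z).card) := by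
        refine sum_le_sum fun z hz => (hHc z hz).trans ?_
        have := hHcard z hz
        gcongr
    _ = Q * K^2 * (Z.card + 2 * ∑ z ∈ Z, ((Hp z).card : ℝ)) := by
        rw [← mul_sum, Finset.sum_add_distrib, ← mul_sum]; simp
    _ ≤ Q * K^2 * (9 * B^2 * (M^2/K) + 2 * (9 * R0^2 * (Cθ * D2 * (M/K)^θ))) := by gcongr
    _ = Q * (9 * B^2) * (M^2 * K) + Q * (2 * (9 * (C''+1)^2 * (Cθ * D2))) * (M^2 * (M/K)^θ) := by
        rw [hR0]; field_simp
    _ ≤ _ := by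
        have u1 : 0 ≤ Q * (9 * B^2) * (M^2 * (M/K)^θ) := by positivity
        have u2 : 0 ≤ Q * (2 * (9 * (C''+1)^2 * (Cθ * D2))) * (M^2 * K) := by positivity
        rw [add_mul, mul_add, mul_add]
        linarith

lemma PP_mono (c θ θ' : ℝ) (h : θ ≤ θ') (hP : PP c θ) : PP c θ' := by
  intro B C hB hC
  obtain ⟨D, hD, hDD⟩ := hP B C hB hC
  refine ⟨D, hD, fun M hM S hS => (hDD M hM S hS).trans ?_⟩
  gcongr

lemma PP_step (θ : ℝ) (hθ : 0 < θ) (hP : ∀ c : ℝ, 1 < c → PP c θ) (c : ℝ) (hc : 1 < c) :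
    PP c (θ/(1+θ)) := by
  intro B C hB hC
  have hc' : 1 < c/(c-1) := by
    rw [lt_div_iff₀ (by linarith)]; linarith
  obtain ⟨K0, D, hK0, hD, hmain⟩ := PP_main θ hθ c hc (hP _ hc') B C hB hC
  set φ := θ/(1+θ) with hφ
  have hφ0 : 0 < φ := by positivity
  have hφ1 : φ ≤ 1 := by rw [hφ, div_le_one (by positivity)]; linarith
  refine ⟨2*D + (K0^(1/φ))^2, by positivity, fun M hM S hS => ?_⟩
  have hM0 : 0 < M := by linarith
  have hM2 : (M:ℝ)^(2+φ) = M^2 * M^φ := by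
    rw [Real.rpow_add hM0]; norm_num
  by_cases hK : K0 ≤ M^φ
  · have hKM : M^φ ≤ M := by
      calc M^φ ≤ M^(1:ℝ) := Real.rpow_le_rpow_of_exponent_le hM hφ1
        _ = M := Real.rpow_one M
    have h1 := hmain M (M^φ) hK hKM S hS
    have h2 : (M / M^φ)^θ = M^φ := by
      have : M / M^φ = M^(1-φ) := by rw [Real.rpow_sub hM0, Real.rpow_one]
      rw [this, ← Real.rpow_mul hM0.le]
      congr 1
      rw [hφ]; field_simp; ring
    rw [h2] at h1
    rw [hM2]
    have : 0 ≤ (K0^(1/φ))^2 * (M^2 * M^φ) := by positivity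
    nlinarith
  · push Not at hK
    have h1 := card4 M B hM hB S (fun n1 n2 n3 n4 hn => by
      obtain ⟨a, b, c, d, _⟩ := hS n1 n2 n3 n4 hn
      exact ⟨a, b, c, d⟩)
    have h3 : M ≤ K0^(1/φ) := by
      calc M = (M^φ)^(1/φ) := by
            rw [← Real.rpow_mul hM0.le, mul_one_div_cancel hφ0.ne', Real.rpow_one]
        _ ≤ K0^(1/φ) := by gcongr
    have h4 : 1 ≤ M^φ := Real.one_le_rpow hM hφ0.le
    calc (S.card:ℝ) ≤ M^4 := h1
      _ = M^2 * (M^2 * 1) := by ring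
      _ ≤ (K0^(1/φ))^2 * (M^2 * M^φ) := by gcongr
      _ ≤ _ := by
        rw [hM2]
        have : 0 ≤ 2*D * (M^2 * M^φ) := by positivity
        linarith

lemma PP_all (κ : ℝ) (hκ : 0 < κ) (c : ℝ) (hc : 1 < c) : PP c κ := by
  have h : ∀ j : ℕ, ∀ c : ℝ, 1 < c → PP c (2/(2*j+1)) := by
    intro j
    induction j with
    | zero => intro c hc; simpa using PP_two c
    | succ j ih =>
      intro c hc
      have := PP_step _ (by positivity) ih c hc
      convert this using 1
      push_cast
      field_simp
      ring
  obtain ⟨j, hj⟩ := exists_nat_gt (1/κ)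
  refine PP_mono c _ κ ?_ (h j c hc)
  rw [div_le_iff₀ (by positivity)]
  rw [div_lt_iff₀ hκ] at hj
  nlinarith

lemma shift_count {α : Type*} [DecidableEq α] (Q : Finset α) (g : α → ℤ) (h : ℤ) :
    ((Q ×ˢ Q).filter (fun x => g x.2 = g x.1 + h)).card ≤
    ((Q ×ˢ Q).filter (fun x => g x.1 = g x.2)).card := by
  classical
  set N : ℤ → ℕ := fun v => (Q.filter (fun p => g p = v)).card with hN
  set V := Q.image g with hV
  have gen : ∀ h : ℤ, ((Q ×ˢ Q).filter (fun x => g x.2 = g x.1 + h)).card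
      = ∑ v ∈ V, N v * N (v+h) := by
    intro h
    rw [Finset.card_eq_sum_card_fiberwise (f := fun x => g x.1) (t := V)]
    · refine sum_congr rfl fun v _ => ?_
      rw [hN, ← Finset.card_product]
      congr 1
      ext ⟨a, b⟩
      simp only [mem_filter, Finset.mem_product]
      constructor
      · rintro ⟨⟨⟨h1, h2⟩, h3⟩, h4⟩; exact ⟨⟨h1, h4⟩, h2, by rw [h3, h4]⟩
      · rintro ⟨⟨h1, h2⟩, h3, h4⟩; exact ⟨⟨⟨h1, h3⟩, by rw [h4, h2]⟩, h2⟩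
    · rintro ⟨a, b⟩ hx
      simp only [Finset.coe_filter, Finset.mem_product, Set.mem_ofPred_eq] at hx
      exact Finset.mem_coe.mpr (Finset.mem_image_of_mem g hx.1.1)
  have e0 : ((Q ×ˢ Q).filter (fun x => g x.1 = g x.2)).card = ∑ v ∈ V, N v * N v := by
    have := gen 0
    simp only [add_zero] at this
    rw [← this]
    congr 1
    ext x
    simp only [mem_filter, eq_comm]
  rw [gen, e0]
  have hsh : ∑ v ∈ V, N (v+h) * N (v+h) ≤ ∑ v ∈ V, N v * N v := by
    have : ∑ v ∈ V, N (v+h) * N (v+h) = ∑ w ∈ V.image (fun v => v + h), N w * N w := by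
      refine (Finset.sum_image (f := fun w => N w * N w) (g := fun v => v + h) ?_).symm
      intro a _ b _ hab
      simpa using hab
    rw [this]
    refine Finset.sum_le_sum_of_ne_zero fun w hw hne => ?_
    have : N w ≠ 0 := by
      intro h0; apply hne; simp [h0]
    have : (Q.filter (fun p => g p = w)).Nonempty := by
      rw [← Finset.card_pos]; exact Nat.pos_of_ne_zero this
    obtain ⟨p, hp⟩ := this
    rw [mem_filter] at hp
    rw [← hp.2]
    exact Finset.mem_image_of_mem g hp.1
  have hyoung : 2 * ∑ v ∈ V, N v * N (v+h) ≤ ∑ v ∈ V, N v * N v + ∑ v ∈ V, N (v+h) * N (v+h) := by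
    rw [← Finset.sum_add_distrib, mul_sum]
    refine sum_le_sum fun v _ => ?_
    have := two_mul_le_add_sq (N v) (N (v+h))
    nlinarith
  omega

lemma N4_bound (c : ℝ) (hc : 1 < c) (κ : ℝ) (hκ : 0 < κ) : ∃ D > 0, ∀ X : ℝ, 1 ≤ X →
    ∀ S : Finset (ℤ × ℤ × ℤ × ℤ), (∀ n1 n2 n3 n4 : ℤ, (n1, n2, n3, n4) ∈ S →
    (X/8 ≤ n1 ∧ (n1:ℝ) ≤ X) ∧ (X/8 ≤ n2 ∧ (n2:ℝ) ≤ X) ∧ (X/8 ≤ n3 ∧ (n3:ℝ) ≤ X) ∧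
    (X/8 ≤ n4 ∧ (n4:ℝ) ≤ X) ∧ ⌊(n1:ℝ)^c⌋ + ⌊(n2:ℝ)^c⌋ = ⌊(n3:ℝ)^c⌋ + ⌊(n4:ℝ)^c⌋) →
    (S.card : ℝ) ≤ D * (X^(2+κ) + X^(4-c+κ)) := by
  classical
  obtain ⟨D, hD, hP⟩ := PP_all κ hκ c hc 8 1 (by norm_num) one_pos
  refine ⟨9*D, by positivity, fun X hX S hS => ?_⟩
  have hX0 : 0 < X := by linarith
  set W := X^(c-2) with hW
  have hW0 : 0 < W := by positivity
  set I := Finset.Icc ⌈X/8⌉ ⌊X⌋ with hI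
  have memI : ∀ n : ℤ, n ∈ I ↔ (X/8 ≤ n ∧ (n:ℝ) ≤ X) := by
    intro n; rw [hI, Finset.mem_Icc, Int.ceil_le, Int.le_floor]
  set g : ℤ × ℤ → ℤ := fun p => ⌊((p.1:ℝ)^c + (p.2:ℝ)^c)/W⌋ with hg
  set T := ((I ×ˢ I) ×ˢ (I ×ˢ I)).filter (fun x => g x.1 = g x.2) with hT
  have hTc : (T.card : ℝ) ≤ D * X^(2+κ) := by
    have := hP X hX (T.map ⟨fun x => (x.1.1, x.1.2, x.2.1, x.2.2), fun x y h => by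
      simp only [Prod.mk.injEq] at h
      obtain ⟨a, b, d, e⟩ := h
      exact Prod.ext (Prod.ext a b) (Prod.ext d e)⟩) ?_
    · rwa [Finset.card_map] at this
    · intro n1 n2 n3 n4 hn
      simp only [Finset.mem_map, Function.Embedding.coeFn_mk, Prod.mk.injEq] at hn
      obtain ⟨⟨⟨a1, a2⟩, ⟨a3, a4⟩⟩, hm, rfl, rfl, rfl, rfl⟩ := hn
      rw [hT, mem_filter] at hm
      simp only [Finset.mem_product, memI] at hm
      obtain ⟨⟨⟨m1, m2⟩, m3, m4⟩, hfl⟩ := hm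
      refine ⟨m1, m2, m3, m4, ?_⟩
      have := Int.abs_sub_lt_one_of_floor_eq_floor hfl
      simp only at this
      rw [← sub_div, abs_div, abs_of_pos hW0, div_lt_one hW0] at this
      rw [one_mul]
      have e : (a1:ℝ)^c + (a2:ℝ)^c - (a3:ℝ)^c - (a4:ℝ)^c = (a1:ℝ)^c + (a2:ℝ)^c - ((a3:ℝ)^c + (a4:ℝ)^c) := by ring
      rw [e]; exact this.le
  set L : ℕ := ⌊2/W⌋₊ + 1 with hL
  set U := (Finset.Icc (-(L:ℤ)) L).biUnion (fun h =>
    ((I ×ˢ I) ×ˢ (I ×ˢ I)).filter (fun x => g x.2 = g x.1 + h)) with hU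
  have hUc : U.card ≤ (2*L+1) * T.card := by
    refine (Finset.card_biUnion_le).trans ?_
    refine (Finset.sum_le_card_nsmul _ _ T.card (fun h _ => shift_count _ g h)).trans ?_
    rw [smul_eq_mul, Int.card_Icc]
    apply le_of_eq
    congr 1
    omega
  have hSU : S.card ≤ U.card := by
    refine Finset.card_le_card_of_injOn (fun x => ((x.1, x.2.1), (x.2.2.1, x.2.2.2))) ?_ ?_
    · rintro ⟨n1, n2, n3, n4⟩ hn
      obtain ⟨h1, h2, h3, h4, h5⟩ := hS n1 n2 n3 n4 (Finset.mem_coe.mp hn)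
      rw [Finset.mem_coe, hU, Finset.mem_biUnion]
      refine ⟨g (n3, n4) - g (n1, n2), ?_, ?_⟩
      · have e1 := Int.floor_le ((n1:ℝ)^c)
        have e2 := Int.floor_le ((n2:ℝ)^c)
        have e3 := Int.floor_le ((n3:ℝ)^c)
        have e4 := Int.floor_le ((n4:ℝ)^c)
        have f1 := Int.lt_floor_add_one ((n1:ℝ)^c)
        have f2 := Int.lt_floor_add_one ((n2:ℝ)^c)
        have f3 := Int.lt_floor_add_one ((n3:ℝ)^c)
        have f4 := Int.lt_floor_add_one ((n4:ℝ)^c)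
        have h5' : (⌊(n1:ℝ)^c⌋:ℝ) + ⌊(n2:ℝ)^c⌋ = ⌊(n3:ℝ)^c⌋ + ⌊(n4:ℝ)^c⌋ := by exact_mod_cast h5
        set A := (n1:ℝ)^c + (n2:ℝ)^c
        set E := (n3:ℝ)^c + (n4:ℝ)^c
        have hA : A/W < E/W + 2/W := by
          rw [← add_div]; gcongr; linarith
        have hE : E/W < A/W + 2/W := by
          rw [← add_div]; gcongr; linarith
        have hLW : 2/W < L := by rw [hL]; push_cast; exact Nat.lt_floor_add_one _
        have ga : (g (n1,n2):ℝ) ≤ A/W := Int.floor_le _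
        have gb : A/W < g (n1,n2) + 1 := Int.lt_floor_add_one _
        have gc : (g (n3,n4):ℝ) ≤ E/W := Int.floor_le _
        have gd : E/W < g (n3,n4) + 1 := Int.lt_floor_add_one _
        have k1 : (g (n3,n4):ℝ) < g (n1,n2) + L + 1 := by linarith
        have k2 : (g (n1,n2):ℝ) < g (n3,n4) + L + 1 := by linarith
        have k1' : g (n3,n4) < g (n1,n2) + L + 1 := by exact_mod_cast k1
        have k2' : g (n1,n2) < g (n3,n4) + L + 1 := by exact_mod_cast k2
        rw [Finset.mem_Icc]
        constructor <;> omega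
      · rw [mem_filter]
        refine ⟨?_, by simp⟩
        simp only [Finset.mem_product, memI]
        exact ⟨⟨h1, h2⟩, h3, h4⟩
    · rintro ⟨n1, n2, n3, n4⟩ _ ⟨m1, m2, m3, m4⟩ _ hx
      simp only [Prod.mk.injEq] at hx ⊢
      tauto
  have hfin : (S.card:ℝ) ≤ (2*L+1) * T.card := by exact_mod_cast hSU.trans hUc
  have hL2 : (L:ℝ) ≤ 2/W + 1 := by
    rw [hL]; push_cast
    have := Nat.floor_le (show 0 ≤ 2/W by positivity)
    linarith
  have hLL : (2*L+1:ℝ) ≤ 9 * (1 + X^(2-c)) := by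
    have : 2/W = 2 * X^(2-c) := by
      rw [hW, div_eq_mul_inv, ← Real.rpow_neg hX0.le]; congr 2; ring
    have : 0 < X^(2-c) := by positivity
    linarith
  calc (S.card:ℝ) ≤ (2*L+1) * T.card := hfin
    _ ≤ (9 * (1 + X^(2-c))) * (D * X^(2+κ)) := by gcongr
    _ = 9*D*(X^(2+κ) + X^(2-c) * X^(2+κ)) := by ring
    _ = _ := by rw [← Real.rpow_add hX0]; rw [show 2 - c + (2+κ) = 4 - c + κ by ring]

/-- Euler summation remainder for the zeta function. -/
noncomputable def rz (n : ℕ) (s : ℂ) : ℂ :=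
  ((n:ℂ)+1)^(-s) - (((n:ℂ)+1)^(1-s) - (n:ℂ)^(1-s))/(1-s)

lemma rz_bound (n : ℕ) (hn : 1 ≤ n) (s : ℂ) (hs : 0 < s.re) (hs1 : s ≠ 1) :
    ‖rz n s‖ ≤ ‖s‖ * (n:ℝ)^(-s.re-1) := by
  have hn0 : (0:ℝ) < n := by exact_mod_cast hn
  have hs0 : -s ≠ 0 := by intro h; rw [neg_eq_zero] at h; rw [h] at hs; simp at hs
  have h1s : 1 - s ≠ 0 := sub_ne_zero.mpr (Ne.symm hs1)
  set I := Set.Icc (n:ℝ) (n+1) with hI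
  have hconv : Convex ℝ I := convex_Icc _ _
  have hl : (n:ℝ) ∈ I := ⟨le_refl _, by linarith⟩
  have hr : (n:ℝ)+1 ∈ I := ⟨by linarith, le_refl _⟩
  set C := ‖s‖ * (n:ℝ)^(-s.re-1) with hC
  have hC0 : 0 ≤ C := by positivity
  have step1 : ∀ u ∈ I, ‖(((n:ℝ)+1:ℝ):ℂ)^(-s) - (u:ℂ)^(-s)‖ ≤ C := by
    intro u hu
    have := Convex.norm_image_sub_le_of_norm_hasDerivWithin_le
      (f := fun y : ℝ => (y:ℂ)^(-s)) (f' := fun x : ℝ => (-s) * (x:ℂ)^(-s-1)) (s := I) (C := C)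
      (fun x hx => (hasDerivAt_ofReal_cpow_const (by have := hx.1; linarith) hs0).hasDerivWithinAt)
      (fun x hx => by
        have hx0 : 0 < x := lt_of_lt_of_le hn0 hx.1
        rw [norm_mul, norm_neg, Complex.norm_cpow_eq_rpow_re_of_pos hx0, hC]
        simp only [Complex.sub_re, Complex.neg_re, Complex.one_re]
        refine mul_le_mul_of_nonneg_left ?_ (norm_nonneg _)
        exact Real.rpow_le_rpow_of_nonpos hn0 hx.1 (by linarith)) hconv hu hr
    refine this.trans ?_
    have h2 : ‖(n:ℝ)+1-u‖ ≤ 1 := by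
      rw [Real.norm_eq_abs, abs_le]; exact ⟨by linarith [hu.2], by linarith [hu.1]⟩
    nlinarith
  have := Convex.norm_image_sub_le_of_norm_hasDerivWithin_le
      (f := fun y : ℝ => (y:ℂ) * (((n:ℝ)+1:ℝ):ℂ)^(-s) - (y:ℂ)^(1-s)/(1-s))
      (f' := fun x : ℝ => (((n:ℝ)+1:ℝ):ℂ)^(-s) - (x:ℂ)^(-s)) (s := I) (C := C)
      (fun x hx => by
        have hx0 : 0 < x := lt_of_lt_of_le hn0 hx.1
        have d1 := (hasDerivAt_ofReal_cpow_const hx0.ne' h1s).div_const (1-s)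
        have d2 := (Complex.ofRealCLM.hasDerivAt (x := x)).mul_const ((((n:ℝ)+1:ℝ):ℂ)^(-s))
        have d3 := d2.sub d1
        refine HasDerivAt.hasDerivWithinAt ?_
        rw [mul_div_cancel_left₀ _ h1s] at d3
        have e1 : Complex.ofRealCLM 1 * (((n:ℝ)+1:ℝ):ℂ)^(-s) - (x:ℂ)^(1-s-1)
          = (((n:ℝ)+1:ℝ):ℂ)^(-s) - (x:ℂ)^(-s) := by
          rw [show 1 - s - 1 = -s by ring]; simp
        rw [e1] at d3
        exact d3) step1 hconv hl hr
  have e : ‖(n:ℝ)+1-n‖ = 1 := by simp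
  rw [e, mul_one] at this
  refine le_trans (le_of_eq ?_) this
  rw [rz]
  congr 1
  push_cast
  ring

lemma rz_diff (n : ℕ) (hn : 1 ≤ n) (s : ℂ) (hs1 : s ≠ 1) : DifferentiableAt ℂ (rz n) s := by
  have h1s : 1 - s ≠ 0 := sub_ne_zero.mpr (Ne.symm hs1)
  have hn0 : (n:ℂ) ≠ 0 := by exact_mod_cast (by omega : n ≠ 0)
  have hn1 : (n:ℂ)+1 ≠ 0 := by exact_mod_cast (by omega : n+1 ≠ 0)
  unfold rz
  refine DifferentiableAt.sub ?_ (DifferentiableAt.div (DifferentiableAt.sub ?_ ?_) (by fun_prop) h1s)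
  · exact DifferentiableAt.const_cpow (by fun_prop) (Or.inl hn1)
  · exact DifferentiableAt.const_cpow (by fun_prop) (Or.inl hn1)
  · exact DifferentiableAt.const_cpow (by fun_prop) (Or.inl hn0)

lemma rpow_tele (a : ℝ) (ha : 1/2 ≤ a) (ha1 : a ≤ 1) (n : ℕ) (hn : 1 ≤ n) :
    (n:ℝ)^(-a-1) ≤ 8 * ((n:ℝ)^(-a) - ((n+1:ℕ):ℝ)^(-a)) := by
  have hn0 : (1:ℝ) ≤ n := by exact_mod_cast hn
  have key : a * ((n:ℝ)+1)^(-a-1) ≤ (n:ℝ)^(-a) - ((n:ℝ)+1)^(-a) := by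
    obtain ⟨ξ, hξ, hd⟩ := exists_hasDerivAt_eq_slope (fun x : ℝ => x^(-a)) (fun x => (-a)*x^(-a-1))
      (show (n:ℝ) < n+1 by linarith)
      (ContinuousOn.rpow_const continuousOn_id (fun x hx => Or.inl (by
        have := hx.1; linarith)))
      (fun x hx => Real.hasDerivAt_rpow_const (Or.inl (by have := hx.1; linarith)))
    have h1 : ((n:ℝ)+1)^(-a-1) ≤ ξ^(-a-1) :=
      Real.rpow_le_rpow_of_nonpos (by have := hξ.1; linarith) hξ.2.le (by linarith)
    simp only [add_sub_cancel_left, div_one] at hd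
    nlinarith
  have h2 : (n:ℝ)^(-a-1) / 4 ≤ ((n:ℝ)+1)^(-a-1) := by
    calc (n:ℝ)^(-a-1) / 4 = (n:ℝ)^(-a-1) * 2^(-2:ℝ) := by
          rw [show (-2:ℝ) = ((-2:ℤ):ℝ) by norm_num, Real.rpow_intCast]; norm_num; ring
      _ ≤ (n:ℝ)^(-a-1) * 2^(-a-1) := by gcongr <;> linarith
      _ = (n*2)^(-a-1) := by rw [Real.mul_rpow] <;> linarith
      _ ≤ ((n:ℝ)+1)^(-a-1) := Real.rpow_le_rpow_of_nonpos (by linarith) (by linarith) (by linarith)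
  push_cast
  have : 0 ≤ ((n:ℝ)+1)^(-a-1) := by positivity
  nlinarith

lemma rz_tail (a : ℝ) (ha : 1/2 ≤ a) (ha1 : a ≤ 1) (N : ℕ) (hN : 1 ≤ N) :
    Summable (fun k : ℕ => ((N+k:ℕ):ℝ)^(-a-1)) ∧ ∑' k : ℕ, ((N+k:ℕ):ℝ)^(-a-1) ≤ 8*(N:ℝ)^(-a) := by
  have hb : ∀ K : ℕ, ∑ k ∈ range K, ((N+k:ℕ):ℝ)^(-a-1) ≤ 8*(N:ℝ)^(-a) := by
    intro K
    calc ∑ k ∈ range K, ((N+k:ℕ):ℝ)^(-a-1)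
        ≤ ∑ k ∈ range K, (8 * ((N+k:ℕ):ℝ)^(-a) - 8 * ((N+(k+1):ℕ):ℝ)^(-a)) := by
          refine sum_le_sum fun k _ => ?_
          have := rpow_tele a ha ha1 (N+k) (by omega)
          rw [mul_sub] at this
          exact this
      _ = 8 * ((N+0:ℕ):ℝ)^(-a) - 8 * ((N+K:ℕ):ℝ)^(-a) :=
          Finset.sum_range_sub' (fun k => 8 * ((N+k:ℕ):ℝ)^(-a)) K
      _ ≤ _ := by
          have : 0 ≤ ((N+K:ℕ):ℝ)^(-a) := by positivity
          simp only [add_zero]; linarith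
  have hs : Summable (fun k : ℕ => ((N+k:ℕ):ℝ)^(-a-1)) :=
    summable_of_sum_range_le (fun k => by positivity) hb
  exact ⟨hs, hs.tsum_le_of_sum_range_le hb⟩

/-- Continuation of zeta across the line of real part one. -/
noncomputable def FZ (N : ℕ) (s : ℂ) : ℂ :=
  ∑ n ∈ range N, ((n:ℂ)+1)^(-s) + (N:ℂ)^(1-s)/(s-1) + ∑' k : ℕ, rz (N+k) s

lemma rz_summable (N : ℕ) (hN : 1 ≤ N) (s : ℂ) (hs : 1/2 ≤ s.re) (hs1 : s ≠ 1) :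
    Summable (fun k => rz (N+k) s) := by
  refine Summable.of_norm_bounded (g := fun k : ℕ => ‖s‖ * ((N+k:ℕ):ℝ)^(-(1/2:ℝ)-1))
    ((rz_tail (1/2) le_rfl (by norm_num) N hN).1.mul_left _) fun k => ?_
  refine (rz_bound (N+k) (by omega) s (by linarith) hs1).trans ?_
  gcongr
  exact_mod_cast (by omega : 1 ≤ N + k)

lemma FZ_eq (N : ℕ) (hN : 1 ≤ N) (s : ℂ) (hs : 1 < s.re) : FZ N s = riemannZeta s := by
  have hs1 : s ≠ 1 := by intro h; rw [h] at hs; simp at hs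
  have hsum : Summable (fun n : ℕ => ((n:ℂ)+1)^(-s)) := by
    have h1 := (Complex.summable_one_div_nat_cpow (p := s)).mpr hs
    have h2 := (summable_nat_add_iff 1).mpr h1
    refine h2.congr fun n => ?_
    rw [Complex.cpow_neg, one_div]; push_cast; rfl
  have hz : riemannZeta s = ∑' n : ℕ, ((n:ℂ)+1)^(-s) := by
    rw [zeta_eq_tsum_one_div_nat_add_one_cpow hs]
    refine tsum_congr fun n => ?_
    rw [Complex.cpow_neg, one_div]
  have hrs := (rz_summable N hN s (by linarith) hs1).hasSum.tendsto_sum_nat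
  have hpart : ∀ K : ℕ, ∑ k ∈ range K, rz (N+k) s =
      ∑ k ∈ range K, (((N+k:ℕ):ℂ)+1)^(-s) -
        (((N+K:ℕ):ℂ)^(1-s) - (N:ℂ)^(1-s))/(1-s) := by
    intro K
    induction K with
    | zero => simp
    | succ K ih =>
      rw [Finset.sum_range_succ, ih, Finset.sum_range_succ, rz]
      push_cast
      rw [show (N:ℂ) + (K+1) = N + K + 1 by ring]
      ring
  have hlim : Filter.Tendsto (fun K : ℕ => ((N+K:ℕ):ℂ)^(1-s)) Filter.atTop (nhds 0) := by
    rw [tendsto_zero_iff_norm_tendsto_zero]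
    have h1 : Filter.Tendsto (fun K : ℕ => ((N+K:ℕ):ℝ)) Filter.atTop Filter.atTop :=
      tendsto_natCast_atTop_atTop.comp (Filter.tendsto_atTop_mono (fun k => (by simp only [id]; omega : id k ≤ N + k)) Filter.tendsto_id)
    have h2 := (tendsto_rpow_neg_atTop (y := s.re - 1) (by linarith)).comp h1
    refine h2.congr fun K => ?_
    have h0 : 0 < N + K := by omega
    rw [Complex.norm_natCast_cpow_of_pos h0]
    simp
  have hsplit := hsum.sum_add_tsum_nat_add N
  have htail := ((summable_nat_add_iff N).mpr hsum).hasSum.tendsto_sum_nat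
  have hlim2 : Filter.Tendsto (fun K => ∑ k ∈ range K, rz (N+k) s) Filter.atTop
      (nhds (∑' k : ℕ, (((k+N:ℕ):ℂ)+1)^(-s) - (0 - (N:ℂ)^(1-s))/(1-s))) := by
    have := htail.sub ((hlim.sub_const ((N:ℂ)^(1-s))).div_const (1-s))
    refine this.congr fun K => ?_
    rw [hpart]
    congr 1
    refine sum_congr rfl fun k _ => ?_
    rw [add_comm k N]
  have heq := tendsto_nhds_unique hrs hlim2
  rw [FZ, heq, hz, ← hsplit]
  have h1s : 1 - s ≠ 0 := sub_ne_zero.mpr (Ne.symm hs1)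
  have h1s' : s - 1 ≠ 0 := sub_ne_zero.mpr hs1
  have : (0 - (N:ℂ)^(1-s))/(1-s) = (N:ℂ)^(1-s)/(s-1) := by
    rw [div_eq_div_iff h1s h1s']; ring
  rw [this]; ring

lemma FZ_diff (N : ℕ) (hN : 1 ≤ N) (U : Set ℂ) (hU : IsOpen U) (A : ℝ)
    (h : ∀ s ∈ U, 1/2 ≤ s.re ∧ s ≠ 1 ∧ ‖s‖ ≤ A) : DifferentiableOn ℂ (FZ N) U := by
  have hn0 : (N:ℂ) ≠ 0 := by exact_mod_cast (by omega : N ≠ 0)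
  unfold FZ
  refine DifferentiableOn.add (DifferentiableOn.add ?_ ?_) ?_
  · refine DifferentiableOn.fun_sum fun n _ s hs => ?_
    have hn1 : (n:ℂ)+1 ≠ 0 := by exact_mod_cast (by omega : n+1 ≠ 0)
    exact (DifferentiableAt.const_cpow (by fun_prop) (Or.inl hn1)).differentiableWithinAt
  · intro s hs
    have d1 : DifferentiableAt ℂ (fun s : ℂ => (N:ℂ)^(1-s)) s :=
      DifferentiableAt.const_cpow (by fun_prop) (Or.inl hn0)
    have d2 : DifferentiableAt ℂ (fun s : ℂ => s - 1) s := by fun_prop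
    exact (d1.fun_div d2 (sub_ne_zero.mpr (h s hs).2.1)).differentiableWithinAt
  · refine Complex.differentiableOn_tsum_of_summable_norm
      (u := fun k : ℕ => A * ((N+k:ℕ):ℝ)^(-(1/2:ℝ)-1))
      ((rz_tail (1/2) le_rfl (by norm_num) N hN).1.mul_left _) ?_ hU ?_
    · exact fun k s hs => (rz_diff (N+k) (by omega) s (h s hs).2.1).differentiableWithinAt
    · intro k s hs
      obtain ⟨h1, h2, h3⟩ := h s hs
      refine (rz_bound (N+k) (by omega) s (by linarith) h2).trans ?_
      have : 0 ≤ A := (norm_nonneg _).trans h3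
      gcongr
      exact_mod_cast (by omega : 1 ≤ N + k)

lemma FZ_bound (N : ℕ) (hN : 1 ≤ N) (R : ℝ) (hR : 0 ≤ R) (hR2 : R ≤ 1/2) (s : ℂ) (hs : 1 - R ≤ s.re)
    (him : 1 ≤ |s.im|) : ‖FZ N s‖ ≤ (N:ℝ)^R * (2 + log N + 8 * ‖s‖/N) := by
  have hs1 : s ≠ 1 := by intro h; rw [h] at him; simp at him; linarith
  have hN0 : (1:ℝ) ≤ N := by exact_mod_cast hN
  have t1 : ‖∑ n ∈ range N, ((n:ℂ)+1)^(-s)‖ ≤ (N:ℝ)^R * (1 + log N) := by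
    calc ‖∑ n ∈ range N, ((n:ℂ)+1)^(-s)‖ ≤ ∑ n ∈ range N, (N:ℝ)^R * ((n:ℝ)+1)⁻¹ := by
          refine norm_sum_le_of_le _ fun n hn => ?_
          rw [Finset.mem_range] at hn
          have hp : (0:ℝ) < (n:ℝ)+1 := by positivity
          have : ((n:ℂ)+1) = (((n:ℝ)+1:ℝ):ℂ) := by push_cast; rfl
          rw [this, Complex.norm_cpow_eq_rpow_re_of_pos hp, Complex.neg_re]
          calc ((n:ℝ)+1)^(-s.re) ≤ ((n:ℝ)+1)^(R + (-1:ℝ)) := by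
                gcongr
                · linarith [(Nat.cast_nonneg n : (0:ℝ) ≤ n)]
                · linarith
            _ = ((n:ℝ)+1)^R * ((n:ℝ)+1)⁻¹ := by
                rw [Real.rpow_add hp, Real.rpow_neg_one]
            _ ≤ _ := by
                gcongr
                exact_mod_cast hn
      _ = (N:ℝ)^R * (harmonic N : ℝ) := by
          rw [← mul_sum, harmonic]; push_cast; rfl
      _ ≤ _ := by gcongr; exact harmonic_le_one_add_log N
  have t2 : ‖(N:ℂ)^(1-s)/(s-1)‖ ≤ (N:ℝ)^R * 1 := by
    rw [norm_div, Complex.norm_natCast_cpow_of_pos (by omega)]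
    have h1 : 1 ≤ ‖s-1‖ := by
      refine him.trans ?_
      have := Complex.abs_im_le_norm (s-1)
      simpa using this
    calc (N:ℝ)^(1-s).re/‖s-1‖ ≤ (N:ℝ)^(1-s).re := div_le_self (by positivity) h1
      _ ≤ (N:ℝ)^R := by
          gcongr
          · simp only [Complex.sub_re, Complex.one_re]; linarith
      _ = _ := by ring
  have t3 : ‖∑' k : ℕ, rz (N+k) s‖ ≤ (N:ℝ)^R * (8 * ‖s‖/N) := by
    obtain ⟨hs2, hle⟩ := rz_tail (1-R) (by linarith) (by linarith) N hN
    calc ‖∑' k : ℕ, rz (N+k) s‖ ≤ ∑' k : ℕ, ‖s‖ * ((N+k:ℕ):ℝ)^(-(1-R)-1) := by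
          refine tsum_of_norm_bounded (hs2.mul_left _).hasSum fun k => ?_
          refine (rz_bound (N+k) (by omega) s (by linarith) hs1).trans ?_
          gcongr
          exact_mod_cast (by omega : 1 ≤ N + k)
      _ ≤ ‖s‖ * (8*(N:ℝ)^(-(1-R))) := by rw [tsum_mul_left]; gcongr
      _ = _ := by
          rw [show -(1-R) = R + (-1) by ring, Real.rpow_add (by linarith), Real.rpow_neg_one]
          field_simp
  calc ‖FZ N s‖ ≤ _ := norm_add₃_le
    _ ≤ _ := add_le_add_three t1 t2 t3
    _ = _ := by ring

set_option maxHeartbeats 400000 in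
lemma zeta_deriv_bound (j : ℕ) : ∃ C > 0, ∀ s : ℂ, 1 < s.re → s.re ≤ 2 → 2 ≤ |s.im| →
    ‖iteratedDeriv j riemannZeta s‖ ≤ C * (log |s.im|)^(j+1) := by
  refine ⟨j.factorial * 110 * 4^j, by positivity, fun s h1 h2 ht => ?_⟩
  set t := |s.im| with htd
  set L := log t with hL
  have hL0 : (0.69:ℝ) ≤ L := by
    have : log 2 ≤ L := Real.log_le_log (by norm_num) ht
    linarith [Real.log_two_gt_d9]
  set R := 1/(4*L) with hR
  have hR0 : 0 < R := by positivity
  have hR2 : R ≤ 2/5 := by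
    rw [hR, div_le_iff₀ (by positivity)]; linarith
  set N := ⌈t⌉₊ with hN
  have htN : t ≤ N := Nat.le_ceil t
  have hN1 : 1 ≤ N := by
    have : (1:ℝ) ≤ N := by linarith
    exact_mod_cast this
  have hNt : (N:ℝ) ≤ t^2 := by
    have : (N:ℝ) < t + 1 := Nat.ceil_lt_add_one (by linarith)
    nlinarith
  have hlogN : log N ≤ 2 * L := by
    calc log N ≤ log (t^2) := Real.log_le_log (by linarith) hNt
      _ = 2 * L := by rw [Real.log_pow]; norm_num; rfl
  have hNR : (N:ℝ)^R ≤ 2 := by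
    rw [Real.rpow_def_of_pos (by linarith)]
    calc Real.exp (log N * R) ≤ Real.exp (1/2) := by
          apply Real.exp_le_exp.mpr
          calc log N * R ≤ 2*L*R := by gcongr
            _ = 1/2 := by rw [hR]; field_simp; norm_num
      _ ≤ 2 := by
          have h := Real.exp_one_lt_d9
          have : Real.exp (1/2) * Real.exp (1/2) = Real.exp 1 := by rw [← Real.exp_add]; norm_num
          nlinarith [Real.exp_pos (1/2)]
  have hball : ∀ r : ℝ, r ≤ 1/2 → ∀ z ∈ Metric.closedBall s r, 1 - r ≤ z.re ∧ 1 ≤ |z.im| ∧ ‖z‖ ≤ 4*t := by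
    intro r hr z hz
    rw [Metric.mem_closedBall, Complex.dist_eq] at hz
    have a1 := (Complex.abs_re_le_norm (z-s)).trans hz
    have a2 := (Complex.abs_im_le_norm (z-s)).trans hz
    rw [Complex.sub_re, abs_le] at a1
    rw [Complex.sub_im] at a2
    have a3 : t ≤ |z.im| + r := by
      have := abs_sub_abs_le_abs_sub s.im z.im
      rw [abs_sub_comm] at this
      linarith
    have a4 : ‖s‖ ≤ 2 + t := by
      refine (Complex.norm_le_abs_re_add_abs_im s).trans ?_
      rw [abs_of_pos (by linarith)]; linarith
    have a5 : ‖z‖ ≤ ‖z - s‖ + ‖s‖ := by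
      have := norm_add_le (z-s) s; simpa using this
    exact ⟨by linarith, by linarith, by linarith⟩
  have hdiff : DifferentiableOn ℂ (FZ N) (Metric.ball s (1/2)) := by
    refine FZ_diff N hN1 _ Metric.isOpen_ball (4*t) fun z hz => ?_
    obtain ⟨b1, b2, b3⟩ := hball (1/2) le_rfl z (Metric.ball_subset_closedBall hz)
    refine ⟨by linarith, ?_, b3⟩
    intro h; rw [h] at b2; simp at b2; linarith
  have hcauchy := Complex.norm_iteratedDeriv_le_of_forall_mem_sphere_norm_le (c := s) (R := R)
    (C := 110 * L) (f := FZ N) j hR0 ?_ ?_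
  · have heq : FZ N =ᶠ[nhds s] riemannZeta := by
      have : {z : ℂ | 1 < z.re} ∈ nhds s :=
        (isOpen_lt continuous_const Complex.continuous_re).mem_nhds h1
      filter_upwards [this] with z hz using FZ_eq N hN1 z hz
    rw [← heq.iteratedDeriv_eq]
    refine hcauchy.trans (le_of_eq ?_)
    rw [hR, one_div, inv_pow, div_inv_eq_mul]
    ring
  · apply DifferentiableOn.diffContOnCl_ball (U := Metric.ball s (1/2)) hdiff
    exact Metric.closedBall_subset_ball (by linarith)
  · intro z hz
    obtain ⟨b1, b2, b3⟩ := hball R (by linarith) z (Metric.sphere_subset_closedBall hz)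
    refine (FZ_bound N hN1 R hR0.le (by linarith) z b1 b2).trans ?_
    have : 8 * ‖z‖ / N ≤ 32 := by
      rw [div_le_iff₀ (by linarith)]
      linarith
    calc (N:ℝ)^R * (2 + log N + 8 * ‖z‖/N) ≤ 2 * (2 + 2*L + 32) := by
          have : 0 ≤ log N := Real.log_nonneg (by linarith)
          gcongr
      _ ≤ _ := by linarith

lemma zeta_real_bound : ∃ C > 0, ∀ σ : ℝ, 1 < σ → σ ≤ 2 → ‖riemannZeta σ‖ ≤ C/(σ-1) := by
  have hc : ContinuousOn (fun x : ℝ => riemannZeta₁ x) (Set.Icc 1 2) :=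
    (differentiable_riemannZeta₁.continuous.comp Complex.continuous_ofReal).continuousOn
  obtain ⟨C, hC⟩ := isCompact_Icc.exists_bound_of_continuousOn hc
  refine ⟨|C|+1, by positivity, fun σ h1 h2 => ?_⟩
  have hne : (σ:ℂ) ≠ 1 := by
    intro h; have : σ = 1 := by exact_mod_cast h
    linarith
  rw [riemannZeta_eq_inv_sub_mul hne, norm_mul, norm_inv]
  have : ‖(σ:ℂ)-1‖ = σ - 1 := by
    rw [show (σ:ℂ)-1 = ((σ-1:ℝ):ℂ) by push_cast; rfl, Complex.norm_real, Real.norm_eq_abs,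
      abs_of_pos (by linarith)]
  rw [this, div_eq_inv_mul]
  have h3 : 0 < σ - 1 := by linarith
  gcongr
  exact (hC σ ⟨h1.le, h2⟩).trans (by linarith [le_abs_self C])

lemma zeta_341 (x y : ℝ) (hx : 0 < x) :
    1 ≤ ‖riemannZeta (1+x)‖^3 * ‖riemannZeta (1+x+Complex.I*y)‖^4 * ‖riemannZeta (1+x+2*Complex.I*y)‖ := by
  have := DirichletCharacter.norm_LFunction_product_ge_one (N := 1) 1 hx y
  rw [DirichletCharacter.LFunctionTrivChar] at this
  simp only [DirichletCharacter.LFunction_modOne_eq] at this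
  rw [norm_mul, norm_mul, norm_pow, norm_pow] at this
  exact this

set_option maxHeartbeats 400000 in
lemma zeta_lower : ∃ c > 0, ∀ s : ℂ, 1 < s.re → s.re ≤ 2 → 2 ≤ |s.im| →
    c / (log |s.im|)^7 ≤ ‖riemannZeta s‖ := by
  obtain ⟨C1, hC1, h1⟩ := zeta_real_bound
  obtain ⟨C2, hC2, h2⟩ := zeta_deriv_bound 0
  obtain ⟨C3, hC3, h3⟩ := zeta_deriv_bound 1
  simp only [iteratedDeriv_zero, iteratedDeriv_one, zero_add, pow_one] at h2 h3
  -- product lower bound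
  set A := C1^3 * (2*C2) with hA
  have hA0 : 0 < A := by positivity
  set e := A^(-(1/4):ℝ) with he
  have he0 : 0 < e := by positivity
  have he4 : e^4 = A⁻¹ := by
    rw [he, ← Real.rpow_natCast, ← Real.rpow_mul hA0.le]; norm_num; exact Real.rpow_neg_one A
  set η := min (1/4) (e/(4*C3)) with hη
  have hη0 : 0 < η := by positivity
  have hη4 : η ≤ 1/4 := min_le_left _ _
  have hηC : 2 * C3 * η ≤ e / 2 := by
    have : η ≤ e/(4*C3) := min_le_right _ _
    rw [le_div_iff₀ (by positivity)] at this
    linarith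
  have hbig : ∀ σ t : ℝ, 1 < σ → σ ≤ 2 → 2 ≤ |t| → η^4 / (log |t|)^9 ≤ σ - 1 →
      e * η^3 / (log |t|)^7 ≤ ‖riemannZeta (σ + Complex.I*t)‖ := by
    intro σ t hσ hσ2 ht hle
    set L := log |t| with hL
    have hL0 : (0.69:ℝ) ≤ L := by
      have : log 2 ≤ L := Real.log_le_log (by norm_num) ht
      linarith [Real.log_two_gt_d9]
    have hLp : 0 < L := by linarith
    have h := zeta_341 (σ-1) t (by linarith)
    have e1 : (1:ℂ) + ((σ-1:ℝ):ℂ) = σ := by push_cast; ring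
    rw [e1] at h
    have b1 := h1 σ hσ hσ2
    have b2 := h2 (σ + 2*Complex.I*t) (by simpa using hσ) (by simpa using hσ2) (by
      simp [abs_mul]; linarith)
    have b3 : ‖riemannZeta (σ + 2*Complex.I*t)‖ ≤ 2*C2*L := by
      refine b2.trans ?_
      have : ((σ:ℂ) + 2*Complex.I*t).im = 2*t := by simp
      rw [this, abs_mul, abs_of_pos (by norm_num : (0:ℝ) < 2),
        Real.log_mul (by norm_num) (by linarith)]
      have : log 2 ≤ L := Real.log_le_log (by norm_num) ht
      nlinarith
    set z := ‖riemannZeta (σ + Complex.I*t)‖ with hz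
    have hσ1 : 0 < σ - 1 := by linarith
    have h4 : 1 ≤ (C1/(σ-1))^3 * z^4 * (2*C2*L) := by
      refine h.trans ?_
      gcongr
    have h5 : (σ-1)^3 / (A * L) ≤ z^4 := by
      rw [div_le_iff₀ (by positivity)]
      have : (C1/(σ-1))^3 * z^4 * (2*C2*L) * (σ-1)^3 = z^4 * (A*L) := by
        rw [hA]; field_simp
      nlinarith [pow_pos hσ1 3]
    have h6 : (e * η^3 / L^7)^4 ≤ z^4 := by
      refine le_trans ?_ h5
      calc (e * η^3 / L^7)^4 = (η^4/L^9)^3/(A*L) := by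
            rw [div_pow, mul_pow, he4]; field_simp
        _ ≤ _ := by gcongr
    exact le_of_pow_le_pow_left₀ (by norm_num) (norm_nonneg _) h6
  refine ⟨e * η^3/2, by positivity, fun s hs1 hs2 ht => ?_⟩
  set t := s.im with htd
  set L := log |t| with hL
  have hL0 : (0.69:ℝ) ≤ L := by
    have : log 2 ≤ L := Real.log_le_log (by norm_num) ht
    linarith [Real.log_two_gt_d9]
  have hLp : 0 < L := by linarith
  have hseq : s = (s.re:ℂ) + Complex.I * t := by
    apply Complex.ext <;> simp [htd]
  set q := η^4/L^9 with hq
  have hq0 : 0 < q := by positivity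
  have hq1 : q ≤ 1 := by
    rw [hq, div_le_one (by positivity)]
    calc η^4 ≤ (1/4)^4 := by gcongr
      _ ≤ (0.69)^9 := by norm_num
      _ ≤ L^9 := by gcongr
  by_cases hcase : q ≤ s.re - 1
  · have := hbig s.re t hs1 hs2 ht hcase
    rw [← hseq] at this
    refine le_trans ?_ this
    gcongr
    have : 0 < e * η^3 := by positivity
    linarith
  · push Not at hcase
    have h7 := hbig (1+q) t (by linarith) (by linarith) ht (by linarith)
    set s0 : ℂ := ((1+q:ℝ):ℂ) + Complex.I*t with hs0
    set K : Set ℂ := {z | 1 < z.re} ∩ {z | z.re ≤ 2} ∩ {z | z.im = t} with hK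
    have hconv : Convex ℝ K := by
      refine (Convex.inter ?_ ?_).inter ?_
      · exact convex_halfSpace_re_gt 1
      · exact convex_halfSpace_re_le 2
      · have : {z : ℂ | z.im = t} = {z | z.im ≤ t} ∩ {z | t ≤ z.im} := by
          ext z; simp [le_antisymm_iff]
        rw [this]
        exact (convex_halfSpace_im_le t).inter (convex_halfSpace_im_ge t)
    have hmv := Convex.norm_image_sub_le_of_norm_hasDerivWithin_le (𝕜 := ℂ) (f := riemannZeta)
      (f' := deriv riemannZeta) (s := K) (C := C3 * L^2) (x := s) (y := s0)
      (fun z hz => by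
        have : z ≠ 1 := by
          intro h; have := hz.1.1; rw [h] at this; simp at this
        exact (differentiableAt_riemannZeta this).hasDerivAt.hasDerivWithinAt)
      (fun z hz => by
        have him : z.im = t := hz.2
        have := h3 z hz.1.1 hz.1.2 (by rw [him]; exact ht)
        rw [him] at this
        exact this) hconv ⟨⟨hs1, hs2⟩, rfl⟩ ⟨⟨by simp [hs0]; linarith, by simp [hs0]; linarith⟩, by simp [hs0]⟩
    have hd : ‖s0 - s‖ ≤ q := by
      have : s0 - s = ((1+q-s.re:ℝ):ℂ) := by
        rw [hs0]; conv_lhs => rw [hseq]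
        push_cast; ring
      rw [this, Complex.norm_real, Real.norm_eq_abs, abs_of_pos (by linarith)]
      linarith
    have h8 : ‖riemannZeta s0‖ ≤ ‖riemannZeta s‖ + C3*L^2*q := by
      have a1 := norm_sub_norm_le (riemannZeta s0) (riemannZeta s)
      have a2 : C3*L^2*‖s0-s‖ ≤ C3*L^2*q := by gcongr
      linarith
    have h9 : C3*L^2*q ≤ e*η^3/2/L^7 := by
      have : C3*L^2*q = C3*η*η^3/L^7 := by rw [hq]; field_simp
      rw [this]
      gcongr
      nlinarith [pow_pos hη0 3]
    have : e*η^3/L^7 = e*η^3/2/L^7 + e*η^3/2/L^7 := by ring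
    linarith

lemma zeta_contDiffAt (s : ℂ) (hs : s ≠ 1) (n : ℕ) : ContDiffAt ℂ n riemannZeta s :=
  (analyticOn_riemannZeta s hs).contDiffAt

set_option maxHeartbeats 400000 in
lemma zlog_deriv_bound (k : ℕ) : ∃ C > 0, ∃ m : ℕ, ∀ s : ℂ, 1 < s.re → s.re ≤ 2 → 2 ≤ |s.im| →
    ‖iteratedDeriv k (fun z => deriv riemannZeta z / riemannZeta z) s‖ ≤ C * (log (3+|s.im|))^m := by
  induction k using Nat.strong_induction_on with
  | _ k ih =>
  obtain ⟨c, hc, hlow⟩ := zeta_lower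
  choose Cz hCz hz using zeta_deriv_bound
  have ih' : ∀ i : ℕ, ∃ C > 0, ∃ m : ℕ, i < k → ∀ s : ℂ, 1 < s.re → s.re ≤ 2 → 2 ≤ |s.im| →
    ‖iteratedDeriv i (fun z => deriv riemannZeta z / riemannZeta z) s‖ ≤ C * (log (3+|s.im|))^m := by
    intro i
    by_cases hi : i < k
    · obtain ⟨C, hC, m, h⟩ := ih i hi
      exact ⟨C, hC, m, fun _ => h⟩
    · exact ⟨1, one_pos, 0, fun h => absurd h hi⟩
  choose Ch hCh mh hh using ih'
  set m := k + 2 + ∑ i ∈ range k, (mh i + k + 1) with hm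
  refine ⟨(Cz (k+1) + ∑ i ∈ range k, (k.choose i) * Ch i * Cz (k-i)) / c,
    by
      have : 0 ≤ ∑ i ∈ range k, (k.choose i) * Ch i * Cz (k-i) :=
        Finset.sum_nonneg fun i _ => by
          have := hCh i; have := hCz (k-i); positivity
      have := hCz (k+1)
      positivity, m+7, fun s h1 h2 ht => ?_⟩
  have hs1 : s ≠ 1 := by intro h; rw [h] at h1; simp at h1
  set g := fun z => deriv riemannZeta z / riemannZeta z with hg
  set L := log (3+|s.im|) with hL
  have hL1 : 1 ≤ L := by
    rw [hL, Real.le_log_iff_exp_le (by positivity)]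
    have := Real.exp_one_lt_d9
    linarith [abs_nonneg s.im]
  have hLL : log |s.im| ≤ L := Real.log_le_log (by linarith) (by linarith)
  have hL0 : 0 < log |s.im| := Real.log_pos (by linarith)
  have hzb : ∀ j, ‖iteratedDeriv j riemannZeta s‖ ≤ Cz j * L^(j+1) := fun j => by
    refine (hz j s h1 h2 ht).trans ?_
    have := hCz j
    gcongr
  have hne : riemannZeta s ≠ 0 := riemannZeta_ne_zero_of_one_le_re h1.le
  have hgc : ContDiffAt ℂ k g s := by
    have a1 : AnalyticAt ℂ riemannZeta s := analyticOn_riemannZeta s hs1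
    exact (a1.deriv.div a1 hne).contDiffAt
  have heq : deriv riemannZeta =ᶠ[nhds s] g * riemannZeta := by
    have : {z : ℂ | 1 < z.re} ∈ nhds s :=
        (isOpen_lt continuous_const Complex.continuous_re).mem_nhds h1
    filter_upwards [this] with z hz
    have : riemannZeta z ≠ 0 := riemannZeta_ne_zero_of_one_le_re (le_of_lt hz)
    simp only [hg, Pi.mul_apply]
    field_simp
  have hmul := iteratedDeriv_mul (n := k) hgc (zeta_contDiffAt s hs1 k)
  rw [← heq.iteratedDeriv_eq, ← iteratedDeriv_succ', Finset.sum_range_succ] at hmul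
  simp only [Nat.choose_self, Nat.cast_one, one_mul, Nat.sub_self, iteratedDeriv_zero] at hmul
  set Sg := ∑ i ∈ range k, (k.choose i:ℂ) * iteratedDeriv i g s * iteratedDeriv (k-i) riemannZeta s with hSg
  have hprod : ‖iteratedDeriv k g s‖ * ‖riemannZeta s‖ ≤
      (Cz (k+1) + ∑ i ∈ range k, (k.choose i) * Ch i * Cz (k-i)) * L^m := by
    rw [← norm_mul]
    have : iteratedDeriv k g s * riemannZeta s = iteratedDeriv (k+1) riemannZeta s - Sg := by
      rw [hmul]; ring
    rw [this, add_mul]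
    refine (norm_sub_le _ _).trans (add_le_add ?_ ?_)
    · refine (hzb (k+1)).trans ?_
      have := hCz (k+1)
      gcongr
      omega
    · rw [hSg, Finset.sum_mul]
      refine norm_sum_le_of_le _ fun i hi => ?_
      have hik := Finset.mem_range.mp hi
      rw [norm_mul, norm_mul, Complex.norm_natCast]
      have a1 := hh i hik s h1 h2 ht
      have a2 := hzb (k-i)
      have := hCh i
      have := hCz (k-i)
      calc (k.choose i:ℝ) * ‖iteratedDeriv i g s‖ * ‖iteratedDeriv (k-i) riemannZeta s‖
          ≤ (k.choose i:ℝ) * (Ch i * L^(mh i)) * (Cz (k-i) * L^(k-i+1)) := by gcongr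
        _ = (k.choose i) * Ch i * Cz (k-i) * L^(mh i + (k-i+1)) := by rw [pow_add]; ring
        _ ≤ _ := by
          gcongr
          have : mh i + k + 1 ≤ ∑ i ∈ range k, (mh i + k + 1) :=
            Finset.single_le_sum (f := fun i => mh i + k + 1) (fun _ _ => Nat.zero_le _) hi
          omega
  have hlow' : c / L^7 ≤ ‖riemannZeta s‖ := by
    refine le_trans ?_ (hlow s h1 h2 ht)
    gcongr
  have h10 : ‖iteratedDeriv k g s‖ * (c/L^7) ≤ _ := (mul_le_mul_of_nonneg_left hlow' (norm_nonneg _)).trans hprod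
  rw [mul_div_assoc', div_le_iff₀ (by positivity)] at h10
  rw [div_mul_eq_mul_div, le_div_iff₀ hc, pow_add]
  linarith

/-- Coefficients of `-ζ'/ζ - ζ`. -/
noncomputable def cfL (n : ℕ) : ℂ := ((ArithmeticFunction.vonMangoldt n - 1 : ℝ) : ℂ)

lemma cfL_summable (s : ℂ) (hs : 1 < s.re) : LSeriesSummable cfL s := by
  have h1 := ArithmeticFunction.LSeriesSummable_vonMangoldt hs
  have h2 : LSeriesSummable 1 s := LSeriesSummable_one_iff.mpr hs
  have := h1.sub h2
  refine (LSeriesSummable_congr s (fun {n} hn => ?_)).mp this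
  simp [cfL]

lemma cfL_abscissa (s : ℂ) (hs : 1 < s.re) : LSeries.abscissaOfAbsConv cfL < s.re := by
  have h := cfL_summable (((1+s.re)/2:ℝ):ℂ) (by simp; linarith)
  refine lt_of_le_of_lt h.abscissaOfAbsConv_le ?_
  rw [Complex.ofReal_re]
  exact_mod_cast (by linarith : (1+s.re)/2 < s.re)

lemma cfL_eq (s : ℂ) (hs : 1 < s.re) :
    LSeries cfL s = - (deriv riemannZeta s / riemannZeta s) - riemannZeta s := by
  have h1 := ArithmeticFunction.LSeriesSummable_vonMangoldt hs
  have h2 : LSeriesSummable 1 s := LSeriesSummable_one_iff.mpr hs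
  have h3 := LSeries_sub h1 h2
  rw [ArithmeticFunction.LSeries_vonMangoldt_eq_deriv_riemannZeta_div hs,
    LSeries_one_eq_riemannZeta hs, neg_div] at h3
  rw [← h3]
  refine LSeries_congr (fun {n} hn => ?_) s
  simp [cfL]

lemma riemannZeta₁_ne (s : ℂ) (hs : 1 ≤ s.re) : riemannZeta₁ s ≠ 0 := by
  by_cases h : s = 1
  · rw [h, riemannZeta₁_one]; exact one_ne_zero
  · have := riemannZeta_ne_zero_of_one_le_re hs
    rw [riemannZeta_eq_inv_sub_mul h] at this
    exact right_ne_zero_of_mul this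

lemma cfL_eq' (s : ℂ) (hs : 1 < s.re) :
    LSeries cfL s = - (deriv riemannZeta₁ s / riemannZeta₁ s) - riemannZeta₀ s := by
  have hs1 : s ≠ 1 := by intro h; rw [h] at hs; simp at hs
  have h1 := riemannZeta₁_ne s hs.le
  have h2 : s - 1 ≠ 0 := sub_ne_zero.mpr hs1
  rw [cfL_eq s hs, deriv_riemannZeta_eq_neg_inv_sub_sq_mul_add hs1]
  nth_rw 2 [riemannZeta_eq_inv_sub_add hs1]
  rw [riemannZeta_eq_inv_sub_mul hs1]
  field_simp
  ring

lemma cfL_bound (k : ℕ) : ∃ C > 0, ∃ m : ℕ, ∀ s : ℂ, 1 < s.re → s.re ≤ 2 →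
    ‖LSeries (LSeries.logMul^[k] cfL) s‖ ≤ C * (log (3+|s.im|))^m := by
  obtain ⟨C1, hC1, m1, h1⟩ := zlog_deriv_bound k
  obtain ⟨C2, hC2, h2⟩ := zeta_deriv_bound k
  set G : ℂ → ℂ := fun s => - (deriv riemannZeta₁ s / riemannZeta₁ s) - riemannZeta₀ s with hG
  have hGa : ∀ s : ℂ, 1 ≤ s.re → AnalyticAt ℂ G s := by
    intro s hs
    have a1 : AnalyticAt ℂ riemannZeta₁ s := differentiable_riemannZeta₁.analyticAt s
    have a0 : AnalyticAt ℂ riemannZeta₀ s := differentiable_riemannZeta₀.analyticAt s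
    exact ((a1.deriv.div a1 (riemannZeta₁_ne s hs)).neg).sub a0
  set K : Set ℂ := Set.Icc (1:ℝ) 2 ×ℂ Set.Icc (-2:ℝ) 2 with hK
  have hKc : IsCompact K := isCompact_Icc.reProdIm isCompact_Icc
  have hcont : ContinuousOn (iteratedDeriv k G) K := by
    intro s hs
    rw [hK, Complex.mem_reProdIm] at hs
    have := (hGa s hs.1.1).iterated_deriv k
    rw [← iteratedDeriv_eq_iterate] at this
    exact this.continuousAt.continuousWithinAt
  obtain ⟨C3, hC3⟩ := hKc.exists_bound_of_continuousOn hcont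
  refine ⟨C1 + C2 + |C3|, by positivity, m1 + (k+1), fun s hs1 hs2 => ?_⟩
  set L := log (3+|s.im|) with hL
  have hL1 : 1 ≤ L := by
    rw [hL, Real.le_log_iff_exp_le (by positivity)]
    have := Real.exp_one_lt_d9
    linarith [abs_nonneg s.im]
  have hnhds : {z : ℂ | 1 < z.re} ∈ nhds s :=
        (isOpen_lt continuous_const Complex.continuous_re).mem_nhds hs1
  have hnorm : ‖LSeries (LSeries.logMul^[k] cfL) s‖ = ‖iteratedDeriv k (LSeries cfL) s‖ := by
    rw [LSeries_iteratedDeriv k (cfL_abscissa s hs1), norm_mul, norm_pow, norm_neg, norm_one, one_pow, one_mul]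
  rw [hnorm, add_mul]
  by_cases ht : 2 ≤ |s.im|
  · have heq : LSeries cfL =ᶠ[nhds s] fun z => - (deriv riemannZeta z / riemannZeta z) - riemannZeta z := by
      filter_upwards [hnhds] with z hz using cfL_eq z hz
    rw [heq.iteratedDeriv_eq]
    have hne : s ≠ 1 := by intro h; rw [h] at hs1; simp at hs1
    have a1 : AnalyticAt ℂ riemannZeta s := analyticOn_riemannZeta s hne
    have a2 := a1.deriv.div a1 (riemannZeta_ne_zero_of_one_le_re hs1.le)
    have e1 := iteratedDeriv_fun_sub (n := k) (x := s)
      (f := fun z => - (deriv riemannZeta z / riemannZeta z)) (g := riemannZeta)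
      a2.neg.contDiffAt a1.contDiffAt
    rw [e1, iteratedDeriv_fun_neg]
    refine (norm_sub_le _ _).trans ?_
    rw [norm_neg]
    have b1 := h1 s hs1 hs2 ht
    have b2 := h2 s hs1 hs2 ht
    have hLL : log |s.im| ≤ L := Real.log_le_log (by linarith) (by linarith)
    have hL0 : 0 < log |s.im| := Real.log_pos (by linarith)
    have c1 : C1 * L^m1 ≤ C1 * L^(m1+(k+1)) := by gcongr; omega
    have c2 : C2 * (log |s.im|)^(k+1) ≤ C2 * L^(m1+(k+1)) := by
      calc C2 * (log |s.im|)^(k+1) ≤ C2 * L^(k+1) := by gcongr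
        _ ≤ _ := mul_le_mul_of_nonneg_left (pow_le_pow_right₀ hL1 (by omega)) hC2.le
    have c3 : 0 ≤ |C3| * L^(m1+(k+1)) := by positivity
    rw [add_mul]
    linarith
  · push Not at ht
    have heq : LSeries cfL =ᶠ[nhds s] G := by
      filter_upwards [hnhds] with z hz using cfL_eq' z hz
    rw [heq.iteratedDeriv_eq]
    have b1 := hC3 s (by
      rw [hK, Complex.mem_reProdIm]
      exact ⟨⟨hs1.le, hs2⟩, abs_le.mp ht.le⟩)
    have c3 : |C3| * 1 ≤ |C3| * L^(m1+(k+1)) := by gcongr; exact one_le_pow₀ hL1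
    have c2 : 0 ≤ (C1+C2) * L^(m1+(k+1)) := by positivity
    linarith [le_abs_self C3]

noncomputable def kerf : ℝ → ℂ := Set.indicator (Set.Ioc 0 1) (fun u => 1 - (u:ℂ))

lemma kerf_eq (u : ℝ) (hu : 0 < u) : kerf u = ((max (1-u) 0 : ℝ) : ℂ) := by
  unfold kerf
  by_cases h : u ≤ 1
  · rw [Set.indicator_of_mem (show u ∈ Set.Ioc (0:ℝ) 1 from ⟨hu, h⟩), max_eq_left (by linarith)]
    push_cast; ring
  · rw [Set.indicator_of_notMem (fun h' => h h'.2), max_eq_right (by linarith)]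
    simp

lemma kerf_mellin (s : ℂ) (hs : 0 < s.re) : HasMellin kerf s (1/s - 1/(s+1)) := by
  have h1 := hasMellin_one_Ioc hs
  have h2 := hasMellin_cpow_Ioc 1 (s := s) (by simp; linarith)
  have h3 := hasMellin_sub h1.1 h2.1
  have e : (fun t : ℝ => Set.indicator (Set.Ioc 0 1) (fun _ => 1 : ℝ → ℂ) t
      - Set.indicator (Set.Ioc 0 1) (fun t => (t:ℂ)^(1:ℂ) : ℝ → ℂ) t) = kerf := by
    funext t
    unfold kerf
    by_cases h : t ∈ Set.Ioc (0:ℝ) 1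
    · simp [Set.indicator_of_mem h]
    · simp [Set.indicator_of_notMem h]
  rw [e, h1.2, h2.2] at h3
  exact h3

noncomputable def kerm (s : ℂ) : ℂ := 1/s - 1/(s+1)

lemma kerm_bound (σ t : ℝ) (hσ : 1 ≤ σ) : ‖kerm (σ + t * Complex.I)‖ ≤ 2 * (1+|t|)^(-(2:ℝ)) := by
  set s : ℂ := σ + t * Complex.I with hs
  have hre : s.re = σ := by simp [hs]
  have him : s.im = t := by simp [hs]
  have h0 : s ≠ 0 := by intro h; rw [h] at hre; simp at hre; linarith
  have h1 : s + 1 ≠ 0 := by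
    intro h
    have := congrArg Complex.re h
    simp [hre] at this; linarith
  have e : kerm s = 1/(s*(s+1)) := by unfold kerm; field_simp; ring
  rw [e, norm_div, norm_one, norm_mul]
  have b : ∀ w : ℂ, 1 ≤ w.re → w.im = t → (1+|t|)^2/2 ≤ ‖w‖^2 := by
    intro w hw1 hw2
    rw [← Complex.normSq_eq_norm_sq, Complex.normSq_apply, hw2]
    have : t*t = |t| * |t| := (abs_mul_abs_self t).symm
    nlinarith [sq_nonneg (|t|-1)]
  have b1 := b s (by rw [hre]; exact hσ) him
  have b2 := b (s+1) (by simp [hre]; linarith) (by simp [him])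
  have b3 : (1+|t|)^2/2 ≤ ‖s‖*‖s+1‖ := by
    have hp : 0 ≤ (1+|t|)^2/2 := by positivity
    refine abs_le_of_sq_le_sq' ?_ (by positivity) |>.2
    calc ((1+|t|)^2/2)^2 = ((1+|t|)^2/2)*((1+|t|)^2/2) := by ring
      _ ≤ ‖s‖^2 * ‖s+1‖^2 := mul_le_mul b1 b2 hp (by positivity)
      _ = _ := by ring
  rw [Real.rpow_neg (by positivity), ← div_eq_mul_inv]
  calc 1/(‖s‖*‖s+1‖) ≤ 1/((1+|t|)^2/2) := by
        apply one_div_le_one_div_of_le (by positivity) b3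
    _ = _ := by
      rw [show (2:ℝ) = ((2:ℕ):ℝ) by norm_num, Real.rpow_natCast]; field_simp

lemma integrable_one_add_abs (r : ℝ) (hr : 1 < r) : Integrable (fun t : ℝ => (1+|t|)^(-r)) := by
  have := integrable_one_add_norm (E := ℝ) (μ := volume) (r := r) (by simpa using hr)
  simpa using this

lemma kerm_cont (σ : ℝ) (hσ : 1 ≤ σ) : Continuous (fun t : ℝ => kerm (σ + t * Complex.I)) := by
  unfold kerm
  have h0 : ∀ t : ℝ, (σ + t * Complex.I : ℂ) ≠ 0 := by
    intro t h
    have := congrArg Complex.re h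
    simp at this; linarith
  have h1 : ∀ t : ℝ, (σ + t * Complex.I + 1 : ℂ) ≠ 0 := by
    intro t h
    have := congrArg Complex.re h
    simp at this; linarith
  exact (continuous_const.div (by fun_prop) h0).sub (continuous_const.div (by fun_prop) h1)

lemma kerm_int (σ : ℝ) (hσ : 1 ≤ σ) : Integrable (fun t : ℝ => kerm (σ + t * Complex.I)) := by
  refine Integrable.mono' ((integrable_one_add_abs 2 (by norm_num)).const_mul 2)
    (kerm_cont σ hσ).aestronglyMeasurable (Filter.Eventually.of_forall fun t => ?_)
  exact kerm_bound σ t hσ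

lemma kerm_inv (σ : ℝ) (hσ : 1 ≤ σ) (u : ℝ) (hu : 0 < u) :
    ∫ t : ℝ, (u:ℂ)^(-(σ + t * Complex.I)) * kerm (σ + t * Complex.I)
      = 2 * π * ((max (1-u) 0 : ℝ) : ℂ) := by
  have hm : ∀ t : ℝ, mellin kerf (σ + t * Complex.I) = kerm (σ + t * Complex.I) := by
    intro t
    exact (kerf_mellin _ (by simp; linarith)).2
  have hv : Complex.VerticalIntegrable (mellin kerf) σ := by
    unfold Complex.VerticalIntegrable
    simp_rw [hm]
    exact kerm_int σ hσ
  have hc : ContinuousAt kerf u := by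
    have : ContinuousAt (fun u : ℝ => ((max (1-u) 0 : ℝ) : ℂ)) u := by fun_prop
    refine this.congr ?_
    filter_upwards [lt_mem_nhds hu] with v hv using (kerf_eq v hv).symm
  have := mellinInv_mellin_eq σ kerf hu (kerf_mellin σ (by simp; linarith)).1 hv hc
  unfold mellinInv at this
  simp_rw [hm] at this
  rw [kerf_eq u hu] at this
  rw [← this]
  simp only [smul_eq_mul]
  rw [Complex.real_smul]
  have hp : (π:ℂ) ≠ 0 := by exact_mod_cast pi_ne_zero
  push_cast
  rw [← mul_assoc, mul_one_div_cancel (by simp [hp]), one_mul]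

lemma perron_bound : ∃ C > 0, ∀ (b : ℕ → ℂ) (σ x K : ℝ), 1 ≤ σ → 0 < x → LSeriesSummable b σ →
    (∀ t : ℝ, ‖LSeries b (σ + t * Complex.I)‖ ≤ K * (1+|t|)^(1/2:ℝ)) →
    ‖∑ n ∈ Finset.Icc 1 ⌊x⌋₊, b n * (1 - n/x)‖ ≤ C * K * x^σ := by
  have hI := integrable_one_add_abs (3/2) (by norm_num)
  have hI0 : 0 ≤ ∫ t : ℝ, (1+|t|)^(-(3/2:ℝ)) := integral_nonneg fun t => by positivity
  refine ⟨2 * (∫ t : ℝ, (1+|t|)^(-(3/2:ℝ))) + 1, by positivity, ?_⟩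
  intro b σ x K hσ hx hb hK
  have hK0 : 0 ≤ K := by
    have := (norm_nonneg _).trans (hK 0)
    simpa using this
  let F : ℕ → ℝ → ℂ := fun n t => LSeries.term b (σ + t * Complex.I) n * (x:ℂ)^(σ + t * Complex.I : ℂ)
    * kerm (σ + t * Complex.I)
  have hxn : ∀ t : ℝ, ‖(x:ℂ)^(σ + t * Complex.I : ℂ)‖ = x^σ := by
    intro t
    rw [Complex.norm_cpow_eq_rpow_re_of_pos hx]; simp
  have htn : ∀ n (t : ℝ), ‖LSeries.term b (σ + t * Complex.I) n‖ = ‖LSeries.term b σ n‖ := by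
    intro n t
    rw [LSeries.norm_term_eq, LSeries.norm_term_eq]; simp
  have hFn : ∀ n t, ‖F n t‖ = ‖LSeries.term b σ n‖ * x^σ * ‖kerm (σ + t * Complex.I)‖ := by
    intro n t
    simp only [F, norm_mul, hxn, htn]
  have hF0 : ∀ n (t : ℝ), n ≠ 0 → F n t = b n * (((n/x:ℝ):ℂ)^(-(σ + t * Complex.I)) * kerm (σ + t * Complex.I)) := by
    intro n t hn
    simp only [F]
    rw [LSeries.term_of_ne_zero hn]
    have hn' : (0:ℝ) < n := by positivity
    have : (((n/x:ℝ):ℂ)^(-(σ + t * Complex.I):ℂ)) = (x:ℂ)^(σ + t * Complex.I : ℂ) / (n:ℂ)^(σ + t * Complex.I : ℂ) := by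
      rw [div_eq_mul_inv (n:ℝ) x, Complex.ofReal_mul, Complex.mul_cpow_ofReal_nonneg hn'.le (by positivity),
        Complex.cpow_neg, Complex.ofReal_inv, Complex.inv_cpow _ _ (by
          rw [Complex.arg_ofReal_of_nonneg hx.le]; exact pi_pos.ne), Complex.cpow_neg, inv_inv]
      push_cast
      ring
    rw [this]
    ring
  have hkc := kerm_cont σ hσ
  have hFc : ∀ n, Continuous (F n) := by
    intro n
    by_cases hn : n = 0
    · subst hn
      simp only [F, LSeries.term_zero, zero_mul]
      exact continuous_const
    · have e : F n = fun t : ℝ => b n * (((n/x:ℝ):ℂ)^(-(σ + t * Complex.I)) * kerm (σ + t * Complex.I)) :=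
        funext fun t => hF0 n t hn
      rw [e]
      refine continuous_const.mul (Continuous.mul ?_ hkc)
      refine Continuous.const_cpow (by fun_prop) (Or.inl ?_)
      exact_mod_cast (by positivity : (n/x:ℝ) ≠ 0)
  have hFi : ∀ n, Integrable (F n) := by
    intro n
    refine Integrable.mono' ((kerm_int σ hσ).norm.const_mul (‖LSeries.term b σ n‖ * x^σ))
      (hFc n).aestronglyMeasurable (Filter.Eventually.of_forall fun t => (hFn n t).le)
  have hS : Summable fun n => ∫ t, ‖F n t‖ := by
    simp_rw [hFn]
    simp_rw [integral_const_mul]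
    exact (hb.norm.mul_right _).mul_right _
  have hsum := hasSum_integral_of_summable_integral_norm hFi hS
  have hInt : ∀ n, ∫ t, F n t = if n ∈ Finset.Icc 1 ⌊x⌋₊ then 2*π*(b n * (1 - n/x)) else 0 := by
    intro n
    by_cases hn : n = 0
    · subst hn
      simp [F]
    · simp_rw [hF0 n _ hn]
      rw [integral_const_mul, kerm_inv σ hσ (n/x) (by positivity)]
      by_cases hnx : (n:ℝ) ≤ x
      · rw [if_pos (Finset.mem_Icc.mpr ⟨by omega, Nat.le_floor hnx⟩), max_eq_left (by
          rw [sub_nonneg, div_le_one hx]; exact hnx)]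
        push_cast; ring
      · rw [if_neg (fun h => hnx ((Nat.le_floor_iff hx.le).mp (Finset.mem_Icc.mp h).2)), max_eq_right (by
          rw [sub_nonpos, one_le_div hx]; linarith)]
        simp
  have hval : ∑ n ∈ Finset.Icc 1 ⌊x⌋₊, 2*π*(b n * (1 - n/x)) = ∫ t, ∑' n, F n t := by
    rw [← hsum.tsum_eq]
    simp_rw [hInt]
    rw [tsum_eq_sum (s := Finset.Icc 1 ⌊x⌋₊) (fun n hn => by rw [if_neg hn])]
    exact sum_congr rfl fun n hn => by rw [if_pos hn]
  have hbd : ‖∫ t, ∑' n, F n t‖ ≤ ∫ t : ℝ, K * x^σ * 2 * (1+|t|)^(-(3/2:ℝ)) := by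
    refine norm_integral_le_of_norm_le (hI.const_mul _) (Filter.Eventually.of_forall fun t => ?_)
    have : ∑' n, F n t = LSeries b (σ + t * Complex.I) * (x:ℂ)^(σ + t * Complex.I : ℂ) * kerm (σ + t * Complex.I) := by
      simp only [F]
      rw [tsum_mul_right, tsum_mul_right]; rfl
    rw [this, norm_mul, norm_mul, hxn]
    calc _ ≤ (K * (1+|t|)^(1/2:ℝ)) * x^σ * (2 * (1+|t|)^(-(2:ℝ))) := by
          gcongr
          · exact hK t
          · exact kerm_bound σ t hσ
      _ = K * x^σ * 2 * ((1+|t|)^(1/2:ℝ) * (1+|t|)^(-(2:ℝ))) := by ring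
      _ = _ := by rw [← Real.rpow_add (by positivity)]; norm_num
  rw [← hval, ← mul_sum, integral_const_mul, norm_mul] at hbd
  have h2pi : 1 ≤ ‖(2*π:ℂ)‖ := by
    rw [norm_mul, Complex.norm_real]
    simp [abs_of_pos pi_pos]
    linarith [pi_gt_three]
  have h3 : ‖∑ n ∈ Finset.Icc 1 ⌊x⌋₊, b n * (1 - n/x)‖ ≤ ‖(2*π:ℂ)‖ * ‖∑ n ∈ Finset.Icc 1 ⌊x⌋₊, b n * (1 - n/x)‖ :=
    le_mul_of_one_le_left (norm_nonneg _) h2pi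
  have h4 : 0 ≤ K * x^σ := by positivity
  refine h3.trans (hbd.trans ?_)
  nlinarith

lemma logpow_le (A : ℕ) (ε : ℝ) (hε : 0 < ε) : ∃ C > 0, ∀ x : ℝ, 1 ≤ x → (log x)^A ≤ C * x^ε := by
  have hd : 0 < ε/(A+1) := by positivity
  refine ⟨((A+1)/ε)^A, by positivity, fun x hx => ?_⟩
  have h1 := Real.log_le_rpow_div (by linarith : 0 ≤ x) hd
  have h0 := Real.log_nonneg hx
  calc (log x)^A ≤ (x^(ε/(A+1))/(ε/(A+1)))^A := by gcongr
    _ = ((A+1)/ε)^A * x^(ε/(A+1)*A) := by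
        rw [div_pow, Real.rpow_mul (by linarith), Real.rpow_natCast, div_eq_mul_inv, mul_comm, ← inv_pow, inv_div]
    _ ≤ ((A+1)/ε)^A * x^ε := by
        gcongr
        rw [div_mul_eq_mul_div, div_le_iff₀ (by positivity)]
        nlinarith

lemma abel_id (z w : ℕ → ℂ) (a b : ℕ) (h : a < b) :
    ∑ n ∈ Ioc a b, w n * z n = w b * (∑ n ∈ Ioc a b, z n)
      - ∑ n ∈ Finset.Ico (a+1) b, (w (n+1) - w n) * (∑ k ∈ Ioc a n, z k) := by
  induction b, h using Nat.le_induction with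
  | base => simp
  | succ b hb ih =>
    rw [← Finset.insert_Ioc_right_eq_Ioc_add_one (by omega : a ≤ b), Finset.sum_insert (by simp), ih,
      Finset.sum_insert (by simp), Finset.sum_Ico_succ_top (by omega)]
    ring

lemma abel_bound (z w : ℕ → ℂ) (a b : ℕ) (M : ℝ) (h : a < b)
    (hM : ∀ n, a < n → n ≤ b → ‖∑ k ∈ Ioc a n, z k‖ ≤ M) :
    ‖∑ n ∈ Ioc a b, w n * z n‖ ≤ M * (‖w b‖ + ∑ n ∈ Finset.Ico (a+1) b, ‖w (n+1) - w n‖) := by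
  rw [abel_id z w a b h]
  refine (norm_sub_le _ _).trans ?_
  rw [mul_add, norm_mul, mul_comm M, mul_sum]
  refine add_le_add (mul_le_mul_of_nonneg_left (hM b h le_rfl) (norm_nonneg _)) ?_
  refine (norm_sum_le _ _).trans (sum_le_sum fun n hn => ?_)
  rw [Finset.mem_Ico] at hn
  rw [norm_mul, mul_comm]
  exact mul_le_mul_of_nonneg_right (hM n (by omega) (by omega)) (norm_nonneg _)

lemma abel_anti (z : ℕ → ℂ) (w : ℕ → ℝ) (a b : ℕ) (M : ℝ) (hM0 : 0 ≤ M)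
    (hM : ∀ n, a < n → n ≤ b → ‖∑ k ∈ Ioc a n, z k‖ ≤ M)
    (hw : ∀ n, a < n → n < b → w (n+1) ≤ w n) (hb : 0 ≤ w b) (ha : 0 ≤ w (a+1)) :
    ‖∑ n ∈ Ioc a b, (w n : ℂ) * z n‖ ≤ M * w (a+1) := by
  rcases Nat.lt_or_ge a b with h | h
  · refine (abel_bound z (fun n => (w n:ℂ)) a b M h hM).trans ?_
    refine mul_le_mul_of_nonneg_left ?_ hM0
    have : ∑ n ∈ Finset.Ico (a+1) b, ‖((w (n+1) : ℝ):ℂ) - ((w n:ℝ):ℂ)‖ = ∑ n ∈ Finset.Ico (a+1) b, -(w (n+1) - w n) := by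
      refine sum_congr rfl fun n hn => ?_
      rw [Finset.mem_Ico] at hn
      rw [← Complex.ofReal_sub, Complex.norm_real, Real.norm_eq_abs, abs_of_nonpos]
      linarith [hw n (by omega) (by omega)]
    rw [this, Finset.sum_neg_distrib, Finset.sum_Ico_sub w (by omega), Complex.norm_real, Real.norm_eq_abs,
      abs_of_nonneg hb]
    linarith
  · rw [Finset.Ioc_eq_empty (by omega)]
    simp; positivity

lemma abel_mono (z : ℕ → ℂ) (w : ℕ → ℝ) (a b : ℕ) (M : ℝ) (hM0 : 0 ≤ M)
    (hM : ∀ n, a < n → n ≤ b → ‖∑ k ∈ Ioc a n, z k‖ ≤ M)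
    (hw : ∀ n, a < n → n < b → w n ≤ w (n+1)) (hb : 0 ≤ w b) (ha : 0 ≤ w (a+1)) :
    ‖∑ n ∈ Ioc a b, (w n : ℂ) * z n‖ ≤ M * (2 * w b) := by
  rcases Nat.lt_or_ge a b with h | h
  · refine (abel_bound z (fun n => (w n:ℂ)) a b M h hM).trans ?_
    refine mul_le_mul_of_nonneg_left ?_ hM0
    have : ∑ n ∈ Finset.Ico (a+1) b, ‖((w (n+1) : ℝ):ℂ) - ((w n:ℝ):ℂ)‖ = ∑ n ∈ Finset.Ico (a+1) b, (w (n+1) - w n) := by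
      refine sum_congr rfl fun n hn => ?_
      rw [Finset.mem_Ico] at hn
      rw [← Complex.ofReal_sub, Complex.norm_real, Real.norm_eq_abs, abs_of_nonneg]
      linarith [hw n (by omega) (by omega)]
    rw [this, Finset.sum_Ico_sub w (by omega), Complex.norm_real, Real.norm_eq_abs,
      abs_of_nonneg hb]
    linarith
  · rw [Finset.Ioc_eq_empty (by omega)]
    simp; positivity

noncomputable def bk (k n : ℕ) : ℝ := (log n)^k * (ArithmeticFunction.vonMangoldt n - 1)

lemma logMul_iter (k n : ℕ) : (LSeries.logMul^[k] cfL) n = ((bk k n : ℝ) : ℂ) := by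
  induction k with
  | zero => simp [bk, cfL]
  | succ k ih =>
    rw [Function.iterate_succ_apply']
    simp only [LSeries.logMul]
    rw [ih]
    unfold bk
    rw [← Complex.natCast_log]
    push_cast; ring

lemma bk_smooth (k : ℕ) : ∃ C > 0, ∀ x : ℝ, 3 ≤ x →
    |∑ n ∈ Finset.Icc 1 ⌊x⌋₊, bk k n * (x - n)| ≤ C * x^2 := by
  obtain ⟨C0, hC0, m, h1⟩ := cfL_bound k
  obtain ⟨C1, hC1, h2⟩ := logpow_le m (1/2) (by norm_num)
  obtain ⟨C2, hC2, h3⟩ := perron_bound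
  refine ⟨C2 * (C0 * C1 * 2) * Real.exp 1, by positivity, fun x hx => ?_⟩
  have hx0 : 0 < x := by linarith
  have hL1 : 1 < log x := by
    rw [Real.lt_log_iff_exp_lt hx0]; linarith [Real.exp_one_lt_d9]
  set σ : ℝ := 1 + 1/log x with hσ
  have hσ1 : 1 < σ := by rw [hσ]; linarith [show 0 < 1/log x by positivity]
  have hσ2 : σ ≤ 2 := by
    have : 1/log x ≤ 1 := by rw [div_le_one (by linarith)]; exact hL1.le
    linarith
  have hsum : LSeriesSummable (LSeries.logMul^[k] cfL) σ := by
    apply LSeriesSummable_of_abscissaOfAbsConv_lt_re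
    rw [LSeries.absicssaOfAbsConv_logPowMul]
    exact cfL_abscissa σ (by simpa using hσ1)
  have hb := h3 _ σ x (C0 * C1 * 2) hσ1.le hx0 hsum (fun t => by
    refine (h1 (σ + t * Complex.I) (by simpa using hσ1) (by simpa using hσ2)).trans ?_
    have him : (σ + t * Complex.I : ℂ).im = t := by simp
    rw [him]
    have a1 := h2 (3+|t|) (by linarith [abs_nonneg t])
    have a2 : (3+|t|)^(1/2:ℝ) ≤ 2 * (1+|t|)^(1/2:ℝ) := by
      calc (3+|t|)^(1/2:ℝ) ≤ (4*(1+|t|))^(1/2:ℝ) := by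
            apply Real.rpow_le_rpow <;> linarith [abs_nonneg t]
        _ = 4^(1/2:ℝ) * (1+|t|)^(1/2:ℝ) := Real.mul_rpow (by norm_num) (by positivity)
        _ = _ := by
          rw [show (4:ℝ) = 2^(2:ℝ) by norm_num, ← Real.rpow_mul (by norm_num)]; norm_num
    calc C0 * log (3+|t|)^m ≤ C0 * (C1 * (2 * (1+|t|)^(1/2:ℝ))) := by
          gcongr; exact a1.trans (by gcongr)
      _ = _ := by ring)
  have hxs : x^σ = x * Real.exp 1 := by
    rw [hσ, Real.rpow_add hx0, Real.rpow_one, Real.rpow_def_of_pos hx0]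
    congr 2
    field_simp
  rw [hxs] at hb
  have e : ∑ n ∈ Finset.Icc 1 ⌊x⌋₊, bk k n * (x - n) = x * ∑ n ∈ Finset.Icc 1 ⌊x⌋₊, bk k n * (1 - n/x) := by
    rw [mul_sum]
    refine sum_congr rfl fun n _ => ?_
    field_simp
  have e2 : ‖∑ n ∈ Finset.Icc 1 ⌊x⌋₊, (LSeries.logMul^[k] cfL) n * (1 - n/x)‖ = |∑ n ∈ Finset.Icc 1 ⌊x⌋₊, bk k n * (1 - n/x)| := by
    rw [← Real.norm_eq_abs, ← Complex.norm_real]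
    congr 1
    push_cast
    refine sum_congr rfl fun n _ => ?_
    rw [logMul_iter]
  rw [e2] at hb
  rw [e, abs_mul, abs_of_pos hx0]
  calc _ ≤ x * (C2 * (C0 * C1 * 2) * (x * Real.exp 1)) := by gcongr
    _ = _ := by ring

lemma bk_ge (k n : ℕ) (y : ℝ) (hn : 1 ≤ n) (hy : (n:ℝ) ≤ y) : -(log y)^k ≤ bk k n := by
  unfold bk
  have h0 : 0 ≤ log n := Real.log_natCast_nonneg n
  have h1 : log n ≤ log y := Real.log_le_log (by exact_mod_cast hn) hy
  have h2 : (log n)^k ≤ (log y)^k := by gcongr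
  have h3 : 0 ≤ (log n)^k := by positivity
  have h4 : 0 ≤ ArithmeticFunction.vonMangoldt n := ArithmeticFunction.vonMangoldt_nonneg
  nlinarith [mul_nonneg h3 h4]

/-- difference inequality -/
lemma smooth_diff (b : ℕ → ℝ) (x y h ℓ : ℝ) (hx : 0 ≤ x) (hxy : y = x + h) (hh : 0 ≤ h) (hℓ : 0 ≤ ℓ)
    (hb : ∀ n : ℕ, 1 ≤ n → (n:ℝ) ≤ y → -ℓ ≤ b n) :
    h * (∑ n ∈ Finset.Icc 1 ⌊x⌋₊, b n) ≤ (∑ n ∈ Finset.Icc 1 ⌊y⌋₊, b n * (y - n))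
      - (∑ n ∈ Finset.Icc 1 ⌊x⌋₊, b n * (x - n)) + (h+1)*h*ℓ ∧
    (∑ n ∈ Finset.Icc 1 ⌊y⌋₊, b n * (y - n))
      - (∑ n ∈ Finset.Icc 1 ⌊x⌋₊, b n * (x - n)) - (h+1)*h*ℓ ≤ h * (∑ n ∈ Finset.Icc 1 ⌊y⌋₊, b n) := by
  have hle : ⌊x⌋₊ ≤ ⌊y⌋₊ := Nat.floor_le_floor (by linarith)
  have hsplit : ∀ f : ℕ → ℝ, ∑ n ∈ Finset.Icc 1 ⌊y⌋₊, f n = ∑ n ∈ Finset.Icc 1 ⌊x⌋₊, f n + ∑ n ∈ Ioc ⌊x⌋₊ ⌊y⌋₊, f n := by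
    intro f
    have e1 : Finset.Icc 1 ⌊y⌋₊ = Ioc 0 ⌊y⌋₊ := by ext; simp; omega
    have e2 : Finset.Icc 1 ⌊x⌋₊ = Ioc 0 ⌊x⌋₊ := by ext; simp; omega
    rw [e1, e2, Finset.sum_Ioc_consecutive f (by omega) hle]
  have hcard : ((Ioc ⌊x⌋₊ ⌊y⌋₊).card : ℝ) ≤ h + 1 := by
    rw [Nat.card_Ioc, Nat.cast_sub hle]
    have := Nat.floor_le (by linarith : 0 ≤ y)
    have := Nat.lt_floor_add_one x
    linarith
  have hmem : ∀ n ∈ Ioc ⌊x⌋₊ ⌊y⌋₊, 1 ≤ n ∧ x < n ∧ (n:ℝ) ≤ y := by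
    intro n hn
    rw [mem_Ioc] at hn
    exact ⟨by omega, (Nat.floor_lt hx).mp hn.1, (Nat.le_floor_iff (by linarith)).mp hn.2⟩
  have key : ∀ g : ℕ → ℝ, (∀ n ∈ Ioc ⌊x⌋₊ ⌊y⌋₊, 0 ≤ g n ∧ g n ≤ h) →
      -((h+1)*h*ℓ) ≤ ∑ n ∈ Ioc ⌊x⌋₊ ⌊y⌋₊, b n * g n := by
    intro g hg
    have : ∑ n ∈ Ioc ⌊x⌋₊ ⌊y⌋₊, (-(h*ℓ)) ≤ ∑ n ∈ Ioc ⌊x⌋₊ ⌊y⌋₊, b n * g n := by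
      refine sum_le_sum fun n hn => ?_
      have h1 := hg n hn
      have h2 := hmem n hn
      have h3 := hb n h2.1 h2.2.2
      nlinarith [mul_nonneg h1.1 (by linarith : 0 ≤ b n + ℓ), mul_nonneg hℓ (by linarith : 0 ≤ h - g n)]
    rw [Finset.sum_const, nsmul_eq_mul] at this
    have h5 : ((Ioc ⌊x⌋₊ ⌊y⌋₊).card : ℝ) * (h*ℓ) ≤ (h+1)*(h*ℓ) := by gcongr
    linarith
  have k1 := key (fun n => y - n) (fun n hn => by
    have := hmem n hn
    constructor <;> linarith)
  have k2 := key (fun n => n - x) (fun n hn => by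
    have := hmem n hn
    constructor <;> linarith)
  have e3 : ∑ n ∈ Finset.Icc 1 ⌊x⌋₊, b n * (y - n) = ∑ n ∈ Finset.Icc 1 ⌊x⌋₊, b n * (x - n) + h * ∑ n ∈ Finset.Icc 1 ⌊x⌋₊, b n := by
    rw [mul_sum, ← Finset.sum_add_distrib]
    refine sum_congr rfl fun n _ => by rw [hxy]; ring
  have e4 : ∑ n ∈ Ioc ⌊x⌋₊ ⌊y⌋₊, b n * (y - n) = h * ∑ n ∈ Ioc ⌊x⌋₊ ⌊y⌋₊, b n - ∑ n ∈ Ioc ⌊x⌋₊ ⌊y⌋₊, b n * (n - x) := by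
    rw [mul_sum, ← Finset.sum_sub_distrib]
    refine sum_congr rfl fun n _ => by rw [hxy]; ring
  rw [hsplit, hsplit b, e3]
  constructor
  · linarith
  · rw [e4]; linarith

lemma bk_sum (m : ℕ) : ∃ C > 0, ∀ x : ℝ, 6 ≤ x →
    |∑ n ∈ Finset.Icc 1 ⌊x⌋₊, bk (2*m) n| ≤ C * x * (log x)^m := by
  obtain ⟨C0, hC0, h0⟩ := bk_smooth (2*m)
  obtain ⟨C1, hC1, h1⟩ := logpow_le m 1 (by norm_num)
  refine ⟨10*C0 + 2*(1+C1)*2^(2*m), by positivity, fun x hx => ?_⟩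
  have hx0 : 0 < x := by linarith
  set L := log x with hL
  have hL1 : 1 ≤ L := by
    rw [hL, Real.le_log_iff_exp_le hx0]; linarith [Real.exp_one_lt_d9]
  have hLm : 1 ≤ L^m := one_le_pow₀ hL1
  set h := x/(2*L^m) with hh
  have hhp : 0 < h := by positivity
  have hhx : h ≤ x/2 := by
    rw [hh]; apply div_le_div_of_nonneg_left <;> linarith
  have hCx := h1 x (by linarith)
  rw [Real.rpow_one] at hCx
  have hh1 : h + 1 ≤ (1+C1) * (x/L^m) := by
    have a1 : 1 ≤ C1 * (x/L^m) := by
      rw [mul_div_assoc', le_div_iff₀ (by positivity)]; linarith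
    have a2 : h ≤ x/L^m := by
      rw [hh]; apply div_le_div_of_nonneg_left <;> linarith
    linarith
  have hlog : log (x+h) ≤ 2*L := by
    calc log (x+h) ≤ log (x*x) := Real.log_le_log (by linarith) (by nlinarith)
      _ = 2*L := by rw [Real.log_mul hx0.ne' hx0.ne']; ring
  have hlog2 : log x ≤ 2*L := by linarith
  have hb1 : ∀ y : ℝ, 0 < y → log y ≤ 2*L → ∀ n : ℕ, 1 ≤ n → (n:ℝ) ≤ y → -(2*L)^(2*m) ≤ bk (2*m) n := by
    intro y hy hy2 n hn hny
    refine le_trans ?_ (bk_ge (2*m) n y hn hny)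
    have : 0 ≤ log y := Real.log_nonneg (le_trans (by exact_mod_cast hn) hny)
    have : (log y)^(2*m) ≤ (2*L)^(2*m) := by gcongr
    linarith
  have d1 := (smooth_diff (bk (2*m)) x (x+h) h ((2*L)^(2*m)) hx0.le rfl hhp.le (by positivity) (hb1 (x+h) (by linarith) hlog)).1
  have d2 := (smooth_diff (bk (2*m)) (x-h) x h ((2*L)^(2*m)) (by linarith) (by ring) hhp.le (by positivity) (hb1 x (by linarith) hlog2)).2
  have s1 := abs_le.mp (h0 x (by linarith))
  have s2 := abs_le.mp (h0 (x+h) (by linarith))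
  have s3 := abs_le.mp (h0 (x-h) (by linarith))
  have q2 : C0 * (x+h)^2 ≤ C0 * (4*x^2) := by
    apply mul_le_mul_of_nonneg_left _ hC0.le
    nlinarith
  have q3 : C0 * (x-h)^2 ≤ C0 * x^2 := by
    apply mul_le_mul_of_nonneg_left _ hC0.le
    nlinarith
  have p1 : 5*C0*x^2 = h * (10*C0*x*L^m) := by rw [hh]; field_simp; norm_num
  have p2 : (h+1)*h*(2*L)^(2*m) ≤ h * ((1+C1)*2^(2*m)*x*L^m) := by
    calc (h+1)*h*(2*L)^(2*m) ≤ ((1+C1) * (x/L^m))*h*(2*L)^(2*m) := by gcongr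
      _ = _ := by
        rw [mul_pow, show L^(2*m) = L^m * L^m by rw [two_mul, pow_add]]
        field_simp
  have r1 : h * (∑ n ∈ Finset.Icc 1 ⌊x⌋₊, bk (2*m) n) ≤ h * (10*C0*x*L^m + (1+C1)*2^(2*m)*x*L^m) := by
    linarith
  have r2 : h * (-(10*C0*x*L^m + (1+C1)*2^(2*m)*x*L^m)) ≤ h * (∑ n ∈ Finset.Icc 1 ⌊x⌋₊, bk (2*m) n) := by
    linarith
  have r1' := le_of_mul_le_mul_left r1 hhp
  have r2' := le_of_mul_le_mul_left r2 hhp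
  have hpos : 0 ≤ (1+C1)*2^(2*m)*x*L^m := by positivity
  rw [abs_le]
  constructor
  · linarith
  · linarith

lemma sqrt_logpow_le (A : ℕ) : ∃ C > 0, ∀ x : ℝ, 36 ≤ x → √x * (1 + log x) ≤ C * (x/(log x)^A) := by
  obtain ⟨C, hC, h⟩ := logpow_le (A+1) (1/2) (by norm_num)
  refine ⟨2*C, by positivity, fun x hx => ?_⟩
  have hx0 : 0 < x := by linarith
  have hL1 : 1 ≤ log x := by
    rw [Real.le_log_iff_exp_le hx0]; linarith [Real.exp_one_lt_d9]
  have h1 := h x (by linarith)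
  rw [← Real.sqrt_eq_rpow] at h1
  rw [mul_div_assoc', le_div_iff₀ (by positivity)]
  calc √x * (1+log x) * log x^A ≤ √x * (2 * log x) * log x^A := by gcongr; linarith
    _ = 2 * √x * log x^(A+1) := by ring
    _ ≤ 2 * √x * (C * √x) := by gcongr
    _ = 2 * C * (√x * √x) := by ring
    _ = _ := by rw [Real.mul_self_sqrt hx0.le]

lemma pnt_psi (m : ℕ) : ∃ C > 0, ∀ x : ℝ, 36 ≤ x → |Chebyshev.psi x - x| ≤ C * (x/(log x)^m) := by
  obtain ⟨C0, hC0, h0⟩ := bk_sum m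
  obtain ⟨C1, hC1, h1⟩ := sqrt_logpow_le m
  refine ⟨2*C0*4^m + 12*C1, by positivity, fun x hx => ?_⟩
  have hx0 : 0 < x := by linarith
  set L := log x with hL
  have hL1 : 1 ≤ L := by
    rw [hL, Real.le_log_iff_exp_le hx0]; linarith [Real.exp_one_lt_d9]
  have hs6 : 6 ≤ √x := by
    rw [Real.le_sqrt (by norm_num) hx0.le]; linarith
  have hsx : √x * √x = x := Real.mul_self_sqrt hx0.le
  have hsle : √x ≤ x := by nlinarith
  set N := ⌊x⌋₊ with hN
  set a := ⌊√x⌋₊ with ha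
  have ha6 : 6 ≤ a := Nat.le_floor (by exact_mod_cast hs6)
  have haN : a ≤ N := Nat.floor_le_floor hsle
  have hax : (a:ℝ) ≤ √x := Nat.floor_le (Real.sqrt_nonneg x)
  have hNx : (N:ℝ) ≤ x := Nat.floor_le hx0.le
  have hNx' : x - 1 < N := by linarith [Nat.lt_floor_add_one x]
  have hA : ∀ n : ℕ, 6 ≤ n → n ≤ N → |∑ k ∈ Ioc 0 n, bk (2*m) k| ≤ C0 * x * L^m := by
    intro n hn hnN
    have hnx : (n:ℝ) ≤ x := le_trans (by exact_mod_cast hnN) hNx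
    have := h0 n (by exact_mod_cast hn)
    rw [Nat.floor_natCast, show Finset.Icc 1 n = Ioc 0 n by ext; simp; omega] at this
    refine this.trans ?_
    have : 0 ≤ log n := Real.log_natCast_nonneg n
    have : log n ≤ L := Real.log_le_log (by positivity) hnx
    gcongr
  have hab := abel_anti (fun k => ((bk (2*m) k:ℝ):ℂ)) (fun k => 1/(log k)^(2*m)) a N (2*C0*x*L^m)
    (by positivity) (fun n hn hnN => by
      rw [← Complex.ofReal_sum, Complex.norm_real, Real.norm_eq_abs]
      have e : ∑ k ∈ Ioc a n, bk (2*m) k = ∑ k ∈ Ioc 0 n, bk (2*m) k - ∑ k ∈ Ioc 0 a, bk (2*m) k := by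
        rw [← Finset.sum_Ioc_consecutive _ (by omega : 0 ≤ a) hn.le]; ring
      rw [e]
      refine (abs_sub _ _).trans ?_
      linarith [hA n (by omega) hnN, hA a ha6 haN])
    (fun n hn hnN => by
      have hlog : 0 < log n := Real.log_pos (by exact_mod_cast (by omega : 1 < n))
      have : log n ≤ log ((n+1:ℕ):ℝ) := Real.log_le_log (by exact_mod_cast (by omega : 0 < n)) (by push_cast; linarith)
      apply one_div_le_one_div_of_le (by positivity)
      gcongr)
    (by have := Real.log_natCast_nonneg N; positivity) (by have := Real.log_natCast_nonneg (a+1); positivity)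
  have hwa : 1/(log ((a+1:ℕ):ℝ))^(2*m) ≤ 4^m/L^(2*m) := by
    have hl : L/2 ≤ log ((a+1:ℕ):ℝ) := by
      rw [hL, ← Real.log_sqrt hx0.le]
      apply Real.log_le_log (by linarith)
      push_cast; exact (Nat.lt_floor_add_one _).le
    calc 1/(log ((a+1:ℕ):ℝ))^(2*m) ≤ 1/(L/2)^(2*m) := by
          apply one_div_le_one_div_of_le (by positivity)
          gcongr
      _ = _ := by rw [div_pow, pow_mul 2]; norm_num
  have hsum2 : |∑ n ∈ Ioc a N, (ArithmeticFunction.vonMangoldt n - 1)| ≤ 2*C0*4^m*(x/L^m) := by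
    have e : ((∑ n ∈ Ioc a N, (ArithmeticFunction.vonMangoldt n - 1) : ℝ):ℂ) =
       ∑ n ∈ Ioc a N, ((1/(log n)^(2*m) : ℝ):ℂ) * ((bk (2*m) n:ℝ):ℂ) := by
      rw [Complex.ofReal_sum]
      refine sum_congr rfl fun n hn => ?_
      rw [← Complex.ofReal_mul]
      congr 1
      rw [mem_Ioc] at hn
      have hlog : 0 < log n := Real.log_pos (by exact_mod_cast (by omega : 1 < n))
      unfold bk
      field_simp
    rw [← Real.norm_eq_abs, ← Complex.norm_real, e]
    refine hab.trans ((mul_le_mul_of_nonneg_left hwa (by positivity)).trans (le_of_eq ?_))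
    rw [show L^(2*m) = L^m * L^m by rw [two_mul, pow_add]]
    field_simp
  have hpsi : ∑ n ∈ Ioc 0 a, ArithmeticFunction.vonMangoldt n ≤ 6 * √x := by
    have := Chebyshev.psi_le_const_mul_self (x := (a:ℝ)) (by positivity)
    unfold Chebyshev.psi at this
    rw [Nat.floor_natCast] at this
    have hl4 : log 4 ≤ 2 := by
      rw [show (4:ℝ) = 2^2 by norm_num, Real.log_pow]; push_cast
      linarith [Real.log_two_lt_d9]
    have hlp : 0 ≤ log 4 := Real.log_nonneg (by norm_num)
    nlinarith
  have hpsi0 : 0 ≤ ∑ n ∈ Ioc 0 a, ArithmeticFunction.vonMangoldt n :=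
    Finset.sum_nonneg fun n _ => ArithmeticFunction.vonMangoldt_nonneg
  have hfin : Chebyshev.psi x - x = (∑ n ∈ Ioc 0 a, ArithmeticFunction.vonMangoldt n) - a
      + ∑ n ∈ Ioc a N, (ArithmeticFunction.vonMangoldt n - 1) + (N - x) := by
    unfold Chebyshev.psi
    rw [← hN, ← Finset.sum_Ioc_consecutive _ (by omega : 0 ≤ a) haN, Finset.sum_sub_distrib, Finset.sum_const,
      Nat.card_Ioc, nsmul_eq_mul, Nat.cast_sub haN]
    ring
  have hsq := h1 x hx
  rw [← hL] at hsq
  have hsq2 : √x ≤ C1 * (x/L^m) := by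
    refine le_trans ?_ hsq
    nlinarith
  have ha0 : (0:ℝ) ≤ a := by positivity
  rw [hfin, add_mul]
  have := abs_le.mp hsum2
  rw [abs_le]
  constructor
  · linarith
  · linarith

lemma pnt_theta (m : ℕ) : ∃ C > 0, ∀ x : ℝ, 36 ≤ x → |Chebyshev.theta x - x| ≤ C * (x/(log x)^m) := by
  obtain ⟨C0, hC0, h0⟩ := pnt_psi m
  obtain ⟨C1, hC1, h1⟩ := sqrt_logpow_le m
  refine ⟨C0 + 2*C1, by positivity, fun x hx => ?_⟩
  have a1 := h0 x hx
  have a2 := h1 x hx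
  have a3 := Chebyshev.abs_psi_sub_theta_le_sqrt_mul_log (x := x) (by linarith)
  have a4 : 0 ≤ √x := Real.sqrt_nonneg x
  have e : Chebyshev.theta x - x = (Chebyshev.psi x - x) - (Chebyshev.psi x - Chebyshev.theta x) := by ring
  rw [e]
  refine (abs_sub _ _).trans ?_
  rw [add_mul]
  linarith

open ArithmeticFunction in
lemma vaughan_id (l m : ArithmeticFunction ℝ) :
    (vonMangoldt : ArithmeticFunction ℝ) = l + m * ArithmeticFunction.log - l * m * (zeta : ArithmeticFunction ℝ)
      + ((moebius : ArithmeticFunction ℝ) - m) * ((vonMangoldt - l) * (zeta : ArithmeticFunction ℝ)) := by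
  have h1 : vonMangoldt * (zeta : ArithmeticFunction ℝ) = ArithmeticFunction.log := vonMangoldt_mul_zeta
  have h2 : (moebius : ArithmeticFunction ℝ) * (zeta : ArithmeticFunction ℝ) = 1 := coe_moebius_mul_coe_zeta
  linear_combination m * h1 + (l - vonMangoldt) * h2

/-- truncation -/
noncomputable def trunc (g : ArithmeticFunction ℝ) (U : ℝ) : ArithmeticFunction ℝ :=
  ⟨fun n => if (n:ℝ) ≤ U then g n else 0, by simp⟩

lemma trunc_apply (g : ArithmeticFunction ℝ) (U : ℝ) (n : ℕ) : trunc g U n = if (n:ℝ) ≤ U then g n else 0 := rfl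

lemma sum_conv (g h : ArithmeticFunction ℝ) (f : ℕ → ℂ) (N : ℕ) (hf : ∀ n, N < n → f n = 0) :
    ∑ n ∈ Ioc 0 N, (((g * h) n : ℝ) : ℂ) * f n =
      ∑ k ∈ Ioc 0 N, ∑ l ∈ Ioc 0 N, (g k : ℂ) * (h l : ℂ) * f (k * l) := by
  have h1 : ∀ n ∈ Ioc 0 N, (((g * h) n : ℝ) : ℂ) * f n =
      ∑ x ∈ ((Ioc 0 N ×ˢ Ioc 0 N).filter (fun x => x.1 * x.2 ≤ N)).filter (fun x => x.1 * x.2 = n),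
        (g x.1 : ℂ) * (h x.2 : ℂ) * f (x.1 * x.2) := by
    intro n hn
    rw [mem_Ioc] at hn
    rw [ArithmeticFunction.mul_apply, Complex.ofReal_sum, Finset.sum_mul]
    have : ((Ioc 0 N ×ˢ Ioc 0 N).filter (fun x => x.1 * x.2 ≤ N)).filter (fun x => x.1 * x.2 = n)
        = n.divisorsAntidiagonal := by
      ext ⟨x, y⟩
      simp only [mem_filter, Finset.mem_product, mem_Ioc, Nat.mem_divisorsAntidiagonal]
      constructor
      · rintro ⟨_, h⟩; exact ⟨h, by omega⟩
      · rintro ⟨h, h0⟩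
        have hx : 0 < x := Nat.pos_of_ne_zero (by rintro rfl; simp at h; omega)
        have hy : 0 < y := Nat.pos_of_ne_zero (by rintro rfl; simp at h; omega)
        have : x ≤ x * y := Nat.le_mul_of_pos_right x hy
        have : y ≤ x * y := Nat.le_mul_of_pos_left y hx
        exact ⟨⟨⟨⟨hx, by omega⟩, ⟨hy, by omega⟩⟩, by omega⟩, h⟩
    rw [this]
    refine sum_congr rfl fun x hx => ?_
    rw [Nat.mem_divisorsAntidiagonal] at hx
    rw [hx.1]; push_cast; ring
  rw [sum_congr rfl h1, Finset.sum_fiberwise_of_maps_to, Finset.sum_filter, Finset.sum_product]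
  · refine sum_congr rfl fun k _ => sum_congr rfl fun l _ => ?_
    split_ifs with h
    · rfl
    · simp only at h ⊢
      rw [hf _ (by omega)]; simp
  · rintro ⟨x, y⟩ hx
    simp only [mem_filter, Finset.mem_product, mem_Ioc] at hx ⊢
    exact ⟨Nat.mul_pos hx.1.1.1 hx.1.2.1, hx.2⟩

noncomputable def vf (θ c : ℝ) (a b : ℕ) (n : ℕ) : ℂ := if a < n ∧ n ≤ b then ee (θ * (n:ℝ)^c) else 0

lemma norm_vf_le (θ c : ℝ) (a b n : ℕ) : ‖vf θ c a b n‖ ≤ 1 := by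
  unfold vf; split_ifs
  · rw [norm_ee]
  · simp

/-- convolution with truncated functions: bound by log -/
lemma conv_abs_le (g h : ArithmeticFunction ℝ) (hg : ∀ n, |g n| ≤ ArithmeticFunction.vonMangoldt n)
    (hh : ∀ n, |h n| ≤ 1) (n : ℕ) : |(g * h) n| ≤ log n := by
  rw [← ArithmeticFunction.log_apply, ← ArithmeticFunction.vonMangoldt_mul_zeta, ArithmeticFunction.mul_apply,
    ArithmeticFunction.mul_apply]
  refine (Finset.abs_sum_le_sum_abs _ _).trans (sum_le_sum fun x hx => ?_)
  rw [Nat.mem_divisorsAntidiagonal] at hx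
  have h2 : x.2 ≠ 0 := by rintro h; rw [h] at hx; simp at hx; omega
  rw [abs_mul, ArithmeticFunction.natCoe_apply, ArithmeticFunction.zeta_apply, if_neg h2]
  push_cast
  exact mul_le_mul (hg _) (hh _) (abs_nonneg _) ArithmeticFunction.vonMangoldt_nonneg

lemma innerE (c : ℝ) (hc : 1 < c) (hcn : ∀ n : ℕ, c ≠ n) : ∃ δ C X0 : ℝ, 0 < δ ∧ δ ≤ 1/4 ∧ 0 < C ∧ 1 ≤ X0 ∧
    ∀ (X M : ℝ) (a b : ℕ) (y : ℝ), X0 ≤ X → X^(1/4:ℝ)/64 ≤ M → M ≤ X → M ≤ a → (b:ℝ) ≤ 32 * M → y ≠ 0 →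
      |y| * M^c ≤ X^(c+2) → ‖∑ m ∈ Ioc a b, ee (y * (m:ℝ)^c)‖ ≤ C * (M * (1/(|y| * M^c) + X^(-δ))) := by
  obtain ⟨K, hK⟩ := exists_nat_gt (5*(c+2))
  obtain ⟨δ, C, hδ, hδ4, hC, h⟩ := exp_sum_E c 32 hc hcn (by norm_num) K
  refine ⟨δ/5, C, 64^20, by positivity, by linarith, hC, by norm_num, ?_⟩
  intro X M a b y hX hM hMX hMa hb hy hyM
  have hX0 : (0:ℝ) < X := by linarith [show (0:ℝ) < 64^20 by norm_num]
  have hX1 : (1:ℝ) ≤ X := by linarith [show (1:ℝ) ≤ 64^20 by norm_num]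
  have hM5 : X^(1/5:ℝ) ≤ M := by
    refine le_trans ?_ hM
    rw [le_div_iff₀ (by norm_num)]
    have h64 : (64:ℝ) ≤ X^(1/20:ℝ) := by
      calc (64:ℝ) = ((64:ℝ)^20)^(1/20:ℝ) := by
            rw [← Real.rpow_natCast, ← Real.rpow_mul (by norm_num)]; norm_num
        _ ≤ _ := Real.rpow_le_rpow (by norm_num) hX (by norm_num)
    calc X^(1/5:ℝ) * 64 ≤ X^(1/5:ℝ) * X^(1/20:ℝ) := by gcongr
      _ = X^(1/4:ℝ) := by rw [← Real.rpow_add hX0]; norm_num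
  have hM1 : 1 ≤ M := le_trans (Real.one_le_rpow hX1 (by norm_num)) hM5
  have hM0 : 0 < M := by linarith
  refine (h M a b y hM1 hMa hb hy (hyM.trans ?_)).trans ?_
  · calc X^(c+2) = (X^(1/5:ℝ))^(5*(c+2)) := by rw [← Real.rpow_mul hX0.le]; congr 1; ring
      _ ≤ M^(5*(c+2)) := Real.rpow_le_rpow (by positivity) hM5 (by linarith)
      _ ≤ _ := Real.rpow_le_rpow_of_exponent_le hM1 (by linarith)
  · refine mul_le_mul_of_nonneg_left ?_ hC.le
    rw [mul_add, mul_one_div]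
    refine add_le_add le_rfl ?_
    rw [sub_eq_add_neg, Real.rpow_add hM0, Real.rpow_one]
    refine mul_le_mul_of_nonneg_left ?_ hM0.le
    calc M^(-δ) ≤ (X^(1/5:ℝ))^(-δ) := Real.rpow_le_rpow_of_nonpos (by positivity) hM5 (by linarith)
      _ = X^(-(δ/5)) := by rw [← Real.rpow_mul hX0.le]; congr 1; ring

def InnerE (c δ C X0 : ℝ) : Prop := ∀ (X M : ℝ) (a b : ℕ) (y : ℝ), X0 ≤ X → X^(1/4:ℝ)/64 ≤ M → M ≤ X → M ≤ a → (b:ℝ) ≤ 32 * M → y ≠ 0 →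
      |y| * M^c ≤ X^(c+2) → ‖∑ m ∈ Ioc a b, ee (y * (m:ℝ)^c)‖ ≤ C * (M * (1/(|y| * M^c) + X^(-δ)))

lemma div_lower (X : ℝ) (d : ℕ) (hd : 1 ≤ d) (h : 32 * (d:ℝ) ≤ X) : X/(16*d) ≤ ((⌊X/8⌋₊/d : ℕ) : ℝ) := by
  have hd0 : (1:ℝ) ≤ d := by exact_mod_cast hd
  have h1 : X/8 < ⌊X/8⌋₊ + 1 := Nat.lt_floor_add_one _
  have h2 : (⌊X/8⌋₊ : ℝ) < d * ((⌊X/8⌋₊/d : ℕ) + 1) := by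
    exact_mod_cast Nat.lt_mul_div_succ ⌊X/8⌋₊ (by omega)
  rw [div_le_iff₀ (by positivity)]
  nlinarith

lemma div_upper (X : ℝ) (hX : 0 ≤ X) (d : ℕ) (hd : 1 ≤ d) : ((⌊X⌋₊/d : ℕ) : ℝ) ≤ X/d := by
  have hd0 : (1:ℝ) ≤ d := by exact_mod_cast hd
  refine Nat.cast_div_le.trans ?_
  gcongr
  exact Nat.floor_le hX

lemma vf_mul (θ c : ℝ) (a b d m : ℕ) (hd : 1 ≤ d) :
    vf θ c a b (d*m) = if m ∈ Ioc (a/d) (b/d) then ee (θ * (d:ℝ)^c * (m:ℝ)^c) else 0 := by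
  unfold vf
  have : (a < d*m ∧ d*m ≤ b) ↔ m ∈ Ioc (a/d) (b/d) := by
    rw [mem_Ioc, Nat.div_lt_iff_lt_mul (by omega), Nat.le_div_iff_mul_le (by omega), mul_comm m d]
  simp only [this]
  split_ifs
  · congr 1
    push_cast
    rw [Real.mul_rpow (by positivity) (by positivity)]; ring
  · rfl

lemma typeI_inner {c δ C X0 : ℝ} (hc : 1 < c) (hδ : 0 < δ) (hC : 0 < C) (hX1 : 1 ≤ X0) (hE : InnerE c δ C X0)
    (X θ : ℝ) (d b' : ℕ) (hX : X0 ≤ X) (hX2 : 1024 ≤ X) (hθ : θ ≠ 0) (hT : |θ| * X^c ≤ X^(c+1))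
    (hd : 1 ≤ d) (hd2 : (d:ℝ) ≤ √X) (hb : b' ≤ ⌊X⌋₊/d) :
    ‖∑ m ∈ Ioc (⌊X/8⌋₊/d) b', ee (θ * (d:ℝ)^c * (m:ℝ)^c)‖ ≤ C * 16^c * ((X/d) * (1/(|θ| * X^c) + X^(-δ))) := by
  have hX0 : 0 < X := by linarith
  have hd0 : (1:ℝ) ≤ d := by exact_mod_cast hd
  have hs : √X * √X = X := Real.mul_self_sqrt hX0.le
  have hs32 : 32 ≤ √X := by rw [Real.le_sqrt (by norm_num) hX0.le]; linarith
  have hdX : 32 * (d:ℝ) ≤ X := by nlinarith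
  have hM : X^(1/4:ℝ)/64 ≤ X/(16*d) := by
    have : √X ≤ X/d := by rw [le_div_iff₀ (by linarith)]; nlinarith
    have h2 : X^(1/4:ℝ) ≤ √X := by
      rw [Real.sqrt_eq_rpow]; exact Real.rpow_le_rpow_of_exponent_le (by linarith) (by norm_num)
    have e : X/(16*d) = X/d/16 := by field_simp
    rw [e]; linarith
  have hbX : (b':ℝ) ≤ X/d := le_trans (by exact_mod_cast hb) (div_upper X hX0.le d hd)
  have e16 : X/(16*d) = X/d/16 := by field_simp
  have hXd0 : 0 < X/d := by positivity
  have hXdX : X/d ≤ X := div_le_self hX0.le hd0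
  have heq : |θ * (d:ℝ)^c| * (X/(16*d))^c = |θ| * X^c / 16^c := by
    rw [abs_mul, abs_of_pos (show (0:ℝ) < (d:ℝ)^c by positivity), Real.div_rpow hX0.le (by positivity),
      Real.mul_rpow (by norm_num) (by positivity)]
    field_simp
  have h16 : (1:ℝ) ≤ 16^c := Real.one_le_rpow (by norm_num) (by linarith)
  have hTp : 0 < |θ| * X^c := by have := abs_pos.mpr hθ; positivity
  have := hE X (X/(16*d)) (⌊X/8⌋₊/d) b' (θ * (d:ℝ)^c) hX hM (by rw [e16]; linarith) (div_lower X d hd hdX)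
    (by rw [e16]; linarith) (by have : (0:ℝ) < (d:ℝ)^c := by positivity
                                exact mul_ne_zero hθ this.ne')
    (by
      rw [heq]
      calc |θ| * X^c/16^c ≤ |θ| * X^c := div_le_self hTp.le h16
        _ ≤ X^(c+1) := hT
        _ ≤ _ := Real.rpow_le_rpow_of_exponent_le (by linarith) (by linarith))
  refine this.trans ?_
  rw [heq, mul_assoc C, e16]
  refine mul_le_mul_of_nonneg_left ?_ hC.le
  have hXδ : 0 < X^(-δ) := by positivity
  have e2 : 1/(|θ| * X^c/16^c) = 16^c * (1/(|θ| * X^c)) := by field_simp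
  rw [e2]
  calc X/d/16 * (16^c * (1/(|θ| * X^c)) + X^(-δ)) ≤ X/d * (16^c * (1/(|θ| * X^c)) + 16^c * X^(-δ)) := by
        refine mul_le_mul (by linarith) ?_ (by positivity) (by positivity)
        refine add_le_add le_rfl ?_
        · exact le_mul_of_one_le_left hXδ.le h16
    _ = _ := by ring

/-- Type I sum bound -/
lemma typeI {c δ C X0 : ℝ} (hc : 1 < c) (hδ : 0 < δ) (hC : 0 < C) (hX1 : 1 ≤ X0) (hE : InnerE c δ C X0)
    (X θ : ℝ) (hX : X0 ≤ X) (hX2 : 1024 ≤ X) (hθ : θ ≠ 0) (hT : |θ| * X^c ≤ X^(c+1))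
    (g : ℕ → ℝ) (h : ℕ → ℝ) (hg : ∀ k : ℕ, 0 < k → (k:ℝ) ≤ √X → |g k| ≤ 1 + log X) (hg0 : ∀ k : ℕ, √X < k → g k = 0)
    (hh : (∀ n, 0 < n → h n = 1) ∨ (∀ n:ℕ, h n = log n)) :
    ‖∑ k ∈ Ioc 0 ⌊X⌋₊, ∑ l ∈ Ioc 0 ⌊X⌋₊, (g k : ℂ) * (h l : ℂ) * vf θ c ⌊X/8⌋₊ ⌊X⌋₊ (k*l)‖
      ≤ 2 * C * 16^c * (1 + log X)^3 * (X * (1/(|θ| * X^c) + X^(-δ))) := by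
  have hX0 : 0 < X := by linarith
  have hL0 : 0 ≤ log X := Real.log_nonneg (by linarith)
  set L := 1 + log X with hL
  have hTp : 0 < |θ| * X^c := by have := abs_pos.mpr hθ; positivity
  set E := 1/(|θ| * X^c) + X^(-δ) with hEdef
  have hEp : 0 < E := by positivity
  have hin : ∀ k ∈ Ioc 0 ⌊X⌋₊, ‖∑ l ∈ Ioc 0 ⌊X⌋₊, (g k : ℂ) * (h l : ℂ) * vf θ c ⌊X/8⌋₊ ⌊X⌋₊ (k*l)‖
      ≤ 2 * C * 16^c * L^2 * X * E * (1/(k:ℝ)) := by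
    intro k hk
    rw [mem_Ioc] at hk
    have hk0 : (0:ℝ) < k := by exact_mod_cast hk.1
    by_cases hks : (k:ℝ) ≤ √X
    · have e1 : ∑ l ∈ Ioc 0 ⌊X⌋₊, (g k : ℂ) * (h l : ℂ) * vf θ c ⌊X/8⌋₊ ⌊X⌋₊ (k*l)
          = (g k : ℂ) * ∑ l ∈ Ioc (⌊X/8⌋₊/k) (⌊X⌋₊/k), (h l : ℂ) * ee (θ * (k:ℝ)^c * (l:ℝ)^c) := by
        rw [mul_sum]
        symm
        have hsub : Ioc (⌊X/8⌋₊/k) (⌊X⌋₊/k) ⊆ Ioc 0 ⌊X⌋₊ := by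
          intro l hl
          rw [mem_Ioc] at hl ⊢
          exact ⟨lt_of_le_of_lt (Nat.zero_le _) hl.1, hl.2.trans (Nat.div_le_self ⌊X⌋₊ k)⟩
        rw [← Finset.sum_subset hsub (f := fun l => (g k : ℂ) * (h l : ℂ) * vf θ c ⌊X/8⌋₊ ⌊X⌋₊ (k*l))]
        · refine sum_congr rfl fun l hl => ?_
          rw [vf_mul _ _ _ _ _ _ hk.1, if_pos hl]; ring
        · intro l _ hl
          rw [vf_mul _ _ _ _ _ _ hk.1, if_neg hl]; ring
      have hpart : ∀ n, ⌊X/8⌋₊/k < n → n ≤ ⌊X⌋₊/k → ‖∑ l ∈ Ioc (⌊X/8⌋₊/k) n, ee (θ * (k:ℝ)^c * (l:ℝ)^c)‖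
          ≤ C * 16^c * ((X/k) * E) := fun n _ hn => typeI_inner hc hδ hC hX1 hE X θ k n hX hX2 hθ hT hk.1 hks hn
      have hM0 : 0 ≤ C * 16^c * ((X/k) * E) := by positivity
      have e2 : ‖∑ l ∈ Ioc (⌊X/8⌋₊/k) (⌊X⌋₊/k), (h l : ℂ) * ee (θ * (k:ℝ)^c * (l:ℝ)^c)‖ ≤ C * 16^c * ((X/k) * E) * (2*L) := by
        rcases hh with hh | hh
        · have : ∑ l ∈ Ioc (⌊X/8⌋₊/k) (⌊X⌋₊/k), (h l : ℂ) * ee (θ * (k:ℝ)^c * (l:ℝ)^c)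
            = ∑ l ∈ Ioc (⌊X/8⌋₊/k) (⌊X⌋₊/k), ee (θ * (k:ℝ)^c * (l:ℝ)^c) := by
            refine sum_congr rfl fun l hl => ?_
            rw [mem_Ioc] at hl
            rw [hh l (lt_of_le_of_lt (Nat.zero_le _) hl.1)]; simp
          rw [this]
          refine (typeI_inner hc hδ hC hX1 hE X θ k _ hX hX2 hθ hT hk.1 hks le_rfl).trans ?_
          exact le_mul_of_one_le_right hM0 (by linarith)
        · have := abel_mono (fun l => ee (θ * (k:ℝ)^c * (l:ℝ)^c)) h (⌊X/8⌋₊/k) (⌊X⌋₊/k) _ hM0 hpart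
            (fun n hn _ => by
              rw [hh, hh]
              apply Real.log_le_log (by exact_mod_cast (lt_of_le_of_lt (Nat.zero_le _) hn : 0 < n))
              push_cast; linarith)
            (by rw [hh]; exact Real.log_natCast_nonneg _) (by rw [hh]; exact Real.log_natCast_nonneg _)
          refine this.trans (mul_le_mul_of_nonneg_left ?_ hM0)
          rw [hh]
          have hu := div_upper X hX0.le k hk.1
          have : X/k ≤ X := div_le_self hX0.le (by exact_mod_cast hk.1)
          have : log ((⌊X⌋₊/k:ℕ):ℝ) ≤ log X := by
            rcases Nat.eq_zero_or_pos (⌊X⌋₊/k) with h0 | h0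
            · rw [h0]; simpa using hL0
            · exact Real.log_le_log (by exact_mod_cast h0) (by linarith)
          linarith
      rw [e1, norm_mul, Complex.norm_real, Real.norm_eq_abs]
      calc |g k| * _ ≤ L * (C * 16^c * ((X/k) * E) * (2*L)) := by
            apply mul_le_mul (hg k hk.1 hks) e2 (norm_nonneg _) (by linarith)
        _ = _ := by field_simp
    · rw [hg0 k (by linarith)]
      simp; positivity
  refine (norm_sum_le _ _).trans ((sum_le_sum hin).trans ?_)
  rw [← mul_sum]
  have hharm : ∑ k ∈ Ioc 0 ⌊X⌋₊, (1/(k:ℝ)) ≤ L := by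
    have h1 := harmonic_le_one_add_log ⌊X⌋₊
    rw [harmonic_eq_sum_Icc] at h1
    push_cast at h1
    have e : ∑ k ∈ Ioc 0 ⌊X⌋₊, (1/(k:ℝ)) = ∑ k ∈ Finset.Icc 1 ⌊X⌋₊, ((k:ℝ))⁻¹ := by
      refine sum_congr (by ext; simp; omega) fun k _ => by rw [one_div]
    rw [e]
    refine h1.trans ?_
    have : log (⌊X⌋₊:ℝ) ≤ log X := Real.log_le_log (by exact_mod_cast Nat.floor_pos.mpr (by linarith)) (Nat.floor_le hX0.le)
    linarith
  calc _ ≤ 2 * C * 16^c * L^2 * X * E * L := by gcongr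
    _ = _ := by ring

lemma harm_le (N : ℕ) (Y : ℝ) (hN : (N:ℝ) ≤ Y) (hY : 1 ≤ Y) : ∑ d ∈ Finset.Icc 1 N, (1/(d:ℝ)) ≤ 1 + log Y := by
  have h1 := harmonic_le_one_add_log N
  rw [harmonic_eq_sum_Icc] at h1
  push_cast at h1
  simp_rw [one_div]
  refine h1.trans ?_
  rcases Nat.eq_zero_or_pos N with h0 | h0
  · rw [h0]; simpa using Real.log_nonneg hY
  · linarith [Real.log_le_log (by exact_mod_cast h0) hN]

lemma harm_pair {ι : Type*} [DecidableEq ι] (S : Finset ι) (φ : ι → ℤ) (hφ : Set.InjOn φ S) (x : ℤ) (N : ℕ) (Y : ℝ)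
    (hN : (N:ℝ) ≤ Y) (hY : 1 ≤ Y) (hS : ∀ i ∈ S, |x - φ i| ≤ N) :
    ∑ i ∈ S.filter (fun i => φ i ≠ x), 1/|(x:ℝ) - φ i| ≤ 2 * (1 + log Y) := by
  classical
  have e1 : ∑ i ∈ S.filter (fun i => φ i ≠ x), 1/|(x:ℝ) - φ i| = ∑ z ∈ (S.filter (fun i => φ i ≠ x)).image φ, 1/|(x:ℝ) - z| := by
    rw [Finset.sum_image]
    intro i hi j hj h
    exact hφ (Finset.mem_coe.mpr (mem_filter.mp hi).1) (Finset.mem_coe.mpr (mem_filter.mp hj).1) h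
  set A := (Finset.Icc 1 N).image (fun d : ℕ => x + (d:ℤ)) with hA
  set B := (Finset.Icc 1 N).image (fun d : ℕ => x - (d:ℤ)) with hB
  have hsub : (S.filter (fun i => φ i ≠ x)).image φ ⊆ A ∪ B := by
    intro z hz
    rw [Finset.mem_image] at hz
    obtain ⟨i, hi, rfl⟩ := hz
    rw [mem_filter] at hi
    have h1 := abs_le.mp (hS i hi.1)
    rw [Finset.mem_union, hA, hB, Finset.mem_image, Finset.mem_image]
    rcases lt_or_gt_of_ne hi.2 with h | h
    · right
      exact ⟨(x - φ i).toNat, by rw [Finset.mem_Icc]; omega, by omega⟩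
    · left
      exact ⟨(φ i - x).toNat, by rw [Finset.mem_Icc]; omega, by omega⟩
  have hAs : ∑ z ∈ A, 1/|(x:ℝ) - z| = ∑ d ∈ Finset.Icc 1 N, (1/(d:ℝ)) := by
    rw [hA, Finset.sum_image (fun a _ b _ h => by simpa using h)]
    refine sum_congr rfl fun d _ => ?_
    push_cast
    rw [show (x:ℝ) - (x + d) = -d by ring, abs_neg, abs_of_nonneg (by positivity)]
  have hBs : ∑ z ∈ B, 1/|(x:ℝ) - z| = ∑ d ∈ Finset.Icc 1 N, (1/(d:ℝ)) := by
    rw [hB, Finset.sum_image (fun a _ b _ h => by simpa using h)]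
    refine sum_congr rfl fun d _ => ?_
    push_cast
    rw [show (x:ℝ) - (x - d) = d by ring, abs_of_nonneg (by positivity)]
  rw [e1]
  refine (Finset.sum_le_sum_of_subset_of_nonneg hsub (fun _ _ _ => by positivity)).trans ?_
  have h2 := Finset.sum_union_inter (s₁ := A) (s₂ := B) (f := fun z : ℤ => 1/|(x:ℝ) - z|)
  have h3 : 0 ≤ ∑ z ∈ A ∩ B, 1/|(x:ℝ) - z| := Finset.sum_nonneg fun _ _ => by positivity
  have h4 := harm_le N Y hN hY
  rw [hAs, hBs] at h2
  linarith

lemma sq_expand {ι κ : Type*} (I : Finset ι) (J : Finset κ) (a : ι → ℂ) (ha : ∀ i ∈ I, ‖a i‖ ≤ 1) (z : ι → κ → ℂ) :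
    ∑ l ∈ J, ‖∑ k ∈ I, a k * z k l‖^2 ≤ ∑ i ∈ I, ∑ j ∈ I, ‖∑ l ∈ J, z i l * (starRingEnd ℂ) (z j l)‖ := by
  have h1 : ((∑ l ∈ J, ‖∑ k ∈ I, a k * z k l‖^2 : ℝ) : ℂ) =
      ∑ i ∈ I, ∑ j ∈ I, a i * (starRingEnd ℂ) (a j) * ∑ l ∈ J, z i l * (starRingEnd ℂ) (z j l) := by
    have : ∀ l ∈ J, ((‖∑ k ∈ I, a k * z k l‖^2 : ℝ) : ℂ) = ∑ i ∈ I, ∑ j ∈ I, a i * (starRingEnd ℂ) (a j) * (z i l * (starRingEnd ℂ) (z j l)) := by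
      intro l _
      push_cast
      rw [← Complex.mul_conj', map_sum, Finset.sum_mul_sum]
      refine sum_congr rfl fun i _ => sum_congr rfl fun j _ => ?_
      rw [map_mul]; ring
    rw [Complex.ofReal_sum, sum_congr rfl this, Finset.sum_comm]
    refine sum_congr rfl fun i _ => ?_
    rw [Finset.sum_comm]
    refine sum_congr rfl fun j _ => ?_
    rw [mul_sum]
  have h2 : ∑ l ∈ J, ‖∑ k ∈ I, a k * z k l‖^2 = ‖((∑ l ∈ J, ‖∑ k ∈ I, a k * z k l‖^2 : ℝ) : ℂ)‖ := by
    rw [Complex.norm_real, Real.norm_eq_abs, abs_of_nonneg (Finset.sum_nonneg fun _ _ => by positivity)]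
  rw [h2, h1]
  refine (norm_sum_le _ _).trans (sum_le_sum fun i hi => (norm_sum_le _ _).trans (sum_le_sum fun j hj => ?_))
  rw [norm_mul, norm_mul, RCLike.norm_conj]
  refine mul_le_of_le_one_left (norm_nonneg _) ?_
  exact mul_le_one₀ (ha i hi) (norm_nonneg _) (ha j hj)

lemma cauchy_norm {κ : Type*} (J : Finset κ) (b : κ → ℝ) (z : κ → ℂ) :
    ‖∑ l ∈ J, (b l : ℂ) * z l‖^2 ≤ (∑ l ∈ J, (b l)^2) * ∑ l ∈ J, ‖z l‖^2 := by
  have h1 : ‖∑ l ∈ J, (b l : ℂ) * z l‖ ≤ ∑ l ∈ J, |b l| * ‖z l‖ := by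
    refine (norm_sum_le _ _).trans (le_of_eq (sum_congr rfl fun l _ => ?_))
    rw [norm_mul, Complex.norm_real, Real.norm_eq_abs]
  have h2 := Finset.sum_mul_sq_le_sq_mul_sq J (fun l => |b l|) (fun l => ‖z l‖)
  simp only [sq_abs] at h2
  exact (pow_le_pow_left₀ (norm_nonneg _) h1 2).trans h2

lemma rpow_sub_lower (c x y : ℝ) (hc : 1 < c) (hy : 0 < y) (hxy : y ≤ x) : (x - y) * y^(c-1) ≤ x^c - y^c := by
  have hx : 0 < x := by linarith
  have e1 : x^c = x * x^(c-1) := by rw [← Real.rpow_one_add' hx.le (by linarith)]; congr 1; ring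
  have e2 : y^c = y * y^(c-1) := by rw [← Real.rpow_one_add' hy.le (by linarith)]; congr 1; ring
  have h : y^(c-1) ≤ x^(c-1) := Real.rpow_le_rpow hy.le hxy (by linarith)
  rw [e1, e2, sub_mul]
  have := mul_le_mul_of_nonneg_left h hx.le
  linarith

lemma rpow_sub_abs (c K x y : ℝ) (hc : 1 < c) (hK : 0 < K) (hx : K ≤ x) (hy : K ≤ y) (hx2 : x ≤ 2*K) (hy2 : y ≤ 2*K) :
    |x - y| * K^(c-1) ≤ |x^c - y^c| ∧ |x^c - y^c| ≤ (2*K)^c := by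
  have key : ∀ u v : ℝ, K ≤ u → u ≤ v → v ≤ 2*K → |v - u| * K^(c-1) ≤ |v^c - u^c| ∧ |v^c - u^c| ≤ (2*K)^c := by
    intro u v hu huv hv
    have h1 := rpow_sub_lower c v u hc (by linarith) huv
    have h2 : K^(c-1) ≤ u^(c-1) := Real.rpow_le_rpow hK.le hu (by linarith)
    have h3 : (v-u) * K^(c-1) ≤ (v-u)*u^(c-1) := mul_le_mul_of_nonneg_left h2 (by linarith)
    have h0 : 0 ≤ (v-u) * K^(c-1) := mul_nonneg (by linarith) (by positivity)
    rw [abs_of_nonneg (by linarith : 0 ≤ v-u), abs_of_nonneg (by linarith : 0 ≤ v^c-u^c)]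
    refine ⟨by linarith, ?_⟩
    have h4 : v^c ≤ (2*K)^c := Real.rpow_le_rpow (by linarith) hv (by linarith)
    have h5 : 0 ≤ u^c := Real.rpow_nonneg (by linarith) _
    linarith
  rcases le_total x y with h | h
  · rw [abs_sub_comm x y, abs_sub_comm (x^c)]
    exact key x y hx h hy2
  · exact key y x hy h hx2

lemma vf_pair_sum (θ c : ℝ) (a b k1 k2 R : ℕ) (h1 : 1 ≤ k1) (h2 : 1 ≤ k2) (hR1 : b/k1 ≤ R) :
    ∑ l ∈ Ioc 0 R, vf θ c a b (k1*l) * (starRingEnd ℂ) (vf θ c a b (k2*l)) =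
      ∑ l ∈ Ioc (max (a/k1) (a/k2)) (min (b/k1) (b/k2)), ee (θ * ((k1:ℝ)^c - (k2:ℝ)^c) * (l:ℝ)^c) := by
  symm
  have hsub : Ioc (max (a/k1) (a/k2)) (min (b/k1) (b/k2)) ⊆ Ioc 0 R := by
    intro l hl
    rw [mem_Ioc] at hl ⊢
    exact ⟨lt_of_le_of_lt (Nat.zero_le _) hl.1, (hl.2.trans (min_le_left _ _)).trans hR1⟩
  have hiff : ∀ l, l ∈ Ioc (max (a/k1) (a/k2)) (min (b/k1) (b/k2)) ↔
      l ∈ Ioc (a/k1) (b/k1) ∧ l ∈ Ioc (a/k2) (b/k2) := by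
    intro l
    simp only [mem_Ioc, max_lt_iff, le_min_iff]
    tauto
  rw [← Finset.sum_subset hsub (f := fun l => vf θ c a b (k1*l) * (starRingEnd ℂ) (vf θ c a b (k2*l)))]
  · refine sum_congr rfl fun l hl => ?_
    have hl' := (hiff l).mp hl
    rw [vf_mul _ _ _ _ _ _ h1, vf_mul _ _ _ _ _ _ h2, if_pos hl'.1, if_pos hl'.2, ← ee_sub]
    congr 1; ring
  · intro l _ hl
    rw [hiff, not_and_or] at hl
    rw [vf_mul _ _ _ _ _ _ h1, vf_mul _ _ _ _ _ _ h2]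
    rcases hl with hl | hl
    · rw [if_neg hl]; simp
    · rw [if_neg hl]; simp

lemma typeII_pair {c δ C X0 : ℝ} (hc : 1 < c) (hC : 0 < C) (hE : InnerE c δ C X0)
    (X θ : ℝ) (K k1 k2 : ℕ) (hX : X0 ≤ X) (hX2 : 64^4 ≤ X) (hθ : θ ≠ 0) (hT : |θ| * X^c ≤ X^(c+1))
    (hK1 : 1 ≤ K) (hK : (K:ℝ) ≤ X^(3/4:ℝ)) (hk1 : k1 ∈ Ioc K (2*K)) (hk2 : k2 ∈ Ioc K (2*K)) (hne : k1 ≠ k2) :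
    ‖∑ l ∈ Ioc 0 (⌊X⌋₊/K), vf θ c ⌊X/8⌋₊ ⌊X⌋₊ (k1*l) * (starRingEnd ℂ) (vf θ c ⌊X/8⌋₊ ⌊X⌋₊ (k2*l))‖
      ≤ C * 32^c * (X/(|θ| * X^c)) * (1/|(k1:ℝ)-k2|) + C * (X/K) * X^(-δ) := by
  have hX0 : 0 < X := by linarith [show (0:ℝ) < 64^4 by norm_num]
  have hX1 : 1 ≤ X := by linarith [show (1:ℝ) ≤ 64^4 by norm_num]
  rw [mem_Ioc] at hk1 hk2
  have hKr : (1:ℝ) ≤ K := by exact_mod_cast hK1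
  have hk1r : (K:ℝ) ≤ k1 := by exact_mod_cast hk1.1.le
  have hk2r : (K:ℝ) ≤ k2 := by exact_mod_cast hk2.1.le
  have hk1s : (k1:ℝ) ≤ 2*K := by exact_mod_cast hk1.2
  have hk2s : (k2:ℝ) ≤ 2*K := by exact_mod_cast hk2.2
  have h64 : (64:ℝ) ≤ X^(1/4:ℝ) := by
    calc (64:ℝ) = ((64:ℝ)^4)^(1/4:ℝ) := by
          rw [← Real.rpow_natCast, ← Real.rpow_mul (by norm_num)]; norm_num
      _ ≤ _ := Real.rpow_le_rpow (by norm_num) hX2 (by norm_num)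
  have hXq : X^(3/4:ℝ) * X^(1/4:ℝ) = X := by rw [← Real.rpow_add hX0]; norm_num
  have hKX : 64 * (K:ℝ) ≤ X := by
    calc 64 * (K:ℝ) ≤ X^(1/4:ℝ) * X^(3/4:ℝ) := by gcongr
      _ = X := by rw [mul_comm]; exact hXq
  rw [vf_pair_sum _ _ _ _ _ _ _ (by omega) (by omega) (Nat.div_le_div_left hk1.1.le (by omega))]
  set M := X/(32*K) with hM
  have hM0 : 0 < M := by positivity
  have hMK : X/K = 32*M := by rw [hM]; field_simp
  obtain ⟨g1, g2⟩ := rpow_sub_abs c K k1 k2 hc (by linarith) hk1r hk2r hk1s hk2s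
  set D := |(k1:ℝ) - k2| with hD
  have hDp : 0 < D := abs_pos.mpr (sub_ne_zero.mpr (by exact_mod_cast hne))
  set y := θ * ((k1:ℝ)^c - (k2:ℝ)^c) with hy
  have hyabs : |y| = |θ| * |(k1:ℝ)^c - (k2:ℝ)^c| := abs_mul _ _
  have hθp := abs_pos.mpr hθ
  have hylow : |θ| * (D * (K:ℝ)^(c-1)) ≤ |y| := by rw [hyabs]; gcongr
  have hypos : 0 < |y| := lt_of_lt_of_le (by positivity) hylow
  have hMc : M^c = X^c/(32^c * (K:ℝ)^c) := by
    rw [hM, Real.div_rpow hX0.le (by positivity), Real.mul_rpow (by norm_num) (by positivity)]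
  have hKc : (K:ℝ)^c = (K:ℝ)^(c-1) * K := by
    rw [← Real.rpow_add_one (by positivity)]; congr 1; ring
  have hyM : |θ| * X^c * D / (32^c * K) ≤ |y| * M^c := by
    calc |θ| * X^c * D / (32^c * K) = (|θ| * (D * (K:ℝ)^(c-1))) * M^c := by
          rw [hMc, hKc]; field_simp
      _ ≤ _ := by gcongr
  have hM1 : X^(1/4:ℝ)/64 ≤ M := by
    rw [hM, div_le_div_iff₀ (by norm_num) (by positivity)]
    calc X^(1/4:ℝ) * (32 * K) ≤ X^(1/4:ℝ) * (32 * X^(3/4:ℝ)) := by gcongr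
      _ = 32 * (X^(3/4:ℝ) * X^(1/4:ℝ)) := by ring
      _ = 32 * X := by rw [hXq]
      _ ≤ _ := by linarith
  have hMX : M ≤ X := div_le_self hX0.le (by linarith)
  have hMa : M ≤ ((max (⌊X/8⌋₊/k1) (⌊X/8⌋₊/k2) : ℕ):ℝ) := by
    have h1 := div_lower X k1 (by omega) (by linarith)
    have h2 : M ≤ X/(16*k1) := by
      rw [hM]; apply div_le_div_of_nonneg_left hX0.le (by linarith); linarith
    refine (h2.trans h1).trans ?_
    exact_mod_cast le_max_left _ _
  have hMb : ((min (⌊X⌋₊/k1) (⌊X⌋₊/k2) : ℕ):ℝ) ≤ 32 * M := by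
    have h1 := div_upper X hX0.le k1 (by omega)
    have h2 : X/k1 ≤ X/K := by
      apply div_le_div_of_nonneg_left hX0.le (by linarith) hk1r
    rw [← hMK]
    refine le_trans ?_ (h1.trans h2)
    exact_mod_cast min_le_left _ _
  have hup : |y| * M^c ≤ X^(c+2) := by
    calc |y| * M^c ≤ (|θ| * (2*K)^c) * (X^c/(32^c * (K:ℝ)^c)) := by rw [hyabs, hMc]; gcongr
      _ = |θ| * X^c * (2^c/32^c) := by
        rw [Real.mul_rpow (by norm_num) (by positivity)]; field_simp
      _ ≤ |θ| * X^c * 1 := by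
        gcongr
        rw [div_le_one (by positivity)]
        exact Real.rpow_le_rpow (by norm_num) (by norm_num) (by linarith)
      _ ≤ X^(c+1) := by rw [mul_one]; exact hT
      _ ≤ _ := Real.rpow_le_rpow_of_exponent_le hX1 (by linarith)
  refine (hE X M _ _ y hX hM1 hMX hMa hMb (abs_pos.mp hypos) hup).trans ?_
  have hinv : 1/(|y| * M^c) ≤ 32^c * K/(|θ| * X^c * D) := by
    calc 1/(|y| * M^c) ≤ 1/(|θ| * X^c * D / (32^c * K)) := one_div_le_one_div_of_le (by positivity) hyM
      _ = _ := by rw [one_div_div]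
  have hδp : 0 < X^(-δ) := by positivity
  calc C * (M * (1/(|y| * M^c) + X^(-δ))) ≤ C * (M * (32^c * K/(|θ| * X^c * D) + X^(-δ))) := by gcongr
    _ = C * 32^c * (X/(|θ| * X^c)) * (1/D) * (1/32) + C * (X/K) * X^(-δ) * (1/32) := by
        rw [hM]; field_simp
    _ ≤ C * 32^c * (X/(|θ| * X^c)) * (1/D) * 1 + C * (X/K) * X^(-δ) * 1 := by gcongr <;> norm_num
    _ = _ := by ring

set_option maxHeartbeats 400000 in
lemma typeII_block {c δ C X0 : ℝ} (hc : 1 < c) (hC : 0 < C) (hE : InnerE c δ C X0)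
    (X θ Lg : ℝ) (K : ℕ) (hX : X0 ≤ X) (hX2 : 64^4 ≤ X) (hθ : θ ≠ 0) (hT : |θ| * X^c ≤ X^(c+1))
    (hK1 : 1 ≤ K) (hK : (K:ℝ) ≤ X^(3/4:ℝ)) (a b : ℕ → ℝ) (ha : ∀ k, |a k| ≤ 1)
    (hb : ∀ l : ℕ, 0 < l → (l:ℝ) ≤ X → |b l| ≤ Lg) :
    ‖∑ k ∈ Ioc K (2*K), ∑ l ∈ Ioc 0 ⌊X⌋₊, (a k:ℂ) * (b l:ℂ) * vf θ c ⌊X/8⌋₊ ⌊X⌋₊ (k*l)‖^2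
      ≤ Lg^2 * X^2 * (1/K + 2 * C * 32^c * ((1 + log X)/(|θ| * X^c)) + C * X^(-δ)) := by
  have hX0 : 0 < X := by linarith [show (0:ℝ) < 64^4 by norm_num]
  have hX1 : 1 ≤ X := by linarith [show (1:ℝ) ≤ 64^4 by norm_num]
  have hKr : (1:ℝ) ≤ K := by exact_mod_cast hK1
  set F := vf θ c ⌊X/8⌋₊ ⌊X⌋₊ with hF
  set R := ⌊X⌋₊/K with hR
  have hRX : (R:ℝ) ≤ X/K := div_upper X hX0.le K hK1
  have hRN : R ≤ ⌊X⌋₊ := Nat.div_le_self _ _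
  have hL0 : 0 ≤ log X := Real.log_nonneg hX1
  have hKX : (K:ℝ) ≤ X := hK.trans (by
    calc X^(3/4:ℝ) ≤ X^(1:ℝ) := Real.rpow_le_rpow_of_exponent_le hX1 (by norm_num)
      _ = X := Real.rpow_one X)
  have e1 : ∑ k ∈ Ioc K (2*K), ∑ l ∈ Ioc 0 ⌊X⌋₊, (a k:ℂ) * (b l:ℂ) * F (k*l)
      = ∑ l ∈ Ioc 0 R, (b l:ℂ) * ∑ k ∈ Ioc K (2*K), (a k:ℂ) * F (k*l) := by
    rw [Finset.sum_comm]
    symm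
    rw [← Finset.sum_subset (Finset.Ioc_subset_Ioc le_rfl hRN)
      (f := fun l => ∑ k ∈ Ioc K (2*K), (a k:ℂ) * (b l:ℂ) * F (k*l))]
    · refine sum_congr rfl fun l _ => ?_
      rw [mul_sum]
      refine sum_congr rfl fun k _ => by ring
    · intro l _ hl
      rw [mem_Ioc, not_and_or] at hl
      refine Finset.sum_eq_zero fun k hk => ?_
      rw [mem_Ioc] at hk
      rw [hF, vf_mul _ _ _ _ _ _ (by omega), if_neg, mul_zero]
      rw [mem_Ioc, not_and_or]
      rcases hl with hl | hl
      · left; exact fun h => hl (lt_of_le_of_lt (Nat.zero_le _) h)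
      · right; exact fun h => hl (h.trans (Nat.div_le_div_left hk.1.le (by omega)))
  have hb2 : ∑ l ∈ Ioc 0 R, (b l)^2 ≤ X/K * Lg^2 := by
    calc ∑ l ∈ Ioc 0 R, (b l)^2 ≤ ∑ l ∈ Ioc 0 R, Lg^2 := by
          refine sum_le_sum fun l hl => ?_
          rw [mem_Ioc] at hl
          rw [← sq_abs]
          refine pow_le_pow_left₀ (abs_nonneg _) (hb l hl.1 ?_) 2
          exact le_trans (by exact_mod_cast hl.2.trans hRN) (Nat.floor_le hX0.le)
      _ = R * Lg^2 := by rw [Finset.sum_const, Nat.card_Ioc, nsmul_eq_mul]; simp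
      _ ≤ _ := by gcongr
  have hz := sq_expand (Ioc K (2*K)) (Ioc 0 R) (fun k => (a k:ℂ))
    (fun k _ => by rw [Complex.norm_real, Real.norm_eq_abs]; exact ha k) (fun k l => F (k*l))
  have hrow : ∀ i ∈ Ioc K (2*K), ∑ j ∈ Ioc K (2*K), ‖∑ l ∈ Ioc 0 R, F (i*l) * (starRingEnd ℂ) (F (j*l))‖
      ≤ X/K + (C * 32^c * (X/(|θ| * X^c)) * (2 * (1 + log X)) + K * (C * (X/K) * X^(-δ))) := by
    intro i hi
    rw [← Finset.add_sum_erase _ _ hi]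
    refine add_le_add ?_ ?_
    · refine (norm_sum_le _ _).trans ?_
      calc ∑ l ∈ Ioc 0 R, ‖F (i*l) * (starRingEnd ℂ) (F (i*l))‖ ≤ ∑ l ∈ Ioc 0 R, (1:ℝ) := by
            refine sum_le_sum fun l _ => ?_
            rw [norm_mul, RCLike.norm_conj]
            exact mul_le_one₀ (norm_vf_le _ _ _ _ _) (norm_nonneg _) (norm_vf_le _ _ _ _ _)
        _ = R := by simp
        _ ≤ _ := hRX
    · have hp : ∀ j ∈ (Ioc K (2*K)).erase i, ‖∑ l ∈ Ioc 0 R, F (i*l) * (starRingEnd ℂ) (F (j*l))‖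
          ≤ C * 32^c * (X/(|θ| * X^c)) * (1/|(i:ℝ)-j|) + C * (X/K) * X^(-δ) := by
        intro j hj
        rw [Finset.mem_erase] at hj
        exact typeII_pair hc hC hE X θ K i j hX hX2 hθ hT hK1 hK hi hj.2 hj.1.symm
      refine (sum_le_sum hp).trans ?_
      rw [Finset.sum_add_distrib, ← mul_sum, Finset.sum_const, nsmul_eq_mul]
      have hθp := abs_pos.mpr hθ
      have hh : ∑ j ∈ (Ioc K (2*K)).erase i, 1/|(i:ℝ)-j| ≤ 2 * (1 + log X) := by
        have := harm_pair (Ioc K (2*K)) (fun j : ℕ => (j:ℤ)) (fun x _ y _ h => by simpa using h) (i:ℤ) K X hKX hX1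
          (fun j hj => by
            rw [mem_Ioc] at hi hj
            rw [abs_le]; omega)
        refine le_trans (le_of_eq ?_) this
        refine sum_congr ?_ fun j _ => by push_cast; rfl
        ext j
        simp only [Finset.mem_erase, mem_filter]
        constructor
        · rintro ⟨h1, h2⟩; exact ⟨h2, by exact_mod_cast h1⟩
        · rintro ⟨h1, h2⟩; exact ⟨by exact_mod_cast h2, h1⟩
      have hcard : (((Ioc K (2*K)).erase i).card : ℝ) ≤ K := by
        have h1 := Finset.card_erase_le (s := Ioc K (2*K)) (a := i)
        rw [Nat.card_Ioc] at h1
        exact_mod_cast (by omega : ((Ioc K (2*K)).erase i).card ≤ K)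
      gcongr
  have hz2 : ∑ l ∈ Ioc 0 R, ‖∑ k ∈ Ioc K (2*K), (a k:ℂ) * F (k*l)‖^2
      ≤ K * (X/K + (C * 32^c * (X/(|θ| * X^c)) * (2 * (1 + log X)) + K * (C * (X/K) * X^(-δ)))) := by
    refine hz.trans ((sum_le_sum hrow).trans (le_of_eq ?_))
    rw [Finset.sum_const, Nat.card_Ioc, nsmul_eq_mul, two_mul, Nat.add_sub_cancel]
  rw [e1]
  refine (cauchy_norm _ _ _).trans ?_
  have hθp := abs_pos.mpr hθ
  calc _ ≤ (X/K * Lg^2) * (K * (X/K + (C * 32^c * (X/(|θ| * X^c)) * (2 * (1 + log X)) + K * (C * (X/K) * X^(-δ))))) :=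
        mul_le_mul hb2 hz2 (Finset.sum_nonneg fun _ _ => by positivity) (by positivity)
    _ = _ := by
      have hXc : X^c ≠ 0 := by positivity
      field_simp
      ring

lemma sum_dyadic (f : ℕ → ℂ) (I : ℕ) : ∑ k ∈ Ioc 0 (2^I), f k = f 1 + ∑ i ∈ range I, ∑ k ∈ Ioc (2^i) (2*2^i), f k := by
  induction I with
  | zero => rw [pow_zero, show Ioc 0 1 = {1} from rfl]; simp
  | succ I ih =>
    rw [Finset.sum_range_succ, ← add_assoc, ← ih, pow_succ', Finset.sum_Ioc_consecutive _ (Nat.zero_le _) (by omega)]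

lemma typeII {c δ C X0 : ℝ} (hc : 1 < c) (hC : 0 < C) (hδ4 : δ ≤ 1/4) (hE : InnerE c δ C X0)
    (X θ : ℝ) (hX : X0 ≤ X) (hX2 : 64^4 ≤ X) (hθ : θ ≠ 0) (hT : |θ| * X^c ≤ X^(c+1))
    (a b : ℕ → ℝ) (ha : ∀ k, |a k| ≤ 1) (ha0 : ∀ k : ℕ, (k:ℝ) ≤ X^(1/4:ℝ) → a k = 0)
    (hb0 : ∀ k : ℕ, (k:ℝ) ≤ X^(1/4:ℝ) → b k = 0)
    (hb : ∀ l : ℕ, |b l| ≤ log l) :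
    ‖∑ k ∈ Ioc 0 ⌊X⌋₊, ∑ l ∈ Ioc 0 ⌊X⌋₊, (a k:ℂ) * (b l:ℂ) * vf θ c ⌊X/8⌋₊ ⌊X⌋₊ (k*l)‖
      ≤ 2 * √(2 + C + 2*C*32^c) * (X * (1 + log X)^3 * √(1/(|θ| * X^c) + X^(-δ))) := by
  have hX0 : 0 < X := by linarith [show (0:ℝ) < 64^4 by norm_num]
  have hX1 : 1 ≤ X := by linarith [show (1:ℝ) ≤ 64^4 by norm_num]
  have hL0 : 0 ≤ log X := Real.log_nonneg hX1
  have hθp := abs_pos.mpr hθ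
  set N := ⌊X⌋₊ with hN
  have hN1 : 1 ≤ N := Nat.le_floor (by exact_mod_cast hX1)
  have hNX : (N:ℝ) ≤ X := Nat.floor_le hX0.le
  set I := Nat.log 2 N + 1 with hI
  have hNI : N < 2^I := Nat.lt_pow_succ_log_self (by norm_num) N
  have hIX : (I:ℝ) ≤ 2 * (1 + log X) := by
    have h1 : (2:ℝ)^(Nat.log 2 N) ≤ X := le_trans (by exact_mod_cast Nat.pow_log_le_self 2 (by omega)) hNX
    have h2 := Real.log_le_log (by positivity) h1
    rw [Real.log_pow] at h2
    have h3 := Real.log_two_gt_d9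
    have h4 : (0:ℝ) ≤ (Nat.log 2 N : ℝ) := by positivity
    rw [hI]; push_cast
    nlinarith
  set F := vf θ c ⌊X/8⌋₊ N with hF
  set g : ℕ → ℂ := fun k => ∑ l ∈ Ioc 0 N, (a k:ℂ) * (b l:ℂ) * F (k*l) with hg
  have hU1 : 1 ≤ X^(1/4:ℝ) := Real.one_le_rpow hX1 (by norm_num)
  have hXq : X^(3/4:ℝ) * X^(1/4:ℝ) = X := by rw [← Real.rpow_add hX0]; norm_num
  have e1 : ∑ k ∈ Ioc 0 N, g k = ∑ k ∈ Ioc 0 (2^I), g k := by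
    refine Finset.sum_subset (Finset.Ioc_subset_Ioc le_rfl hNI.le) fun k hk hk2 => ?_
    refine Finset.sum_eq_zero fun l hl => ?_
    rw [mem_Ioc] at hk hk2 hl
    have : N < k * l := lt_of_lt_of_le (by omega) (Nat.le_mul_of_pos_right k hl.1)
    rw [hF, vf, if_neg (by omega), mul_zero]
  have e2 : g 1 = 0 := by
    refine Finset.sum_eq_zero fun l hl => ?_
    rw [ha0 1 (by exact_mod_cast hU1)]; simp
  set z := 1/(|θ| * X^c) + X^(-δ) with hz
  have hz0 : 0 ≤ z := by positivity
  set C' := 2 + C + 2*C*32^c with hC'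
  have hC'0 : 0 ≤ C' := by positivity
  have hblock : ∀ i ∈ range I, ‖∑ k ∈ Ioc (2^i) (2*2^i), g k‖ ≤ log X * X * √(C' * (1 + log X) * z) := by
    intro i _
    by_cases h1 : ((2*2^i : ℕ):ℝ) ≤ X^(1/4:ℝ)
    · rw [Finset.sum_eq_zero]
      · rw [norm_zero]; positivity
      · intro k hk
        rw [mem_Ioc] at hk
        refine Finset.sum_eq_zero fun l hl => ?_
        rw [ha0 k (le_trans (by exact_mod_cast hk.2) h1)]; simp
    by_cases h2 : ((2^i : ℕ):ℝ) ≤ X^(3/4:ℝ)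
    · have := typeII_block hc hC hE X θ (log X) (2^i) hX hX2 hθ hT Nat.one_le_two_pow h2 a b ha (fun l hl hlX =>
        (hb l).trans (Real.log_le_log (by exact_mod_cast hl) hlX))
      push Not at h1
      have hK0 : (0:ℝ) < ((2^i : ℕ):ℝ) := by positivity
      have hK : 1/((2^i:ℕ):ℝ) ≤ 2 * X^(-δ) := by
        have h3 : X^(-(1/4:ℝ)) ≤ X^(-δ) := Real.rpow_le_rpow_of_exponent_le hX1 (by linarith)
        have h4 : 1/((2^i:ℕ):ℝ) ≤ 2 * X^(-(1/4:ℝ)) := by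
          rw [Real.rpow_neg hX0.le, div_le_iff₀ hK0]
          push_cast at h1 ⊢
          have h6 : X^(1/4:ℝ) * (X^(1/4:ℝ))⁻¹ = 1 := mul_inv_cancel₀ (by positivity)
          have h5 : X^(1/4:ℝ) * (X^(1/4:ℝ))⁻¹ ≤ (2 * 2^i) * (X^(1/4:ℝ))⁻¹ := by gcongr
          linarith
        linarith
      have hsq : ‖∑ k ∈ Ioc (2^i) (2*2^i), g k‖^2 ≤ (log X * X)^2 * (C' * (1 + log X) * z) := by
        refine this.trans ?_
        rw [mul_pow]
        refine mul_le_mul_of_nonneg_left ?_ (by positivity)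
        have p1 : 0 < X^(-δ) := by positivity
        have p2 : 0 < 1/(|θ| * X^c) := by positivity
        have e3 : C' * (1 + log X) * z = 2 * C * 32^c * ((1 + log X)/(|θ| * X^c)) + (2 + C) * ((1 + log X)/(|θ| * X^c))
            + (2 + C) * X^(-δ) + ((2+C) * log X + 2*C*32^c*(1+log X)) * X^(-δ) := by
          rw [hC', hz]; ring
        rw [e3]
        have q1 : 0 ≤ (2 + C) * ((1 + log X)/(|θ| * X^c)) := by positivity
        have q2 : 0 ≤ ((2+C) * log X + 2*C*32^c*(1+log X)) * X^(-δ) := by positivity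
        linarith
      have := Real.sqrt_le_sqrt hsq
      rwa [Real.sqrt_sq (norm_nonneg _), Real.sqrt_mul (by positivity), Real.sqrt_sq (by positivity)] at this
    · rw [Finset.sum_eq_zero]
      · rw [norm_zero]; positivity
      · intro k hk
        rw [mem_Ioc] at hk
        push Not at h2
        refine Finset.sum_eq_zero fun l hl => ?_
        by_cases hl2 : (l:ℝ) ≤ X^(1/4:ℝ)
        · rw [hb0 l hl2]; simp
        · push Not at hl2
          rw [hF, vf, if_neg, mul_zero]
          rintro ⟨_, h⟩
          have h4 : ((k * l : ℕ):ℝ) ≤ X := le_trans (by exact_mod_cast h) hNX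
          have h5 : ((2^i:ℕ):ℝ) ≤ k := by exact_mod_cast hk.1.le
          have h6 : X^(3/4:ℝ) * X^(1/4:ℝ) < k * l := by
            apply mul_lt_mul'' (by linarith) hl2 (by positivity) (by positivity)
          push_cast at h4
          linarith
  rw [e1, sum_dyadic, e2, zero_add]
  refine (norm_sum_le _ _).trans ((sum_le_sum hblock).trans ?_)
  rw [Finset.sum_const, Finset.card_range, nsmul_eq_mul, Real.sqrt_mul (by positivity), Real.sqrt_mul (by positivity)]
  have hs : √(1 + log X) ≤ 1 + log X := by
    rw [Real.sqrt_le_left (by positivity)]; nlinarith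
  calc (I:ℝ) * (log X * X * (√C' * √(1 + log X) * √z))
      ≤ (2 * (1 + log X)) * ((1 + log X) * X * (√C' * (1 + log X) * √z)) := by
        gcongr; linarith
    _ = _ := by ring

noncomputable def VV (c X θ : ℝ) : ℂ := ∑ n ∈ Ioc ⌊X/8⌋₊ ⌊X⌋₊, (ArithmeticFunction.vonMangoldt n : ℂ) * ee (θ * (n:ℝ)^c)

lemma trunc_abs_le (g : ArithmeticFunction ℝ) (U : ℝ) (n : ℕ) : |trunc g U n| ≤ |g n| := by
  rw [trunc_apply]; split_ifs
  · exact le_rfl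
  · simp

lemma af_sub_apply (g h : ArithmeticFunction ℝ) (n : ℕ) : (g - h) n = g n - h n := by
  have := congrArg (fun f : ArithmeticFunction ℝ => f n) (sub_add_cancel g h)
  simp only [ArithmeticFunction.add_apply] at this
  linarith

lemma sub_trunc (g : ArithmeticFunction ℝ) (U : ℝ) (n : ℕ) : (g - trunc g U) n = if (n:ℝ) ≤ U then 0 else g n := by
  rw [af_sub_apply, trunc_apply]; split_ifs <;> simp

lemma mul_eq_zero_of (g h : ArithmeticFunction ℝ) (n : ℕ) (H : ∀ d e, d * e = n → g d * h e = 0) : (g * h) n = 0 := by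
  rw [ArithmeticFunction.mul_apply]
  refine Finset.sum_eq_zero fun x hx => ?_
  rw [Nat.mem_divisorsAntidiagonal] at hx
  exact H _ _ hx.1

lemma moebius_abs_le (n : ℕ) : |((ArithmeticFunction.moebius : ArithmeticFunction ℤ) : ArithmeticFunction ℝ) n| ≤ 1 := by
  rw [ArithmeticFunction.intCoe_apply]
  exact_mod_cast ArithmeticFunction.abs_moebius_le_one

set_option maxHeartbeats 400000 in
lemma V_bound (c : ℝ) (hc : 1 < c) (hcn : ∀ n : ℕ, c ≠ n) : ∃ δ C X0 : ℝ, 0 < δ ∧ 0 < C ∧ 1 ≤ X0 ∧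
    ∀ X θ : ℝ, X0 ≤ X → 1 ≤ |θ| * X^c → |θ| * X^c ≤ X^(c+1) →
      ‖VV c X θ‖ ≤ C * (X * (1 + log X)^3 * √(1/(|θ| * X^c) + X^(-δ))) := by
  obtain ⟨δ, C, X0, hδ, hδ4, hC, hX01, hE⟩ := innerE c hc hcn
  change InnerE c δ C X0 at hE
  refine ⟨δ, 2 * (2*C*16^c) * 2 + 2 * √(2 + C + 2*C*32^c), max X0 (64^4), hδ, by positivity, le_max_of_le_left hX01, ?_⟩
  intro X θ hXX hT1 hT
  have hX : X0 ≤ X := (le_max_left _ _).trans hXX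
  have hX2 : 64^4 ≤ X := (le_max_right _ _).trans hXX
  have hX0 : 0 < X := by linarith [show (0:ℝ) < 64^4 by norm_num]
  have hX1 : 1 ≤ X := by linarith [show (1:ℝ) ≤ 64^4 by norm_num]
  have hL0 : 0 ≤ log X := Real.log_nonneg hX1
  have hθ : θ ≠ 0 := by rintro rfl; rw [abs_zero, zero_mul] at hT1; linarith
  have hθp := abs_pos.mpr hθ
  set N := ⌊X⌋₊ with hN
  set U := X^(1/4:ℝ) with hU
  have hUU : U * U = √X := by rw [hU, ← Real.rpow_add hX0, Real.sqrt_eq_rpow]; norm_num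
  have hU1 : 1 ≤ U := Real.one_le_rpow hX1 (by norm_num)
  have h64 : (64:ℝ) ≤ U := by
    calc (64:ℝ) = ((64:ℝ)^4)^(1/4:ℝ) := by
          rw [← Real.rpow_natCast, ← Real.rpow_mul (by norm_num)]; norm_num
      _ ≤ _ := Real.rpow_le_rpow (by norm_num) hX2 (by norm_num)
  have hUs : U ≤ √X := by rw [← hUU]; nlinarith
  have hUX : 64 * U ≤ X := by
    have : √X * √X = X := Real.mul_self_sqrt hX0.le
    nlinarith
  set F := vf θ c ⌊X/8⌋₊ N with hF
  have hF0 : ∀ n, N < n → F n = 0 := fun n hn => by rw [hF, vf, if_neg (by omega)]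
  set Λ' : ArithmeticFunction ℝ := ArithmeticFunction.vonMangoldt with hΛ
  set M' : ArithmeticFunction ℝ := ((ArithmeticFunction.moebius : ArithmeticFunction ℤ) : ArithmeticFunction ℝ) with hM'
  set Z' : ArithmeticFunction ℝ := ((ArithmeticFunction.zeta : ArithmeticFunction ℕ) : ArithmeticFunction ℝ) with hZ'
  set l := trunc Λ' U with hl
  set m := trunc M' U with hm
  have hΛ0 : ∀ n, |Λ' n| = Λ' n := fun n => abs_of_nonneg ArithmeticFunction.vonMangoldt_nonneg
  have hlΛ : ∀ n, |l n| ≤ Λ' n := fun n => (trunc_abs_le _ _ _).trans (hΛ0 n).le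
  have hm1 : ∀ n, |m n| ≤ 1 := fun n => (trunc_abs_le _ _ _).trans (moebius_abs_le n)
  have hZ1 : ∀ n : ℕ, |Z' n| ≤ 1 := by
    intro n
    rw [hZ', ArithmeticFunction.natCoe_apply, ArithmeticFunction.zeta_apply]
    split_ifs <;> simp
  have hsub : Ioc ⌊X/8⌋₊ N ⊆ Ioc 0 N := Finset.Ioc_subset_Ioc (Nat.zero_le _) le_rfl
  have eV : VV c X θ = ∑ n ∈ Ioc 0 N, ((Λ' n : ℝ):ℂ) * F n := by
    rw [VV, ← Finset.sum_subset hsub (f := fun n => ((Λ' n : ℝ):ℂ) * F n)]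
    · refine sum_congr rfl fun n hn => ?_
      rw [mem_Ioc] at hn
      rw [hF, vf, if_pos hn]
    · intro n _ hn
      rw [mem_Ioc] at hn
      rw [hF, vf, if_neg hn, mul_zero]
  have hΛn : ∀ n, ((Λ' n : ℝ):ℂ) = ((l n:ℝ):ℂ) + (((m * ArithmeticFunction.log) n : ℝ):ℂ) - (((l * m * Z') n : ℝ):ℂ)
      + ((((M' - m) * ((Λ' - l) * Z')) n : ℝ):ℂ) := by
    intro n
    have := congrArg (fun f : ArithmeticFunction ℝ => f n) (vaughan_id l m)
    simp only [ArithmeticFunction.add_apply, af_sub_apply] at this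
    rw [hΛ, this]; push_cast; rfl
  have e2 : VV c X θ = (∑ n ∈ Ioc 0 N, ((l n:ℝ):ℂ) * F n) + (∑ n ∈ Ioc 0 N, (((m * ArithmeticFunction.log) n : ℝ):ℂ) * F n)
      - (∑ n ∈ Ioc 0 N, (((l * m * Z') n : ℝ):ℂ) * F n) + ∑ n ∈ Ioc 0 N, ((((M' - m) * ((Λ' - l) * Z')) n : ℝ):ℂ) * F n := by
    rw [eV, ← Finset.sum_add_distrib, ← Finset.sum_sub_distrib, ← Finset.sum_add_distrib]
    refine sum_congr rfl fun n _ => ?_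
    rw [hΛn n]; ring
  have t0 : ∑ n ∈ Ioc 0 N, ((l n:ℝ):ℂ) * F n = 0 := by
    refine Finset.sum_eq_zero fun n _ => ?_
    by_cases h : (n:ℝ) ≤ U
    · rw [hF, vf, if_neg, mul_zero]
      rintro ⟨h1, _⟩
      have := (Nat.floor_lt (by positivity)).mp h1
      linarith
    · rw [hl, trunc_apply, if_neg h]; simp
  set z := 1/(|θ| * X^c) + X^(-δ) with hz
  have hz0 : 0 ≤ z := by positivity
  have hz2 : z ≤ 2 := by
    have h1 : 1/(|θ| * X^c) ≤ 1 := (div_le_one (by positivity)).mpr hT1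
    have h2 : X^(-δ) ≤ 1 := Real.rpow_le_one_of_one_le_of_nonpos hX1 (by linarith)
    linarith
  have hzs : z ≤ 2 * √z := by
    have h1 := Real.mul_self_sqrt hz0
    have h2 : √z ≤ 2 := by rw [Real.sqrt_le_left (by norm_num)]; linarith
    nlinarith [Real.sqrt_nonneg z]
  have hX3 : (1024:ℝ) ≤ X := by linarith [show (1024:ℝ) ≤ 64^4 by norm_num]
  have t1 : ‖∑ n ∈ Ioc 0 N, (((m * ArithmeticFunction.log) n : ℝ):ℂ) * F n‖ ≤ 2*C*16^c*(1+log X)^3*(X*z) := by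
    rw [sum_conv _ _ _ _ hF0]
    refine typeI hc hδ hC hX01 hE X θ hX hX3 hθ hT (fun k => m k) (fun k => ArithmeticFunction.log k) ?_ ?_ (Or.inr fun n => rfl)
    · intro k _ _
      linarith [hm1 k]
    · intro k hk
      rw [hm, trunc_apply, if_neg (by linarith)]
  have t2 : ‖∑ n ∈ Ioc 0 N, (((l * m * Z') n : ℝ):ℂ) * F n‖ ≤ 2*C*16^c*(1+log X)^3*(X*z) := by
    rw [sum_conv _ _ _ _ hF0]
    refine typeI hc hδ hC hX01 hE X θ hX hX3 hθ hT (fun k => (l * m) k) (fun k => Z' k) ?_ ?_ (Or.inl fun n hn => ?_)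
    · intro k hk hks
      refine (conv_abs_le l m hlΛ hm1 k).trans ?_
      have hkX : (k:ℝ) ≤ X := hks.trans (by rw [Real.sqrt_le_left hX0.le]; nlinarith)
      have := Real.log_le_log (by exact_mod_cast hk) hkX
      linarith
    · intro k hk
      refine mul_eq_zero_of _ _ _ fun d e hde => ?_
      rw [hl, hm, trunc_apply, trunc_apply]
      by_cases h1 : (d:ℝ) ≤ U
      · by_cases h2 : (e:ℝ) ≤ U
        · exfalso
          have : (k:ℝ) ≤ U * U := by rw [← hde]; push_cast; gcongr
          linarith
        · rw [if_neg h2, mul_zero]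
      · rw [if_neg h1, zero_mul]
    · change Z' n = 1
      rw [hZ', ArithmeticFunction.natCoe_apply, ArithmeticFunction.zeta_apply, if_neg hn.ne']; simp
  have t3 : ‖∑ n ∈ Ioc 0 N, ((((M' - m) * ((Λ' - l) * Z')) n : ℝ):ℂ) * F n‖
      ≤ 2 * √(2 + C + 2*C*32^c) * (X * (1 + log X)^3 * √z) := by
    rw [sum_conv _ _ _ _ hF0]
    refine typeII hc hC hδ4 hE X θ hX hX2 hθ hT (fun k => (M' - m) k) (fun k => ((Λ' - l) * Z') k) ?_ ?_ ?_ ?_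
    · intro k
      change |(M' - m) k| ≤ 1
      rw [hm, sub_trunc]
      split_ifs
      · simp
      · exact moebius_abs_le k
    · intro k hk
      change (M' - m) k = 0
      rw [hm, sub_trunc, if_pos hk]
    · intro k hk
      refine mul_eq_zero_of _ _ _ fun d e hde => ?_
      rcases Nat.eq_zero_or_pos e with rfl | he
      · simp
      · have : (d:ℝ) ≤ U := by
          refine le_trans ?_ hk
          exact_mod_cast hde ▸ Nat.le_mul_of_pos_right d he
        rw [hl, sub_trunc, if_pos this, zero_mul]
    · intro k
      refine conv_abs_le _ _ (fun n => ?_) hZ1 k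
      rw [hl, sub_trunc]
      split_ifs
      · rw [abs_zero]; exact ArithmeticFunction.vonMangoldt_nonneg
      · exact (hΛ0 n).le
  rw [e2, t0, zero_add]
  have hXz : X * z ≤ X * (2 * √z) := by gcongr
  have t4 : 2*C*16^c*(1+log X)^3*(X*z) ≤ 2*C*16^c*(1+log X)^3*(X*(2*√z)) := by gcongr
  refine (norm_add_le _ _).trans ?_
  refine (add_le_add ((norm_sub_le _ _).trans (add_le_add (t1.trans t4) (t2.trans t4))) t3).trans (le_of_eq ?_)
  ring

/-- Fejer kernel -/
noncomputable def Fj (H : ℕ) (y : ℝ) : ℝ := ‖∑ j ∈ range H, ee (j * y)‖^2 / (H:ℝ)^2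

lemma Fj_nonneg (H : ℕ) (y : ℝ) : 0 ≤ Fj H y := by unfold Fj; positivity

lemma Fj_expand (H : ℕ) (y : ℝ) : (Fj H y : ℂ) = (1/(H:ℂ)^2) * ∑ j ∈ range H, ∑ k ∈ range H, ee ((((j:ℤ)-(k:ℤ) : ℤ):ℝ) * y) := by
  unfold Fj
  push_cast
  rw [← Complex.mul_conj', map_sum, Finset.sum_mul_sum, div_eq_mul_one_div, mul_comm]
  congr 1
  refine sum_congr rfl fun j _ => sum_congr rfl fun k _ => ?_
  rw [← ee_sub]; congr 1; push_cast; ring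

lemma Fj_period (H : ℕ) (y : ℝ) (m : ℤ) : Fj H (y + m) = Fj H y := by
  unfold Fj
  congr 3
  refine sum_congr rfl fun j _ => ?_
  rw [mul_add, show (j:ℝ) * (m:ℝ) = ((j * m : ℤ):ℝ) by push_cast; ring, ee_add_int]

lemma Fj_sum (H : ℕ) (hH : 0 < H) (y : ℝ) : ∑ t ∈ range H, Fj H (y - t/H) = 1 := by
  have hH0 : (H:ℂ) ≠ 0 := by exact_mod_cast hH.ne'
  have : ((∑ t ∈ range H, Fj H (y - t/H) : ℝ):ℂ) = 1 := by
    push_cast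
    simp_rw [Fj_expand]
    rw [← mul_sum, Finset.sum_comm]
    have h1 : ∀ j ∈ range H, ∑ t ∈ range H, ∑ k ∈ range H, ee ((((j:ℤ)-(k:ℤ) : ℤ):ℝ) * (y - t/H)) = H := by
      intro j hj
      rw [Finset.sum_comm]
      have h2 : ∀ k ∈ range H, ∑ t ∈ range H, ee ((((j:ℤ)-(k:ℤ) : ℤ):ℝ) * (y - t/H)) = if k = j then (H:ℂ) else 0 := by
        intro k hk
        have h3 : ∀ t : ℕ, ee ((((j:ℤ)-(k:ℤ) : ℤ):ℝ) * (y - t/H)) = ee ((((j:ℤ)-(k:ℤ) : ℤ):ℝ) * y) * ee ((((k:ℤ)-(j:ℤ) : ℤ):ℝ) * t / H) := by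
          intro t; rw [← ee_add]; congr 1; push_cast; ring
        simp_rw [h3]
        rw [← mul_sum, sum_ee_range H hH]
        rw [Finset.mem_range] at hj hk
        by_cases hkj : k = j
        · subst hkj; simp [ee_zero]
        · rw [if_neg hkj, if_neg, mul_zero]
          rintro hd
          have h5 := Int.eq_zero_of_abs_lt_dvd hd (by rw [abs_lt]; omega)
          omega
      rw [sum_congr rfl h2, Finset.sum_ite_eq' _ _ _, if_pos hj]
    rw [sum_congr rfl h1, Finset.sum_const, Finset.card_range, nsmul_eq_mul]
    field_simp
  exact_mod_cast this

lemma Fj_le (H : ℕ) (hH : 0 < H) (y η : ℝ) (hη : 0 < η) (h1 : η ≤ |y|) (h2 : |y| ≤ 1 - η) : Fj H y ≤ 1/(4 * H^2 * η^2) := by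
  have hs : 2 * η ≤ |Real.sin (π * y)| := by
    refine (two_mul_le_sin' hη h1 h2).trans ?_
    rcases abs_cases y with ⟨h, _⟩ | ⟨h, _⟩
    · rw [h]; exact le_abs_self _
    · rw [h, mul_neg, Real.sin_neg]; exact neg_le_abs _
  have h4 : 4 * η ≤ ‖1 - ee y‖ := by rw [norm_one_sub_ee]; linarith
  have hne : ee y ≠ 1 := by
    intro h; rw [h, sub_self, norm_zero] at h4; linarith
  have hg : ∑ j ∈ range H, ee (j * y) = (ee y ^ H - 1)/(ee y - 1) := by
    rw [← geom_sum_eq hne]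
    exact sum_congr rfl fun j _ => ee_natmul _ _
  have hn : ‖∑ j ∈ range H, ee (j * y)‖ ≤ 1/(2*η) := by
    rw [hg, norm_div, norm_sub_rev (ee y) 1, div_le_div_iff₀ (by linarith) (by positivity)]
    have : ‖ee y ^ H - 1‖ ≤ 2 := by
      refine (norm_sub_le _ _).trans ?_
      rw [norm_pow, norm_ee]; norm_num
    nlinarith
  have hH0 : (0:ℝ) < H := by exact_mod_cast hH
  unfold Fj
  rw [div_le_div_iff₀ (by positivity) (by positivity)]
  calc _ ≤ (1/(2*η))^2 * (4 * (H:ℝ)^2 * η^2) := by gcongr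
    _ = 1 * (H:ℝ)^2 := by field_simp; norm_num

lemma Fj_lower (h : ℕ) (hh : 0 < h) (v : ℝ) (hv : |v| ≤ 1/(32*h)) : 1/2 ≤ Fj h v := by
  have hh0 : (0:ℝ) < h := by exact_mod_cast hh
  have h1 : ‖∑ j ∈ range h, (1 - ee (j * v))‖ ≤ h * (1/5) := by
    refine (norm_sum_le _ _).trans ?_
    calc _ ≤ ∑ j ∈ range h, (1/5:ℝ) := by
          refine sum_le_sum fun j hj => ?_
          rw [norm_sub_rev]
          refine (norm_ee_sub_one_le _).trans ?_
          rw [Finset.mem_range] at hj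
          have hjr : (j:ℝ) ≤ h := by exact_mod_cast hj.le
          rw [abs_mul, Nat.abs_cast]
          calc 2 * π * ((j:ℝ) * |v|) ≤ 2 * π * (h * (1/(32*h))) := by gcongr
            _ = π/16 := by field_simp; norm_num
            _ ≤ 1/5 := by linarith [Real.pi_lt_d2]
      _ = _ := by rw [Finset.sum_const, Finset.card_range, nsmul_eq_mul]
  rw [Finset.sum_sub_distrib, Finset.sum_const, Finset.card_range, nsmul_eq_mul, mul_one] at h1
  have h2 : (h:ℝ) - ‖∑ j ∈ range h, ee (j * v)‖ ≤ h * (1/5) := by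
    have := norm_sub_norm_le (h:ℂ) (∑ j ∈ range h, ee (j * v))
    rw [Complex.norm_natCast] at this
    linarith
  unfold Fj
  rw [div_le_div_iff₀ (by norm_num) (by positivity)]
  nlinarith

/-- pointwise approximation -/
lemma floor_pointwise (h : ℕ) (hh : 0 < h) (α y : ℝ) (hα : |α| ≤ 1/2) :
    ‖ee (-(α * Int.fract y)) - ∑ t ∈ range (h^3), ee (-(α * (t/(h^3:ℕ)))) * (Fj (h^3) (y - t/(h^3:ℕ)) : ℂ)‖
      ≤ 513/h + 4 * Fj h y := by
  have hh0 : (0:ℝ) < h := by exact_mod_cast hh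
  have hh1 : (1:ℝ) ≤ h := by exact_mod_cast hh
  set H := h^3 with hH
  have hHp : 0 < H := by positivity
  have hH0 : (0:ℝ) < H := by exact_mod_cast hHp
  have hHr : (H:ℝ) = (h:ℝ)^3 := by rw [hH]; push_cast; rfl
  set u := Int.fract y with hu
  have hu0 : 0 ≤ u := Int.fract_nonneg y
  have hu1 : u < 1 := Int.fract_lt_one y
  have hy : y = u + (⌊y⌋:ℤ) := (Int.fract_add_floor y).symm
  have hFt : ∀ t : ℕ, Fj H (y - t/H) = Fj H (u - t/H) := by
    intro t
    rw [show y - (t:ℝ)/H = (u - t/H) + (⌊y⌋:ℤ) by linarith, Fj_period]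
  have hFh : Fj h y = Fj h u := by rw [hy, Fj_period]
  simp_rw [hFt]
  rw [hFh]
  have hS := Fj_sum H hHp u
  have e1 : ee (-(α * u)) - ∑ t ∈ range H, ee (-(α * (t/H))) * (Fj H (u - t/H) : ℂ)
      = ∑ t ∈ range H, (ee (-(α * u)) - ee (-(α * (t/H)))) * (Fj H (u - t/H) : ℂ) := by
    simp_rw [sub_mul]
    rw [Finset.sum_sub_distrib, ← mul_sum, ← Complex.ofReal_sum, hS]; simp
  rw [e1]
  have hnn : ∀ t : ℕ, ‖(ee (-(α * u)) - ee (-(α * (t/H)))) * (Fj H (u - t/H) : ℂ)‖ = ‖ee (-(α * u)) - ee (-(α * (t/H)))‖ * Fj H (u - t/H) := by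
    intro t; rw [norm_mul, Complex.norm_real, Real.norm_of_nonneg (Fj_nonneg _ _)]
  have h2 : ∀ t : ℕ, ‖ee (-(α * u)) - ee (-(α * (t/H)))‖ ≤ 2 := by
    intro t; refine (norm_sub_le _ _).trans ?_; rw [norm_ee, norm_ee]; norm_num
  refine (norm_sum_le _ _).trans ?_
  simp_rw [hnn]
  set η : ℝ := 1/(32*h) with hη
  have hη0 : 0 < η := by positivity
  have hFh0 := Fj_nonneg h u
  by_cases hedge : u ≤ η ∨ 1 - η ≤ u
  · have hF : 1/2 ≤ Fj h u := by
      rcases hedge with h3 | h3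
      · exact Fj_lower h hh u (by rw [abs_of_nonneg hu0]; exact h3)
      · rw [← Fj_period h u (-1)]
        apply Fj_lower h hh
        push_cast
        rw [abs_le]; constructor <;> linarith
    calc _ ≤ ∑ t ∈ range H, 2 * Fj H (u - t/H) :=
          sum_le_sum fun t _ => mul_le_mul_of_nonneg_right (h2 t) (Fj_nonneg _ _)
      _ = 2 := by rw [← mul_sum, hS, mul_one]
      _ ≤ _ := by have : 0 ≤ 513/(h:ℝ) := by positivity
                  linarith
  · push Not at hedge
    have hterm : ∀ t ∈ range H, ‖ee (-(α * u)) - ee (-(α * (t/H)))‖ * Fj H (u - t/H)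
        ≤ (π * η) * Fj H (u - t/H) + 1/(2 * H^2 * η^2) := by
      intro t ht
      rw [Finset.mem_range] at ht
      have hF0 := Fj_nonneg H (u - t/H)
      have ht1 : (t:ℝ)/H ≤ 1 := by rw [div_le_one hH0]; exact_mod_cast ht.le
      have ht0 : (0:ℝ) ≤ (t:ℝ)/H := by positivity
      by_cases hcl : |u - t/H| ≤ η
      · have h3 : ‖ee (-(α * u)) - ee (-(α * (t/H)))‖ ≤ π * η := by
          refine (norm_ee_sub_le _ _).trans ?_
          rw [show -(α * u) - -(α * ((t:ℝ)/H)) = -(α * (u - t/H)) by ring, abs_neg, abs_mul]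
          calc 2 * π * (|α| * |u - t/H|) ≤ 2 * π * ((1/2) * η) := by gcongr
            _ = _ := by ring
        have : 0 ≤ 1/(2 * (H:ℝ)^2 * η^2) := by positivity
        have := mul_le_mul_of_nonneg_right h3 hF0
        linarith
      · push Not at hcl
        have h3 := Fj_le H hHp (u - t/H) η hη0 hcl.le (by rw [abs_le]; constructor <;> linarith)
        have h4 := mul_le_mul (h2 t) h3 hF0 (by norm_num)
        have h5 : 0 ≤ (π * η) * Fj H (u - t/H) := by positivity
        have h6 : 2 * (1/(4 * (H:ℝ)^2 * η^2)) = 1/(2 * H^2 * η^2) := by field_simp; norm_num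
        linarith
    refine (sum_le_sum hterm).trans ?_
    rw [Finset.sum_add_distrib, ← mul_sum, hS, Finset.sum_const, Finset.card_range, nsmul_eq_mul]
    have h7 : (H:ℝ) * (1/(2 * H^2 * η^2)) = 512/h := by
      rw [hη, hHr]; field_simp; norm_num
    have h8 : π * η ≤ 1/h := by
      rw [hη, mul_one_div, div_le_div_iff₀ (by positivity) hh0]
      nlinarith [Real.pi_lt_d2]
    rw [h7, mul_one]
    have : (513:ℝ)/h = 512/h + 1/h := by ring
    linarith

lemma floor_remove (P : Finset ℕ) (w x : ℕ → ℝ) (hw : ∀ n ∈ P, 0 ≤ w n) (h : ℕ) (hh : 0 < h) (α m W : ℝ) (hα : |α| ≤ 1/2)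
    (hW : ∑ n ∈ P, w n ≤ W) (hm0 : 0 ≤ m)
    (hm1 : ∀ d : ℤ, d ≠ 0 → |d| < h → ‖∑ n ∈ P, (w n : ℂ) * ee (d * x n)‖ ≤ m)
    (hm2 : ∀ d : ℤ, |d| < h^3 → ‖∑ n ∈ P, (w n : ℂ) * ee ((α + d) * x n)‖ ≤ m) :
    ‖∑ n ∈ P, (w n : ℂ) * ee (α * ⌊x n⌋)‖ ≤ 517 * (W/h) + 4 * m + h^3 * m := by
  have hh0 : (0:ℝ) < h := by exact_mod_cast hh
  have hW0 : 0 ≤ W := (Finset.sum_nonneg hw).trans hW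
  set H := h^3 with hH
  have hHp : 0 < H := by positivity
  have hH0 : (0:ℝ) < H := by exact_mod_cast hHp
  set G : ℝ → ℂ := fun y => ∑ t ∈ range H, ee (-(α * (t/H))) * (Fj H (y - t/H) : ℂ) with hG
  have e1 : ∑ n ∈ P, (w n : ℂ) * ee (α * ⌊x n⌋) = ∑ n ∈ P, (w n : ℂ) * ee (α * x n) * (ee (-(α * Int.fract (x n))) - G (x n))
      + ∑ n ∈ P, (w n : ℂ) * ee (α * x n) * G (x n) := by
    rw [← Finset.sum_add_distrib]
    refine sum_congr rfl fun n _ => ?_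
    have : ee (α * ⌊x n⌋) = ee (α * x n) * ee (-(α * Int.fract (x n))) := by
      rw [← ee_add]; congr 1; rw [Int.fract]; ring
    rw [this]; ring
  have hF : ∑ n ∈ P, w n * Fj h (x n) ≤ W/h + m := by
    have e2 : ((∑ n ∈ P, w n * Fj h (x n) : ℝ):ℂ) = (1/(h:ℂ)^2) * ∑ j ∈ range h, ∑ k ∈ range h,
        ∑ n ∈ P, (w n:ℂ) * ee ((((j:ℤ)-(k:ℤ) : ℤ):ℝ) * x n) := by
      push_cast
      simp_rw [Fj_expand]
      rw [mul_sum]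
      simp_rw [mul_sum]
      rw [Finset.sum_comm]
      refine sum_congr rfl fun j _ => ?_
      rw [Finset.sum_comm]
      refine sum_congr rfl fun k _ => sum_congr rfl fun n _ => ?_
      push_cast; ring
    have hn : ∑ n ∈ P, w n * Fj h (x n) = ‖((∑ n ∈ P, w n * Fj h (x n) : ℝ):ℂ)‖ := by
      rw [Complex.norm_real, Real.norm_of_nonneg]
      exact Finset.sum_nonneg fun n hn => mul_nonneg (hw n hn) (Fj_nonneg _ _)
    rw [hn, e2, norm_mul, norm_div, norm_one, norm_pow, Complex.norm_natCast]
    have h3 : ‖∑ j ∈ range h, ∑ k ∈ range h, ∑ n ∈ P, (w n:ℂ) * ee ((((j:ℤ)-(k:ℤ) : ℤ):ℝ) * x n)‖ ≤ ∑ j ∈ range h, (W + h * m) := by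
      refine (norm_sum_le _ _).trans (sum_le_sum fun j hj => ?_)
      refine (norm_sum_le _ _).trans ?_
      rw [← Finset.add_sum_erase _ _ hj]
      refine add_le_add ?_ ?_
      · refine (norm_sum_le _ _).trans (le_trans (sum_le_sum fun n hn => ?_) hW)
        rw [norm_mul, norm_ee, Complex.norm_real, Real.norm_of_nonneg (hw n hn), mul_one]
      · calc _ ≤ ∑ k ∈ (range h).erase j, m := by
              refine sum_le_sum fun k hk => ?_
              rw [Finset.mem_erase, Finset.mem_range] at hk
              rw [Finset.mem_range] at hj
              exact hm1 _ (by omega) (by rw [abs_lt]; omega)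
          _ ≤ _ := by
              rw [Finset.sum_const, nsmul_eq_mul]
              refine mul_le_mul_of_nonneg_right ?_ hm0
              have := Finset.card_erase_le (s := range h) (a := j)
              rw [Finset.card_range] at this
              exact_mod_cast this
    rw [Finset.sum_const, Finset.card_range, nsmul_eq_mul] at h3
    calc _ ≤ 1/(h:ℝ)^2 * (h * (W + h*m)) := by gcongr
      _ = _ := by field_simp
  have t1 : ‖∑ n ∈ P, (w n : ℂ) * ee (α * x n) * (ee (-(α * Int.fract (x n))) - G (x n))‖ ≤ 517 * (W/h) + 4 * m := by
    refine (norm_sum_le _ _).trans ?_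
    calc _ ≤ ∑ n ∈ P, (513/h * w n + 4 * (w n * Fj h (x n))) := by
          refine sum_le_sum fun n hn => ?_
          rw [norm_mul, norm_mul, norm_ee, Complex.norm_real, Real.norm_of_nonneg (hw n hn), mul_one]
          have := mul_le_mul_of_nonneg_left (floor_pointwise h hh α (x n) hα) (hw n hn)
          refine this.trans (le_of_eq (by ring))
      _ = 513/h * ∑ n ∈ P, w n + 4 * ∑ n ∈ P, w n * Fj h (x n) := by
          rw [Finset.sum_add_distrib, mul_sum, mul_sum]
      _ ≤ 513/h * W + 4 * (W/h + m) := by gcongr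
      _ = _ := by ring
  have t2 : ‖∑ n ∈ P, (w n : ℂ) * ee (α * x n) * G (x n)‖ ≤ H * m := by
    have e3 : ∑ n ∈ P, (w n : ℂ) * ee (α * x n) * G (x n) = ∑ t ∈ range H, ee (-(α * (t/H))) * ((1/(H:ℂ)^2) *
        ∑ j ∈ range H, ∑ k ∈ range H, ee (-((((j:ℤ)-(k:ℤ) : ℤ):ℝ) * (t/H))) * ∑ n ∈ P, (w n:ℂ) * ee ((α + ((j:ℤ)-(k:ℤ) : ℤ)) * x n)) := by
      simp_rw [hG, Fj_expand, mul_sum]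
      rw [Finset.sum_comm]
      refine sum_congr rfl fun t _ => ?_
      rw [Finset.sum_comm]
      refine sum_congr rfl fun j _ => ?_
      rw [Finset.sum_comm]
      refine sum_congr rfl fun k _ => sum_congr rfl fun n _ => ?_
      have h5 : ee (α * x n) * ee ((((j:ℤ)-(k:ℤ) : ℤ):ℝ) * (x n - t/H)) = ee (-((((j:ℤ)-(k:ℤ) : ℤ):ℝ) * (t/H))) * ee ((α + ((j:ℤ)-(k:ℤ) : ℤ)) * x n) := by
        rw [← ee_add, ← ee_add]; congr 1; ring
      linear_combination (w n : ℂ) * ee (-(α * (t/H))) * (1/(H:ℂ)^2) * h5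
    rw [e3]
    refine (norm_sum_le _ _).trans ?_
    calc _ ≤ ∑ t ∈ range H, m := by
          refine sum_le_sum fun t _ => ?_
          rw [norm_mul, norm_ee, one_mul, norm_mul, norm_div, norm_one, norm_pow, Complex.norm_natCast]
          have h6 : ‖∑ j ∈ range H, ∑ k ∈ range H, ee (-((((j:ℤ)-(k:ℤ) : ℤ):ℝ) * (t/H))) * ∑ n ∈ P, (w n:ℂ) * ee ((α + ((j:ℤ)-(k:ℤ) : ℤ)) * x n)‖
              ≤ ∑ j ∈ range H, ∑ k ∈ range H, m := by
            refine (norm_sum_le _ _).trans (sum_le_sum fun j hj => ?_)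
            refine (norm_sum_le _ _).trans (sum_le_sum fun k hk => ?_)
            rw [Finset.mem_range] at hj hk
            rw [norm_mul, norm_ee, one_mul]
            refine hm2 _ ?_
            rw [abs_lt]
            have : ((h:ℤ)^3) = (H:ℤ) := by rw [hH]; push_cast; rfl
            rw [this]; omega
          simp only [Finset.sum_const, Finset.card_range, nsmul_eq_mul] at h6
          calc _ ≤ 1/(H:ℝ)^2 * (H * (H * m)) := by gcongr
            _ = m := by field_simp
      _ = H * m := by rw [Finset.sum_const, Finset.card_range, nsmul_eq_mul]
  rw [e1]
  refine (norm_add_le _ _).trans ?_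
  have : (H:ℝ) = (h:ℝ)^3 := by rw [hH]; push_cast; rfl
  rw [this] at t2
  linarith

lemma ev_log_ge (A : ℝ) : ∀ᶠ X : ℝ in Filter.atTop, A ≤ log X :=
  Real.tendsto_log_atTop.eventually_ge_atTop A

lemma ev_logpow (A : ℕ) (ε D : ℝ) (hε : 0 < ε) : ∀ᶠ X : ℝ in Filter.atTop, D * (log X)^A ≤ X^ε := by
  obtain ⟨C, hC, h⟩ := logpow_le A (ε/2) (by positivity)
  filter_upwards [Filter.eventually_ge_atTop 1, (tendsto_rpow_atTop (by positivity : 0 < ε/2)).eventually_ge_atTop (|D| * C)] with X hX1 hX2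
  have hX0 : 0 < X := by linarith
  have hL := Real.log_nonneg hX1
  calc D * (log X)^A ≤ |D| * (C * X^(ε/2)) := by
        apply mul_le_mul (le_abs_self _) (h X hX1) (by positivity) (by positivity)
    _ = (|D| * C) * X^(ε/2) := by ring
    _ ≤ X^(ε/2) * X^(ε/2) := by gcongr
    _ = X^ε := by rw [← Real.rpow_add hX0]; congr 1; ring

lemma V_log (c : ℝ) (hc : 1 < c) (hcn : ∀ n : ℕ, c ≠ n) (B : ℕ) : ∀ᶠ X : ℝ in Filter.atTop, ∀ θ : ℝ,
    (log X)^(2*B+8) ≤ |θ| * X^c → |θ| ≤ X → ‖VV c X θ‖ ≤ X/(log X)^B := by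
  obtain ⟨δ, C, X0, hδ, hC, hX0, h⟩ := V_bound c hc hcn
  filter_upwards [Filter.eventually_ge_atTop X0, ev_log_ge (max 1 (16 * C)), ev_logpow (2*B+8) δ 1 hδ] with X hX hL hδX θ hT hθ
  have hXp : 0 < X := by linarith
  set L := log X with hLd
  have hL1 : 1 ≤ L := (le_max_left _ _).trans hL
  have hLC : 16 * C ≤ L := (le_max_right _ _).trans hL
  have hL0 : 0 < L := by linarith
  rw [one_mul] at hδX
  refine (h X θ hX (le_trans (one_le_pow₀ hL1) hT) ?_).trans ?_
  · rw [Real.rpow_add_one hXp.ne', mul_comm]; gcongr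
  have hz : 1/(|θ| * X^c) + X^(-δ) ≤ (2/L^(B+4))^2 := by
    have h1 : 1/(|θ| * X^c) ≤ 1/L^(2*B+8) := one_div_le_one_div_of_le (by positivity) hT
    have h2 : X^(-δ) ≤ 1/L^(2*B+8) := by
      rw [Real.rpow_neg hXp.le, ← one_div]; exact one_div_le_one_div_of_le (by positivity) hδX
    have h3 : (2/L^(B+4))^2 = 4 * (1/L^(2*B+8)) := by rw [div_pow, ← pow_mul]; ring
    have h4 : 0 < 1/L^(2*B+8) := by positivity
    linarith
  have hs : √(1/(|θ| * X^c) + X^(-δ)) ≤ 2/L^(B+4) := by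
    rw [Real.sqrt_le_left (by positivity)]; exact hz
  calc C * (X * (1 + L)^3 * √(1/(|θ| * X^c) + X^(-δ))) ≤ C * (X * (2*L)^3 * (2/L^(B+4))) := by
        gcongr; linarith
    _ = (16 * C) * (X/L^B) / L := by field_simp; ring
    _ ≤ L * (X/L^B) / L := by gcongr
    _ = X/L^B := by field_simp

noncomputable def aa (n : ℕ) : ℝ := if n.Prime then log n else 0

lemma aa_nonneg (n : ℕ) : 0 ≤ aa n := by
  unfold aa; split_ifs with h
  · exact Real.log_nonneg (by exact_mod_cast h.one_le)
  · exact le_rfl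

lemma aa_le_vM (n : ℕ) : aa n ≤ ArithmeticFunction.vonMangoldt n := by
  unfold aa; split_ifs with h
  · rw [ArithmeticFunction.vonMangoldt_apply_prime h]
  · exact ArithmeticFunction.vonMangoldt_nonneg

noncomputable def SS (c X α : ℝ) : ℂ := ∑ n ∈ Ioc ⌊X/8⌋₊ ⌊X⌋₊, (aa n : ℂ) * ee (α * ⌊(n:ℝ)^c⌋)

lemma theta_eq_aa (x : ℝ) : Chebyshev.theta x = ∑ n ∈ Ioc 0 ⌊x⌋₊, aa n := by
  rw [Chebyshev.theta, Finset.sum_filter]; rfl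

lemma S_sup (c : ℝ) (hc : 1 < c) (hcn : ∀ n : ℕ, c ≠ n) (B : ℕ) : ∃ B' : ℕ, ∀ᶠ X : ℝ in Filter.atTop, ∀ α : ℝ, |α| ≤ 1/2 →
    (log X)^B' ≤ |α| * X^c → ‖SS c X α‖ ≤ X/(log X)^B := by
  refine ⟨2*(4*B+5)+8, ?_⟩
  filter_upwards [V_log c hc hcn (4*B+5), ev_log_ge 4000, ev_logpow (2*(4*B+5)+8) 1 2 (by norm_num), ev_logpow (3*B+3) 1 10 (by norm_num),
    ev_logpow (B+2) (1/2) 2 (by norm_num), Filter.eventually_ge_atTop 1] with X hV hL hX1 hX2 hX3 hX11 α hα hT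
  have hXp : 0 < X := by linarith
  set L := log X with hLd
  have hL0 : 0 < L := by linarith
  rw [Real.rpow_one] at hX1 hX2
  have hXc : X ≤ X^c := by
    calc X = X^(1:ℝ) := (Real.rpow_one X).symm
      _ ≤ X^c := Real.rpow_le_rpow_of_exponent_le hX11 hc.le
  set P := Ioc ⌊X/8⌋₊ ⌊X⌋₊ with hP
  have hPsub : P ⊆ Ioc 0 ⌊X⌋₊ := Finset.Ioc_subset_Ioc (Nat.zero_le _) le_rfl
  set h := ⌈L^(B+1)⌉₊ with hh
  have hLB : 1 ≤ L^(B+1) := one_le_pow₀ (by linarith)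
  have hh1 : L^(B+1) ≤ h := Nat.le_ceil _
  have hh2 : (h:ℝ) ≤ 2 * L^(B+1) := by
    have := Nat.ceil_lt_add_one (by positivity : 0 ≤ L^(B+1))
    linarith
  have hhp : 0 < h := by
    have : (0:ℝ) < h := by linarith
    exact_mod_cast this
  have hh3 : (h:ℝ)^3 ≤ 8 * L^(3*B+3) := by
    calc (h:ℝ)^3 ≤ (2 * L^(B+1))^3 := by gcongr
      _ = 8 * L^(3*B+3) := by rw [mul_pow, ← pow_mul]; ring
  have hLB3 : 1 ≤ L^(3*B+3) := one_le_pow₀ (by linarith)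
  set m := X/L^(4*B+5) with hm
  have hm0 : 0 ≤ m := by positivity
  have hW : ∑ n ∈ P, (ArithmeticFunction.vonMangoldt n : ℝ) ≤ 6 * X := by
    calc _ ≤ ∑ n ∈ Ioc 0 ⌊X⌋₊, (ArithmeticFunction.vonMangoldt n : ℝ) :=
          Finset.sum_le_sum_of_subset_of_nonneg hPsub fun _ _ _ => ArithmeticFunction.vonMangoldt_nonneg
      _ = Chebyshev.psi X := rfl
      _ ≤ (log 4 + 4) * X := Chebyshev.psi_le_const_mul_self hXp.le
      _ ≤ 6 * X := by
        have : log 4 ≤ 2 := by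
          rw [show (4:ℝ) = 2^2 by norm_num, Real.log_pow]
          have := Real.log_two_lt_d9
          push_cast; linarith
        gcongr; linarith
  have hfr := floor_remove P (fun n => ArithmeticFunction.vonMangoldt n) (fun n => (n:ℝ)^c)
    (fun n _ => ArithmeticFunction.vonMangoldt_nonneg) h hhp α m (6*X) hα hW hm0 ?_ ?_
  rotate_left
  · intro d hd hdh
    refine hV d ?_ ?_
    · have : (1:ℝ) ≤ |(d:ℝ)| := by exact_mod_cast Int.one_le_abs hd
      nlinarith [show 0 < X^c by positivity]
    · have h1 : |(d:ℝ)| ≤ h := by exact_mod_cast hdh.le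
      have h2 : (h:ℝ) ≤ (h:ℝ)^3 := by
        refine le_self_pow₀ (by linarith) (by norm_num)
      linarith
  · intro d hdh
    have h1 : |(d:ℝ)| ≤ (h:ℝ)^3 := by exact_mod_cast hdh.le
    refine hV (α + d) ?_ ?_
    · by_cases hd : d = 0
      · subst hd; simpa using hT
      · have h2 : (1:ℝ) ≤ |(d:ℝ)| := by exact_mod_cast Int.one_le_abs hd
        have h3 : 1/2 ≤ |α + d| := by
          have := abs_sub_abs_le_abs_sub (d:ℝ) (-α)
          rw [abs_neg, sub_neg_eq_add, add_comm] at this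
          linarith
        nlinarith [show 0 < X^c by positivity]
    · have := abs_add_le α (d:ℝ)
      linarith
  have hdiff : ‖SS c X α - ∑ n ∈ P, ((ArithmeticFunction.vonMangoldt n : ℝ):ℂ) * ee (α * ⌊(n:ℝ)^c⌋)‖ ≤ 2 * √X * L := by
    rw [SS, ← Finset.sum_sub_distrib]
    refine (norm_sum_le _ _).trans ?_
    calc _ ≤ ∑ n ∈ P, (ArithmeticFunction.vonMangoldt n - aa n) := by
          refine sum_le_sum fun n _ => ?_
          rw [← sub_mul, norm_mul, norm_ee, mul_one, ← Complex.ofReal_sub, Complex.norm_real, Real.norm_eq_abs, abs_sub_comm, abs_of_nonneg]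
          linarith [aa_le_vM n]
      _ ≤ ∑ n ∈ Ioc 0 ⌊X⌋₊, (ArithmeticFunction.vonMangoldt n - aa n) :=
          Finset.sum_le_sum_of_subset_of_nonneg hPsub fun n _ _ => by linarith [aa_le_vM n]
      _ = Chebyshev.psi X - Chebyshev.theta X := by
          rw [Finset.sum_sub_distrib, theta_eq_aa]; rfl
      _ ≤ |Chebyshev.psi X - Chebyshev.theta X| := le_abs_self _
      _ ≤ _ := Chebyshev.abs_psi_sub_theta_le_sqrt_mul_log hX11
  have hfin1 : 2 * √X * L ≤ X/L^(B+1) := by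
    rw [le_div_iff₀ (by positivity)]
    rw [← Real.sqrt_eq_rpow] at hX3
    calc 2 * √X * L * L^(B+1) = √X * (2 * L^(B+2)) := by ring
      _ ≤ √X * √X := by gcongr
      _ = X := Real.mul_self_sqrt hXp.le
  have hfin2 : 517 * (6*X/h) ≤ 3102 * (X/L^(B+1)) := by
    calc 517 * (6*X/h) ≤ 517 * (6*X/L^(B+1)) := by gcongr
      _ = _ := by ring
  have hmL : L^(3*B+3) * m = X/L^(B+1) / L := by rw [hm]; field_simp; ring
  have hfin3 : 4 * m + (h:ℝ)^3 * m ≤ 12 * (X/L^(B+1)) := by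
    have h1 : X/L^(B+1)/L ≤ X/L^(B+1) := div_le_self (by positivity) (by linarith)
    have h2 : m ≤ L^(3*B+3) * m := le_mul_of_one_le_left hm0 hLB3
    have h3 : (h:ℝ)^3 * m ≤ 8 * L^(3*B+3) * m := by gcongr
    linarith
  have hfin4 : 4000 * (X/L^(B+1)) ≤ X/L^B := by
    calc 4000 * (X/L^(B+1)) ≤ L * (X/L^(B+1)) := by gcongr
      _ = X/L^B := by field_simp; ring
  have hpos : 0 < X/L^(B+1) := by positivity
  calc ‖SS c X α‖ = ‖(SS c X α - ∑ n ∈ P, ((ArithmeticFunction.vonMangoldt n : ℝ):ℂ) * ee (α * ⌊(n:ℝ)^c⌋)) + ∑ n ∈ P, ((ArithmeticFunction.vonMangoldt n : ℝ):ℂ) * ee (α * ⌊(n:ℝ)^c⌋)‖ := by rw [sub_add_cancel]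
    _ ≤ _ := norm_add_le _ _
    _ ≤ 2 * √X * L + (517 * (6*X/h) + 4 * m + h^3 * m) := add_le_add hdiff hfr
    _ ≤ _ := by linarith

noncomputable def jset (r : ℕ) : Finset ℤ := Ioc (-(3*(r:ℤ))) (3*r)

lemma orth (r : ℕ) (hr : 0 < r) (s : ℤ) (hs : |s| < 6*r) :
    ∑ j ∈ jset r, ee ((j:ℝ)/(6*r) * s) = if s = 0 then 6*(r:ℂ) else 0 := by
  have hr0 : (r:ℝ) ≠ 0 := by positivity
  have e1 : ∑ j ∈ jset r, ee ((j:ℝ)/(6*r) * s) = ∑ w ∈ range (6*r), ee ((s:ℝ) * (1 - 3*r)/(6*r)) * ee ((s:ℝ) * w / ((6*r:ℕ):ℝ)) := by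
    refine Finset.sum_bij' (fun j _ => (j + 3*r - 1).toNat) (fun w _ => (w:ℤ) - 3*r + 1) ?_ ?_ ?_ ?_ ?_
    · intro j hj; rw [jset, mem_Ioc] at hj; rw [Finset.mem_range]; omega
    · intro w hw; rw [Finset.mem_range] at hw; rw [jset, mem_Ioc]; omega
    · intro j hj; rw [jset, mem_Ioc] at hj; omega
    · intro w hw; omega
    · intro j hj
      rw [jset, mem_Ioc] at hj
      have h1 : (((j + 3*r - 1).toNat : ℕ):ℝ) = (j:ℝ) + 3*r - 1 := by
        have : (((j + 3*r - 1).toNat : ℕ):ℤ) = j + 3*r - 1 := Int.toNat_of_nonneg (by omega)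
        exact_mod_cast this
      rw [← ee_add, h1]; congr 1; push_cast; field_simp; ring
  rw [e1, ← mul_sum, sum_ee_range _ (by omega)]
  by_cases h : s = 0
  · subst h; simp [ee_zero]
  · rw [if_neg h, if_neg, mul_zero]
    intro hd
    exact h (Int.eq_zero_of_abs_lt_dvd hd (by push_cast; exact hs))

/-- weighted count of solutions -/
lemma fifth_moment {ι : Type*} [DecidableEq ι] (A : Finset ι) (a : ι → ℝ) (f : ι → ℤ) (r : ℕ) (hr : 0 < r) (h0 : ∀ n ∈ A, 0 ≤ f n) (h1 : ∀ n ∈ A, f n ≤ r) :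
    ∑ j ∈ jset r, (∑ n ∈ A, (a n:ℂ) * ee ((j:ℝ)/(6*r) * f n))^5 * ee (-((j:ℝ)/(6*r) * r))
      = 6 * r * ((∑ t ∈ (Fintype.piFinset (fun _ : Fin 5 => A)).filter (fun t => ∑ i, f (t i) = r), ∏ i, a (t i) : ℝ) : ℂ) := by
  have e1 : ∀ j : ℤ, (∑ n ∈ A, (a n:ℂ) * ee ((j:ℝ)/(6*r) * f n))^5 * ee (-((j:ℝ)/(6*r) * r))
      = ∑ t ∈ Fintype.piFinset (fun _ : Fin 5 => A), ((∏ i, a (t i) : ℝ):ℂ) * ee ((j:ℝ)/(6*r) * ((∑ i, f (t i) - r : ℤ):ℝ)) := by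
    intro j
    rw [Finset.sum_pow', Finset.sum_mul]
    refine sum_congr rfl fun t _ => ?_
    rw [Finset.prod_mul_distrib, mul_assoc]
    push_cast
    congr 1
    simp only [Fin.prod_univ_five, Fin.sum_univ_five]
    simp only [← ee_add]
    congr 1; ring
  simp_rw [e1]
  rw [Finset.sum_comm, Complex.ofReal_sum, mul_sum, Finset.sum_filter]
  refine sum_congr rfl fun t ht => ?_
  rw [Fintype.mem_piFinset] at ht
  rw [← mul_sum, orth r hr]
  · by_cases h : ∑ i, f (t i) = r
    · rw [if_pos h, if_pos (by omega)]; ring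
    · rw [if_neg h, if_neg (by omega), mul_zero]
  · rw [Fin.sum_univ_five]
    have a0 := h0 _ (ht 0); have a1 := h0 _ (ht 1); have a2 := h0 _ (ht 2); have a3 := h0 _ (ht 3); have a4 := h0 _ (ht 4)
    have b0 := h1 _ (ht 0); have b1 := h1 _ (ht 1); have b2 := h1 _ (ht 2); have b3 := h1 _ (ht 3); have b4 := h1 _ (ht 4)
    rw [abs_lt]; omega

lemma parseval {ι : Type*} (A : Finset ι) (a : ι → ℝ) (g : ι → ℤ) (r : ℕ) (hr : 0 < r) (h0 : ∀ n ∈ A, 0 ≤ g n) (h1 : ∀ n ∈ A, g n ≤ 2*r) :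
    ∑ j ∈ jset r, ‖∑ n ∈ A, (a n:ℂ) * ee ((j:ℝ)/(6*r) * g n)‖^2 = 6 * r * ∑ t ∈ (A ×ˢ A).filter (fun t => g t.1 = g t.2), a t.1 * a t.2 := by
  have : ((∑ j ∈ jset r, ‖∑ n ∈ A, (a n:ℂ) * ee ((j:ℝ)/(6*r) * g n)‖^2 : ℝ):ℂ)
      = ((6 * r * ∑ t ∈ (A ×ˢ A).filter (fun t => g t.1 = g t.2), a t.1 * a t.2 : ℝ):ℂ) := by
    push_cast
    have e1 : ∀ j : ℤ, ((‖∑ n ∈ A, (a n:ℂ) * ee ((j:ℝ)/(6*r) * g n)‖:ℂ))^2 = ∑ t ∈ A ×ˢ A, ((a t.1 : ℂ) * (a t.2:ℂ)) * ee ((j:ℝ)/(6*r) * ((g t.1 - g t.2 : ℤ):ℝ)) := by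
      intro j
      rw [← Complex.mul_conj', map_sum, Finset.sum_mul_sum, Finset.sum_product]
      refine sum_congr rfl fun x _ => sum_congr rfl fun y _ => ?_
      rw [map_mul, Complex.conj_ofReal]
      push_cast
      rw [mul_sub, ee_sub]; ring
    simp_rw [e1]
    rw [Finset.sum_comm, mul_sum, Finset.sum_filter]
    refine sum_congr rfl fun t ht => ?_
    rw [Finset.mem_product] at ht
    rw [← mul_sum, orth r hr]
    · by_cases h : g t.1 = g t.2
      · rw [if_pos h, if_pos (by omega)]; ring
      · rw [if_neg h, if_neg (by omega), mul_zero]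
    · have a0 := h0 _ ht.1; have a1 := h0 _ ht.2
      have b0 := h1 _ ht.1; have b1 := h1 _ ht.2
      rw [abs_lt]; omega
  exact_mod_cast this

lemma memP (X : ℝ) (hX : 0 ≤ X) (n : ℕ) : n ∈ Ioc ⌊X/8⌋₊ ⌊X⌋₊ ↔ X/8 < n ∧ (n:ℝ) ≤ X := by
  rw [mem_Ioc, Nat.floor_lt (by positivity), Nat.le_floor_iff hX]

lemma floor_pow_mem (c X : ℝ) (hc : 1 < c) (hX : 0 ≤ X) (r : ℕ) (hr : X^c = r) (n : ℕ) (hn : n ∈ Ioc ⌊X/8⌋₊ ⌊X⌋₊) :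
    0 ≤ ⌊(n:ℝ)^c⌋ ∧ ⌊(n:ℝ)^c⌋ ≤ r := by
  rw [memP X hX] at hn
  refine ⟨Int.floor_nonneg.mpr (by positivity), ?_⟩
  have h1 : (n:ℝ)^c ≤ X^c := Real.rpow_le_rpow (by positivity) hn.2 (by linarith)
  rw [hr] at h1
  have := Int.floor_le_floor h1
  simpa using this

lemma aa_le_log (X : ℝ) (hX : 1 ≤ X) (n : ℕ) (hn : n ∈ Ioc ⌊X/8⌋₊ ⌊X⌋₊) : aa n ≤ log X := by
  rw [memP X (by linarith)] at hn
  unfold aa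
  split_ifs
  · exact Real.log_le_log (by linarith) hn.2
  · exact Real.log_nonneg hX

lemma fourth (c : ℝ) (hc : 1 < c) (κ : ℝ) (hκ : 0 < κ) : ∃ D > 0, ∀ X : ℝ, 1 ≤ X → ∀ r : ℕ, 0 < r → X^c = r →
    ∑ j ∈ jset r, ‖SS c X ((j:ℝ)/(6*r))‖^4 ≤ 6 * r * ((log X)^4 * (D * (X^(2+κ) + X^(4-c+κ)))) := by
  classical
  obtain ⟨D, hD, h⟩ := N4_bound c hc κ hκ
  refine ⟨D, hD, fun X hX r hr hXr => ?_⟩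
  have hX0 : 0 ≤ X := by linarith
  set P := Ioc ⌊X/8⌋₊ ⌊X⌋₊ with hP
  set f : ℕ → ℤ := fun n => ⌊(n:ℝ)^c⌋ with hf
  have hfm : ∀ n ∈ P, 0 ≤ f n ∧ f n ≤ r := fun n hn => floor_pow_mem c X hc hX0 r hXr n hn
  have e1 : ∀ j : ℤ, ‖SS c X ((j:ℝ)/(6*r))‖^4 = ‖∑ t ∈ P ×ˢ P, ((aa t.1 * aa t.2 : ℝ):ℂ) * ee ((j:ℝ)/(6*r) * ((f t.1 + f t.2 : ℤ):ℝ))‖^2 := by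
    intro j
    rw [pow_mul (‖SS c X ((j:ℝ)/(6*r))‖) 2 2, ← norm_pow]
    congr 2
    rw [sq, SS, Finset.sum_mul_sum, Finset.sum_product]
    refine sum_congr rfl fun x _ => sum_congr rfl fun y _ => ?_
    push_cast
    rw [mul_add, ee_add]; ring
  simp_rw [e1]
  rw [parseval (P ×ˢ P) (fun t => aa t.1 * aa t.2) (fun t => f t.1 + f t.2) r hr]
  · gcongr
    have hL := Real.log_nonneg hX
    have h1 : ∀ t ∈ ((P ×ˢ P) ×ˢ (P ×ˢ P)).filter (fun t => f t.1.1 + f t.1.2 = f t.2.1 + f t.2.2),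
        aa t.1.1 * aa t.1.2 * (aa t.2.1 * aa t.2.2) ≤ (log X)^4 := by
      intro t ht
      simp only [mem_filter, Finset.mem_product] at ht
      calc _ ≤ log X * log X * (log X * log X) := by
            have := aa_nonneg t.1.1; have := aa_nonneg t.1.2; have := aa_nonneg t.2.1; have := aa_nonneg t.2.2
            have := aa_le_log X hX _ ht.1.1.1; have := aa_le_log X hX _ ht.1.1.2
            have := aa_le_log X hX _ ht.1.2.1; have := aa_le_log X hX _ ht.1.2.2
            gcongr
        _ = _ := by ring
    refine (sum_le_sum h1).trans ?_
    rw [Finset.sum_const, nsmul_eq_mul, mul_comm]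
    gcongr
    set T := ((P ×ˢ P) ×ˢ (P ×ˢ P)).filter (fun t => f t.1.1 + f t.1.2 = f t.2.1 + f t.2.2) with hT
    have hinj : Function.Injective (fun t : (ℕ × ℕ) × (ℕ × ℕ) => ((t.1.1:ℤ), (t.1.2:ℤ), (t.2.1:ℤ), (t.2.2:ℤ))) := by
      rintro ⟨⟨a, b⟩, ⟨d, e⟩⟩ ⟨⟨a', b'⟩, ⟨d', e'⟩⟩ h
      simpa [and_assoc] using h
    rw [← Finset.card_image_of_injective T hinj]
    refine h X hX _ ?_
    intro n1 n2 n3 n4 hn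
    rw [Finset.mem_image] at hn
    obtain ⟨⟨⟨a, b⟩, ⟨d, e⟩⟩, ht, he⟩ := hn
    simp only [Prod.mk.injEq] at he
    obtain ⟨rfl, rfl, rfl, rfl⟩ := he
    simp only [hT, mem_filter, Finset.mem_product, hP, memP X hX0] at ht
    obtain ⟨⟨⟨h1, h2⟩, h3, h4⟩, h5⟩ := ht
    push_cast
    exact ⟨⟨h1.1.le, h1.2⟩, ⟨h2.1.le, h2.2⟩, ⟨h3.1.le, h3.2⟩, ⟨h4.1.le, h4.2⟩, h5⟩
  · intro t ht
    rw [Finset.mem_product] at ht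
    linarith [(hfm _ ht.1).1, (hfm _ ht.2).1]
  · intro t ht
    rw [Finset.mem_product] at ht
    linarith [(hfm _ ht.1).2, (hfm _ ht.2).2]

lemma I_bound (c : ℝ) (hc : 1 < c) (hcn : ∀ n : ℕ, c ≠ n) : ∃ C > 0, ∀ X β : ℝ, 16 ≤ X → β ≠ 0 →
    ‖∑ n ∈ Ioc ⌊X/8⌋₊ ⌊X⌋₊, ee (β * (n:ℝ)^c)‖ ≤ C * (1/(|β| * X^(c-1))) + C * (X^(c/6+1/2) * |β|^(1/6:ℝ)) + C * X^(5/6:ℝ) := by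
  obtain ⟨c1, C1, hc1, hC1, h1⟩ := pow_KL c 16 hc (by norm_num)
  obtain ⟨C2, hC2, h2⟩ := pow_test 3 (1/6) (1/2) (by norm_num) (by norm_num) VDC_three c 16 (fall_ne_zero c hcn 3) (by norm_num)
  set C := C1 * 16^(c-1) + C2 + C2 * c1^(-(1/6:ℝ)) with hC
  have p1 : 0 < C1 * 16^(c-1) := by positivity
  have p3 : 0 < C2 * c1^(-(1/6:ℝ)) := by positivity
  have hC0 : 0 < C := by positivity
  refine ⟨C, hC0, fun X β hX hβ => ?_⟩
  have hX0 : 0 < X := by linarith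
  have hβ0 := abs_pos.mpr hβ
  set M := X/16 with hM
  have hM0 : 0 < M := by positivity
  have hM1 : 1 ≤ M := by rw [hM, le_div_iff₀ (by norm_num)]; linarith
  have hMX : M ≤ X := by rw [hM]; linarith
  have ha : M ≤ (⌊X/8⌋₊:ℝ) := by
    have := Nat.lt_floor_add_one (X/8)
    rw [hM]; linarith
  have hb : (⌊X⌋₊:ℝ) ≤ 16 * M := by
    have := Nat.floor_le hX0.le
    rw [hM]; linarith
  have q1 : 0 < C * (1/(|β| * X^(c-1))) := by positivity
  have q2 : 0 < C * (X^(c/6+1/2) * |β|^(1/6:ℝ)) := by positivity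
  have q3 : 0 < C * X^(5/6:ℝ) := by positivity
  by_cases h : |β| * M^(c-1) ≤ c1
  · refine (h1 M _ _ β hM1 ha hb hβ h).trans ?_
    have : C1/(|β| * M^(c-1)) = C1 * 16^(c-1) * (1/(|β| * X^(c-1))) := by
      rw [hM, Real.div_rpow hX0.le (by norm_num)]; field_simp
    rw [this]
    have : C1 * 16^(c-1) * (1/(|β| * X^(c-1))) ≤ C * (1/(|β| * X^(c-1))) := by
      gcongr; linarith
    linarith
  · push Not at h
    refine (h2 M _ _ β hM1 ha hb hβ).trans ?_
    have e1 : M * (|β| * M^(c-(3:ℕ)))^(1/6:ℝ) = M^(c/6+1/2) * |β|^(1/6:ℝ) := by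
      rw [Real.mul_rpow hβ0.le (by positivity), ← Real.rpow_mul hM0.le]
      have : M^(c/6+1/2) = M * M^((c-(3:ℕ))*(1/6)) := by
        rw [show c/6+1/2 = 1 + (c-(3:ℕ))*(1/6) by push_cast; ring, Real.rpow_add hM0, Real.rpow_one]
      rw [this]; ring
    have t1 : M * (|β| * M^(c-(3:ℕ)))^(1/6:ℝ) ≤ X^(c/6+1/2) * |β|^(1/6:ℝ) := by
      rw [e1]; gcongr
    have hlow : c1 * M^(-(2:ℝ)) ≤ |β| * M^(c-(3:ℕ)) := by
      have : M^(c-(3:ℕ)) = M^(c-1) * M^(-(2:ℝ)) := by rw [← Real.rpow_add hM0]; congr 1; push_cast; ring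
      rw [this, ← mul_assoc]; gcongr
    have t2 : M^(1/2:ℝ) * (|β| * M^(c-(3:ℕ)))^(-(1/6:ℝ)) ≤ c1^(-(1/6:ℝ)) * X^(5/6:ℝ) := by
      calc _ ≤ M^(1/2:ℝ) * (c1 * M^(-(2:ℝ)))^(-(1/6:ℝ)) := by
            gcongr 1
            exact Real.rpow_le_rpow_of_nonpos (by positivity) hlow (by norm_num)
        _ = c1^(-(1/6:ℝ)) * M^(5/6:ℝ) := by
            rw [Real.mul_rpow hc1.le (by positivity), ← Real.rpow_mul hM0.le, mul_left_comm, ← Real.rpow_add hM0]; norm_num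
        _ ≤ _ := by gcongr
    have t3 : C2 * (X^(c/6+1/2) * |β|^(1/6:ℝ)) ≤ C * (X^(c/6+1/2) * |β|^(1/6:ℝ)) := by
      gcongr; linarith
    have t4 : C2 * (c1^(-(1/6:ℝ)) * X^(5/6:ℝ)) ≤ C * X^(5/6:ℝ) := by
      rw [← mul_assoc]; gcongr; linarith
    have t5 := mul_le_mul_of_nonneg_left t1 hC2.le
    have t6 := mul_le_mul_of_nonneg_left t2 hC2.le
    rw [mul_add]
    linarith

lemma card_P_le (X : ℝ) (hX : 0 ≤ X) : ((Ioc ⌊X/8⌋₊ ⌊X⌋₊).card : ℝ) ≤ X := by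
  rw [Nat.card_Ioc]
  exact le_trans (by exact_mod_cast Nat.sub_le _ _) (Nat.floor_le hX)

/-- off-diagonal pairs -/
lemma pair_bound (c : ℝ) (hc : 1 < c) (hc2 : c < 609/293) (hcn : ∀ n : ℕ, c ≠ n) : ∃ C > 0, ∀ᶠ X : ℝ in Filter.atTop,
    ∀ η β : ℝ, X^(-(2/25:ℝ))/2 ≤ η → η ≤ 1/(log X)^10 → β ≠ 0 → |β| ≤ η^(5/2:ℝ) →
    ‖∑ n ∈ Ioc ⌊X/8⌋₊ ⌊X⌋₊, ee (β * ⌊(n:ℝ)^c⌋)‖ ≤ C * (1/(|β| * X^(c-1))) + η^2 * X/(2 * (log X)^2) := by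
  obtain ⟨C, hC, hI⟩ := I_bound c hc hcn
  refine ⟨C, hC, ?_⟩
  filter_upwards [Filter.eventually_ge_atTop 16, ev_log_ge 40, ev_logpow 2 (1/2-c/6-19/150) (24*C) (by linarith),
    ev_logpow 2 (1/150) (24*C) (by norm_num)] with X hX hL h1 h2 η β hη1 hη2 hβ hβη
  have hX0 : 0 < X := by linarith
  set L := log X with hLd
  have hL0 : 0 < L := by linarith
  have hη0 : 0 < η := lt_of_lt_of_le (by positivity) hη1
  have hβ0 := abs_pos.mpr hβ
  set P := Ioc ⌊X/8⌋₊ ⌊X⌋₊ with hP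
  have hd : ‖∑ n ∈ P, ee (β * ⌊(n:ℝ)^c⌋) - ∑ n ∈ P, ee (β * (n:ℝ)^c)‖ ≤ 2 * π * |β| * X := by
    rw [← Finset.sum_sub_distrib]
    refine (norm_sum_le _ _).trans ?_
    calc _ ≤ ∑ n ∈ P, 2 * π * |β| := by
          refine sum_le_sum fun n _ => ?_
          refine (norm_ee_sub_le _ _).trans ?_
          rw [← mul_sub, abs_mul, ← mul_assoc]
          refine mul_le_of_le_one_right (by positivity) ?_
          rw [abs_sub_comm, abs_of_nonneg (by linarith [Int.floor_le ((n:ℝ)^c)])]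
          linarith [Int.lt_floor_add_one ((n:ℝ)^c)]
      _ = P.card * (2 * π * |β|) := by rw [Finset.sum_const, nsmul_eq_mul]
      _ ≤ X * (2 * π * |β|) := by gcongr; exact card_P_le X hX0.le
      _ = _ := by ring
  -- three error terms
  have g1 : C * (X^(c/6+1/2) * |β|^(1/6:ℝ)) ≤ η^2 * X/(6*L^2) := by
    have a1 : |β|^(1/6:ℝ) ≤ η^(5/12:ℝ) := by
      calc |β|^(1/6:ℝ) ≤ (η^(5/2:ℝ))^(1/6:ℝ) := by gcongr
        _ = _ := by rw [← Real.rpow_mul hη0.le]; norm_num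
    have a2 : X^(-(19/150:ℝ))/4 ≤ η^(19/12:ℝ) := by
      calc X^(-(19/150:ℝ))/4 ≤ X^(-(19/150:ℝ))/2^(19/12:ℝ) := by
            have : (2:ℝ)^(19/12:ℝ) ≤ 4 := by
              calc (2:ℝ)^(19/12:ℝ) ≤ 2^(2:ℝ) := Real.rpow_le_rpow_of_exponent_le (by norm_num) (by norm_num)
                _ = 4 := by norm_num
            gcongr
        _ = (X^(-(2/25:ℝ))/2)^(19/12:ℝ) := by
            rw [Real.div_rpow (by positivity) (by norm_num), ← Real.rpow_mul hX0.le]; norm_num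
        _ ≤ _ := by gcongr
    rw [le_div_iff₀ (by positivity)]
    have e2 : η^2 = η^(19/12:ℝ) * η^(5/12:ℝ) := by rw [← Real.rpow_add hη0]; norm_num
    have e3 : X^(c/6+1/2) * X^(1/2-c/6-19/150) * (X^(19/150:ℝ) * X^(-(19/150:ℝ))) = X * X^(-(19/150:ℝ)) := by
      rw [← Real.rpow_add hX0, ← Real.rpow_add hX0, ← Real.rpow_add hX0, ← Real.rpow_one_add' hX0.le (by norm_num)]; congr 1; ring
    have e4 : X^(19/150:ℝ) * X^(-(19/150:ℝ)) = 1 := by rw [← Real.rpow_add hX0]; norm_num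
    rw [e4, mul_one] at e3
    calc C * (X^(c/6+1/2) * |β|^(1/6:ℝ)) * (6*L^2) ≤ C * (X^(c/6+1/2) * η^(5/12:ℝ)) * (6*L^2) := by gcongr
      _ = X^(c/6+1/2) * (24 * C * L^2) * η^(5/12:ℝ) / 4 := by ring
      _ ≤ X^(c/6+1/2) * X^(1/2-c/6-19/150) * η^(5/12:ℝ) / 4 := by gcongr
      _ = (X^(-(19/150:ℝ))/4) * η^(5/12:ℝ) * X := by rw [e3]; ring
      _ ≤ η^(19/12:ℝ) * η^(5/12:ℝ) * X := by gcongr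
      _ = _ := by rw [e2]
  have g2 : C * X^(5/6:ℝ) ≤ η^2 * X/(6*L^2) := by
    rw [le_div_iff₀ (by positivity)]
    have a2 : X^(-(4/25:ℝ))/4 ≤ η^2 := by
      calc X^(-(4/25:ℝ))/4 = (X^(-(2/25:ℝ))/2)^2 := by
            rw [div_pow, ← Real.rpow_natCast (X^(-(2/25:ℝ))), ← Real.rpow_mul hX0.le]; norm_num
        _ ≤ _ := by gcongr
    have e3 : X^(5/6:ℝ) * X^(1/150:ℝ) = X^(-(4/25:ℝ)) * X := by
      rw [← Real.rpow_add hX0, ← Real.rpow_add_one hX0.ne']; norm_num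
    calc C * X^(5/6:ℝ) * (6*L^2) = X^(5/6:ℝ) * (24 * C * L^2) / 4 := by ring
      _ ≤ X^(5/6:ℝ) * X^(1/150:ℝ) / 4 := by gcongr
      _ = X^(-(4/25:ℝ))/4 * X := by rw [e3]; ring
      _ ≤ _ := by gcongr
  have g3 : 2 * π * |β| * X ≤ η^2 * X/(6*L^2) := by
    rw [le_div_iff₀ (by positivity)]
    have e2 : η^(5/2:ℝ) = η^2 * η^(1/2:ℝ) := by rw [← Real.rpow_natCast η 2, ← Real.rpow_add hη0]; norm_num
    have a3 : η^(1/2:ℝ) ≤ 1/L^5 := by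
      rw [← Real.sqrt_eq_rpow, Real.sqrt_le_left (by positivity), div_pow, ← pow_mul]; simpa using hη2
    have a4 : 12 * π * L^2 * (1/L^5) ≤ 1 := by
      have : 12 * π ≤ L^3 := by nlinarith [Real.pi_lt_d2, mul_pos hL0 hL0]
      rw [mul_one_div, div_le_one (by positivity)]
      calc 12 * π * L^2 ≤ L^3 * L^2 := by gcongr
        _ = L^5 := by ring
    calc 2 * π * |β| * X * (6*L^2) ≤ 2 * π * (η^2 * (1/L^5)) * X * (6*L^2) := by
          gcongr; exact hβη.trans (by rw [e2]; gcongr)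
      _ = η^2 * X * (12 * π * L^2 * (1/L^5)) := by ring
      _ ≤ η^2 * X * 1 := by gcongr
      _ = _ := by ring
  have hI' := hI X β hX hβ
  have htri := norm_sub_norm_le (∑ n ∈ P, ee (β * ⌊(n:ℝ)^c⌋)) (∑ n ∈ P, ee (β * (n:ℝ)^c))
  have e5 : η^2 * X/(2*L^2) = 3 * (η^2 * X/(6*L^2)) := by field_simp; norm_num
  rw [e5]
  linarith

lemma window (c : ℝ) (hc : 1 < c) (hc2 : c < 609/293) (hcn : ∀ n : ℕ, c ≠ n) : ∃ C > 0, ∀ᶠ X : ℝ in Filter.atTop,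
    ∀ r : ℕ, X^c = r → ∀ η : ℝ, X^(-(2/25:ℝ))/2 ≤ η → η ≤ 1/(log X)^10 → ∀ E : Finset ℤ,
    (∀ i ∈ E, ∀ j ∈ E, |(i:ℝ) - j| ≤ η^(5/2:ℝ) * (6*r)) → (∀ j ∈ E, η * X ≤ ‖SS c X ((j:ℝ)/(6*r))‖) →
    (E.card : ℝ) * η^2 ≤ C * (log X)^3 := by
  obtain ⟨C, hC, hI⟩ := pair_bound c hc hc2 hcn
  refine ⟨2 + 120 * C, by positivity, ?_⟩
  filter_upwards [hI, Filter.eventually_ge_atTop 6, ev_log_ge 1] with X hI hX hL r hr η hη1 hη2 E hE hS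
  classical
  have hX0 : 0 < X := by linarith
  have hX1 : 1 ≤ X := by linarith
  set L := log X with hLd
  have hL0 : 0 < L := by linarith
  have hη0 : 0 < η := lt_of_lt_of_le (by positivity) hη1
  have hr0 : (0:ℝ) < r := by rw [← hr]; positivity
  rcases E.eq_empty_or_nonempty with rfl | hne
  · simp; positivity
  have hR0 : (0:ℝ) < E.card := by exact_mod_cast hne.card_pos
  set P := Ioc ⌊X/8⌋₊ ⌊X⌋₊ with hP
  set ω : ℤ → ℂ := fun j => (starRingEnd ℂ) (SS c X ((j:ℝ)/(6*r))) / (‖SS c X ((j:ℝ)/(6*r))‖ : ℂ) with hω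
  have hω1 : ∀ j ∈ E, ‖ω j‖ ≤ 1 := by
    intro j hj
    rw [hω]; dsimp only
    rw [norm_div, RCLike.norm_conj, Complex.norm_real, norm_norm]
    exact div_self_le_one _
  have hωS : ∀ j ∈ E, ω j * SS c X ((j:ℝ)/(6*r)) = (‖SS c X ((j:ℝ)/(6*r))‖ : ℂ) := by
    intro j hj
    have h0 : 0 < ‖SS c X ((j:ℝ)/(6*r))‖ := lt_of_lt_of_le (by positivity) (hS j hj)
    have h0' : (‖SS c X ((j:ℝ)/(6*r))‖ : ℂ) ≠ 0 := by exact_mod_cast h0.ne'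
    rw [hω]; dsimp only
    rw [div_mul_eq_mul_div, mul_comm, Complex.mul_conj', sq, mul_div_assoc, div_self h0', mul_one]
  set f : ℕ → ℤ := fun n => ⌊(n:ℝ)^c⌋ with hf
  have e1 : ((∑ j ∈ E, ‖SS c X ((j:ℝ)/(6*r))‖ : ℝ):ℂ) = ∑ n ∈ P, (aa n : ℂ) * ∑ j ∈ E, ω j * ee ((j:ℝ)/(6*r) * f n) := by
    push_cast
    rw [← sum_congr rfl hωS]
    simp_rw [SS, mul_sum]
    rw [Finset.sum_comm]
    refine sum_congr rfl fun n _ => sum_congr rfl fun j _ => by ring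
  have h1 : (E.card * (η * X))^2 ≤ ‖∑ n ∈ P, (aa n : ℂ) * ∑ j ∈ E, ω j * ee ((j:ℝ)/(6*r) * f n)‖^2 := by
    rw [← e1, Complex.norm_real, Real.norm_of_nonneg (Finset.sum_nonneg fun _ _ => norm_nonneg _)]
    gcongr
    rw [← nsmul_eq_mul]
    exact Finset.card_nsmul_le_sum _ _ _ hS
  have h2 : ∑ n ∈ P, (aa n)^2 ≤ X * L^2 := by
    calc ∑ n ∈ P, (aa n)^2 ≤ ∑ n ∈ P, L^2 := sum_le_sum fun n hn => pow_le_pow_left₀ (aa_nonneg n) (aa_le_log X hX1 n hn) 2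
      _ = P.card * L^2 := by rw [Finset.sum_const, nsmul_eq_mul]
      _ ≤ _ := by gcongr; exact card_P_le X hX0.le
  have h3 := sq_expand E P ω hω1 (fun j n => ee ((j:ℝ)/(6*r) * f n))
  have hrow : ∀ i ∈ E, ∑ j ∈ E, ‖∑ n ∈ P, ee ((i:ℝ)/(6*r) * f n) * (starRingEnd ℂ) (ee ((j:ℝ)/(6*r) * f n))‖
      ≤ X + (6 * C * X * (10 * L) + E.card * (η^2 * X/(2*L^2))) := by
    intro i hi
    have e2 : ∀ j : ℤ, ∑ n ∈ P, ee ((i:ℝ)/(6*r) * f n) * (starRingEnd ℂ) (ee ((j:ℝ)/(6*r) * f n)) = ∑ n ∈ P, ee (((i:ℝ) - j)/(6*r) * f n) := by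
      intro j
      refine sum_congr rfl fun n _ => ?_
      rw [← ee_sub]; congr 1; ring
    simp_rw [e2]
    rw [← Finset.add_sum_erase _ _ hi]
    refine add_le_add ?_ ?_
    · refine (norm_sum_ee_le _ _).trans (card_P_le X hX0.le)
    · calc _ ≤ ∑ j ∈ E.erase i, (6 * C * X * (1/|(i:ℝ) - j|) + η^2 * X/(2*L^2)) := by
            refine sum_le_sum fun j hj => ?_
            rw [Finset.mem_erase] at hj
            have hij : (i:ℝ) - j ≠ 0 := sub_ne_zero.mpr (by exact_mod_cast hj.1.symm)
            have hij0 := abs_pos.mpr hij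
            have hβ : |((i:ℝ) - j)/(6*r)| = |(i:ℝ) - j|/(6*r) := by rw [abs_div, abs_of_pos (by positivity : (0:ℝ) < 6*r)]
            have := hI η (((i:ℝ) - j)/(6*r)) hη1 hη2 (div_ne_zero hij (by positivity)) (by
              rw [hβ, div_le_iff₀ (by positivity)]; exact hE i hi j hj.2)
            refine this.trans (le_of_eq ?_)
            congr 1
            rw [hβ]
            have : (r:ℝ) = X^(c-1) * X := by rw [← hr, ← Real.rpow_add_one hX0.ne']; congr 1; ring
            rw [this]; field_simp
        _ = 6 * C * X * ∑ j ∈ E.erase i, 1/|(i:ℝ) - j| + (E.erase i).card * (η^2 * X/(2*L^2)) := by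
            rw [Finset.sum_add_distrib, ← mul_sum, Finset.sum_const, nsmul_eq_mul]
        _ ≤ _ := by
            have hη1' : η ≤ 1 := hη2.trans (by rw [div_le_one (by positivity)]; exact one_le_pow₀ hL)
            have hrX : ((6*r : ℕ):ℝ) ≤ X^4 := by
              push_cast; rw [← hr]
              have : X^c ≤ X^(3:ℝ) := Real.rpow_le_rpow_of_exponent_le hX1 (by linarith)
              have h3 : X^(3:ℝ) = X^3 := by exact_mod_cast Real.rpow_natCast X 3
              rw [h3] at this
              calc 6 * X^c ≤ X * X^3 := by gcongr
                _ = X^4 := by ring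
            have hh := harm_pair E (fun j => j) (fun _ _ _ _ h => h) i (6*r) (X^4) hrX (one_le_pow₀ hX1) (fun j hj => by
              have h5 := hE i hi j hj
              have h6 : η^(5/2:ℝ) ≤ 1 := Real.rpow_le_one hη0.le hη1' (by norm_num)
              have h7 : |(i:ℝ) - j| ≤ 6*r := h5.trans (mul_le_of_le_one_left (by positivity) h6)
              exact_mod_cast h7)
            have e4 : ∑ j ∈ E.erase i, 1/|(i:ℝ) - j| ≤ 10 * L := by
              rw [show E.erase i = E.filter (fun j => j ≠ i) by ext; simp [and_comm]]
              refine hh.trans ?_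
              rw [Real.log_pow]; push_cast; linarith
            have e5 : ((E.erase i).card : ℝ) ≤ E.card := by exact_mod_cast Finset.card_erase_le
            gcongr
  have h4 : ∑ i ∈ E, ∑ j ∈ E, ‖∑ n ∈ P, ee ((i:ℝ)/(6*r) * f n) * (starRingEnd ℂ) (ee ((j:ℝ)/(6*r) * f n))‖
      ≤ E.card * (X + (6 * C * X * (10 * L) + E.card * (η^2 * X/(2*L^2)))) := by
    refine (sum_le_sum hrow).trans (le_of_eq ?_)
    rw [Finset.sum_const, nsmul_eq_mul]
  have h5 := h1.trans ((cauchy_norm P aa _).trans (mul_le_mul h2 (h3.trans h4) (Finset.sum_nonneg fun _ _ => by positivity) (by positivity)))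
  set R : ℝ := (E.card : ℝ) with hR
  have e6 : X * L^2 * (R * (X + (6 * C * X * (10 * L) + R * (η^2 * X/(2*L^2))))) = (R * X^2) * (L^2 + 60 * C * L^3) + (R * η * X)^2/2 := by
    field_simp; ring
  rw [e6] at h5
  have h6 : (R * X^2) * (R * η^2) ≤ (R * X^2) * (2 * (L^2 + 60 * C * L^3)) := by nlinarith
  have h7 := le_of_mul_le_mul_left h6 (by positivity)
  have h8 : L^2 ≤ L^3 := pow_le_pow_right₀ hL (by norm_num)
  linarith

lemma level (c : ℝ) (hc : 1 < c) (hc2 : c < 609/293) (hcn : ∀ n : ℕ, c ≠ n) :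
    ∃ C > 0, ∀ᶠ X : ℝ in Filter.atTop, ∀ r : ℕ, X^c = r → ∀ η : ℝ, X^(-(2/25:ℝ))/2 ≤ η → η ≤ 1/(log X)^10 →
      ∀ E : Finset ℤ, E ⊆ jset r → (∀ j ∈ E, η * X ≤ ‖SS c X ((j:ℝ)/(6*r))‖) →
      (E.card : ℝ) * η^(9/2:ℝ) ≤ C * (log X)^3 := by
  obtain ⟨C, hC, hW⟩ := window c hc hc2 hcn
  refine ⟨4 * C, by positivity, ?_⟩
  filter_upwards [hW, Filter.eventually_ge_atTop (4:ℝ), ev_log_ge 1] with X hW hX4 hL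
  intro r hr η hη1 hη2 E hEj hE
  have hX0 : 0 < X := by linarith
  have hr0 : (0:ℝ) < r := by rw [← hr]; positivity
  have hη0 : 0 < η := lt_of_lt_of_le (by positivity) hη1
  have hη1' : η ≤ 1 := hη2.trans (by rw [div_le_one (by positivity)]; exact one_le_pow₀ hL)
  have hT : 1 ≤ η^(5/2:ℝ) * (6*r) := by
    have h1 : (X^(-(2/25:ℝ))/2)^(5/2:ℝ) ≤ η^(5/2:ℝ) := Real.rpow_le_rpow (by positivity) hη1 (by norm_num)
    have h2 : (X^(-(2/25:ℝ))/2)^(5/2:ℝ) = X^(-(1/5:ℝ)) * (1/2)^(5/2:ℝ) := by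
      rw [div_eq_mul_one_div, Real.mul_rpow (by positivity) (by norm_num), ← Real.rpow_mul hX0.le]; norm_num
    have h3 : (1/8:ℝ) ≤ (1/2:ℝ)^(5/2:ℝ) := by
      have := Real.rpow_le_rpow_of_exponent_ge (by norm_num : (0:ℝ) < 1/2) (by norm_num) (by norm_num : (5/2:ℝ) ≤ (3:ℕ))
      rw [Real.rpow_natCast] at this; norm_num at this ⊢; exact this
    have h4 : X^(-(1/5:ℝ)) * X^c ≥ 2 := by
      rw [← Real.rpow_add hX0]
      calc X^(-(1/5)+c) ≥ X^(1/2:ℝ) := Real.rpow_le_rpow_of_exponent_le (by linarith) (by linarith)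
        _ ≥ 4^(1/2:ℝ) := Real.rpow_le_rpow (by norm_num) hX4 (by norm_num)
        _ = 2 := by rw [← Real.sqrt_eq_rpow, show (4:ℝ) = 2^2 by norm_num, Real.sqrt_sq (by norm_num)]
    rw [h2] at h1
    have h5 : X^(-(1/5:ℝ)) * (1/8) ≤ η^(5/2:ℝ) := le_trans (by gcongr) h1
    calc (1:ℝ) ≤ (X^(-(1/5:ℝ)) * X^c) * (6/8) := by linarith
      _ = X^(-(1/5:ℝ)) * (1/8) * (6 * r) := by rw [← hr]; ring
      _ ≤ _ := by gcongr
  set T := η^(5/2:ℝ) * (6*r) with hTd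
  obtain ⟨l, hl⟩ : ∃ l : ℤ, l = ⌊T⌋ := ⟨_, rfl⟩
  have hl1 : 1 ≤ l := by rw [hl]; exact Int.le_floor.mpr (by exact_mod_cast hT)
  have hl1R : (1:ℝ) ≤ l := by exact_mod_cast hl1
  have hlT : (l:ℝ) ≤ T := by rw [hl]; exact Int.floor_le _
  have hlT2 : T ≤ 2 * l := by have := Int.lt_floor_add_one T; rw [← hl] at this; linarith
  have hfib : ∀ a ∈ E.image (fun j => j / l), (E.filter (fun j => j / l = a)).card ≤ ⌊C * (log X)^3/η^2⌋₊ := by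
    intro a _
    apply Nat.le_floor
    rw [le_div_iff₀ (by positivity)]
    apply hW r hr η hη1 hη2
    · intro i hi j hj
      rw [mem_filter] at hi hj
      have h1 := Int.emod_add_mul_ediv i l
      have h2 := Int.emod_add_mul_ediv j l
      rw [hi.2] at h1; rw [hj.2] at h2
      have h3 := Int.emod_nonneg i (by omega : l ≠ 0)
      have h4 := Int.emod_nonneg j (by omega : l ≠ 0)
      have h5 := Int.emod_lt_of_pos i (by omega : 0 < l)
      have h6 := Int.emod_lt_of_pos j (by omega : 0 < l)
      have h7 : |i - j| ≤ l := by rw [abs_le]; constructor <;> linarith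
      refine le_trans ?_ hlT
      exact_mod_cast h7
    · intro j hj; exact hE j (mem_filter.mp hj).1
  have himg : ((E.image (fun j => j / l)).card : ℝ) ≤ 4 * (η^(5/2:ℝ))⁻¹ := by
    have hsub : E.image (fun j => j / l) ⊆ Finset.Icc ((-(3*(r:ℤ)))/l) ((3*(r:ℤ))/l) := by
      intro a ha
      rw [Finset.mem_image] at ha
      obtain ⟨j, hj, rfl⟩ := ha
      have := hEj hj
      rw [jset, mem_Ioc] at this
      rw [Finset.mem_Icc]
      exact ⟨Int.ediv_le_ediv (by omega) this.1.le, Int.ediv_le_ediv (by omega) this.2⟩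
    have h1 := Finset.card_le_card hsub
    rw [Int.card_Icc] at h1
    have h2 : (((3*(r:ℤ))/l : ℤ):ℝ) ≤ 3*r/l := by
      rw [le_div_iff₀ (by linarith)]
      exact_mod_cast Int.ediv_mul_le (3*(r:ℤ)) (by omega : l ≠ 0)
    have h3 : -(3*(r:ℝ)/l) - 1 ≤ (((-(3*(r:ℤ)))/l : ℤ):ℝ) := by
      have := Int.lt_ediv_add_one_mul_self (-(3*(r:ℤ))) (by omega : 0 < l)
      have h : -(3*(r:ℝ)) < ((((-(3*(r:ℤ)))/l : ℤ):ℝ) + 1) * l := by exact_mod_cast this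
      rw [← neg_div, sub_le_iff_le_add, div_le_iff₀ (by linarith)]
      exact h.le
    have h4 : ((((3*(r:ℤ))/l + 1 - (-(3*(r:ℤ)))/l).toNat : ℕ):ℝ) ≤ 6*r/l + 2 := by
      have hnn : 0 ≤ (3*(r:ℤ))/l + 1 - (-(3*(r:ℤ)))/l := by
        have := Int.ediv_le_ediv (by omega : 0 < l) (by omega : -(3*(r:ℤ)) ≤ 3*(r:ℤ)); omega
      have : ((((3*(r:ℤ))/l + 1 - (-(3*(r:ℤ)))/l).toNat : ℤ):ℝ) = (((3*(r:ℤ))/l : ℤ):ℝ) + 1 - (((-(3*(r:ℤ)))/l : ℤ):ℝ) := by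
        rw [Int.toNat_of_nonneg hnn]; push_cast; ring
      rw [Int.cast_natCast] at this
      rw [this]
      have : 6*(r:ℝ)/l = 3*r/l + 3*r/l := by ring
      linarith
    have h5 : 6*(r:ℝ)/l ≤ 2 * (η^(5/2:ℝ))⁻¹ := by
      rw [div_le_iff₀ (by linarith), mul_assoc, inv_mul_eq_div, mul_div_assoc', le_div_iff₀ (by positivity)]
      linarith
    have h6 : 1 ≤ (η^(5/2:ℝ))⁻¹ := one_le_inv_iff₀.mpr ⟨by positivity, Real.rpow_le_one hη0.le hη1' (by norm_num)⟩
    have h7 : ((E.image (fun j => j / l)).card : ℝ) ≤ (((3*(r:ℤ))/l + 1 - (-(3*(r:ℤ)))/l).toNat : ℕ) := by exact_mod_cast h1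
    linarith
  have h1 := Finset.card_le_mul_card_image E _ hfib
  have h2 : (E.card : ℝ) ≤ (C * (log X)^3/η^2) * (4 * (η^(5/2:ℝ))⁻¹) := by
    calc (E.card : ℝ) ≤ (⌊C * (log X)^3/η^2⌋₊ : ℝ) * ((E.image (fun j => j / l)).card : ℝ) := by exact_mod_cast h1
      _ ≤ _ := mul_le_mul (Nat.floor_le (by positivity)) himg (by positivity) (by positivity)
  have h3 : η^(9/2:ℝ) = η^2 * η^(5/2:ℝ) := by
    rw [← Real.rpow_natCast η 2, ← Real.rpow_add hη0]; norm_num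
  rw [h3]
  have h4 : 0 < η^(5/2:ℝ) := by positivity
  calc (E.card:ℝ) * (η^2 * η^(5/2:ℝ)) ≤ (C * (log X)^3/η^2) * (4 * (η^(5/2:ℝ))⁻¹) * (η^2 * η^(5/2:ℝ)) := by gcongr
    _ = _ := by field_simp

lemma minor_small (c : ℝ) (hc : 1 < c) (hc2 : c < 609/293) :
    ∀ᶠ X : ℝ in Filter.atTop, ∀ r : ℕ, X^c = r →
      ∑ j ∈ (jset r).filter (fun j : ℤ => ‖SS c X ((j:ℝ)/(6*r))‖ ≤ X^(23/25:ℝ)), ‖SS c X ((j:ℝ)/(6*r))‖^5 ≤ X^5/log X := by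
  obtain ⟨D, hD, hF⟩ := fourth c hc (1/1000) (by norm_num)
  filter_upwards [ev_logpow 5 (4/10000) (12*D) (by norm_num), ev_log_ge 1, Filter.eventually_ge_atTop (1:ℝ)] with X hX5 hL hX1 r hr
  have hX0 : 0 < X := by linarith
  have hr0 : (0:ℝ) < r := by rw [← hr]; positivity
  have h4 := hF X hX1 r (by exact_mod_cast hr0) hr
  have e1 : X^(23/25:ℝ) * (r * X^(2+1/1000:ℝ)) ≤ X^(49996/10000:ℝ) := by
    rw [← hr, ← Real.rpow_add hX0, ← Real.rpow_add hX0]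
    exact Real.rpow_le_rpow_of_exponent_le hX1 (by linarith)
  have e2 : X^(23/25:ℝ) * (r * X^(4-c+1/1000:ℝ)) ≤ X^(49996/10000:ℝ) := by
    rw [← hr, ← Real.rpow_add hX0, ← Real.rpow_add hX0]
    exact Real.rpow_le_rpow_of_exponent_le hX1 (by linarith)
  have e3 : X^(49996/10000:ℝ) * X^(4/10000:ℝ) = X^5 := by
    rw [← Real.rpow_add hX0, ← Real.rpow_natCast X 5]; norm_num
  rw [le_div_iff₀ (by linarith)]
  calc _ ≤ (X^(23/25:ℝ) * ∑ j ∈ jset r, ‖SS c X ((j:ℝ)/(6*r))‖^4) * log X := by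
        gcongr
        rw [mul_sum]
        refine (sum_le_sum (g := fun j : ℤ => X^(23/25:ℝ) * ‖SS c X ((j:ℝ)/(6*r))‖^4) fun j hj => ?_).trans
          (Finset.sum_le_sum_of_subset_of_nonneg (Finset.filter_subset _ _) fun _ _ _ => by positivity)
        rw [pow_succ' _ 4]
        have := (mem_filter.mp hj).2
        gcongr
    _ ≤ (X^(23/25:ℝ) * (6 * r * ((log X)^4 * (D * (X^(2+1/1000:ℝ) + X^(4-c+1/1000:ℝ)))))) * log X := by gcongr
    _ = 6 * D * (log X)^5 * (X^(23/25:ℝ) * (r * X^(2+1/1000:ℝ)) + X^(23/25:ℝ) * (r * X^(4-c+1/1000:ℝ))) := by ring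
    _ ≤ 6 * D * (log X)^5 * (X^(49996/10000:ℝ) + X^(49996/10000:ℝ)) := by gcongr
    _ = X^(49996/10000:ℝ) * (12 * D * (log X)^5) := by ring
    _ ≤ X^(49996/10000:ℝ) * X^(4/10000:ℝ) := by gcongr
    _ = X^5 := e3

lemma minor_large (c : ℝ) (hc : 1 < c) (hc2 : c < 609/293) (hcn : ∀ n : ℕ, c ≠ n) :
    ∃ C > 0, ∀ᶠ X : ℝ in Filter.atTop, ∀ r : ℕ, X^c = r → ∀ E ⊆ jset r,
      (∀ j ∈ E, X^(23/25:ℝ) < ‖SS c X ((j:ℝ)/(6*r))‖ ∧ ‖SS c X ((j:ℝ)/(6*r))‖ ≤ X/(log X)^10) →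
      ∑ j ∈ E, ‖SS c X ((j:ℝ)/(6*r))‖^5 ≤ C * (X^5/log X) := by
  obtain ⟨C, hC, hLv⟩ := level c hc hc2 hcn
  refine ⟨96 * C, by positivity, ?_⟩
  filter_upwards [hLv, ev_log_ge 1, Filter.eventually_ge_atTop (1:ℝ)] with X hLv hL hX1 r hr E hEj hE
  have hX0 : 0 < X := by linarith
  set s : ℤ → ℝ := fun j => ‖SS c X ((j:ℝ)/(6*r))‖ with hs
  set L := log X with hLd
  set lv : ℤ → ℕ := fun j => Nat.log 2 ⌊X / s j⌋₊ with hlv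
  have hs0 : ∀ j ∈ E, 0 < s j := fun j hj => lt_of_le_of_lt (by positivity) (hE j hj).1
  have hXs : ∀ j ∈ E, L^10 ≤ X / s j := by
    intro j hj
    have h1 := (hE j hj).2
    have h2 := hs0 j hj
    rw [le_div_iff₀ (by positivity)] at h1 ⊢
    linarith
  have hlow : ∀ j ∈ E, (2:ℝ)^(lv j) ≤ X / s j := by
    intro j hj
    have h1 : 1 ≤ ⌊X / s j⌋₊ := Nat.le_floor (by push_cast; exact (one_le_pow₀ hL).trans (hXs j hj))
    have h2 : 2^(lv j) ≤ ⌊X / s j⌋₊ := Nat.pow_log_le_self 2 (by omega)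
    exact le_trans (by exact_mod_cast h2) (Nat.floor_le (by have := hs0 j hj; positivity))
  have hup : ∀ j ∈ E, X / s j < (2:ℝ)^(lv j + 1) := by
    intro j hj
    have h2 : ⌊X / s j⌋₊ < 2^(lv j + 1) := Nat.lt_pow_succ_log_self (by norm_num) _
    have := (Nat.floor_lt (by have := hs0 j hj; positivity)).mp h2
    exact_mod_cast this
  have hX8 : ∀ j ∈ E, X / s j < X^(2/25:ℝ) := by
    intro j hj
    rw [div_lt_iff₀ (hs0 j hj)]
    calc X = X^(2/25:ℝ) * X^(23/25:ℝ) := by rw [← Real.rpow_add hX0]; norm_num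
      _ < _ := by have := (hE j hj).1; gcongr
  have hN : ∀ j ∈ E, lv j ∈ range (⌊2*L⌋₊ + 1) := by
    intro j hj
    rw [Finset.mem_range, Nat.lt_succ_iff]
    apply Nat.le_floor
    have h1 : (2:ℝ)^(lv j) ≤ X := (hlow j hj).trans ((hX8 j hj).le.trans (by
      nth_rw 2 [← Real.rpow_one X]; exact Real.rpow_le_rpow_of_exponent_le hX1 (by norm_num)))
    have h2 := Real.log_le_log (by positivity) h1
    rw [Real.log_pow] at h2
    have h3 := Real.log_two_gt_d9
    have h4 : (lv j : ℝ) * (1/2) ≤ lv j * log 2 := by gcongr; linarith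
    linarith
  rw [← Finset.sum_fiberwise_of_maps_to hN]
  have hfib : ∀ i ∈ range (⌊2*L⌋₊ + 1), ∑ j ∈ E.filter (fun j => lv j = i), s j^5 ≤ 32 * C * (X^5/L^2) := by
    intro i _
    rcases (E.filter (fun j => lv j = i)).eq_empty_or_nonempty with h0 | ⟨j0, hj0⟩
    · rw [h0, Finset.sum_empty]; positivity
    rw [mem_filter] at hj0
    obtain ⟨hj0, rfl⟩ := hj0
    set i := lv j0 with hi
    obtain ⟨η, hη⟩ : ∃ η : ℝ, η = 1/2^(i+1) := ⟨_, rfl⟩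
    have hη0 : 0 < η := by rw [hη]; positivity
    have hη1 : X^(-(2/25:ℝ))/2 ≤ η := by
      have h1 : (2:ℝ)^i ≤ X^(2/25:ℝ) := (hlow j0 hj0).trans (hX8 j0 hj0).le
      rw [hη, Real.rpow_neg hX0.le, pow_succ, inv_eq_one_div, div_div]
      gcongr
    have hη2 : η ≤ 1/L^10 := by
      rw [hη]
      have := (hXs j0 hj0).trans (hup j0 hj0).le
      gcongr
    have h1 := hLv r hr η hη1 hη2 (E.filter (fun j => lv j = i)) ((Finset.filter_subset _ _).trans hEj) (by
      intro j hj
      rw [mem_filter] at hj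
      have h1 := hup j hj.1
      rw [hj.2, div_lt_iff₀ (hs0 j hj.1)] at h1
      rw [hη, one_div, inv_mul_eq_div, div_le_iff₀ (by positivity)]
      change X ≤ s j * _
      linarith)
    have h2 : ∀ j ∈ E.filter (fun j => lv j = i), s j^5 ≤ (2*η*X)^5 := by
      intro j hj
      rw [mem_filter] at hj
      have h1 := hlow j hj.1
      rw [hj.2, le_div_iff₀ (hs0 j hj.1)] at h1
      have h3 : s j ≤ 2*η*X := by
        rw [hη, pow_succ]
        rw [show 2 * (1/((2:ℝ)^i*2)) * X = X/2^i by field_simp, le_div_iff₀ (by positivity)]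
        linarith
      exact pow_le_pow_left₀ (hs0 j hj.1).le h3 5
    have h3 := Finset.sum_le_card_nsmul _ _ _ h2
    rw [nsmul_eq_mul] at h3
    refine h3.trans ?_
    have h5 : η^5 = η^(9/2:ℝ) * η^(1/2:ℝ) := by rw [← Real.rpow_add hη0, ← Real.rpow_natCast η 5]; norm_num
    have h6 : η^(1/2:ℝ) ≤ 1/L^5 := by
      calc η^(1/2:ℝ) ≤ (1/L^10)^(1/2:ℝ) := Real.rpow_le_rpow hη0.le hη2 (by norm_num)
        _ = 1/L^5 := by
          rw [← Real.sqrt_eq_rpow, show 1/L^10 = (1/L^5)^2 by rw [div_pow]; ring, Real.sqrt_sq (by positivity)]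
    calc _ = 32 * X^5 * ((E.filter (fun j => lv j = i)).card * η^(9/2:ℝ)) * η^(1/2:ℝ) := by
          rw [mul_pow, mul_pow, h5]; ring
      _ ≤ 32 * X^5 * (C * L^3) * (1/L^5) := by gcongr
      _ = _ := by field_simp
  refine (Finset.sum_le_card_nsmul _ _ _ hfib).trans ?_
  rw [nsmul_eq_mul, Finset.card_range]
  have h1 : ((⌊2*L⌋₊ + 1 : ℕ):ℝ) ≤ 3 * L := by
    have := Nat.floor_le (by positivity : 0 ≤ 2*L)
    push_cast; linarith
  calc _ ≤ 3 * L * (32 * C * (X^5/L^2)) := by gcongr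
    _ = _ := by field_simp; ring

lemma minor (c : ℝ) (hc : 1 < c) (hc2 : c < 609/293) (hcn : ∀ n : ℕ, c ≠ n) :
    ∃ B : ℕ, ∃ C > 0, ∀ᶠ X : ℝ in Filter.atTop, ∀ r : ℕ, X^c = r →
      ∑ j ∈ (jset r).filter (fun j : ℤ => 6 * (log X)^(B+1) ≤ |(j:ℝ)|), ‖SS c X ((j:ℝ)/(6*r))‖^5 ≤ C * (X^5/log X) := by
  obtain ⟨B, hB⟩ := S_sup c hc hcn 10
  obtain ⟨C, hC, hLg⟩ := minor_large c hc hc2 hcn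
  refine ⟨B, 1 + C, by positivity, ?_⟩
  filter_upwards [ev_log_ge 1, hB, hLg, minor_small c hc hc2, Filter.eventually_ge_atTop (1:ℝ)] with X hL hB hLg hSm hX1 r hr
  have hX0 : 0 < X := by linarith
  have hr0 : (0:ℝ) < r := by rw [← hr]; positivity
  rw [← Finset.sum_filter_add_sum_filter_not _ (fun j : ℤ => ‖SS c X ((j:ℝ)/(6*r))‖ ≤ X^(23/25:ℝ)), add_mul, one_mul]
  refine add_le_add ((Finset.sum_le_sum_of_subset_of_nonneg ?_ fun _ _ _ => by positivity).trans (hSm r hr)) (hLg r hr _ ?_ ?_)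
  · intro j hj
    simp only [mem_filter] at hj ⊢
    exact ⟨hj.1.1, hj.2⟩
  · intro j hj
    simp only [mem_filter] at hj
    exact hj.1.1
  · intro j hj
    simp only [mem_filter, not_le] at hj
    obtain ⟨⟨h1, h2⟩, h3⟩ := hj
    refine ⟨h3, hB _ ?_ ?_⟩
    · rw [jset, mem_Ioc] at h1
      have : |(j:ℝ)| ≤ 3*r := by
        have : |j| ≤ 3*(r:ℤ) := by rw [abs_le]; omega
        exact_mod_cast this
      rw [abs_div, abs_of_pos (by positivity : (0:ℝ) < 6*r), div_le_iff₀ (by positivity)]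
      linarith
    · rw [hr, abs_div, abs_of_pos (by positivity : (0:ℝ) < 6*r), div_mul_eq_mul_div, le_div_iff₀ (by positivity)]
      have h4 : (log X)^B ≤ (log X)^(B+1) := pow_le_pow_right₀ hL (by omega)
      calc (log X)^B * (6*r) = 6 * (log X)^B * r := by ring
        _ ≤ _ := by gcongr; linarith

lemma geo_bound (α : ℝ) (h0 : 0 < |α|) (h1 : |α| ≤ 1/2) (a n : ℕ) (h : a ≤ n) :
    ‖∑ k ∈ Ioc a n, ee (α * k)‖ ≤ 1/(2*|α|) := by
  have e : ∀ n, a ≤ n → (∑ k ∈ Ioc a n, ee (α * k)) * (1 - ee α) = ee (α * (a+1)) - ee (α * (n+1)) := by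
    intro n hn
    induction n, hn using Nat.le_induction with
    | base => simp
    | succ m hm ih =>
      rw [Finset.sum_Ioc_succ_top (by omega), add_mul, ih, mul_sub, mul_one, ← ee_add]
      push_cast
      rw [show α * ((m:ℝ)+1) + α = α * ((m:ℝ)+1+1) by ring]
      ring
  have h2 : ‖(∑ k ∈ Ioc a n, ee (α * k)) * (1 - ee α)‖ ≤ 2 := by
    rw [e n h]
    refine (norm_sub_le _ _).trans ?_
    rw [norm_ee, norm_ee]; norm_num
  have h3 : 4 * |α| ≤ ‖1 - ee α‖ := by
    rw [norm_one_sub_ee]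
    have h4 := two_mul_le_sin h0.le h1
    have h5 : Real.sin (π * |α|) ≤ |Real.sin (π * α)| := by
      rcases abs_cases α with h | h
      · rw [h.1]; exact le_abs_self _
      · rw [h.1, mul_neg, Real.sin_neg]; exact neg_le_abs _
    linarith
  rw [norm_mul] at h2
  rw [le_div_iff₀ (by positivity)]
  nlinarith [norm_nonneg (∑ k ∈ Ioc a n, ee (α * k))]

noncomputable def ww (c : ℝ) (m : ℕ) : ℝ := ((m:ℝ)+1)^(1/c) - (m:ℝ)^(1/c)

lemma ww_low (c : ℝ) (hc : 1 < c) (m : ℕ) : 1/c * ((m:ℝ)+1)^(1/c-1) ≤ ww c m := by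
  have hp : 1/c ≤ 1 := by rw [div_le_one (by linarith)]; exact hc.le
  have hm : (0:ℝ) < (m:ℝ)+1 := by positivity
  have hs : (-1:ℝ) ≤ -(1/((m:ℝ)+1)) := by
    rw [neg_le_neg_iff, div_le_one hm]; linarith [Nat.cast_nonneg (α := ℝ) m]
  have h := rpow_one_add_le_one_add_mul_self hs (by positivity : 0 ≤ 1/c) hp
  have h2 : (m:ℝ)^(1/c) = ((m:ℝ)+1)^(1/c) * (1 + -(1/((m:ℝ)+1)))^(1/c) := by
    rw [← Real.mul_rpow hm.le (by linarith)]
    congr 1; field_simp; ring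
  rw [ww, h2, Real.rpow_sub_one hm.ne']
  have h3 := mul_le_mul_of_nonneg_left h (by positivity : 0 ≤ ((m:ℝ)+1)^(1/c))
  have h4 : ((m:ℝ)+1)^(1/c) * (1 + 1/c * -(1/((m:ℝ)+1))) = ((m:ℝ)+1)^(1/c) - 1/c * (((m:ℝ)+1)^(1/c)/((m:ℝ)+1)) := by ring
  linarith

lemma ww_up (c : ℝ) (hc : 1 < c) (m : ℕ) (hm : 0 < m) : ww c m ≤ 1/c * (m:ℝ)^(1/c-1) := by
  have hp : 1/c ≤ 1 := by rw [div_le_one (by linarith)]; exact hc.le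
  have hm : (0:ℝ) < (m:ℝ) := by positivity
  have h := rpow_one_add_le_one_add_mul_self (le_trans (by norm_num) (by positivity : 0 ≤ 1/(m:ℝ)) : (-1:ℝ) ≤ 1/(m:ℝ)) (by positivity : 0 ≤ 1/c) hp
  have h2 : ((m:ℝ)+1)^(1/c) = (m:ℝ)^(1/c) * (1 + 1/(m:ℝ))^(1/c) := by
    rw [← Real.mul_rpow hm.le (by positivity)]
    congr 1; field_simp
  rw [ww, h2, Real.rpow_sub_one hm.ne']
  have h3 := mul_le_mul_of_nonneg_left h (by positivity : 0 ≤ (m:ℝ)^(1/c))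
  have h4 : (m:ℝ)^(1/c) * (1 + 1/c * (1/(m:ℝ))) = (m:ℝ)^(1/c) + 1/c * ((m:ℝ)^(1/c)/(m:ℝ)) := by ring
  linarith

lemma ww_nonneg (c : ℝ) (hc : 1 < c) (m : ℕ) : 0 ≤ ww c m := le_trans (by positivity) (ww_low c hc m)

lemma ww_anti (c : ℝ) (hc : 1 < c) (m : ℕ) : ww c (m+1) ≤ ww c m := by
  have h := ww_up c hc (m+1) (by omega)
  push_cast at h
  exact h.trans (ww_low c hc m)

noncomputable def QQ (c X : ℝ) (r : ℕ) : Finset ℕ := Ioc (⌊(X/8)^c⌋₊ - 1) r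

noncomputable def WW (c X : ℝ) (r : ℕ) (α : ℝ) : ℂ := ∑ m ∈ QQ c X r, (ww c m : ℂ) * ee (α * m)

lemma M1_low (c : ℝ) (hc : 1 < c) (hc3 : c ≤ 3) (X : ℝ) (hX : 8 ≤ X) (r : ℕ) (hr : X^c = r) :
    1 ≤ ⌊(X/8)^c⌋₊ ∧ (r:ℝ)/1024 ≤ ⌊(X/8)^c⌋₊ ∧ (⌊(X/8)^c⌋₊:ℝ) ≤ r/8 := by
  have hX0 : 0 < X := by linarith
  have h1 : 1 ≤ (X/8)^c := Real.one_le_rpow (by linarith) (by linarith)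
  have h2 : 1 ≤ ⌊(X/8)^c⌋₊ := Nat.le_floor (by exact_mod_cast h1)
  have h2R : (1:ℝ) ≤ (⌊(X/8)^c⌋₊:ℝ) := by exact_mod_cast h2
  have e : (X/8)^c = r/8^c := by rw [Real.div_rpow hX0.le (by norm_num), hr]
  have h8 : (8:ℝ)^c ≤ 512 := by
    calc (8:ℝ)^c ≤ 8^((3:ℕ):ℝ) := Real.rpow_le_rpow_of_exponent_le (by norm_num) (by exact_mod_cast hc3)
      _ = 512 := by rw [Real.rpow_natCast]; norm_num
  have h8' : (8:ℝ) ≤ 8^c := by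
    nth_rw 1 [← Real.rpow_one 8]; exact Real.rpow_le_rpow_of_exponent_le (by norm_num) hc.le
  refine ⟨h2, ?_, ?_⟩
  · have h3 := Nat.lt_floor_add_one ((X/8)^c)
    have h4 : (r:ℝ)/512 ≤ (X/8)^c := by rw [e]; gcongr
    linarith
  · refine (Nat.floor_le (by linarith)).trans ?_
    rw [e]; gcongr

lemma W_bound (c : ℝ) (hc : 1 < c) (hc3 : c ≤ 3) (X : ℝ) (hX : 8 ≤ X) (r : ℕ) (hr : X^c = r) (j : ℤ) (hj : j ∈ jset r) (hj0 : j ≠ 0) :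
    ‖WW c X r ((j:ℝ)/(6*r))‖ ≤ 3072 * X / |(j:ℝ)| := by
  have hX0 : 0 < X := by linarith
  have hr0 : (0:ℝ) < r := by rw [← hr]; positivity
  obtain ⟨h1, h2, h3⟩ := M1_low c hc hc3 X hX r hr
  have hj1 : 0 < |(j:ℝ)| := abs_pos.mpr (by exact_mod_cast hj0)
  have hα : |(j:ℝ)/(6*r)| = |(j:ℝ)|/(6*r) := by rw [abs_div, abs_of_pos (by positivity : (0:ℝ) < 6*r)]
  have hα2 : |(j:ℝ)/(6*r)| ≤ 1/2 := by
    rw [hα, div_le_iff₀ (by positivity)]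
    rw [jset, mem_Ioc] at hj
    have : |j| ≤ 3*(r:ℤ) := by rw [abs_le]; omega
    have : |(j:ℝ)| ≤ 3*r := by exact_mod_cast this
    linarith
  have h := abel_anti (fun m : ℕ => ee ((j:ℝ)/(6*r) * m)) (ww c) (⌊(X/8)^c⌋₊ - 1) r (1/(2*|(j:ℝ)/(6*r)|)) (by positivity)
    (fun n hn _ => geo_bound _ (by rw [hα]; positivity) hα2 _ n hn.le) (fun n _ _ => ww_anti c hc n) (ww_nonneg c hc _) (ww_nonneg c hc _)
  rw [WW, QQ]
  refine h.trans ?_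
  rw [Nat.sub_add_cancel h1]
  have h4 : ww c ⌊(X/8)^c⌋₊ ≤ 1024 * (X / r) := by
    have hp : 1/c ≤ 1 := by rw [div_le_one (by linarith)]; exact hc.le
    calc ww c ⌊(X/8)^c⌋₊ ≤ 1/c * (⌊(X/8)^c⌋₊:ℝ)^(1/c-1) := ww_up c hc _ h1
      _ ≤ 1 * ((r:ℝ)/1024)^(1/c-1) := by
          refine mul_le_mul hp ?_ (by positivity) (by norm_num)
          exact Real.rpow_le_rpow_of_nonpos (by positivity) h2 (by linarith)
      _ = 1024^(1-1/c) * (X / r) := by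
          rw [one_mul, Real.div_rpow hr0.le (by norm_num), Real.rpow_sub_one hr0.ne', ← hr, ← Real.rpow_mul hX0.le, mul_one_div_cancel (by linarith),
            Real.rpow_one, div_eq_mul_inv, ← Real.rpow_neg (by norm_num)]
          rw [neg_sub]; ring
      _ ≤ 1024 * (X / r) := by
          gcongr
          nth_rw 2 [← Real.rpow_one 1024]
          exact Real.rpow_le_rpow_of_exponent_le (by norm_num) (by have : 0 < 1/c := by positivity
                                                                   linarith)
  calc _ ≤ 1/(2*|(j:ℝ)/(6*r)|) * (1024 * (X / r)) := by gcongr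
    _ = _ := by rw [hα]; field_simp; norm_num

lemma W_minor (c : ℝ) (hc : 1 < c) (hc3 : c ≤ 3) (B : ℕ) :
    ∃ C > 0, ∀ᶠ X : ℝ in Filter.atTop, ∀ r : ℕ, X^c = r →
      ∑ j ∈ (jset r).filter (fun j : ℤ => 6 * (log X)^(B+1) ≤ |(j:ℝ)|), ‖WW c X r ((j:ℝ)/(6*r))‖^5 ≤ C * (X^5/log X) := by
  refine ⟨3072^5*10, by positivity, ?_⟩
  filter_upwards [ev_log_ge 1, Filter.eventually_ge_atTop (8:ℝ)] with X hL hX r hr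
  have hX0 : 0 < X := by linarith
  have hr0 : (0:ℝ) < r := by rw [← hr]; positivity
  set L := log X with hLd
  set S := (jset r).filter (fun j : ℤ => 6 * L^(B+1) ≤ |(j:ℝ)|) with hS
  have hL1 : L ≤ L^(B+1) := by
    calc L = L^1 := (pow_one L).symm
      _ ≤ _ := pow_le_pow_right₀ hL (by omega)
  have hjL : ∀ j ∈ S, L ≤ |(j:ℝ)| ∧ j ≠ 0 := by
    intro j hj
    have h := (mem_filter.mp hj).2
    have h1 : L ≤ |(j:ℝ)| := by linarith
    refine ⟨h1, ?_⟩
    rintro rfl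
    rw [Int.cast_zero, abs_zero] at h1; linarith
  have hrX : ((3*r : ℕ):ℝ) ≤ X^4 := by
    push_cast; rw [← hr]
    have : X^c ≤ X^((3:ℕ):ℝ) := Real.rpow_le_rpow_of_exponent_le (by linarith) (by exact_mod_cast hc3)
    rw [Real.rpow_natCast] at this
    calc 3 * X^c ≤ X * X^3 := by gcongr; linarith
      _ = X^4 := by ring
  have hh := harm_pair S (fun j => j) (fun _ _ _ _ h => h) 0 (3*r) (X^4) hrX (one_le_pow₀ (by linarith)) (fun j hj => by
    have h1 := (mem_filter.mp hj).1
    rw [jset, mem_Ioc] at h1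
    push_cast
    rw [abs_le]; omega)
  rw [Finset.filter_true_of_mem (fun j hj => (hjL j hj).2), Real.log_pow] at hh
  simp only [Int.cast_zero, zero_sub, abs_neg] at hh
  calc ∑ j ∈ S, ‖WW c X r ((j:ℝ)/(6*r))‖^5 ≤ ∑ j ∈ S, (3072^5 * X^5/L^4) * (1/|(j:ℝ)|) := by
        refine sum_le_sum fun j hj => ?_
        have h1 := W_bound c hc hc3 X hX r hr j (mem_filter.mp hj).1 (hjL j hj).2
        have h2 := (hjL j hj).1
        have h3 : 0 < |(j:ℝ)| := by linarith
        calc _ ≤ (3072 * X / |(j:ℝ)|)^5 := pow_le_pow_left₀ (norm_nonneg _) h1 5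
          _ = 3072^5 * X^5 / |(j:ℝ)|^4 * (1/|(j:ℝ)|) := by field_simp
          _ ≤ _ := by gcongr
    _ = (3072^5 * X^5/L^4) * ∑ j ∈ S, 1/|(j:ℝ)| := by rw [mul_sum]
    _ ≤ (3072^5 * X^5/L^4) * (10 * L^3) := by
        have h3 : L ≤ L^3 := by
          calc L = L^1 := (pow_one L).symm
            _ ≤ _ := pow_le_pow_right₀ hL (by norm_num)
        gcongr
        push_cast at hh
        linarith
    _ = _ := by field_simp

lemma W_main (c : ℝ) (hc : 1 < c) (hc3 : c ≤ 3) (X : ℝ) (hX : 8 ≤ X) (r : ℕ) (hr : X^c = r) (hr2 : 140 ≤ r) :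
    X^5/(80^4*6^5) ≤ r * ∑ t ∈ (Fintype.piFinset (fun _ : Fin 5 => QQ c X r)).filter (fun t => ∑ i, ((t i : ℕ):ℤ) = (r:ℤ)), ∏ i, ww c (t i) := by
  have hX0 : 0 < X := by linarith
  have hr0 : (0:ℝ) < r := by rw [← hr]; positivity
  obtain ⟨h1, h2, h3⟩ := M1_low c hc hc3 X hX r hr
  obtain ⟨K, hK⟩ : ∃ K, K = r/40 := ⟨_, rfl⟩
  have hK1 : 40 * K ≤ r := by omega
  have hK2 : r < 40 * K + 40 := by omega
  have hK1R : 40 * (K:ℝ) ≤ r := by exact_mod_cast hK1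
  have hK2R : (r:ℝ) < 40 * K + 40 := by exact_mod_cast hK2
  have hr2R : (140:ℝ) ≤ r := by exact_mod_cast hr2
  have hM : ⌊(X/8)^c⌋₊ ≤ 7 * K := by
    have : (⌊(X/8)^c⌋₊:ℝ) ≤ 7 * K := by linarith
    exact_mod_cast this
  set A := (Fintype.piFinset (fun _ : Fin 5 => QQ c X r)).filter (fun t => ∑ i, ((t i : ℕ):ℤ) = (r:ℤ)) with hA
  have hcard : K^4 ≤ A.card := by
    have e1 : (Fintype.piFinset (fun _ : Fin 4 => range K)).card = K^4 := by
      rw [Fintype.card_piFinset]; simp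
    rw [← e1]
    refine Finset.card_le_card_of_injOn (fun d => (Fin.cons (r - ∑ i, (7*K + d i)) (fun i => 7*K + d i) : Fin 5 → ℕ)) ?_ ?_
    · intro d hd
      simp only [Finset.mem_coe, Fintype.mem_piFinset, Finset.mem_range] at hd
      have hs : ∑ i, (7*K + d i) ≤ 32 * K := by
        calc ∑ i, (7*K + d i) ≤ ∑ _i : Fin 4, 8 * K := sum_le_sum fun i _ => by have := hd i; omega
          _ = 32 * K := by simp; ring
      simp only [hA, Finset.mem_coe, mem_filter, Fintype.mem_piFinset]
      constructor
      · intro i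
        refine Fin.cases ?_ (fun i => ?_) i
        · rw [Fin.cons_zero, QQ, mem_Ioc]; omega
        · rw [Fin.cons_succ, QQ, mem_Ioc]
          have := hd i; omega
      · rw [← Nat.cast_sum, Fin.sum_cons]
        congr 1; omega
    · intro d _ d' _ h
      have h2 := (Fin.cons_injective2 h).2
      funext i
      have := congrFun h2 i
      omega
  have hprod : ∀ t ∈ A, (X/(6*r))^5 ≤ ∏ i, ww c (t i) := by
    intro t ht
    have ht1 := Fintype.mem_piFinset.mp (mem_filter.mp ht).1
    calc (X/(6*r))^5 = ∏ _i : Fin 5, (X/(6*r)) := by rw [Finset.prod_const, Finset.card_univ, Fintype.card_fin]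
      _ ≤ _ := by
        refine Finset.prod_le_prod (fun _ _ => by positivity) fun i _ => ?_
        have h5 := ht1 i
        rw [QQ, mem_Ioc] at h5
        have h6 : ((t i:ℕ):ℝ) + 1 ≤ 2 * r := by
          have : (t i) + 1 ≤ 2 * r := by omega
          exact_mod_cast this
        have hp : 0 < 1/c := by positivity
        have hp1 : 1/c ≤ 1 := by rw [div_le_one (by linarith)]; exact hc.le
        have hp3 : 1/3 ≤ 1/c := by gcongr
        calc X/(6*r) = 1/3 * ((1/2) * (X/r)) := by field_simp; norm_num
          _ ≤ 1/c * (2^(1/c-1) * (X/r)) := by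
              have : (1/2:ℝ) ≤ 2^(1/c-1) := by
                calc (1/2:ℝ) = 2^(-1:ℝ) := by rw [Real.rpow_neg_one]; norm_num
                  _ ≤ _ := Real.rpow_le_rpow_of_exponent_le (by norm_num) (by linarith)
              gcongr
          _ = 1/c * (2 * (r:ℝ))^(1/c-1) := by
              rw [Real.mul_rpow (by norm_num) hr0.le, Real.rpow_sub_one hr0.ne' (1/c)]
              congr 3
              rw [← hr, ← Real.rpow_mul hX0.le, mul_one_div_cancel (by linarith), Real.rpow_one]
          _ ≤ 1/c * (((t i:ℕ):ℝ)+1)^(1/c-1) := by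
              gcongr 1/c * ?_
              exact Real.rpow_le_rpow_of_nonpos (by positivity) h6 (by linarith)
          _ ≤ _ := ww_low c hc _
  have h6 := Finset.card_nsmul_le_sum A _ _ hprod
  rw [nsmul_eq_mul] at h6
  have h7 : ((r:ℝ)/80)^4 ≤ A.card := by
    calc ((r:ℝ)/80)^4 ≤ (K:ℝ)^4 := by gcongr; linarith
      _ ≤ (A.card:ℝ) := by exact_mod_cast hcard
  calc X^5/(80^4*6^5) = r * (((r:ℝ)/80)^4 * (X/(6*r))^5) := by field_simp; try norm_num
    _ ≤ r * (A.card * (X/(6*r))^5) := by gcongr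
    _ ≤ _ := by gcongr

lemma ww_le_one (c : ℝ) (hc : 1 < c) (m : ℕ) (hm : 0 < m) : ww c m ≤ 1 := by
  have hp : 1/c ≤ 1 := by rw [div_le_one (by linarith)]; exact hc.le
  have h1 : (m:ℝ)^(1/c-1) ≤ 1 := Real.rpow_le_one_of_one_le_of_nonpos (by exact_mod_cast hm) (by linarith)
  calc ww c m ≤ 1/c * (m:ℝ)^(1/c-1) := ww_up c hc m hm
    _ ≤ 1 * 1 := mul_le_mul hp h1 (by positivity) (by norm_num)
    _ = 1 := by norm_num

lemma ww_sum (c : ℝ) (M u : ℕ) (hM : 1 ≤ M) (h : M ≤ u) :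
    ∑ m ∈ Ioc (M-1) u, ww c m = ((u:ℝ)+1)^(1/c) - (M:ℝ)^(1/c) := by
  induction u, h using Nat.le_induction with
  | base =>
    have : Ioc (M-1) M = {M} := by ext x; simp only [mem_Ioc, Finset.mem_singleton]; omega
    rw [this, Finset.sum_singleton, ww]
  | succ u hu ih =>
    rw [Finset.sum_Ioc_succ_top (by omega), ih, ww]; push_cast; ring

lemma theta_close (A : ℕ) : ∃ C > 0, ∀ᶠ X : ℝ in Filter.atTop, ∀ x, X^(1/2:ℝ) ≤ x → x ≤ X → |Chebyshev.theta x - x| ≤ C * (X/(log X)^A) := by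
  obtain ⟨C, hC, h⟩ := pnt_theta A
  refine ⟨C * 2^A, by positivity, ?_⟩
  filter_upwards [Filter.eventually_ge_atTop (1296:ℝ), ev_log_ge 1] with X hX hL x h1 h2
  have hX0 : 0 < X := by linarith
  have h36 : 36 ≤ x := by
    refine le_trans ?_ h1
    calc (36:ℝ) = 1296^(1/2:ℝ) := by rw [← Real.sqrt_eq_rpow, show (1296:ℝ) = 36^2 by norm_num, Real.sqrt_sq (by norm_num)]
      _ ≤ _ := Real.rpow_le_rpow (by norm_num) hX (by norm_num)
  have h3 := Real.log_le_log (by positivity) h1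
  rw [Real.log_rpow hX0] at h3
  have h5 : ((1/2) * log X)^A ≤ (log x)^A := pow_le_pow_left₀ (by positivity) h3 A
  calc |Chebyshev.theta x - x| ≤ C * (x/(log x)^A) := h x h36
    _ ≤ C * (X/((1/2) * log X)^A) := by gcongr
    _ = _ := by rw [mul_pow, div_pow, one_pow]; field_simp

lemma filter_eq (c : ℝ) (hc : 1 < c) (X : ℝ) (u : ℕ) :
    (Ioc ⌊X/8⌋₊ ⌊X⌋₊).filter (fun n : ℕ => ⌊(n:ℝ)^c⌋₊ ≤ u) =
      Ioc ⌊X/8⌋₊ (min (⌈((u:ℝ)+1)^(1/c)⌉₊ - 1) ⌊X⌋₊) := by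
  have hc0 : 0 < c := by linarith
  ext n
  rw [mem_filter, mem_Ioc, mem_Ioc, le_min_iff]
  have key : 0 < n → (⌊(n:ℝ)^c⌋₊ ≤ u ↔ n ≤ ⌈((u:ℝ)+1)^(1/c)⌉₊ - 1) := by
    intro hn
    have h1 : ⌊(n:ℝ)^c⌋₊ ≤ u ↔ (n:ℝ)^c < (u:ℝ)+1 := by
      rw [← Nat.lt_succ_iff, Nat.floor_lt (by positivity)]; push_cast; rfl
    have h2 : n ≤ ⌈((u:ℝ)+1)^(1/c)⌉₊ - 1 ↔ (n:ℝ) < ((u:ℝ)+1)^(1/c) := by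
      rw [← Nat.lt_ceil]; omega
    rw [h1, h2, ← Real.rpow_lt_rpow_iff (x := (n:ℝ)) (y := ((u:ℝ)+1)^(1/c)) (z := c) (by positivity) (by positivity) hc0, ← Real.rpow_mul (by positivity),
      one_div_mul_cancel hc0.ne', Real.rpow_one]
  constructor
  · rintro ⟨⟨h1, h2⟩, h3⟩; exact ⟨h1, (key (by omega)).mp h3, h2⟩
  · rintro ⟨h1, h2, h3⟩; exact ⟨⟨h1, h3⟩, (key (by omega)).mpr h2⟩

lemma D_bound (c : ℝ) (hc : 1 < c) (hc3 : c ≤ 3) (A : ℕ) : ∃ C > 0, ∀ᶠ X : ℝ in Filter.atTop, ∀ r : ℕ, X^c = r →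
    ∀ u : ℕ, ⌊(X/8)^c⌋₊ ≤ u → u ≤ r →
      |∑ n ∈ (Ioc ⌊X/8⌋₊ ⌊X⌋₊).filter (fun n : ℕ => ⌊(n:ℝ)^c⌋₊ ≤ u), aa n - (((u:ℝ)+1)^(1/c) - (⌊(X/8)^c⌋₊:ℝ)^(1/c))|
        ≤ C * (X/(log X)^A) := by
  obtain ⟨C, hC, hT⟩ := theta_close A
  refine ⟨2 * C + 1, by positivity, ?_⟩
  filter_upwards [hT, ev_logpow A 1 3 (by norm_num), ev_log_ge 1, Filter.eventually_ge_atTop (256:ℝ)] with X hT h3 hL hX r hr u hu1 hu2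
  have hX0 : 0 < X := by linarith
  have hc0 : 0 < c := by linarith
  have hci : 0 ≤ 1/c := by positivity
  obtain ⟨h1, -, -⟩ := M1_low c hc hc3 X (by linarith) r hr
  rw [filter_eq c hc]
  set M := ⌊(X/8)^c⌋₊ with hM
  obtain ⟨Y, hY⟩ : ∃ Y, Y = ((u:ℝ)+1)^(1/c) := ⟨_, rfl⟩
  rw [← hY]
  have hinv : ∀ Z : ℝ, 0 < Z → (Z^c)^(1/c) = Z := fun Z hZ => by
    rw [← Real.rpow_mul hZ.le, mul_one_div_cancel hc0.ne', Real.rpow_one]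
  have hM8 : X/8 ≤ ((M:ℝ)+1)^(1/c) := by
    rw [← hinv (X/8) (by positivity)]
    exact Real.rpow_le_rpow (by positivity) (Nat.lt_floor_add_one _).le hci
  have hM8s : X/8 < ((M:ℝ)+1)^(1/c) := by
    nth_rw 1 [← hinv (X/8) (by positivity)]
    exact Real.rpow_lt_rpow (by positivity) (Nat.lt_floor_add_one _) (by positivity)
  have hM1 : (M:ℝ)^(1/c) ≤ X/8 := by
    rw [← hinv (X/8) (by positivity)]
    exact Real.rpow_le_rpow (by positivity) (Nat.floor_le (by positivity)) hci
  have hM2 : X/8 - 1 ≤ (M:ℝ)^(1/c) := by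
    have := ww_le_one c hc M h1
    rw [ww] at this; linarith
  have hY8 : X/8 < Y := lt_of_lt_of_le hM8s (by
    rw [hY]; exact Real.rpow_le_rpow (by positivity) (by have : (M:ℝ) ≤ u := by exact_mod_cast hu1
                                                         linarith) hci)
  have hYX : Y ≤ X + 1 := by
    have h5 := ww_le_one c hc r (by omega)
    rw [ww, ← hr, hinv X hX0, hr] at h5
    have h6 : Y ≤ ((r:ℝ)+1)^(1/c) := by
      rw [hY]; exact Real.rpow_le_rpow (by positivity) (by have : (u:ℝ) ≤ r := by exact_mod_cast hu2
                                                           linarith) hci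
    linarith
  obtain ⟨K, hK⟩ : ∃ K, K = min (⌈Y⌉₊ - 1) ⌊X⌋₊ := ⟨_, rfl⟩
  rw [← hK]
  have hceil : 1 ≤ ⌈Y⌉₊ := Nat.one_le_iff_ne_zero.mpr (Nat.ceil_pos.mpr (by linarith)).ne'
  have hceilR : ((⌈Y⌉₊ - 1 : ℕ):ℝ) = (⌈Y⌉₊:ℝ) - 1 := by push_cast [Nat.cast_sub hceil]; ring
  have hKR : (K:ℝ) = min ((⌈Y⌉₊:ℝ) - 1) (⌊X⌋₊:ℝ) := by rw [hK, Nat.cast_min, hceilR]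
  have hKX : (K:ℝ) ≤ X := by rw [hKR]; exact (min_le_right _ _).trans (Nat.floor_le hX0.le)
  have hKY : (K:ℝ) ≤ Y := by
    rw [hKR]; refine (min_le_left _ _).trans ?_
    have := Nat.ceil_lt_add_one (by linarith : 0 ≤ Y); linarith
  have hKY2 : Y - 2 ≤ (K:ℝ) := by
    rw [hKR, le_min_iff]
    constructor
    · linarith [Nat.le_ceil Y]
    · linarith [Nat.lt_floor_add_one X]
  have hKa : ⌊X/8⌋₊ ≤ K := by
    rw [hK, le_min_iff]
    constructor
    · have h7 : ⌊X/8⌋₊ < ⌈Y⌉₊ := Nat.lt_ceil.mpr (lt_of_le_of_lt (Nat.floor_le (by positivity)) hY8)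
      omega
    · exact Nat.floor_le_floor (by linarith)
  have hsum : ∑ n ∈ Ioc ⌊X/8⌋₊ K, aa n = Chebyshev.theta K - Chebyshev.theta (X/8) := by
    rw [theta_eq_aa, theta_eq_aa, Nat.floor_natCast, ← Finset.sum_Ioc_consecutive _ (Nat.zero_le _) hKa]; ring
  have hsq : X^(1/2:ℝ) ≤ X/16 := by
    rw [← Real.sqrt_eq_rpow, Real.sqrt_le_left (by positivity)]
    nlinarith
  have t1 := hT K (by linarith) hKX
  have t2 := hT (X/8) (by linarith) (by linarith)
  have t3 : 3 ≤ X/(log X)^A := by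
    rw [le_div_iff₀ (by positivity)]; rwa [Real.rpow_one] at h3
  rw [hsum]
  rw [abs_le] at t1 t2 ⊢
  constructor <;> nlinarith [t1.1, t1.2, t2.1, t2.2]

lemma SW_diff (c : ℝ) (hc : 1 < c) (hc3 : c ≤ 3) (A : ℕ) : ∃ C > 0, ∀ᶠ X : ℝ in Filter.atTop, ∀ r : ℕ, X^c = r →
    ∀ α : ℝ, ‖SS c X α - WW c X r α‖ ≤ C * (X/(log X)^A) * (1 + 2 * π * |α| * r) := by
  obtain ⟨C, hC, hD⟩ := D_bound c hc hc3 A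
  refine ⟨C, hC, ?_⟩
  filter_upwards [hD, ev_log_ge 1, Filter.eventually_ge_atTop (8:ℝ)] with X hD hL hX r hr α
  have hX0 : 0 < X := by linarith
  have hc0 : 0 < c := by linarith
  obtain ⟨h1, -, h18⟩ := M1_low c hc hc3 X hX r hr
  set M := ⌊(X/8)^c⌋₊ with hM
  have hMr : M ≤ r := by
    have : (M:ℝ) ≤ r := h18.trans (by linarith [Nat.cast_nonneg (α := ℝ) r])
    exact_mod_cast this
  set P := Ioc ⌊X/8⌋₊ ⌊X⌋₊ with hP
  set g : ℕ → ℕ := fun n => ⌊(n:ℝ)^c⌋₊ with hg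
  have hgM : ∀ n ∈ P, M ≤ g n := by
    intro n hn
    have := ((memP X hX0.le n).mp hn).1
    exact Nat.floor_le_floor (Real.rpow_le_rpow (by positivity) this.le hc0.le)
  have hgr : ∀ n ∈ P, g n ≤ r := by
    intro n hn
    have := ((memP X hX0.le n).mp hn).2
    apply Nat.floor_le_of_le
    rw [← hr]
    exact Real.rpow_le_rpow (by positivity) this hc0.le
  set b : ℕ → ℝ := fun m => ∑ n ∈ P.filter (fun n => g n = m), aa n with hb
  have hS : SS c X α = ∑ m ∈ Ioc (M-1) r, (b m : ℂ) * ee (α * m) := by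
    have hmap : ∀ n ∈ P, g n ∈ Ioc (M-1) r := fun n hn => by
      rw [mem_Ioc]; have := hgM n hn; have := hgr n hn; omega
    rw [SS, ← Finset.sum_fiberwise_of_maps_to hmap]
    refine sum_congr rfl fun m _ => ?_
    rw [hb]; push_cast
    rw [Finset.sum_mul]
    refine sum_congr rfl fun n hn => ?_
    rw [← (mem_filter.mp hn).2, hg]
    congr 3
    exact (natCast_floor_eq_intCast_floor (by positivity)).symm
  have hdiff : SS c X α - WW c X r α = ∑ m ∈ Ioc (M-1) r, ee (α * m) * ((b m - ww c m : ℝ) : ℂ) := by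
    rw [hS, WW, QQ, ← Finset.sum_sub_distrib]
    refine sum_congr rfl fun m _ => ?_
    push_cast; ring
  rw [hdiff]
  have hpart : ∀ n, M - 1 < n → n ≤ r → ‖∑ k ∈ Ioc (M-1) n, ((b k - ww c k : ℝ) : ℂ)‖ ≤ C * (X/(log X)^A) := by
    intro u hu1 hu2
    rw [← Complex.ofReal_sum, Complex.norm_real, Real.norm_eq_abs, Finset.sum_sub_distrib, ww_sum c M u h1 (by omega)]
    have e1 : ∑ m ∈ Ioc (M-1) u, b m = ∑ n ∈ P.filter (fun n => g n ≤ u), aa n := by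
      have hmap : ∀ n ∈ P.filter (fun n => g n ≤ u), g n ∈ Ioc (M-1) u := fun n hn => by
        rw [mem_filter] at hn
        rw [mem_Ioc]; have := hgM n hn.1; omega
      rw [← Finset.sum_fiberwise_of_maps_to hmap]
      refine sum_congr rfl fun m hm => ?_
      rw [hb, Finset.filter_filter]
      refine sum_congr (Finset.filter_congr fun n _ => ?_) fun _ _ => rfl
      rw [mem_Ioc] at hm
      constructor
      · intro h; exact ⟨by omega, h⟩
      · exact fun h => h.2
    rw [e1]
    exact hD r hr u (by omega) hu2
  refine (abel_bound _ (fun m : ℕ => ee (α * m)) (M-1) r _ (by omega) hpart).trans ?_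
  refine mul_le_mul_of_nonneg_left ?_ (by positivity)
  rw [norm_ee]
  refine add_le_add le_rfl ?_
  calc ∑ n ∈ Finset.Ico (M-1+1) r, ‖ee (α * ((n+1 : ℕ):ℝ)) - ee (α * n)‖ ≤ ∑ n ∈ Finset.Ico (M-1+1) r, 2 * π * |α| := by
        refine sum_le_sum fun n _ => (norm_ee_sub_le _ _).trans (le_of_eq ?_)
        congr 2; push_cast; ring
    _ ≤ _ := by
        rw [Finset.sum_const, nsmul_eq_mul, Nat.card_Ico, mul_comm]
        gcongr
        exact_mod_cast Nat.sub_le _ _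

lemma major (c : ℝ) (hc : 1 < c) (hc3 : c ≤ 3) (B : ℕ) :
    ∃ C > 0, ∀ᶠ X : ℝ in Filter.atTop, ∀ r : ℕ, X^c = r →
      ∑ j ∈ (jset r).filter (fun j : ℤ => ¬ 6 * (log X)^(B+1) ≤ |(j:ℝ)|), ‖SS c X ((j:ℝ)/(6*r))^5 - WW c X r ((j:ℝ)/(6*r))^5‖ ≤ C * (X^5/log X) := by
  obtain ⟨C, hC, hD⟩ := SW_diff c hc hc3 (2*B+3)
  refine ⟨13 * (80 * 8 * C), by positivity, ?_⟩
  filter_upwards [hD, ev_log_ge 1, Filter.eventually_ge_atTop (8:ℝ)] with X hD hL hX r hr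
  have hX0 : 0 < X := by linarith
  have hc0 : 0 < c := by linarith
  have hr0 : (0:ℝ) < r := by rw [← hr]; positivity
  set L := log X with hLd
  have hLB : 1 ≤ L^(B+1) := one_le_pow₀ hL
  have hSn : ∀ α, ‖SS c X α‖ ≤ 2 * X := by
    intro α
    rw [SS]
    refine (norm_sum_le _ _).trans ?_
    calc ∑ n ∈ Ioc ⌊X/8⌋₊ ⌊X⌋₊, ‖(aa n:ℂ) * ee (α * ⌊(n:ℝ)^c⌋)‖ = ∑ n ∈ Ioc ⌊X/8⌋₊ ⌊X⌋₊, aa n := by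
          refine sum_congr rfl fun n _ => ?_
          rw [norm_mul, norm_ee, mul_one, Complex.norm_real, Real.norm_of_nonneg (aa_nonneg n)]
      _ ≤ ∑ n ∈ Ioc 0 ⌊X⌋₊, aa n := Finset.sum_le_sum_of_subset_of_nonneg (Finset.Ioc_subset_Ioc_left (Nat.zero_le _)) fun n _ _ => aa_nonneg n
      _ = Chebyshev.theta X := (theta_eq_aa X).symm
      _ ≤ log 4 * X := Chebyshev.theta_le_log4_mul_x hX0.le
      _ ≤ _ := by
          gcongr
          rw [show (4:ℝ) = 2^2 by norm_num, Real.log_pow]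
          have := Real.log_two_lt_d9
          push_cast; linarith
  obtain ⟨h1, -, h18⟩ := M1_low c hc hc3 X hX r hr
  have hMr : ⌊(X/8)^c⌋₊ ≤ r := by
    have : (⌊(X/8)^c⌋₊:ℝ) ≤ r := h18.trans (by linarith)
    exact_mod_cast this
  have hWn : ∀ α, ‖WW c X r α‖ ≤ 2 * X := by
    intro α
    rw [WW]
    refine (norm_sum_le _ _).trans ?_
    calc ∑ m ∈ QQ c X r, ‖(ww c m:ℂ) * ee (α * m)‖ = ∑ m ∈ QQ c X r, ww c m := by
          refine sum_congr rfl fun n _ => ?_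
          rw [norm_mul, norm_ee, mul_one, Complex.norm_real, Real.norm_of_nonneg (ww_nonneg c hc n)]
      _ = ((r:ℝ)+1)^(1/c) - (⌊(X/8)^c⌋₊:ℝ)^(1/c) := ww_sum c _ r h1 hMr
      _ ≤ ww c r + (r:ℝ)^(1/c) := by
          rw [ww]
          have : 0 ≤ (⌊(X/8)^c⌋₊:ℝ)^(1/c) := by positivity
          linarith
      _ ≤ 1 + X := by
          refine add_le_add (ww_le_one c hc r (by omega)) (le_of_eq ?_)
          rw [← hr, ← Real.rpow_mul hX0.le, mul_one_div_cancel hc0.ne', Real.rpow_one]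
      _ ≤ _ := by linarith
  have hterm : ∀ j ∈ (jset r).filter (fun j : ℤ => ¬ 6 * L^(B+1) ≤ |(j:ℝ)|),
      ‖SS c X ((j:ℝ)/(6*r))^5 - WW c X r ((j:ℝ)/(6*r))^5‖ ≤ 80 * 8 * C * (X^5/L^(B+2)) := by
    intro j hj
    have hj1 := (mem_filter.mp hj).2
    rw [not_le] at hj1
    have hd := hD r hr ((j:ℝ)/(6*r))
    have hα : |(j:ℝ)/(6*r)| * r = |(j:ℝ)|/6 := by rw [abs_div, abs_of_pos (by positivity : (0:ℝ) < 6*r)]; field_simp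
    have h5 : 1 + 2 * π * |(j:ℝ)/(6*r)| * r ≤ 8 * L^(B+1) := by
      rw [mul_assoc, hα]
      have h6 : 2 * π * (|(j:ℝ)|/6) ≤ 2 * 3.15 * L^(B+1) := by
        have := Real.pi_lt_d2
        gcongr
        linarith
      linarith
    have h7 : ‖SS c X ((j:ℝ)/(6*r)) - WW c X r ((j:ℝ)/(6*r))‖ ≤ C * (X/L^(2*B+3)) * (8 * L^(B+1)) := hd.trans (by gcongr)
    have hs := hSn ((j:ℝ)/(6*r))
    have hw := hWn ((j:ℝ)/(6*r))
    generalize SS c X ((j:ℝ)/(6*r)) = s at *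
    generalize WW c X r ((j:ℝ)/(6*r)) = w at *
    have e : s^5 - w^5 = (s - w) * (s^4 + s^3*w + s^2*w^2 + s*w^3 + w^4) := by ring
    have h8 : ‖s^4 + s^3*w + s^2*w^2 + s*w^3 + w^4‖ ≤ 80 * X^4 := by
      calc _ ≤ ‖s^4‖ + ‖s^3*w‖ + ‖s^2*w^2‖ + ‖s*w^3‖ + ‖w^4‖ := (norm_add_le _ _).trans (add_le_add norm_add₄_le le_rfl)
        _ = ‖s‖^4 + ‖s‖^3*‖w‖ + ‖s‖^2*‖w‖^2 + ‖s‖*‖w‖^3 + ‖w‖^4 := by simp only [norm_mul, norm_pow]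
        _ ≤ (2*X)^4 + (2*X)^3*(2*X) + (2*X)^2*(2*X)^2 + (2*X)*(2*X)^3 + (2*X)^4 := by gcongr
        _ = _ := by ring
    rw [e, norm_mul]
    calc _ ≤ (C * (X/L^(2*B+3)) * (8 * L^(B+1))) * (80 * X^4) := by gcongr
      _ = _ := by
        have : L^(2*B+3) = L^(B+2) * L^(B+1) := by rw [← pow_add]; congr 1; ring
        rw [this]; field_simp; try norm_num
  refine (Finset.sum_le_card_nsmul _ _ _ hterm).trans ?_
  rw [nsmul_eq_mul]
  have hcard : (((jset r).filter (fun j : ℤ => ¬ 6 * L^(B+1) ≤ |(j:ℝ)|)).card : ℝ) ≤ 13 * L^(B+1) := by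
    have hsub : (jset r).filter (fun j : ℤ => ¬ 6 * L^(B+1) ≤ |(j:ℝ)|) ⊆ Finset.Icc (-(⌊6 * L^(B+1)⌋₊:ℤ)) ⌊6 * L^(B+1)⌋₊ := by
      intro j hj
      have hj1 := (mem_filter.mp hj).2
      rw [not_le] at hj1
      rw [Finset.mem_Icc]
      have : j.natAbs ≤ ⌊6 * L^(B+1)⌋₊ := Nat.le_floor (by rw [Nat.cast_natAbs, Int.cast_abs]; exact hj1.le)
      omega
    have h9 := Finset.card_le_card hsub
    rw [Int.card_Icc] at h9
    have h10 : (((jset r).filter (fun j : ℤ => ¬ 6 * L^(B+1) ≤ |(j:ℝ)|)).card : ℝ) ≤ 2 * (⌊6 * L^(B+1)⌋₊:ℝ) + 1 := by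
      have : ((jset r).filter (fun j : ℤ => ¬ 6 * L^(B+1) ≤ |(j:ℝ)|)).card ≤ 2 * ⌊6 * L^(B+1)⌋₊ + 1 := by omega
      exact_mod_cast this
    have h11 := Nat.floor_le (by positivity : 0 ≤ 6 * L^(B+1))
    linarith
  calc _ ≤ 13 * L^(B+1) * (80 * 8 * C * (X^5/L^(B+2))) := by gcongr
    _ = _ := by
      rw [show L^(B+2) = L^(B+1) * L from pow_succ L (B+1)]; field_simp

lemma RS_lower (c : ℝ) (hc : 1 < c) (hc2 : c < 609/293) (hcn : ∀ n : ℕ, c ≠ n) :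
    ∃ κ > 0, ∀ᶠ X : ℝ in Filter.atTop, ∀ r : ℕ, X^c = r →
      κ * X^5 ≤ r * ∑ t ∈ (Fintype.piFinset (fun _ : Fin 5 => Ioc ⌊X/8⌋₊ ⌊X⌋₊)).filter (fun t => ∑ i, ⌊((t i : ℕ):ℝ)^c⌋ = (r:ℤ)), ∏ i, aa (t i) := by
  have hc3 : c ≤ 3 := by linarith
  obtain ⟨B, C1, hC1, hm⟩ := minor c hc hc2 hcn
  obtain ⟨C2, hC2, hw⟩ := W_minor c hc hc3 B
  obtain ⟨C3, hC3, hM⟩ := major c hc hc3 B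
  obtain ⟨κ, hκ⟩ : ∃ κ : ℝ, κ = 1/(80^4*6^5) := ⟨_, rfl⟩
  have hκ0 : 0 < κ := by rw [hκ]; positivity
  refine ⟨κ/2, by positivity, ?_⟩
  filter_upwards [hm, hw, hM, ev_log_ge 1, ev_log_ge ((C1+C2+C3)/κ), Filter.eventually_ge_atTop (140:ℝ)] with X hm hw hM hL hL2 hX r hr
  have hX0 : 0 < X := by linarith
  have hr1 : (140:ℝ) ≤ r := by
    rw [← hr]; refine hX.trans ?_
    nth_rw 1 [← Real.rpow_one X]
    exact Real.rpow_le_rpow_of_exponent_le (by linarith) hc.le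
  have hr0 : (0:ℝ) < r := by linarith
  have hr2 : 140 ≤ r := by exact_mod_cast hr1
  have hmain := W_main c hc hc3 X (by linarith) r hr hr2
  have f1 := fifth_moment (Ioc ⌊X/8⌋₊ ⌊X⌋₊) aa (fun n => ⌊(n:ℝ)^c⌋) r (by omega)
    (fun n hn => (floor_pow_mem c X hc hX0.le r hr n hn).1) (fun n hn => (floor_pow_mem c X hc hX0.le r hr n hn).2)
  have f2 := fifth_moment (QQ c X r) (ww c) (fun n => (n:ℤ)) r (by omega)
    (fun n _ => by omega) (fun n hn => by rw [QQ, mem_Ioc] at hn; omega)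
  simp only [Int.cast_natCast] at f2
  set RS := ∑ t ∈ (Fintype.piFinset (fun _ : Fin 5 => Ioc ⌊X/8⌋₊ ⌊X⌋₊)).filter (fun t => ∑ i, ⌊((t i : ℕ):ℝ)^c⌋ = (r:ℤ)), ∏ i, aa (t i) with hRS
  set RW := ∑ t ∈ (Fintype.piFinset (fun _ : Fin 5 => QQ c X r)).filter (fun t => ∑ i, ((t i : ℕ):ℤ) = (r:ℤ)), ∏ i, ww c (t i) with hRW
  have f1' : ∑ j ∈ jset r, SS c X ((j:ℝ)/(6*r))^5 * ee (-((j:ℝ)/(6*r)*r)) = 6*r*(RS:ℂ) := f1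
  have f2' : ∑ j ∈ jset r, WW c X r ((j:ℝ)/(6*r))^5 * ee (-((j:ℝ)/(6*r)*r)) = 6*r*(RW:ℂ) := f2
  have hdiff : |6*r*RS - 6*r*RW| ≤ (C1+C2+C3) * (X^5/log X) := by
    have e : ((6*r*RS - 6*r*RW : ℝ):ℂ) = ∑ j ∈ jset r, (SS c X ((j:ℝ)/(6*r))^5 - WW c X r ((j:ℝ)/(6*r))^5) * ee (-((j:ℝ)/(6*r)*r)) := by
      push_cast
      rw [← f1', ← f2', ← Finset.sum_sub_distrib]
      exact sum_congr rfl fun j _ => by ring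
    rw [← Real.norm_eq_abs, ← Complex.norm_real, e]
    refine (norm_sum_le _ _).trans ?_
    simp only [norm_mul, norm_ee, mul_one]
    rw [← Finset.sum_filter_add_sum_filter_not _ (fun j : ℤ => 6 * (log X)^(B+1) ≤ |(j:ℝ)|), add_mul, add_mul]
    refine add_le_add ?_ (hM r hr)
    refine le_trans ?_ (add_le_add (hm r hr) (hw r hr))
    rw [← Finset.sum_add_distrib]
    refine sum_le_sum fun j _ => (norm_sub_le _ _).trans ?_
    rw [norm_pow, norm_pow]
  have h1 : (C1+C2+C3) * (X^5/log X) ≤ κ * X^5 := by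
    rw [mul_div_assoc', div_le_iff₀ (by linarith)]
    rw [div_le_iff₀ hκ0] at hL2
    calc (C1+C2+C3) * X^5 ≤ (log X * κ) * X^5 := by gcongr
      _ = _ := by ring
  have h2 : κ * X^5 ≤ r * RW := by
    refine le_trans (le_of_eq ?_) hmain
    rw [hκ]; ring
  have h3 := (abs_le.mp hdiff).1
  have h4 : 0 < κ * X^5 := by positivity
  have h5 : κ/2 * X^5 = (κ * X^5)/2 := by ring
  rw [h5]
  have e1 : 6 * r * RS = 6 * (r * RS) := by ring
  have e2 : 6 * r * RW = 6 * (r * RW) := by ring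
  rw [e1, e2] at h3
  linarith

lemma RS_upper (c : ℝ) (r : ℕ) (hr : 0 < r) (X : ℝ) (hX : X = (r:ℝ)^(1/c)) (hX1 : 1 ≤ X) :
    ∑ t ∈ (Fintype.piFinset (fun _ : Fin 5 => Ioc ⌊X/8⌋₊ ⌊X⌋₊)).filter (fun t => ∑ i, ⌊((t i : ℕ):ℝ)^c⌋ = (r:ℤ)), ∏ i, aa (t i)
      ≤ (log X)^5 * (countSolFloor c r 5 : ℝ) := by
  classical
  set F := (Fintype.piFinset (fun _ : Fin 5 => Ioc ⌊X/8⌋₊ ⌊X⌋₊)).filter (fun t => ∑ i, ⌊((t i : ℕ):ℝ)^c⌋ = (r:ℤ)) with hF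
  have hL : 0 ≤ log X := Real.log_nonneg hX1
  have hcnt : countSolFloor c r 5 = (F.filter (fun t => ∀ i, (t i).Prime)).card := by
    rw [countSolFloor]
    refine Nat.subtype_card _ fun t => ?_
    rw [mem_filter, hF, mem_filter, Fintype.mem_piFinset, ← hX]
    simp only [memP X (by linarith)]
    constructor
    · rintro ⟨⟨h1, h2⟩, h3⟩; exact ⟨fun j => ⟨h3 j, h1 j⟩, h2⟩
    · rintro ⟨h1, h2⟩; exact ⟨⟨fun j => (h1 j).2, h2⟩, fun j => (h1 j).1⟩
  have hz : ∑ t ∈ F, ∏ i, aa (t i) = ∑ t ∈ F.filter (fun t => ∀ i, (t i).Prime), ∏ i, aa (t i) := by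
    refine (Finset.sum_filter_of_ne fun t _ h i => ?_).symm
    by_contra hi
    exact h (Finset.prod_eq_zero (Finset.mem_univ i) (by rw [aa, if_neg hi]))
  rw [hz, hcnt, mul_comm, ← nsmul_eq_mul]
  refine Finset.sum_le_card_nsmul _ _ _ fun t ht => ?_
  have ht1 := Fintype.mem_piFinset.mp (mem_filter.mp (mem_filter.mp ht).1).1
  calc ∏ i, aa (t i) ≤ ∏ _i : Fin 5, log X := Finset.prod_le_prod (fun i _ => aa_nonneg _) fun i _ => aa_le_log X hX1 _ (ht1 i)
    _ = (log X)^5 := by rw [Finset.prod_const, Finset.card_univ, Fintype.card_fin]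

theorem baker_thm6 (c : ℝ) (hc1 : 1 < c) (hc2 : c < 609/293) (hc3 : ∀ n : ℕ, c ≠ n) :
    ∃ c₀ > 0, ∃ r₀ : ℕ, ∀ r : ℕ, r₀ ≤ r →
      c₀ * (r : ℝ) ^ (5/c - 1) / (log r) ^ 5 ≤ (countSolFloor c r 5 : ℝ) := by
  obtain ⟨κ, hκ, hev⟩ := RS_lower c hc1 hc2 hc3
  have hc0 : 0 < c := by linarith
  have ht : Filter.Tendsto (fun r : ℕ => (r:ℝ)^(1/c)) Filter.atTop Filter.atTop :=
    (tendsto_rpow_atTop (by positivity)).comp tendsto_natCast_atTop_atTop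
  have hev2 := ht.eventually (hev.and (ev_log_ge 1))
  obtain ⟨r₀, hr₀⟩ := Filter.eventually_atTop.mp hev2
  refine ⟨κ, hκ, r₀ + 2, fun r hr => ?_⟩
  obtain ⟨h1, hL⟩ := hr₀ r (by omega)
  have hr0 : (0:ℝ) < r := by exact_mod_cast (by omega : 0 < r)
  have hr1 : (1:ℝ) ≤ r := by exact_mod_cast (by omega : 1 ≤ r)
  obtain ⟨X, hX⟩ : ∃ X : ℝ, X = (r:ℝ)^(1/c) := ⟨_, rfl⟩
  rw [← hX] at h1 hL
  have hX1 : 1 ≤ X := by rw [hX]; exact Real.one_le_rpow hr1 (by positivity)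
  have hXr : X^c = r := by rw [hX, ← Real.rpow_mul hr0.le, one_div_mul_cancel hc0.ne', Real.rpow_one]
  have h2 := h1 r hXr
  have h3 := RS_upper c r (by omega) X hX hX1
  have hlog : log X ≤ log r := by
    rw [hX, Real.log_rpow hr0]
    have : 1/c ≤ 1 := by rw [div_le_one hc0]; exact hc1.le
    exact mul_le_of_le_one_left (Real.log_nonneg hr1) this
  have hlr : 0 < log r := by linarith
  have hX5 : (r:ℝ)^(5/c-1) * r = X^5 := by
    rw [← Real.rpow_add_one hr0.ne', hX, ← Real.rpow_natCast, ← Real.rpow_mul hr0.le]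
    congr 1; push_cast; ring
  have h4 : κ * (r:ℝ)^(5/c-1) * r ≤ ((log r)^5 * (countSolFloor c r 5 : ℝ)) * r := by
    rw [mul_assoc, hX5]
    refine h2.trans ?_
    rw [mul_comm]
    gcongr
    refine h3.trans ?_
    gcongr
  have h5 := le_of_mul_le_mul_right h4 hr0
  rw [div_le_iff₀ (by positivity)]
  linarith
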